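/- Let k and ℓ be number fields, let a, b ∈ k and c, d ∈ ℓ be nonzero, and set K = k_{a,b} and L = ℓ_{c,d}. If there exists a Witt equivalence from K to L, then [k : ℚ] = [ℓ : ℚ]. -/

import Mathlib

open MvPolynomial

noncomputable section

/-- The defining polynomial `a·x² + b·y² − 1` of the affine conic. -/
def conicPoly (k : Type*) [Field k] (a b : k) : MvPolynomial (Fin 2) k :=
  C a * X 0 ^ 2 + C b * X 1 ^ 2 - 1

/-- The coordinate ring `k[x,y]/(a·x² + b·y² − 1)` of the affine conic. -/
abbrev ConicRing (k : Type*) [Field k] (a b : k) : Type _ :=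
  MvPolynomial (Fin 2) k ⧸ Ideal.span {conicPoly k a b}

/-- `K` (together with the embedding `ι : k →+* K`) is a model of the function field
`k_{a,b}`, i.e. the quotient field of `k[x,y]/(a·x² + b·y² − 1)`. -/
def IsConicFunctionField (k : Type*) [Field k] (a b : k)
    (K : Type*) [Field K] (ι : k →+* K) : Prop :=
  ∃ f : ConicRing k a b →+* K,
    Function.Injective f ∧
    f.comp (algebraMap k (ConicRing k a b)) = ι ∧
    ∀ z : K, ∃ p q : ConicRing k a b, f q ≠ 0 ∧ z = f p / f q

/-- The subgroup of squares in `Kˣ`. -/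
def sqSubgroup (K : Type*) [Field K] : Subgroup Kˣ :=
  MonoidHom.range (powMonoidHom 2 : Kˣ →* Kˣ)

/-- The square class group `Kˣ/Kˣ²`. -/
abbrev SqClass (K : Type*) [Field K] := Kˣ ⧸ sqSubgroup K

/-- The square class of a unit. -/
def sqCl {K : Type*} [Field K] (u : Kˣ) : SqClass K := QuotientGroup.mk u

/-- `α : Kˣ/Kˣ² → Lˣ/Lˣ²` is a Witt equivalence: it sends `-1` to `-1` and preserves
binary value sets. -/
structure IsWittEquiv {K L : Type*} [Field K] [Field L]
    (α : SqClass K ≃* SqClass L) : Prop where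
  map_neg_one : α (sqCl (-1)) = sqCl (-1)
  represents : ∀ (a b c : Kˣ) (a' b' c' : Lˣ),
    α (sqCl a) = sqCl a' → α (sqCl b) = sqCl b' → α (sqCl c) = sqCl c' →
    ((∃ x y : K, (c : K) = (a : K) * x ^ 2 + (b : K) * y ^ 2) ↔
      (∃ x y : L, (c' : L) = (a' : L) * x ^ 2 + (b' : L) * y ^ 2))

/-- Two fields are Witt equivalent if there is a Witt equivalence between them. -/
def WittEquivalent (K L : Type*) [Field K] [Field L] : Prop :=
  ∃ α : SqClass K ≃* SqClass L, IsWittEquiv α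

/-- An ordering of a field `F`. -/
structure IsOrdering {F : Type*} [Field F] (P : Set F) : Prop where
  add_mem : ∀ x ∈ P, ∀ y ∈ P, x + y ∈ P
  mul_mem : ∀ x ∈ P, ∀ y ∈ P, x * y ∈ P
  total : ∀ x : F, x ∈ P ∨ -x ∈ P
  antisymm : ∀ x : F, x ∈ P → -x ∈ P → x = 0

/-- Rigidity data on a field: `T ≤ H` are (indicator predicates of) subgroups of the
multiplicative group, `H` of index two, elements outside `H` are `T`-rigid, and `h` is a
non-rigid element of `H`. -/
structure RigidData {K : Type*} [Field K] (T H : K → Prop) (h : K) : Prop where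
  t_mul : ∀ x y, T x → T y → T (x * y)
  t_inv : ∀ x, T x → T x⁻¹
  t_sq : ∀ x, x ≠ 0 → T (x ^ 2)
  t_neg : T (-1)
  t_le : ∀ x, T x → H x
  h_mul : ∀ x y, H x → H y → H (x * y)
  h_inv : ∀ x, H x → H x⁻¹
  h_zero : ¬ H 0
  index : ∀ x y, x ≠ 0 → y ≠ 0 → ¬ H x → ¬ H y → H (x * y)
  rigid : ∀ x, x ≠ 0 → ¬ H x → T (1 + x) ∨ T ((1 + x) / x)
  mem : H h
  not_t : ¬ T h
  not_t_add : ¬ T (1 + h)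
  not_t_div : ¬ T ((1 + h) / h)
  add_ne : 1 + h ≠ 0

namespace RigidData

variable {K : Type*} [Field K] {T H : K → Prop} {h : K}

section basic

variable (D : RigidData T H h)
include D

lemma t_one : T 1 := by simpa using D.t_sq 1 one_ne_zero

lemma ne_zero {x : K} (hx : H x) : x ≠ 0 := by
  rintro rfl; exact D.h_zero hx

lemma t_ne_zero {x : K} (hx : T x) : x ≠ 0 := D.ne_zero (D.t_le _ hx)

lemma t_div {x y : K} (hx : T x) (hy : T y) : T (x / y) := by
  rw [div_eq_mul_inv]; exact D.t_mul _ _ hx (D.t_inv _ hy)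

lemma h_div {x y : K} (hx : H x) (hy : H y) : H (x / y) := by
  rw [div_eq_mul_inv]; exact D.h_mul _ _ hx (D.h_inv _ hy)

lemma t_neg_iff {x : K} : T (-x) ↔ T x := by
  constructor
  · intro hx; simpa using D.t_mul _ _ D.t_neg hx
  · intro hx; simpa using D.t_mul _ _ D.t_neg hx

lemma h_neg_iff {x : K} : H (-x) ↔ H x := by
  constructor
  · intro hx; simpa using D.h_mul _ _ (D.t_le _ D.t_neg) hx
  · intro hx; simpa using D.h_mul _ _ (D.t_le _ D.t_neg) hx

lemma t_congr {x y : K} (hxy : T (x / y)) : T x ↔ T y := by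
  have h0 := D.t_ne_zero hxy
  have hx : x ≠ 0 := by rintro rfl; simp at h0
  have hy : y ≠ 0 := by rintro rfl; simp at h0
  constructor
  · intro h1
    have := D.t_div h1 hxy
    rwa [show x / (x / y) = y by field_simp] at this
  · intro h1
    have := D.t_mul _ _ hxy h1
    rwa [show x / y * y = x by field_simp] at this

lemma h_congr {x y : K} (hxy : H (x / y)) : H x ↔ H y := by
  have h0 := D.ne_zero hxy
  have hx : x ≠ 0 := by rintro rfl; simp at h0
  have hy : y ≠ 0 := by rintro rfl; simp at h0
  constructor
  · intro h1
    have := D.h_div h1 hxy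
    rwa [show x / (x / y) = y by field_simp] at this
  · intro h1
    have := D.h_mul _ _ hxy h1
    rwa [show x / y * y = x by field_simp] at this

lemma rigid_add {a x : K} (ha : a ≠ 0) (hx : x ≠ 0) (hax : ¬ H (x / a)) :
    T ((a + x) / a) ∨ T ((a + x) / x) := by
  have := D.rigid (x / a) (div_ne_zero hx ha) hax
  rwa [show 1 + x / a = (a + x) / a by field_simp,
    show (a + x) / a / (x / a) = (a + x) / x by field_simp] at this

lemma dominated_of_add {a b x : K} (hb : H b) (hab : H (a + b))
    (hab' : ¬ T ((a + b) / b)) (ha : H a) (hx : x ≠ 0) (hxH : ¬ H x)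
    (hlt : T ((a + b + x) / (a + b))) : T ((a + x) / a) := by
  have ha0 := D.ne_zero ha
  have hb0 := D.ne_zero hb
  have hc0 := D.ne_zero hab
  by_contra hcon
  have h1 : T ((a + x) / x) := by
    refine (D.rigid_add ha0 hx ?_).resolve_left hcon
    intro h2; exact hxH ((D.h_congr h2).2 ha)
  have hs0 : a + x ≠ 0 := by
    intro h0; rw [h0] at h1; exact D.t_ne_zero h1 (by simp)
  have hsum : a + b + x ≠ 0 := by
    intro h0; rw [h0] at hlt; exact D.t_ne_zero hlt (by simp)
  have hsH : ¬ H (a + x) := fun h2 => hxH ((D.h_congr (D.t_le _ h1)).1 h2)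
  rcases D.rigid_add (a := b) (x := a + x) hb0 hs0
    (fun h2 => hsH ((D.h_congr h2).2 hb)) with h2 | h2
  · apply hab'
    have := D.t_div h2 hlt
    rwa [show (b + (a + x)) / b / ((a + b + x) / (a + b)) = (a + b) / b by
      rw [show b + (a + x) = a + b + x by ring]; field_simp] at this
  · have h3 := D.t_div hlt (D.t_mul _ _ h2 h1)
    rw [show (a + b + x) / (a + b) / ((b + (a + x)) / (a + x) * ((a + x) / x)) = x / (a + b) by
      rw [show b + (a + x) = a + b + x by ring]; field_simp] at h3
    exact hxH ((D.h_congr (D.t_le _ h3)).2 hab)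

lemma h_add : H (1 + h) := by
  by_contra hc
  have hh := D.ne_zero D.mem
  have h1 := D.rigid_add (a := -1) (x := 1 + h) (by simp) D.add_ne
    (fun h2 => hc ((D.h_congr h2).2 (D.t_le _ D.t_neg)))
  rw [show -1 + (1 + h) = h by ring, show h / -1 = -h by rw [div_neg, div_one], D.t_neg_iff] at h1
  rcases h1 with h1 | h1
  · exact D.not_t h1
  · exact hc ((D.h_congr (D.t_le _ h1)).1 D.mem)

lemma dominated_tfae {x : K} (hx : x ≠ 0) (hxH : ¬ H x) :
    (T (1 + x) → T (1 - x)) ∧ (T (1 + x) ↔ T ((h + x) / h)) ∧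
    (T (1 + x) ↔ T ((1 + h + x) / (1 + h))) := by
  have hh := D.ne_zero D.mem
  have hc := D.h_add
  have hc0 := D.add_ne
  have h1H : H 1 := D.t_le _ D.t_one
  have e1 : T ((1 + h + x) / (1 + h)) → T (1 + x) := by
    intro hlt
    simpa using D.dominated_of_add (a := 1) (b := h) D.mem hc D.not_t_div h1H hx hxH hlt
  have e2 : T ((1 + h + x) / (1 + h)) → T ((h + x) / h) := by
    intro hlt
    refine D.dominated_of_add (a := h) (b := 1) h1H (by rwa [add_comm]) ?_ D.mem hx hxH
      (by rwa [add_comm h 1])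
    simpa [add_comm] using D.not_t_add
  have e3 : T (1 + x) → T ((1 + h + x) / (1 + h)) := by
    intro hlt
    refine D.dominated_of_add (a := 1 + h) (b := -h) (D.h_neg_iff.2 D.mem)
      (by rw [add_neg_cancel_right]; exact h1H) ?_ hc hx hxH
      (by rw [add_neg_cancel_right, div_one]; exact hlt)
    rw [add_neg_cancel_right]
    intro h2
    apply D.not_t
    have := D.t_inv _ (D.t_neg_iff.2 h2)
    rwa [show (-(1 / -h))⁻¹ = h by simp] at this
  have e4 : T ((h + x) / h) → T ((1 + h + x) / (1 + h)) := by
    intro hlt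
    refine D.dominated_of_add (a := 1 + h) (b := -1) (D.h_neg_iff.2 h1H) ?_ ?_ hc hx hxH ?_
    · rw [show 1 + h + -1 = h by ring]; exact D.mem
    · rw [show 1 + h + -1 = h by ring, div_neg, div_one, D.t_neg_iff]; exact D.not_t
    · rw [show 1 + h + -1 = h by ring]; exact hlt
  have e5 : T ((h + x) / h) → T (1 - x) := by
    intro hlt
    have := D.dominated_of_add (a := -1) (b := 1 + h) (x := x) hc
      (by rw [show -1 + (1 + h) = h by ring]; exact D.mem) ?_ (D.h_neg_iff.2 h1H) hx hxH
      (by rw [show -1 + (1 + h) = h by ring]; exact hlt)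
    · rwa [show (-1 + x) / -1 = 1 - x by rw [div_neg, div_one]; ring] at this
    · rw [show -1 + (1 + h) = h by ring]
      intro h2
      apply D.not_t_div
      have := D.t_inv _ h2
      rwa [inv_div] at this
  exact ⟨fun h0 => e5 (e2 (e3 h0)), ⟨fun h0 => e2 (e3 h0), fun h0 => e1 (e4 h0)⟩, e3, e1⟩

end basic

/-- Elements outside `H` which are dominated by `1`. -/
def Small (T H : K → Prop) (x : K) : Prop := x ≠ 0 ∧ ¬ H x ∧ T (1 + x)

section small

variable (D : RigidData T H h)
include D

lemma small_or_inv {x : K} (hx : x ≠ 0) (hxH : ¬ H x) : Small T H x ∨ Small T H x⁻¹ := by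
  rcases D.rigid x hx hxH with h1 | h1
  · exact Or.inl ⟨hx, hxH, h1⟩
  · refine Or.inr ⟨inv_ne_zero hx, fun h2 => hxH (by simpa using D.h_inv _ h2), ?_⟩
    rwa [show (1 + x) / x = 1 + x⁻¹ by field_simp; ring] at h1

lemma not_small_inv {x : K} (hx : Small T H x) : ¬ Small T H x⁻¹ := by
  intro h1
  have h0 := hx.1
  have h2 := D.t_div hx.2.2 h1.2.2
  have h3 := D.t_ne_zero hx.2.2
  rw [show (1 + x) / (1 + x⁻¹) = x by
    rw [show 1 + x⁻¹ = (1 + x) / x by field_simp; ring]; field_simp] at h2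
  exact hx.2.1 (D.t_le _ h2)

lemma small_neg {x : K} (hx : Small T H x) : Small T H (-x) :=
  ⟨neg_ne_zero.2 hx.1, fun h1 => hx.2.1 (D.h_neg_iff.1 h1), by
    rw [← sub_eq_add_neg]; exact (D.dominated_tfae hx.1 hx.2.1).1 hx.2.2⟩

lemma small_mul_h {x : K} (hx0 : x ≠ 0) : Small T H (h * x) ↔ Small T H x := by
  have hh := D.ne_zero D.mem
  have hH : H (h * x) ↔ H x := by
    apply D.h_congr
    rw [show h * x / x = h by field_simp]; exact D.mem
  unfold Small
  rw [hH]
  have hhx : h * x ≠ 0 := mul_ne_zero hh hx0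
  simp only [ne_eq, hhx, hx0, not_false_eq_true, true_and]
  refine and_congr_right fun h1 => ?_
  rw [(D.dominated_tfae hhx (fun h2 => h1 (hH.1 h2))).2.1,
    show (h + h * x) / h = 1 + x by field_simp]

lemma small_mul_c {x : K} (hx0 : x ≠ 0) : Small T H ((1 + h) * x) ↔ Small T H x := by
  have hh := D.add_ne
  have hH : H ((1 + h) * x) ↔ H x := by
    apply D.h_congr
    rw [show (1 + h) * x / x = 1 + h by field_simp]; exact D.h_add
  unfold Small
  rw [hH]
  have hhx : (1 + h) * x ≠ 0 := mul_ne_zero hh hx0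
  simp only [ne_eq, hhx, hx0, not_false_eq_true, true_and]
  refine and_congr_right fun h1 => ?_
  rw [(D.dominated_tfae hhx (fun h2 => h1 (hH.1 h2))).2.2,
    show (1 + h + (1 + h) * x) / (1 + h) = 1 + x by field_simp]

lemma one_add_mul_aux {x z : K} (hx : Small T H x) (hz : T (1 + z)) :
    T (1 + x * z) ∨ T ((1 + x * z) / x) := by
  have h1 : T (1 - x) := by simpa [sub_eq_add_neg] using (D.small_neg hx).2.2
  have h2 := D.t_ne_zero h1
  have h3 := D.t_ne_zero hz
  have h4 : T (x * (1 + z) / x) := by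
    rwa [mul_div_cancel_left₀ _ hx.1]
  have h5 : ¬ H (x * (1 + z) / (1 - x)) := by
    intro h6
    have := (D.h_congr h6).2 (D.t_le _ h1)
    exact hx.2.1 ((D.h_congr (D.t_le _ h4)).1 this)
  have h6 := D.rigid_add h2 (mul_ne_zero hx.1 h3) h5
  rw [show 1 - x + x * (1 + z) = 1 + x * z by ring] at h6
  rcases h6 with h6 | h6
  · exact Or.inl ((D.t_congr h6).2 h1)
  · right
    have := D.t_mul _ _ h6 h4
    rwa [show (1 + x * z) / (x * (1 + z)) * (x * (1 + z) / x) = (1 + x * z) / x by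
      have := hx.1; field_simp] at this

lemma one_add_mul_of_not {x y : K} (hx : Small T H x) (hy : Small T H y) (hxy : ¬ T (x / y)) :
    T (1 + x * y) := by
  rcases D.one_add_mul_aux hx hy.2.2 with h1 | h1
  · exact h1
  rcases D.one_add_mul_aux hy hx.2.2 with h2 | h2
  · rwa [mul_comm]
  exfalso
  apply hxy
  have := D.t_div h2 h1
  have h3 := D.t_ne_zero h1
  have hx0 := hx.1
  have hy0 := hy.1
  have h4 : 1 + x * y ≠ 0 := fun h => h3 (by simp [h])
  rwa [show (1 + y * x) / y / ((1 + x * y) / x) = x / y by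
    rw [mul_comm y x]; field_simp] at this

lemma one_add_mul {x y : K} (hx : Small T H x) (hy : Small T H y) : T (1 + x * y) := by
  by_cases hxy : T (x / y)
  swap
  · exact D.one_add_mul_of_not hx hy hxy
  by_contra hcon
  have hx0 := hx.1
  have hy0 := hy.1
  have hh := D.ne_zero D.mem
  have hc0 := D.add_ne
  have h1 := (D.one_add_mul_aux hx hy.2.2).resolve_left hcon
  have hs0 : 1 + x * y ≠ 0 := fun h => D.t_ne_zero h1 (by simp [h])
  have hch : T (1 + x * ((1 + h) * y)) := by
    refine D.one_add_mul_of_not hx ((D.small_mul_c hy0).2 hy) fun h2 => D.not_t_add ?_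
    have := D.t_div hxy h2
    rwa [show x / y / (x / ((1 + h) * y)) = 1 + h by field_simp] at this
  have hsH : ¬ H (1 + x * y) := fun h2 => hx.2.1 ((D.h_congr (D.t_le _ h1)).1 h2)
  have hxyT : T (x * y) := by
    have := D.t_mul _ _ hxy (D.t_sq y hy0)
    rwa [show x / y * y ^ 2 = x * y by field_simp] at this
  have hhxy : H (h * (x * y)) := D.h_mul _ _ D.mem (D.t_le _ hxyT)
  have h2 := D.rigid_add (a := h * (x * y)) (x := 1 + x * y) (D.ne_zero hhxy) hs0
    (fun h3 => hsH ((D.h_congr h3).2 hhxy))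
  rw [show h * (x * y) + (1 + x * y) = 1 + x * ((1 + h) * y) by ring] at h2
  rcases h2 with h2 | h2
  · apply D.not_t
    have := (D.t_congr h2).1 hch
    refine (D.t_congr ?_).2 this
    rw [show h / (h * (x * y)) = (x * y)⁻¹ by field_simp]
    exact D.t_inv _ hxyT
  · exact hsH (D.t_le _ ((D.t_congr h2).1 hch))

lemma not_h_mul {x y : K} (hx : H x) (hy : ¬ H y) : ¬ H (x * y) := by
  intro h1
  have hx0 := D.ne_zero hx
  have := D.h_div h1 hx
  rw [mul_div_cancel_left₀ _ hx0] at this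
  exact hy this

lemma not_h_inv {x : K} (hx : ¬ H x) : ¬ H x⁻¹ := fun h1 => hx (by simpa using D.h_inv _ h1)

lemma div_of_one_add_mul {x y z : K} (hx : Small T H x) (hy : Small T H y)
    (h1 : Small T H z) (hn : ¬ T (1 + x * y * z)) : T (x / y) := by
  have h2 := (D.one_add_mul_aux hx (D.one_add_mul hy h1)).resolve_left (by rwa [← mul_assoc])
  have h3 := (D.one_add_mul_aux hy (D.one_add_mul hx h1)).resolve_left
    (by rwa [← mul_assoc, mul_comm y x])
  have h4 := D.t_div h3 h2
  have h5 := D.t_ne_zero h3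
  have hx0 := hx.1
  have hy0 := hy.1
  rw [show y * (x * z) = x * (y * z) by ring] at h4 h5
  have h6 : 1 + x * (y * z) ≠ 0 := fun h => h5 (by simp [h])
  rwa [div_div_div_cancel_left' _ _ h6] at h4

lemma small_mul_mul {x y z : K} (hx : Small T H x) (hy : Small T H y) (hz : Small T H z) :
    Small T H (x * y * z) := by
  have h0 : x * y * z ≠ 0 := mul_ne_zero (mul_ne_zero hx.1 hy.1) hz.1
  have h1 : ¬ H (x * y * z) := D.not_h_mul (D.index _ _ hx.1 hy.1 hx.2.1 hy.2.1) hz.2.1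
  refine ⟨h0, h1, ?_⟩
  by_contra hn
  have h2 := D.div_of_one_add_mul hx hy hz hn
  have hhx := (D.small_mul_h hx.1).2 hx
  have h3 := D.div_of_one_add_mul hhx hy hz fun h4 => hn <| by
    have : Small T H (h * (x * y * z)) := by
      refine ⟨mul_ne_zero (D.ne_zero D.mem) h0, D.not_h_mul D.mem h1, ?_⟩
      rwa [show h * (x * y * z) = h * x * y * z by ring]
    exact ((D.small_mul_h h0).1 this).2.2
  apply D.not_t
  have := D.t_div h3 h2
  have hx0 := hx.1
  have hy0 := hy.1
  rwa [show h * x / y / (x / y) = h by field_simp] at this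

omit D in
/-- Elements of `H` preserving the small elements. -/
def Mult (T H : K → Prop) (u : K) : Prop := H u ∧ ∀ y, Small T H y → Small T H (u * y)

lemma mult_or_inv {u : K} (hu : H u) : Mult T H u ∨ Mult T H u⁻¹ := by
  by_contra! hcon
  obtain ⟨h1, h2⟩ := hcon
  have hu0 := D.ne_zero hu
  simp only [Mult, hu, true_and, not_forall, D.h_inv _ hu] at h1 h2
  obtain ⟨x, hx, hux⟩ := h1
  obtain ⟨y, hy, huy⟩ := h2
  have hx0 := hx.1
  have h3 := (D.small_or_inv (mul_ne_zero hu0 hx0) (D.not_h_mul hu hx.2.1)).resolve_left hux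
  apply huy
  have := D.small_mul_mul hx h3 hy
  rwa [show x * (u * x)⁻¹ * y = u⁻¹ * y by field_simp] at this

/-- Membership in the valuation ring determined by rigidity data. -/
def Int (T H : K → Prop) (x : K) : Prop := x = 0 ∨ Small T H x ∨ Mult T H x

lemma int_or_inv (x : K) : Int T H x ∨ Int T H x⁻¹ := by
  by_cases hx : x = 0
  · exact Or.inl (Or.inl hx)
  by_cases hxH : H x
  · rcases D.mult_or_inv hxH with h1 | h1
    · exact Or.inl (Or.inr (Or.inr h1))
    · exact Or.inr (Or.inr (Or.inr h1))
  · rcases D.small_or_inv hx hxH with h1 | h1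
    · exact Or.inl (Or.inr (Or.inl h1))
    · exact Or.inr (Or.inr (Or.inl h1))

lemma int_mul {x y : K} (hx : Int T H x) (hy : Int T H y) : Int T H (x * y) := by
  rcases hx with rfl | hx | hx
  · left; simp
  · rcases hy with rfl | hy | hy
    · left; simp
    · exact Or.inr (Or.inr ⟨D.index _ _ hx.1 hy.1 hx.2.1 hy.2.1,
        fun z hz => D.small_mul_mul hx hy hz⟩)
    · right; left; rw [mul_comm]; exact hy.2 _ hx
  · rcases hy with rfl | hy | hy
    · left; simp
    · exact Or.inr (Or.inl (hx.2 _ hy))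
    · refine Or.inr (Or.inr ⟨D.h_mul _ _ hx.1 hy.1, fun z hz => ?_⟩)
      rw [mul_assoc]; exact hx.2 _ (hy.2 _ hz)

lemma int_one : Int T H 1 :=
  Or.inr (Or.inr ⟨D.t_le _ D.t_one, fun y hy => by rwa [one_mul]⟩)

lemma int_neg {x : K} (hx : Int T H x) : Int T H (-x) := by
  have : Int T H (-1) := Or.inr (Or.inr ⟨D.t_le _ D.t_neg, fun y hy => by
    rw [neg_one_mul]; exact D.small_neg hy⟩)
  simpa using D.int_mul this hx

lemma t_one_sub_mul {x y : K} (hx : Small T H x) (hy : Small T H y) : T (1 - x * y) := by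
  simpa [sub_eq_add_neg] using D.one_add_mul (D.small_neg hx) hy

lemma int_one_add_of_small {u : K} (hu : Small T H u) : Mult T H (1 + u) := by
  refine ⟨D.t_le _ hu.2.2, fun y hy => ?_⟩
  have h0 := D.t_ne_zero hu.2.2
  have hy0 := hy.1
  by_contra hn
  have h1 := (D.small_or_inv (mul_ne_zero h0 hy0)
    (D.not_h_mul (D.t_le _ hu.2.2) hy.2.1)).resolve_left hn
  have h2 := D.t_le _ (D.t_one_sub_mul hy h1)
  refine (D.small_mul_mul hu hy h1).2.1 ?_
  rwa [show u * y * ((1 + u) * y)⁻¹ = 1 - y * ((1 + u) * y)⁻¹ by field_simp; ring]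

lemma small_div_one_add {y v : K} (hy : Small T H y) (hv : Small T H v) :
    Small T H (v / (1 + y)) := by
  have h0 := D.t_ne_zero hy.2.2
  have hv0 := hv.1
  by_contra hn
  have h1 := (D.small_or_inv (div_ne_zero hv0 h0)
    (by rw [div_eq_inv_mul]; exact D.not_h_mul (D.h_inv _ (D.t_le _ hy.2.2)) hv.2.1)).resolve_left
    hn
  have h2 := D.t_le _ (D.t_one_sub_mul hv h1)
  rw [show 1 - v * (v / (1 + y))⁻¹ = -y by field_simp; ring, D.h_neg_iff] at h2
  exact hy.2.1 h2

lemma int_one_add {u : K} (hu : Int T H u) : Int T H (1 + u) := by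
  rcases hu with rfl | hu | hu
  · simpa using D.int_one
  · exact Or.inr (Or.inr (D.int_one_add_of_small hu))
  by_cases h0 : 1 + u = 0
  · exact Or.inl h0
  by_cases hH : H (1 + u)
  · refine Or.inr (Or.inr ⟨hH, fun y hy => ?_⟩)
    have hy0 := hy.1
    by_contra hn
    have hz := (D.small_or_inv (mul_ne_zero h0 hy0) (D.not_h_mul hH hy.2.1)).resolve_left hn
    have hv := D.small_div_one_add hy (hu.2 _ hy)
    have h1 := D.t_mul _ _ hy.2.2 hv.2.2
    have h2 := D.t_ne_zero hy.2.2
    apply hn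
    refine ⟨mul_ne_zero h0 hy0, D.not_h_mul hH hy.2.1, ?_⟩
    rwa [show (1 + y) * (1 + u * y / (1 + y)) = 1 + (1 + u) * y by field_simp; ring] at h1
  · right; left
    by_contra hn
    have hz := (D.small_or_inv h0 hH).resolve_left hn
    refine (hu.2 _ hz).2.1 ?_
    have := D.t_le _ (D.small_neg hz).2.2
    rwa [show 1 + -(1 + u)⁻¹ = u * (1 + u)⁻¹ by field_simp; ring] at this

lemma int_add {x y : K} (hx : Int T H x) (hy : Int T H y) : Int T H (x + y) := by
  by_cases hx0 : x = 0
  · simpa [hx0]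
  by_cases hy0 : y = 0
  · simpa [hy0]
  rcases D.int_or_inv (y / x) with h1 | h1
  · have := D.int_mul hx (D.int_one_add h1)
    rwa [show x * (1 + y / x) = x + y by field_simp] at this
  · have := D.int_mul hy (D.int_one_add h1)
    rwa [show y * (1 + (y / x)⁻¹) = x + y by field_simp; ring] at this

/-- The valuation ring determined by rigidity data. -/
def valuationSubring : ValuationSubring K where
  carrier := {x | Int T H x}
  mul_mem' := D.int_mul
  one_mem' := D.int_one
  add_mem' := D.int_add
  zero_mem' := Or.inl rfl
  neg_mem' := D.int_neg
  mem_or_inv_mem' := D.int_or_inv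

lemma mem_valuationSubring {x : K} : x ∈ D.valuationSubring ↔ Int T H x := Iff.rfl

lemma exists_valuationSubring : ∃ A : ValuationSubring K,
    (∀ x, A.valuation x = 1 → H x) ∧ ∀ x, A.valuation x < 1 → T (1 + x) := by
  refine ⟨D.valuationSubring, fun x hx => ?_, fun x hx => ?_⟩
  · have hx0 : x ≠ 0 := by rintro rfl; simp at hx
    have h1 : Int T H x := by
      rw [← mem_valuationSubring D, ← ValuationSubring.valuation_le_one_iff, hx]
    have h2 : Int T H x⁻¹ := by
      rw [← mem_valuationSubring D, ← ValuationSubring.valuation_le_one_iff, map_inv₀, hx, inv_one]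
    rcases h1 with h1 | h1 | h1
    · exact absurd h1 hx0
    · rcases h2 with h2 | h2 | h2
      · simp [hx0] at h2
      · exact absurd h2 (D.not_small_inv h1)
      · exact absurd h2.1 (D.not_h_inv h1.2.1)
    · exact h1.1
  · by_cases hx0 : x = 0
    · simpa [hx0] using D.t_one
    have h1 : Int T H x := by
      rw [← mem_valuationSubring D, ← ValuationSubring.valuation_le_one_iff]; exact hx.le
    have h2 : ¬ Int T H x⁻¹ := by
      rw [← mem_valuationSubring D, ← ValuationSubring.valuation_le_one_iff, map_inv₀, not_le]
      exact (one_lt_inv₀ (by simpa [zero_lt_iff] using hx0)).2 hx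
    rcases h1 with h1 | h1 | h1
    · exact absurd h1 hx0
    · exact h1.2.2
    · have h3 : ¬ Mult T H x⁻¹ := fun h => h2 (Or.inr (Or.inr h))
      simp only [Mult, D.h_inv _ h1.1, true_and, not_forall] at h3
      obtain ⟨y, hy, hxy⟩ := h3
      have hy0 := hy.1
      have h4 := (D.small_or_inv (mul_ne_zero (inv_ne_zero hx0) hy0)
        (D.not_h_mul (D.h_inv _ h1.1) hy.2.1)).resolve_left hxy
      have := D.one_add_mul h4 hy
      rwa [show (x⁻¹ * y)⁻¹ * y = x by field_simp] at this

end small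

end RigidData

section Abstract

variable {V : Type*} [CommGroup V]

/-- The subgroup generated by the values in `H` of binary forms `⟨1, x⟩` with `x ∉ H`. -/
def TT (R : V → V → V → Prop) (H : Subgroup V) : Subgroup V :=
  Subgroup.closure {c | c ∈ H ∧ ∃ x, x ∉ H ∧ R 1 x c}

lemma TT_le (R : V → V → V → Prop) (H : Subgroup V) : TT R H ≤ H :=
  (Subgroup.closure_le _).2 fun _ hc => hc.1

/-- `TT H` together with the class of `-1`. -/
def TPM (e : V) (R : V → V → V → Prop) (H : Subgroup V) : Subgroup V :=
  TT R H ⊔ Subgroup.zpowers e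

/-- Subgroups of index two which behave like the subgroup of elements of even value for a
discrete valuation with a sufficiently large residue field. -/
structure Good (e : V) (R : V → V → V → Prop) (H : Subgroup V) : Prop where
  index : ∀ x y, x ∉ H → y ∉ H → x * y ∈ H
  exists_not_mem : ∃ x, x ∉ H
  e_mem : e ∈ H
  rigid : ∀ x, x ∉ H → ∀ t₁ ∈ TT R H, ∀ t₂ ∈ TT R H, ∀ c, R t₁ (t₂ * x) c →
    c ∈ TT R H ∨ ∃ t ∈ TT R H, c = x * t
  exists_not_rigid : ∃ h c, h ∈ H ∧ R 1 h c ∧ h ∉ TPM e R H ∧ c ∉ TPM e R H ∧ c * h ∉ TPM e R H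

end Abstract

/-- `q : Kˣ → V` presents `(V, e, R)` as the square class group of `K` with the class of `-1`
and the relation of representation by binary forms. -/
structure Interp {K V : Type*} [Field K] [CommGroup V] (e : V) (R : V → V → V → Prop)
    (q : Kˣ →* V) : Prop where
  surj : Function.Surjective q
  ker : ∀ u, q u = 1 ↔ ∃ v, u = v ^ 2
  neg_one : q (-1) = e
  rep : ∀ a b c : Kˣ, R (q a) (q b) (q c) ↔ ∃ x y : K, (c : K) = a * x ^ 2 + b * y ^ 2

/-- Elements of `K` whose class lies in `H`. -/
def Pull {K V : Type*} [Field K] [CommGroup V] (q : Kˣ →* V) (H : Subgroup V) (x : K) : Prop :=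
  ∃ u : Kˣ, (u : K) = x ∧ q u ∈ H

lemma TPM_le {V : Type*} [CommGroup V] {e : V} {R : V → V → V → Prop} {H : Subgroup V}
    (he : e ∈ H) : TPM e R H ≤ H :=
  sup_le (TT_le R H) (by simpa using he)

section Pull

variable {K V : Type*} [Field K] [CommGroup V] {e : V} {R : V → V → V → Prop}
  {q : Kˣ →* V} {H : Subgroup V}

lemma pull_coe (u : Kˣ) : Pull q H (u : K) ↔ q u ∈ H :=
  ⟨fun ⟨v, hv, h⟩ => by rwa [← Units.ext hv], fun h => ⟨u, rfl, h⟩⟩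

lemma Pull.ne_zero {x : K} (h : Pull q H x) : x ≠ 0 := by
  obtain ⟨u, rfl, -⟩ := h; exact u.ne_zero

lemma Pull.mul {x y : K} (hx : Pull q H x) (hy : Pull q H y) : Pull q H (x * y) := by
  obtain ⟨u, rfl, hu⟩ := hx
  obtain ⟨v, rfl, hv⟩ := hy
  exact ⟨u * v, by simp, by rw [map_mul]; exact H.mul_mem hu hv⟩

lemma Pull.inv {x : K} (hx : Pull q H x) : Pull q H x⁻¹ := by
  obtain ⟨u, rfl, hu⟩ := hx
  exact ⟨u⁻¹, by simp, by rw [map_inv]; exact H.inv_mem hu⟩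

lemma Pull.div {x y : K} (hx : Pull q H x) (hy : Pull q H y) : Pull q H (x / y) := by
  rw [div_eq_mul_inv]; exact hx.mul hy.inv

lemma Pull.mono {H' : Subgroup V} (h : H ≤ H') {x : K} (hx : Pull q H x) : Pull q H' x := by
  obtain ⟨u, hu, hu'⟩ := hx
  exact ⟨u, hu, h hu'⟩

lemma pull_one : Pull q H (1 : K) := ⟨1, by simp, by simp⟩

lemma Pull.zpow {x : K} (hx : Pull q H x) (n : ℤ) : Pull q H (x ^ n) := by
  obtain ⟨u, rfl, hu⟩ := hx
  exact ⟨u ^ n, by simp, by rw [map_zpow]; exact H.zpow_mem hu n⟩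

lemma pull_mul_right_iff {x y : K} (hy : Pull q H y) : Pull q H (x * y) ↔ Pull q H x := by
  refine ⟨fun h => ?_, fun h => h.mul hy⟩
  have := h.div hy
  rwa [mul_div_cancel_right₀ _ hy.ne_zero] at this

lemma pull_mul_left_iff {x y : K} (hy : Pull q H y) : Pull q H (y * x) ↔ Pull q H x := by
  rw [mul_comm, pull_mul_right_iff hy]

namespace Interp

variable (I : Interp e R q)
include I

lemma e_mul_e : e * e = 1 := by
  rw [← I.neg_one, ← map_mul]; simp

lemma pull_sq {x : K} (hx : x ≠ 0) : Pull q H (x ^ 2) :=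
  ⟨Units.mk0 x hx ^ 2, by simp, by rw [(I.ker _).2 ⟨_, rfl⟩]; exact H.one_mem⟩

lemma pull_neg_one (he : e ∈ H) : Pull q H (-1 : K) :=
  ⟨-1, by simp, by rwa [I.neg_one]⟩

lemma pull_mul_sq {x y : K} (hy : y ≠ 0) : Pull q H (x * y ^ 2) ↔ Pull q H x :=
  pull_mul_right_iff (I.pull_sq hy)

lemma mem_TPM {z : V} : z ∈ TPM e R H ↔ z ∈ TT R H ∨ e * z ∈ TT R H := by
  constructor
  · intro hz
    obtain ⟨t, ht, w, hw, rfl⟩ := Subgroup.mem_sup.1 hz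
    obtain ⟨n, rfl⟩ := Subgroup.mem_zpowers_iff.1 hw
    rcases Int.even_or_odd' n with ⟨m, rfl | rfl⟩
    · left; rwa [zpow_mul, show e ^ (2 : ℤ) = 1 by rw [zpow_two, I.e_mul_e], one_zpow, mul_one]
    · right
      rwa [zpow_add, zpow_mul, show e ^ (2 : ℤ) = 1 by rw [zpow_two, I.e_mul_e], one_zpow,
        one_mul, zpow_one, mul_comm t, ← mul_assoc, I.e_mul_e, one_mul]
  · rintro (h | h)
    · exact Subgroup.mem_sup_left h
    · have := (TPM e R H).mul_mem (Subgroup.mem_sup_right (Subgroup.mem_zpowers e))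
        (Subgroup.mem_sup_left h)
      rwa [← mul_assoc, I.e_mul_e, one_mul] at this

lemma pull_TPM {x : K} : Pull q (TPM e R H) x ↔ Pull q (TT R H) x ∨ Pull q (TT R H) (-x) := by
  constructor
  · rintro ⟨u, rfl, hu⟩
    rcases I.mem_TPM.1 hu with h | h
    · exact Or.inl ⟨u, rfl, h⟩
    · exact Or.inr ⟨-u, by simp, by rwa [← neg_one_mul, map_mul, I.neg_one]⟩
  · rintro (⟨u, rfl, hu⟩ | ⟨u, hu, hu'⟩)
    · exact ⟨u, rfl, I.mem_TPM.2 (Or.inl hu)⟩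
    · refine ⟨-u, by simp [hu], I.mem_TPM.2 (Or.inr ?_)⟩
      rwa [← I.neg_one, ← map_mul, neg_one_mul, neg_neg]

/-- A subgroup satisfying `Good` comes from a valuation. -/
lemma exists_valuationSubring_of_good (hH : Good e R H) : ∃ A : ValuationSubring K,
    (∀ x, A.valuation x = 1 → Pull q H x) ∧
    (∀ x, A.valuation x < 1 → Pull q (TPM e R H) (1 + x)) ∧
    ∃ h, A.valuation h = 1 ∧ A.valuation (1 + h) = 1 ∧ ¬ Pull q (TPM e R H) h ∧
      ¬ Pull q (TPM e R H) (1 + h) ∧ ¬ Pull q (TPM e R H) (h * (1 + h)) := by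
  obtain ⟨h₀, c₀, hh₀, hR, h1, h2, h3⟩ := hH.exists_not_rigid
  obtain ⟨h, rfl⟩ := I.surj h₀
  obtain ⟨c, rfl⟩ := I.surj c₀
  rw [← map_one q, I.rep] at hR
  obtain ⟨x, y, hxy⟩ := hR
  rw [← map_mul] at h3
  rw [← pull_coe] at hh₀ h1 h2 h3
  rw [Units.val_one, one_mul] at hxy
  have hx : x ≠ 0 := by
    rintro rfl
    have hy : y ≠ 0 := by rintro rfl; exact c.ne_zero (by simp [hxy])
    apply h3
    have := I.pull_sq (H := TPM e R H) (mul_ne_zero h.ne_zero hy)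
    rwa [Units.val_mul, hxy, show (0 ^ 2 + (h : K) * y ^ 2) * h = (h * y) ^ 2 by ring]
  have hy : y ≠ 0 := by
    rintro rfl
    apply h2
    have := I.pull_sq (H := TPM e R H) hx
    rwa [hxy, show x ^ 2 + (h : K) * 0 ^ 2 = x ^ 2 by ring]
  have hyx := div_ne_zero hy hx
  have hcx : (c : K) = (1 + h * (y / x) ^ 2) * x ^ 2 := by rw [hxy]; field_simp
  have h0 : (h : K) ≠ 0 := h.ne_zero
  set g : K := h * (y / x) ^ 2 with hg
  have g0 : g ≠ 0 := mul_ne_zero h0 (pow_ne_zero 2 hyx)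
  have gH : Pull q H g := (I.pull_mul_sq hyx).2 hh₀
  have g1 : ¬ Pull q (TPM e R H) g := by rwa [hg, I.pull_mul_sq hyx]
  have g2 : ¬ Pull q (TPM e R H) (1 + g) := by rwa [hcx, I.pull_mul_sq hx] at h2
  have g3 : ¬ Pull q (TPM e R H) (g * (1 + g)) := by
    rw [Units.val_mul, hcx] at h3
    rw [← I.pull_mul_sq hx, ← I.pull_mul_sq (div_ne_zero hx hy)]
    convert h3 using 2
    rw [hg]; field_simp
  have D : RigidData (Pull q (TPM e R H)) (Pull q H) g := {
    t_mul := fun x y hx hy => hx.mul hy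
    t_inv := fun x hx => hx.inv
    t_sq := fun x hx => I.pull_sq hx
    t_neg := ⟨-1, by simp, by
      rw [I.neg_one]; exact Subgroup.mem_sup_right (Subgroup.mem_zpowers e)⟩
    t_le := fun x hx => hx.mono (TPM_le hH.e_mem)
    h_mul := fun x y hx hy => hx.mul hy
    h_inv := fun x hx => hx.inv
    h_zero := fun h => h.ne_zero rfl
    index := fun x y hx hy hxH hyH => by
      refine ⟨Units.mk0 x hx * Units.mk0 y hy, by simp, ?_⟩
      rw [map_mul]
      exact hH.index _ _ (fun h => hxH ⟨_, by simp, h⟩) (fun h => hyH ⟨_, by simp, h⟩)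
    rigid := fun x hx hxH => by
      have h0 : 1 + x ≠ 0 := by
        intro h0
        apply hxH
        rw [show x = -1 by linear_combination h0]
        exact I.pull_neg_one hH.e_mem
      have hq : q (Units.mk0 x hx) ∉ H := fun h => hxH ⟨_, by simp, h⟩
      have hR : R (q 1) (q (1 * Units.mk0 x hx)) (q (Units.mk0 (1 + x) h0)) :=
        (I.rep _ _ _).2 ⟨1, 1, by simp⟩
      rw [map_one, map_mul, map_one] at hR
      rcases hH.rigid _ hq 1 (one_mem _) 1 (one_mem _) _ hR with h1 | ⟨t, ht, h1⟩
      · exact Or.inl ⟨_, by simp, Subgroup.mem_sup_left h1⟩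
      · refine Or.inr ⟨Units.mk0 (1 + x) h0 / Units.mk0 x hx, by simp, ?_⟩
        rw [map_div, h1, mul_div_cancel_left]
        exact Subgroup.mem_sup_left ht
    mem := gH
    not_t := g1
    not_t_add := g2
    not_t_div := fun h => g3 <| by
      have := (I.pull_mul_sq g0).2 h
      rwa [show (1 + g) / g * g ^ 2 = g * (1 + g) by field_simp] at this
    add_ne := by
      intro h0
      apply c.ne_zero
      rw [hcx, h0, zero_mul] }
  obtain ⟨A, hA1, hA2⟩ := D.exists_valuationSubring
  have hg1 : A.valuation g = 1 := by
    rcases lt_trichotomy (A.valuation g) 1 with h1 | h1 | h1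
    · exact absurd (hA2 _ h1) g2
    · exact h1
    · have := hA2 g⁻¹ (by rw [map_inv₀]; exact inv_lt_one_of_one_lt₀ h1)
      exact absurd (by rwa [show 1 + g⁻¹ = (1 + g) / g by field_simp; ring] at this) D.not_t_div
  refine ⟨A, hA1, hA2, g, hg1, ?_, g1, g2, g3⟩
  have h4 : A.valuation (1 + g) ≤ 1 := by
    refine (A.valuation.map_add 1 g).trans ?_
    simp [hg1]
  refine h4.lt_or_eq.resolve_left fun h5 => g1 ?_
  have := hA2 (-(1 + g)) (by rwa [Valuation.map_neg])
  rw [show 1 + -(1 + g) = -g by ring] at this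
  exact D.t_neg_iff.1 this

/-- Elements of `TT H` are principal units up to squares. -/
lemma exists_of_pull_TT {A : ValuationSubring K} (hA : ∀ x, A.valuation x = 1 → Pull q H x)
    {x : K} (hx : Pull q (TT R H) x) :
    ∃ m y, A.valuation m < 1 ∧ y ≠ 0 ∧ x = (1 + m) * y ^ 2 := by
  have he : e ∈ H := by
    rw [← I.neg_one, ← pull_coe]; exact hA _ (by simp)
  obtain ⟨u, rfl, hu⟩ := hx
  suffices ∀ v ∈ TT R H, ∀ u : Kˣ, q u = v → ∃ (m y : K), A.valuation m < 1 ∧ y ≠ 0 ∧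
    (u : K) = (1 + m) * y ^ 2 from this _ hu u rfl
  have hone : ∀ m : K, A.valuation m < 1 → A.valuation (1 + m) = 1 := fun m hm => by
    exact A.valuation.map_one_add_of_lt hm
  clear hu u
  intro v hv
  induction hv using Subgroup.closure_induction with
  | one =>
    intro u hu
    obtain ⟨w, rfl⟩ := (I.ker u).1 hu
    exact ⟨0, w, by simp, w.ne_zero, by simp⟩
  | mul a b _ _ iha ihb =>
    intro u hu
    obtain ⟨u₁, rfl⟩ := I.surj a
    obtain ⟨m, y, hm, hy, h1⟩ := iha u₁ rfl
    obtain ⟨n, z, hn, hz, h2⟩ := ihb (u / u₁) (by rw [map_div, hu, mul_div_cancel_left])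
    refine ⟨m + n + m * n, y * z, ?_, mul_ne_zero hy hz, ?_⟩
    · refine (A.valuation.map_add_lt (A.valuation.map_add_lt hm hn) ?_)
      rw [map_mul]; exact mul_lt_one_of_nonneg_of_lt_one_left zero_le hm hn.le
    · rw [show u = u₁ * (u / u₁) by simp, Units.val_mul, h1, h2]; ring
  | inv a _ iha =>
    intro u hu
    obtain ⟨m, y, hm, hy, h1⟩ := iha u⁻¹ (by rw [map_inv, hu, inv_inv])
    have h3 : (1 + m) ≠ 0 := by
      intro h; have := hone m hm; rw [h] at this; simp at this
    refine ⟨-m / (1 + m), y⁻¹, ?_, inv_ne_zero hy, ?_⟩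
    · rw [map_div₀, Valuation.map_neg, hone m hm]; simpa
    · rw [show (u : K) = ((u⁻¹ : Kˣ) : K)⁻¹ by simp, h1]; field_simp; ring
  | mem c hc =>
    intro u hu
    obtain ⟨hcH, x, hx, hR⟩ := hc
    obtain ⟨x, rfl⟩ := I.surj x
    rw [← hu, ← map_one q, I.rep] at hR
    obtain ⟨y, z, hyz⟩ := hR
    rw [← hu, ← pull_coe] at hcH
    rw [← pull_coe] at hx
    rw [Units.val_one, one_mul] at hyz
    have hy : y ≠ 0 := by
      rintro rfl
      apply hx
      have hz : z ≠ 0 := by rintro rfl; exact u.ne_zero (by simp [hyz])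
      rwa [hyz, zero_pow two_ne_zero, zero_add, I.pull_mul_sq hz] at hcH
    by_cases hz : z = 0
    · exact ⟨0, y, by simp, hy, by simp [hyz, hz]⟩
    have hzy := div_ne_zero hz hy
    set g : K := x * (z / y) ^ 2 with hg
    have hug : (u : K) = (1 + g) * y ^ 2 := by rw [hyz, hg]; field_simp
    have gH : ¬ Pull q H g := by rwa [hg, I.pull_mul_sq hzy]
    have g0 : g ≠ 0 := mul_ne_zero x.ne_zero (pow_ne_zero 2 hzy)
    refine ⟨g, y, ?_, hy, hug⟩
    rcases lt_trichotomy (A.valuation g) 1 with h1 | h1 | h1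
    · exact h1
    · exact absurd (hA _ h1) gH
    · exfalso
      have := hA _ (hone g⁻¹ (by rw [map_inv₀]; exact inv_lt_one_of_one_lt₀ h1))
      rw [hug, I.pull_mul_sq hy, show 1 + g = g * (1 + g⁻¹) by field_simp; ring,
        pull_mul_right_iff this] at hcH
      exact gH hcH

end Interp

end Pull

section DVPair

variable {K V : Type*} [Field K] [CommGroup V] {e : V} {R : V → V → V → Prop}
  {q : Kˣ →* V} {H : Subgroup V}

/-- `A` is a discrete valuation ring with uniformizer `ϖ` and `H` consists of the classes of even
value. -/
structure DVPair (q : Kˣ →* V) (A : ValuationSubring K) (H : Subgroup V) (ϖ : K) : Prop where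
  ne_zero : ϖ ≠ 0
  lt_one : A.valuation ϖ < 1
  not_mem : ¬ Pull q H ϖ
  unit_mem : ∀ x, A.valuation x = 1 → Pull q H x
  exists_zpow : ∀ x, x ≠ 0 → ∃ n : ℤ, A.valuation x = A.valuation ϖ ^ n

lemma exists_eq_mul_one_add_of_lt {A : ValuationSubring K} {a b : K}
    (hab : A.valuation b < A.valuation a) :
    ∃ m, A.valuation m < 1 ∧ a + b = a * (1 + m) := by
  have ha : a ≠ 0 := by rintro rfl; simp at hab
  refine ⟨b / a, ?_, by field_simp⟩
  rw [map_div₀]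
  exact (div_lt_one₀ (by simpa [zero_lt_iff] using ha)).2 hab

/-- `x` is neither a square nor the negative of a square in the residue field. -/
def NonSq (A : ValuationSubring K) (x : K) : Prop :=
  ∀ s, ¬ A.valuation (x - s ^ 2) < 1 ∧ ¬ A.valuation (x + s ^ 2) < 1

namespace DVPair

variable {A : ValuationSubring K} {ϖ : K} (D : DVPair q A H ϖ)
include D

lemma pull_congr {x y : K} (hxy : A.valuation x = A.valuation y) : Pull q H x ↔ Pull q H y := by
  by_cases hx : x = 0
  · have hy : y = 0 := by simpa [hx] using hxy.symm
    rw [hx, hy]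
  have hy : y ≠ 0 := by rintro rfl; simp [hx] at hxy
  have h1 : Pull q H (x / y) := D.unit_mem _ (by
    rw [map_div₀, hxy, div_self]; simpa using hy)
  rw [show x = x / y * y by field_simp, pull_mul_left_iff h1]

lemma val_pos : 0 < A.valuation ϖ := by simpa [zero_lt_iff] using D.ne_zero

lemma zpow_lt_one_iff {n : ℤ} : A.valuation ϖ ^ n < 1 ↔ 0 < n :=
  zpow_lt_one_iff_right_of_lt_one₀ D.val_pos D.lt_one

lemma le_of_lt_one {x : K} (hx : A.valuation x < 1) : A.valuation x ≤ A.valuation ϖ := by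
  by_cases hx0 : x = 0
  · simp [hx0]
  obtain ⟨n, hn⟩ := D.exists_zpow x hx0
  rw [hn] at hx ⊢
  have := D.zpow_lt_one_iff.1 hx
  calc _ ≤ A.valuation ϖ ^ (1 : ℤ) := zpow_le_zpow_right_of_le_one₀ D.val_pos D.lt_one.le (by omega)
    _ = _ := zpow_one _

variable (I : Interp e R q)
include I

lemma even_iff {x : K} {n : ℤ} (h : A.valuation x = A.valuation ϖ ^ n) :
    Pull q H x ↔ Even n := by
  rw [← map_zpow₀] at h
  rw [D.pull_congr h]
  have h2 : ∀ m : ℤ, Pull q H (ϖ ^ (2 * m)) := fun m => by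
    rw [mul_comm, zpow_mul]; exact_mod_cast I.pull_sq (zpow_ne_zero m D.ne_zero)
  rcases Int.even_or_odd' n with ⟨m, rfl | rfl⟩
  · simp [h2 m]
  · rw [zpow_add₀ D.ne_zero, zpow_one, pull_mul_left_iff (h2 m)]
    simp [D.not_mem]

lemma e_mem : e ∈ H := by
  rw [← I.neg_one, ← pull_coe]; exact D.unit_mem _ (by simp)

lemma index {x y : K} (hx : x ≠ 0) (hy : y ≠ 0) (hxH : ¬ Pull q H x) (hyH : ¬ Pull q H y) :
    Pull q H (x * y) := by
  obtain ⟨m, hm⟩ := D.exists_zpow x hx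
  obtain ⟨n, hn⟩ := D.exists_zpow y hy
  rw [D.even_iff I hm] at hxH
  rw [D.even_iff I hn] at hyH
  have : A.valuation (x * y) = A.valuation ϖ ^ (m + n) := by
    rw [map_mul, hm, hn, zpow_add₀ D.val_pos.ne']
  rw [D.even_iff I this, Int.even_add]
  tauto

lemma pull_TT_one_add_of_not {m : K} (hm : A.valuation m < 1) (hmH : ¬ Pull q H m) :
    Pull q (TT R H) (1 + m) := by
  by_cases hm0 : m = 0
  · simpa [hm0] using pull_one
  have h1 := A.valuation.map_one_add_of_lt hm
  have h2 : 1 + m ≠ 0 := by intro h; simp [h] at h1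
  refine ⟨Units.mk0 _ h2, by simp, Subgroup.subset_closure ⟨?_, q (Units.mk0 m hm0), ?_, ?_⟩⟩
  · rw [← pull_coe]; exact D.unit_mem _ h1
  · rwa [← pull_coe]
  · rw [← map_one q, I.rep]; exact ⟨1, 1, by simp⟩

lemma pull_TT_one_add {m : K} (hm : A.valuation m < 1) : Pull q (TT R H) (1 + m) := by
  by_cases hmH : Pull q H m
  swap
  · exact D.pull_TT_one_add_of_not I hm hmH
  have h1 := A.valuation.map_one_add_of_lt D.lt_one
  have h2 : 1 + ϖ ≠ 0 := by intro h; simp [h] at h1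
  have h3 : A.valuation m < A.valuation ϖ :=
    (D.le_of_lt_one hm).lt_of_ne fun h => D.not_mem ((D.pull_congr h).1 hmH)
  have h4 : A.valuation (m - ϖ) = A.valuation ϖ := by
    rw [A.valuation.map_sub_swap]; exact Valuation.map_sub_eq_of_lt_left _ h3
  have h5 : A.valuation ((m - ϖ) / (1 + ϖ)) = A.valuation ϖ := by
    rw [map_div₀, h4, h1, div_one]
  have := (D.pull_TT_one_add_of_not I D.lt_one D.not_mem).mul
    (D.pull_TT_one_add_of_not I (m := (m - ϖ) / (1 + ϖ)) (by rw [h5]; exact D.lt_one)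
      (by rw [D.pull_congr h5]; exact D.not_mem))
  rwa [show (1 + ϖ) * (1 + (m - ϖ) / (1 + ϖ)) = 1 + m by field_simp; ring] at this

lemma pull_TT_iff {x : K} : Pull q (TT R H) x ↔
    ∃ m y, A.valuation m < 1 ∧ y ≠ 0 ∧ x = (1 + m) * y ^ 2 := by
  refine ⟨I.exists_of_pull_TT D.unit_mem, ?_⟩
  rintro ⟨m, y, hm, hy, rfl⟩
  rw [I.pull_mul_sq hy]
  exact D.pull_TT_one_add I hm

lemma not_pull_TPM {x : K} (hx : A.valuation x = 1) (h : NonSq A x) :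
    ¬ Pull q (TPM e R H) x := by
  have key : ∀ x : K, A.valuation x = 1 → Pull q (TT R H) x →
      ∃ s, A.valuation (x - s ^ 2) < 1 := by
    intro x hx h
    obtain ⟨m, y, hm, hy, rfl⟩ := (D.pull_TT_iff I).1 h
    rw [map_mul, A.valuation.map_one_add_of_lt hm, one_mul] at hx
    refine ⟨y, ?_⟩
    rw [show (1 + m) * y ^ 2 - y ^ 2 = m * y ^ 2 by ring, map_mul, hx, mul_one]
    exact hm
  rw [I.pull_TPM]
  rintro (h1 | h1)
  · obtain ⟨s, hs⟩ := key x hx h1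
    exact (h s).1 hs
  · obtain ⟨s, hs⟩ := key (-x) (by rwa [Valuation.map_neg]) h1
    apply (h s).2
    rwa [show -x - s ^ 2 = -(x + s ^ 2) by ring, Valuation.map_neg] at hs

lemma rigid {x : K} (hx : ¬ Pull q H x) {t₁ t₂ : K} (h₁ : Pull q (TT R H) t₁)
    (h₂ : Pull q (TT R H) t₂) {c u w : K} (hc : c ≠ 0) (h : c = t₁ * u ^ 2 + t₂ * x * w ^ 2) :
    Pull q (TT R H) c ∨ ∃ t, Pull q (TT R H) t ∧ c = x * t := by
  by_cases hu : u = 0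
  · right
    have hw : w ≠ 0 := by rintro rfl; simp [hu] at h; exact hc h
    exact ⟨t₂ * w ^ 2, (I.pull_mul_sq hw).2 h₂, by rw [h, hu]; ring⟩
  by_cases hw : w = 0
  · left
    rw [h, hw]
    simpa using (I.pull_mul_sq hu).2 h₁
  have h3 : A.valuation (t₁ * u ^ 2) ≠ A.valuation (t₂ * x * w ^ 2) := by
    intro h4
    have h5 := (I.pull_mul_sq hu).2 (h₁.mono (TT_le R H))
    rw [D.pull_congr h4, I.pull_mul_sq hw, pull_mul_left_iff (h₂.mono (TT_le R H))] at h5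
    exact hx h5
  rcases h3.lt_or_gt with h3 | h3
  · obtain ⟨m, hm, h6⟩ := exists_eq_mul_one_add_of_lt h3
    right
    refine ⟨t₂ * w ^ 2 * (1 + m),
      ((I.pull_mul_sq hw).2 h₂).mul (D.pull_TT_one_add I hm), ?_⟩
    rw [h, add_comm, h6]; ring
  · obtain ⟨m, hm, h6⟩ := exists_eq_mul_one_add_of_lt h3
    left
    rw [h, h6]
    exact ((I.pull_mul_sq hu).2 h₁).mul (D.pull_TT_one_add I hm)

lemma good {h : K} (h0 : A.valuation h = 1) (h1 : A.valuation (1 + h) = 1) (n0 : NonSq A h)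
    (n1 : NonSq A (1 + h)) (n2 : NonSq A (h * (1 + h))) : Good e R H where
  index x y hx hy := by
    obtain ⟨x, rfl⟩ := I.surj x
    obtain ⟨y, rfl⟩ := I.surj y
    rw [← pull_coe] at hx hy
    rw [← map_mul, ← pull_coe, Units.val_mul]
    exact D.index I x.ne_zero y.ne_zero hx hy
  exists_not_mem := ⟨q (Units.mk0 ϖ D.ne_zero), by rw [← pull_coe]; exact D.not_mem⟩
  e_mem := D.e_mem I
  rigid x hx t₁ ht₁ t₂ ht₂ c hR := by
    obtain ⟨x, rfl⟩ := I.surj x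
    obtain ⟨t₁, rfl⟩ := I.surj t₁
    obtain ⟨t₂, rfl⟩ := I.surj t₂
    obtain ⟨c, rfl⟩ := I.surj c
    rw [← pull_coe] at hx ht₁ ht₂
    rw [← map_mul, I.rep] at hR
    obtain ⟨u, w, h⟩ := hR
    rw [Units.val_mul] at h
    rcases D.rigid I hx ht₁ ht₂ c.ne_zero h with h | ⟨t, ⟨t, rfl, ht⟩, h⟩
    · left; rwa [← pull_coe]
    · right; refine ⟨q t, ht, ?_⟩
      rw [← map_mul]; congr 1; ext; simpa using h
  exists_not_rigid := by
    have h0' : h ≠ 0 := by rintro rfl; simp at h0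
    have h1' : 1 + h ≠ 0 := by intro h; simp [h] at h1
    refine ⟨q (Units.mk0 h h0'), q (Units.mk0 _ h1'), ?_, ?_, ?_, ?_, ?_⟩
    · rw [← pull_coe]; exact D.unit_mem _ h0
    · rw [← map_one q, I.rep]; exact ⟨1, 1, by simp⟩
    · rw [← pull_coe]; exact D.not_pull_TPM I h0 n0
    · rw [← pull_coe]; exact D.not_pull_TPM I h1 n1
    · rw [← map_mul, ← pull_coe, mul_comm]
      exact D.not_pull_TPM I (x := h * (1 + h)) (by rw [map_mul, h0, h1, one_mul]) n2

end DVPair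

end DVPair

section HorDVR

lemma exists_val_eq_of_sum_eq_zero {L Γ ι : Type*} [Field L] [LinearOrderedCommGroupWithZero Γ]
    (v : Valuation L Γ) (s : Finset ι) (f : ι → L) (hs : ∑ i ∈ s, f i = 0) {i₀ : ι} (hi₀ : i₀ ∈ s)
    (h0 : f i₀ ≠ 0) : ∃ i ∈ s, ∃ j ∈ s, i ≠ j ∧ f i ≠ 0 ∧ f j ≠ 0 ∧ v (f i) = v (f j) := by
  classical
  obtain ⟨i, hi, hmax⟩ := s.exists_max_image (fun i => v (f i)) ⟨i₀, hi₀⟩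
  have hfi : f i ≠ 0 := by
    intro h
    have := hmax i₀ hi₀
    simp [h, h0] at this
  by_contra! hcon
  have h1 : ∀ j ∈ s.erase i, v (f j) < v (f i) := by
    intro j hj
    obtain ⟨hji, hj⟩ := Finset.mem_erase.1 hj
    refine (hmax j hj).lt_of_ne fun h => ?_
    have hfj : f j ≠ 0 := by
      intro h0
      rw [h0, map_zero] at h
      exact hfi ((map_eq_zero v).1 h.symm)
    exact hcon i hi j hj hji.symm hfi hfj h.symm
  have h2 : v (∑ j ∈ s.erase i, f j) < v (f i) :=
    v.map_sum_lt (by simpa using hfi) h1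
  rw [← Finset.add_sum_erase _ _ hi] at hs
  rw [show ∑ j ∈ s.erase i, f j = - f i by linear_combination hs, Valuation.map_neg] at h2
  exact lt_irrefl _ h2

variable {F L : Type*} [Field F] [Field L] [Algebra F L] [FiniteDimensional F L]
  {A : ValuationSubring L}

lemma exists_pow_val_eq {z : L} (hz : z ≠ 0) : ∃ j, 0 < j ∧ j ≤ Module.finrank F L ∧
    ∃ x : F, x ≠ 0 ∧ A.valuation z ^ j = A.valuation (algebraMap F L x) := by
  set n := Module.finrank F L
  have h1 : ¬ LinearIndependent F (fun i : Fin (n + 1) => z ^ (i : ℕ)) := by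
    intro h
    have := h.fintype_card_le_finrank
    simp [n] at this
  rw [Fintype.linearIndependent_iff] at h1
  push Not at h1
  obtain ⟨g, hg, i₀, hi₀⟩ := h1
  have h2 : g i₀ • z ^ (i₀ : ℕ) ≠ 0 := smul_ne_zero hi₀ (pow_ne_zero _ hz)
  obtain ⟨i, -, j, -, hij, hi0, hj0, hv⟩ := exists_val_eq_of_sum_eq_zero A.valuation _ _ hg
    (Finset.mem_univ i₀) h2
  wlog hlt : i < j generalizing i j
  · exact this j i hij.symm hj0 hi0 hv.symm (lt_of_le_of_ne (not_lt.1 hlt) hij.symm)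
  have hgi : g i ≠ 0 := fun h => hi0 (by simp [h])
  have hgj : g j ≠ 0 := fun h => hj0 (by simp [h])
  refine ⟨j - i, by have : (i : ℕ) < j := hlt; omega, by omega, g i / g j, div_ne_zero hgi hgj, ?_⟩
  have hvz : A.valuation z ≠ 0 := by simpa using hz
  have hvj : A.valuation (algebraMap F L (g j)) ≠ 0 := by simpa using hgj
  rw [Algebra.smul_def, Algebra.smul_def, map_mul, map_mul, map_pow, map_pow] at hv
  rw [map_div₀, map_div₀, eq_div_iff hvj]
  apply mul_right_cancel₀ (pow_ne_zero (i : ℕ) hvz)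
  rw [hv]
  have : (j : ℕ) = (j - i) + i := by have : (i : ℕ) < j := hlt; omega
  conv_rhs => rw [this, pow_add]
  rw [mul_right_comm, mul_comm, mul_comm (_ ^ _) (_ ^ _)]

/-- If the value group of `F` is infinite cyclic and `L / F` is finite then the value group of `L`
is infinite cyclic. -/
lemma exists_uniformizer {y : L} (hy : A.valuation y < 1) (hy0 : y ≠ 0)
    (h : ∀ x : F, x ≠ 0 → ∃ n : ℤ, A.valuation (algebraMap F L x) = A.valuation y ^ n) :
    ∃ ϖ : L, ϖ ≠ 0 ∧ A.valuation ϖ < 1 ∧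
      ∀ z : L, z ≠ 0 → ∃ n : ℤ, A.valuation z = A.valuation ϖ ^ n := by
  set N := (Module.finrank F L).factorial
  have hN : N ≠ 0 := Nat.factorial_ne_zero _
  have hvy : 0 < A.valuation y := by simpa [zero_lt_iff] using hy0
  have key : ∀ z : L, z ≠ 0 → ∃ m : ℤ, A.valuation z ^ N = A.valuation y ^ m := by
    intro z hz
    obtain ⟨j, hj, hjn, x, hx, hxz⟩ := exists_pow_val_eq (F := F) (A := A) hz
    obtain ⟨m, hm⟩ := h x hx
    obtain ⟨d, hd⟩ := Nat.dvd_factorial hj hjn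
    refine ⟨m * d, ?_⟩
    rw [show N = j * d from hd, pow_mul, hxz, hm, zpow_mul, zpow_natCast]
  let S : AddSubgroup ℤ := {
    carrier := {m | ∃ z : L, z ≠ 0 ∧ A.valuation z ^ N = A.valuation y ^ m}
    add_mem' := by
      rintro a b ⟨z, hz, h1⟩ ⟨w, hw, h2⟩
      exact ⟨z * w, mul_ne_zero hz hw, by rw [map_mul, mul_pow, h1, h2, zpow_add₀ hvy.ne']⟩
    zero_mem' := ⟨1, one_ne_zero, by simp⟩
    neg_mem' := by
      rintro a ⟨z, hz, h1⟩
      exact ⟨z⁻¹, inv_ne_zero hz, by rw [map_inv₀, inv_pow, h1, zpow_neg]⟩ }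
  obtain ⟨d, hd⟩ := Int.subgroup_cyclic S
  rw [← AddSubgroup.zmultiples_eq_closure] at hd
  have hS : (N : ℤ) ∈ S := ⟨y, hy0, by rw [zpow_natCast]⟩
  wlog hd0 : 0 ≤ d generalizing d
  · exact this (-d) (by rw [hd]; simp) (by omega)
  have hdpos : 0 < d := by
    refine hd0.lt_of_ne fun h => hN ?_
    rw [hd, ← h] at hS
    simpa using hS
  obtain ⟨ϖ, hϖ, h1⟩ : d ∈ S := by rw [hd]; simp
  refine ⟨ϖ, hϖ, ?_, fun z hz => ?_⟩
  · rw [← pow_lt_one_iff hN, h1]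
    exact (zpow_lt_one_iff_right_of_lt_one₀ hvy hy).2 hdpos
  · obtain ⟨m, hm⟩ := key z hz
    have : m ∈ S := ⟨z, hz, hm⟩
    rw [hd, AddSubgroup.mem_zmultiples_iff] at this
    obtain ⟨n, rfl⟩ := this
    refine ⟨n, (pow_left_inj₀ zero_le zero_le hN).1 ?_⟩
    rw [hm, smul_eq_mul, mul_comm, zpow_mul, ← h1, ← zpow_natCast, ← zpow_natCast, zpow_comm]

/-- The residue field is finite over any field whose image contains the residues of `F`. -/
lemma finite_residueField (κ : Type*) [Field κ] [Algebra κ (IsLocalRing.ResidueField A)]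
    (hκ : ∀ (x : F) (hx : algebraMap F L x ∈ A), ∃ z : κ,
      algebraMap κ _ z = IsLocalRing.residue A ⟨_, hx⟩) :
    FiniteDimensional κ (IsLocalRing.ResidueField A) := by
  classical
  have h1 : Module.rank κ (IsLocalRing.ResidueField A) ≤ Module.finrank F L := by
    apply rank_le
    intro s hs
    choose e he using fun i : s => IsLocalRing.residue_surjective (R := A) i
    have h2 : LinearIndependent F (fun i : s => (e i : L)) := by
      rw [Fintype.linearIndependent_iff]
      by_contra! hcon
      obtain ⟨g, hg, i₀, hi₀⟩ := hcon
      obtain ⟨i, -, hmax⟩ := Finset.univ.exists_max_image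
        (fun i => A.valuation (algebraMap F L (g i))) ⟨i₀, Finset.mem_univ i₀⟩
      have hgi : g i ≠ 0 := by
        intro h
        have := hmax i₀ (Finset.mem_univ _)
        simp [h, hi₀] at this
      have hmem : ∀ j, algebraMap F L (g j / g i) ∈ A := by
        intro j
        rw [← ValuationSubring.valuation_le_one_iff, map_div₀, map_div₀]
        exact div_le_one_of_le₀ (hmax j (Finset.mem_univ _)) zero_le
      rw [Fintype.linearIndependent_iff] at hs
      have h3 : ∑ j : s, (⟨_, hmem j⟩ : A) * e j = 0 := by
        apply Subtype.ext
        push_cast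
        rw [← mul_right_inj' (a := algebraMap F L (g i)) (by simpa using hgi)]
        rw [Finset.mul_sum, mul_zero, ← hg]
        refine Finset.sum_congr rfl fun j _ => ?_
        have hgi' : algebraMap F L (g i) ≠ 0 := by simpa using hgi
        rw [← map_div₀, ← mul_assoc, ← map_mul, mul_div_cancel₀ _ hgi, Algebra.smul_def]
      choose z hz using fun j => hκ _ (hmem j)
      have h4 := hs z (by
        have := congrArg (IsLocalRing.residue A) h3
        rw [map_sum, map_zero] at this
        rw [← this]
        refine Finset.sum_congr rfl fun j _ => ?_
        rw [map_mul, he, Algebra.smul_def, hz]) i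
      have h5 : IsLocalRing.residue A ⟨_, hmem i⟩ = 0 := by rw [← hz, h4, map_zero]
      rw [show (⟨_, hmem i⟩ : A) = 1 by apply Subtype.ext; simp [hgi], map_one] at h5
      exact one_ne_zero h5
    simpa using h2.fintype_card_le_finrank
  refine Module.rank_lt_aleph0_iff.1 ?_
  exact h1.trans_lt (Cardinal.natCast_lt_aleph0)

end HorDVR

open IntermediateField in
/-- Every transcendental element generates a subfield of finite index. -/
def IsCurve (L : Type*) [Field L] [CharZero L] : Prop :=
  ∀ y : L, Transcendental ℚ y → FiniteDimensional ℚ⟮y⟯ L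

section Residue

variable {L : Type*} [Field L] {A : ValuationSubring L}

local notation "κ(" A ")" => IsLocalRing.ResidueField A

lemma int_mem (m : ℤ) : A.valuation (m : L) ≤ 1 :=
  (A.valuation_le_one_iff _).2 (intCast_mem A m)

lemma val_int_eq_one {p : ℕ} (hp : p.Prime) (hv : A.valuation (p : L) < 1) {m : ℤ}
    (hm : ¬ (p : ℤ) ∣ m) : A.valuation (m : L) = 1 := by
  have h1 : IsCoprime (p : ℤ) m := (Nat.prime_iff_prime_int.1 hp).coprime_iff_not_dvd.2 hm
  obtain ⟨a, b, hab⟩ := h1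
  refine (int_mem m).lt_or_eq.resolve_left fun h => ?_
  have h2 : (1 : L) = a * p + b * m := by simpa using congrArg (Int.cast : ℤ → L) hab.symm
  have h3 : A.valuation (a * p + b * m : L) < 1 := by
    apply A.valuation.map_add_lt
    · rw [map_mul]; exact mul_lt_one_of_nonneg_of_lt_one_right (int_mem a) zero_le hv
    · rw [map_mul]; exact mul_lt_one_of_nonneg_of_lt_one_right (int_mem b) zero_le h
  rw [← h2, map_one] at h3
  exact lt_irrefl _ h3

lemma residue_eq_zero_iff {x : L} (hx : x ∈ A) :
    IsLocalRing.residue A ⟨x, hx⟩ = 0 ↔ A.valuation x < 1 := by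
  rw [IsLocalRing.residue_eq_zero_iff, ValuationSubring.valuation_lt_one_iff]

lemma charP_residue {p : ℕ} (hp : p.Prime) (hv : A.valuation (p : L) < 1) : CharP κ(A) p := by
  rw [CharP.charP_iff_prime_eq_zero hp]
  have := (residue_eq_zero_iff (A := A) (x := p) (natCast_mem A p)).2 hv
  rw [← this]
  exact (map_natCast (IsLocalRing.residue A) p).symm

lemma residue_intCast (m : ℤ) (h : (m : L) ∈ A) : IsLocalRing.residue A ⟨m, h⟩ = m :=
  map_intCast (IsLocalRing.residue A) m

end Residue

section RatVal

set_option linter.unusedSectionVars false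

variable {L : Type*} [Field L] [CharZero L] {A : ValuationSubring L}

local notation "κ(" A ")" => IsLocalRing.ResidueField A

lemma exists_val_int_eq {p : ℕ} (hp : p.Prime) (hv : A.valuation (p : L) < 1) {m : ℤ}
    (hm : m ≠ 0) : ∃ n : ℕ, A.valuation (m : L) = A.valuation (p : L) ^ n := by
  have hfin : FiniteMultiplicity (p : ℤ) m := by
    rw [Int.finiteMultiplicity_iff]; exact ⟨by simpa using hp.one_lt.ne', hm⟩
  obtain ⟨c, hc, hc'⟩ := hfin.exists_eq_pow_mul_and_not_dvd
  refine ⟨multiplicity (p : ℤ) m, ?_⟩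
  conv_lhs => rw [hc]
  push_cast
  rw [map_mul, val_int_eq_one hp hv hc', mul_one, map_pow]

lemma exists_val_rat_eq {p : ℕ} (hp : p.Prime) (hv : A.valuation (p : L) < 1) {x : ℚ}
    (hx : x ≠ 0) : ∃ n : ℤ, A.valuation (x : L) = A.valuation (p : L) ^ n := by
  obtain ⟨a, ha⟩ := exists_val_int_eq hp hv (m := x.num) (by simpa using hx)
  obtain ⟨b, hb⟩ := exists_val_int_eq hp hv (m := x.den) (by simp)
  have hp0 : A.valuation (p : L) ≠ 0 := by simpa using hp.ne_zero
  refine ⟨a - b, ?_⟩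
  rw [Rat.cast_def, map_div₀, ha, zpow_sub₀ hp0, zpow_natCast, zpow_natCast, ← hb]
  simp

lemma exists_rat_eq_div {p : ℕ} (hp : p.Prime) (hv : A.valuation (p : L) < 1) {x : ℚ}
    (hx : A.valuation (x : L) ≤ 1) : A.valuation (x.den : L) = 1 := by
  have := val_int_eq_one (A := A) hp hv (m := x.den)
  push_cast at this
  refine this fun h => ?_
  have h1 : ¬ (p : ℤ) ∣ x.num := by
    intro h2
    have := x.reduced
    rw [Int.natCast_dvd_natCast] at h
    exact hp.one_lt.ne' (Nat.dvd_one.1 (this ▸ Nat.dvd_gcd (Int.natCast_dvd.1 h2) h))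
  have h2 := val_int_eq_one hp hv h1
  obtain ⟨d, hd⟩ := h
  have h3 : (x : L) * x.den = x.num := by exact_mod_cast Rat.mul_den_eq_num x
  have h4 : (x.den : L) = p * d := by exact_mod_cast hd
  have h5 := congrArg A.valuation h3
  rw [h2, h4, map_mul, map_mul] at h5
  have h6 : A.valuation (p : L) * A.valuation (d : L) < 1 :=
    mul_lt_one_of_nonneg_of_lt_one_left zero_le hv (int_mem d)
  have h7 := mul_lt_one_of_nonneg_of_lt_one_right hx zero_le h6
  rw [h5] at h7
  exact lt_irrefl _ h7

lemma exists_residue_rat {p : ℕ} [Fact p.Prime] (hv : A.valuation (p : L) < 1)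
    [Algebra (ZMod p) κ(A)] {x : ℚ}
    (hx : (x : L) ∈ A) : ∃ z : ZMod p, algebraMap _ κ(A) z = IsLocalRing.residue A ⟨x, hx⟩ := by
  have h1 := exists_rat_eq_div (Fact.out : p.Prime) hv ((A.valuation_le_one_iff _).2 hx)
  refine ⟨x.num / x.den, ?_⟩
  have h3 : (x : L) * (x.den : ℤ) = x.num := by exact_mod_cast Rat.mul_den_eq_num x
  have h4 : ((x.den : ℤ) : κ(A)) ≠ 0 := by
    rw [← residue_intCast (A := A) _ (intCast_mem A _), Ne, residue_eq_zero_iff]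
    push_cast
    rw [h1]; exact lt_irrefl _
  have h5 : (⟨x, hx⟩ : A) * ⟨(x.den : ℤ), intCast_mem A _⟩ = ⟨x.num, intCast_mem A _⟩ :=
    Subtype.ext h3
  have h6 := congrArg (IsLocalRing.residue A) h5
  rw [map_mul, residue_intCast, residue_intCast] at h6
  rw [eq_comm, map_div₀, map_intCast, map_natCast, eq_div_iff (by exact_mod_cast h4)]
  exact_mod_cast h6

open IntermediateField

lemma exists_residue_aeval {p : ℕ} [Fact p.Prime] (hv : A.valuation (p : L) < 1)
    [Algebra (ZMod p) κ(A)] {t : L} (ht : t ∈ A) (P : Polynomial ℚ)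
    (hP : ∀ i, (P.coeff i : L) ∈ A) :
    ∃ (h : Polynomial.aeval t P ∈ A) (P' : Polynomial (ZMod p)),
      IsLocalRing.residue A ⟨_, h⟩ = Polynomial.aeval (IsLocalRing.residue A ⟨t, ht⟩) P' ∧
      ∀ i, algebraMap _ κ(A) (P'.coeff i) = IsLocalRing.residue A ⟨_, hP i⟩ := by
  choose z hz using fun i => exists_residue_rat hv (hP i)
  have h1 : Polynomial.aeval t P = ((∑ i ∈ Finset.range (P.natDegree + 1),
      (⟨_, hP i⟩ : A) * ⟨t, ht⟩ ^ i : A) : L) := by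
    rw [Polynomial.aeval_eq_sum_range]
    push_cast
    exact Finset.sum_congr rfl fun i _ => by rw [Rat.smul_def]
  refine ⟨by rw [h1]; exact SetLike.coe_mem _, ∑ i ∈ Finset.range (P.natDegree + 1),
    Polynomial.monomial i (z i), ?_, fun i => ?_⟩
  · simp only [h1]
    rw [map_sum, map_sum]
    refine Finset.sum_congr rfl fun i _ => ?_
    rw [Polynomial.aeval_monomial, hz, map_mul, map_pow]
  · rw [Polynomial.finsetSum_coeff]
    simp only [Polynomial.coeff_monomial, Finset.sum_ite_eq', Finset.mem_range]
    split_ifs with hi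
    · exact hz i
    · rw [map_zero, eq_comm, residue_eq_zero_iff, Polynomial.coeff_eq_zero_of_natDegree_lt (by
        omega)]
      simp

lemma exists_eq_mul_aeval {p : ℕ} [Fact p.Prime] (hv : A.valuation (p : L) < 1)
    [Algebra (ZMod p) κ(A)] {t : L} (ht : t ∈ A)
    (htr : Transcendental (ZMod p) (IsLocalRing.residue A ⟨t, ht⟩)) {P : Polynomial ℚ}
    (hP : P ≠ 0) : ∃ (c : ℚ) (a : A) (P' : Polynomial (ZMod p)), c ≠ 0 ∧
      Polynomial.aeval t P = c * a ∧ A.valuation a = 1 ∧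
      IsLocalRing.residue A a = Polynomial.aeval (IsLocalRing.residue A ⟨t, ht⟩) P' := by
  obtain ⟨i, -, hmax⟩ := P.support.exists_max_image
    (fun i => A.valuation (P.coeff i : L)) (Polynomial.support_nonempty.2 hP)
  have hmax' : ∀ j, A.valuation (P.coeff j : L) ≤ A.valuation (P.coeff i : L) := fun j => by
    by_cases hj : j ∈ P.support
    · exact hmax j hj
    · simp [Polynomial.notMem_support_iff.1 hj]
  have hi : P.coeff i ≠ 0 := by
    intro h
    apply hP
    ext j
    have := hmax' j
    simpa [h] using this
  have hi' : A.valuation (P.coeff i : L) ≠ 0 := by simpa using hi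
  obtain ⟨h, P', h1, h2⟩ := exists_residue_aeval hv ht (Polynomial.C (P.coeff i)⁻¹ * P) fun j => by
    rw [Polynomial.coeff_C_mul, ← A.valuation_le_one_iff, Rat.cast_mul, Rat.cast_inv, map_mul,
      map_inv₀, ← div_eq_inv_mul]
    exact div_le_one_of_le₀ (hmax' j) zero_le
  have hP' : P' ≠ 0 := by
    rintro rfl
    have := h2 i
    simp only [Polynomial.coeff_zero, map_zero, Polynomial.coeff_C_mul, inv_mul_cancel₀ hi,
      Rat.cast_one] at this
    exact zero_ne_one (this.trans (map_one _))
  refine ⟨P.coeff i, ⟨_, h⟩, P', hi, ?_, ?_, h1⟩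
  · have : ((P.coeff i : ℚ) : L) ≠ 0 := by simpa using hi
    simp [this]
  · have h3 : IsLocalRing.residue A ⟨_, h⟩ ≠ 0 := by
      rw [h1]; exact fun h => hP' ((transcendental_iff.1 htr) P' h)
    rw [Ne, residue_eq_zero_iff] at h3
    exact ((A.valuation_le_one_iff _).2 h).lt_or_eq.resolve_left h3

lemma transcendental_of_residue {p : ℕ} [Fact p.Prime] (hv : A.valuation (p : L) < 1)
    [Algebra (ZMod p) κ(A)] {t : L} (ht : t ∈ A)
    (htr : Transcendental (ZMod p) (IsLocalRing.residue A ⟨t, ht⟩)) : Transcendental ℚ t := by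
  rw [transcendental_iff]
  intro P hP
  by_contra h
  obtain ⟨c, a, P', hc, h1, h2, -⟩ := exists_eq_mul_aeval hv ht htr h
  rw [hP] at h1
  rcases mul_eq_zero.1 h1.symm with h3 | h3
  · exact hc (by exact_mod_cast h3)
  · simp [h3] at h2

lemma exists_of_mem_adjoin {p : ℕ} [Fact p.Prime] (hv : A.valuation (p : L) < 1)
    [Algebra (ZMod p) κ(A)] {t : L} (ht : t ∈ A)
    (htr : Transcendental (ZMod p) (IsLocalRing.residue A ⟨t, ht⟩)) {x : L} (hx : x ∈ ℚ⟮t⟯)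
    (hx0 : x ≠ 0) : ∃ (c : ℚ) (a : A), c ≠ 0 ∧ x = c * a ∧ A.valuation a = 1 ∧
      IsLocalRing.residue A a ∈ (ZMod p)⟮IsLocalRing.residue A ⟨t, ht⟩⟯ := by
  obtain ⟨P, Q, rfl⟩ := (mem_adjoin_simple_iff _ _).1 hx
  have hP : P ≠ 0 := by rintro rfl; simp at hx0
  have hQ : Q ≠ 0 := by rintro rfl; simp at hx0
  obtain ⟨c, a, P', hc, h1, h2, h3⟩ := exists_eq_mul_aeval hv ht htr hP
  obtain ⟨d, b, Q', hd, h4, h5, h6⟩ := exists_eq_mul_aeval hv ht htr hQ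
  have hb : IsUnit b := by rwa [ValuationSubring.valuation_eq_one_iff]
  have hb0 : (b : L) ≠ 0 := by rintro h; simp [h] at h5
  obtain ⟨b, rfl⟩ := hb
  have hbi : ((b⁻¹ : Aˣ) : L) = ((b : A) : L)⁻¹ := by
    refine eq_inv_of_mul_eq_one_left ?_
    exact_mod_cast congrArg Subtype.val (Units.inv_mul b)
  refine ⟨c / d, a * (b⁻¹ : Aˣ), div_ne_zero hc hd, ?_, ?_, ?_⟩
  · rw [h1, h4]; push_cast; rw [hbi]
    have : (d : L) ≠ 0 := by simpa using hd
    field_simp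
  · push_cast; rw [map_mul, h2, hbi, map_inv₀, h5]; simp
  · rw [map_mul]
    refine mul_mem ?_ ?_
    · rw [h3]; exact algebra_adjoin_le_adjoin _ _ (Polynomial.aeval_mem_adjoin_singleton _ _)
    · rw [map_units_inv]
      refine inv_mem ?_
      rw [h6]; exact algebra_adjoin_le_adjoin _ _ (Polynomial.aeval_mem_adjoin_singleton _ _)

/-- Valuations with residue characteristic `p` and transcendental residue field. -/
lemma vertical {p : ℕ} [Fact p.Prime] (hv : A.valuation (p : L) < 1)
    [Algebra (ZMod p) κ(A)] {t : L} (ht : t ∈ A)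
    (htr : Transcendental (ZMod p) (IsLocalRing.residue A ⟨t, ht⟩)) (hL : IsCurve L) :
    (∃ ϖ : L, ϖ ≠ 0 ∧ A.valuation ϖ < 1 ∧
      ∀ z : L, z ≠ 0 → ∃ n : ℤ, A.valuation z = A.valuation ϖ ^ n) ∧
    FiniteDimensional (ZMod p)⟮IsLocalRing.residue A ⟨t, ht⟩⟯ κ(A) := by
  have hp : p.Prime := Fact.out
  have := hL t (transcendental_of_residue hv ht htr)
  constructor
  · refine exists_uniformizer (F := ℚ⟮t⟯) hv (by exact_mod_cast hp.ne_zero) fun x hx => ?_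
    obtain ⟨c, a, hc, h1, h2, -⟩ := exists_of_mem_adjoin hv ht htr x.2 (by simpa using hx)
    obtain ⟨n, hn⟩ := exists_val_rat_eq hp hv hc
    exact ⟨n, by rw [IntermediateField.algebraMap_apply, h1, map_mul, h2, mul_one, hn]⟩
  · refine finite_residueField (F := ℚ⟮t⟯) _ fun x hx => ?_
    by_cases hx0 : x = 0
    · refine ⟨0, ?_⟩
      rw [map_zero, eq_comm, residue_eq_zero_iff]; simp [hx0]
    obtain ⟨c, a, hc, h1, h2, h3⟩ := exists_of_mem_adjoin hv ht htr x.2 (by simpa using hx0)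
    have hcA : (c : L) ∈ A := by
      rw [← A.valuation_le_one_iff] at hx ⊢
      rwa [IntermediateField.algebraMap_apply, h1, map_mul, h2, mul_one] at hx
    obtain ⟨z, hz⟩ := exists_residue_rat hv hcA
    refine ⟨⟨_, mul_mem ((ZMod p)⟮IsLocalRing.residue A ⟨t, ht⟩⟯.algebraMap_mem z) h3⟩, ?_⟩
    change algebraMap (ZMod p) _ z * IsLocalRing.residue A a = _
    rw [hz, ← map_mul]
    congr 1
    exact Subtype.ext h1.symm

end RatVal

section Horizontal

set_option linter.unusedSectionVars false

variable {L : Type*} [Field L] {A : ValuationSubring L}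

local notation "κ(" A ")" => IsLocalRing.ResidueField A

lemma val_rat_eq_one [CharZero L] (hA : ∀ n : ℕ, n ≠ 0 → A.valuation (n : L) = 1) {c : ℚ} (hc :
    c ≠ 0) :
    A.valuation (c : L) = 1 := by
  have h1 : A.valuation ((c.num : ℤ) : L) = 1 := by
    have h0 : c.num ≠ 0 := by simpa using hc
    obtain ⟨n, h | h⟩ := Int.eq_nat_or_neg c.num
    · rw [h] at h0 ⊢; exact_mod_cast hA n (by exact_mod_cast h0)
    · rw [h] at h0 ⊢; push_cast; rw [Valuation.map_neg]; exact hA n (by simpa using h0)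
  rw [Rat.cast_def, map_div₀, h1, hA _ c.den_nz, div_one]

variable {k₀ : Type*} [Field k₀] [Algebra k₀ L]

lemma algebraMap_mem_of_val (hA : ∀ c : k₀, c ≠ 0 → A.valuation (algebraMap k₀ L c) = 1) (c : k₀) :
    algebraMap k₀ L c ∈ A := by
  by_cases hc : c = 0
  · simp [hc]
  · rw [← A.valuation_le_one_iff, hA c hc]

lemma val_one_add {m : L} (hm : A.valuation m < 1) : A.valuation (1 + m) = 1 :=
  A.valuation.map_one_add_of_lt hm

lemma aeval_eq_of_val_lt (hA : ∀ c : k₀, c ≠ 0 → A.valuation (algebraMap k₀ L c) = 1) {y : L}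
    (hy : A.valuation y < 1) {P : Polynomial k₀} (hP : P ≠ 0) :
    ∃ (n : ℕ) (c : k₀) (m : L), c ≠ 0 ∧ A.valuation m < 1 ∧
      Polynomial.aeval y P = y ^ n * (algebraMap k₀ L c * (1 + m)) := by
  obtain ⟨U, hU, hU'⟩ := Polynomial.exists_eq_pow_rootMultiplicity_mul_and_not_dvd P hP 0
  rw [map_zero, sub_zero] at hU hU'
  have hc : U.coeff 0 ≠ 0 := fun h => hU' (Polynomial.X_dvd_iff.2 h)
  have hc' : algebraMap k₀ L (U.coeff 0) ≠ 0 := by simpa using hc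
  refine ⟨Polynomial.rootMultiplicity 0 P, U.coeff 0,
    Polynomial.aeval y U.divX * y / algebraMap k₀ L (U.coeff 0), hc, ?_, ?_⟩
  · rw [map_div₀, hA _ hc, div_one, map_mul]
    refine mul_lt_one_of_nonneg_of_lt_one_right ?_ zero_le hy
    rw [A.valuation_le_one_iff, Polynomial.aeval_eq_sum_range]
    refine sum_mem fun i _ => ?_
    rw [Algebra.smul_def]
    exact mul_mem (algebraMap_mem_of_val hA _) (pow_mem ((A.valuation_le_one_iff _).1 hy.le) _)
  · conv_lhs => rw [hU]
    rw [map_mul, map_pow, Polynomial.aeval_X]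
    congr 1
    conv_lhs => rw [← Polynomial.divX_mul_X_add U]
    simp only [map_add, map_mul, Polynomial.aeval_X, Polynomial.aeval_C]
    field_simp
    ring

lemma transcendental_of_val_lt (hA : ∀ c : k₀, c ≠ 0 → A.valuation (algebraMap k₀ L c) = 1) {y : L}
    (hy : A.valuation y < 1) (hy0 : y ≠ 0) : Transcendental k₀ y := by
  rw [transcendental_iff]
  intro P hP
  by_contra h
  obtain ⟨n, c, m, hc, hm, h1⟩ := aeval_eq_of_val_lt hA hy h
  rw [hP] at h1
  have h2 := val_one_add hm
  rcases mul_eq_zero.1 h1.symm with h3 | h3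
  · exact absurd h3 (pow_ne_zero _ hy0)
  · rcases mul_eq_zero.1 h3 with h3 | h3
    · exact hc (by simpa using h3)
    · simp [h3] at h2

open IntermediateField

lemma eq_of_mem_adjoin_of_val_lt (hA : ∀ c : k₀, c ≠ 0 → A.valuation (algebraMap k₀ L c) = 1)
    {y : L} (hy : A.valuation y < 1) (hy0 : y ≠ 0) {x : L} (hx : x ∈ k₀⟮y⟯) (hx0 : x ≠ 0) :
    ∃ (n : ℤ) (c : k₀) (m : L), c ≠ 0 ∧ A.valuation m < 1 ∧
      x = y ^ n * (algebraMap k₀ L c * (1 + m)) := by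
  obtain ⟨P, Q, rfl⟩ := (mem_adjoin_simple_iff _ _).1 hx
  have hP : P ≠ 0 := by rintro rfl; simp at hx0
  have hQ : Q ≠ 0 := by rintro rfl; simp at hx0
  obtain ⟨n, c, m, hc, h1, h2⟩ := aeval_eq_of_val_lt hA hy hP
  obtain ⟨n', c', m', hc', h3, h4⟩ := aeval_eq_of_val_lt hA hy hQ
  have h5 := val_one_add h3
  have h6 : 1 + m' ≠ 0 := by intro h; simp [h] at h5
  have h7 : algebraMap k₀ L c' ≠ 0 := by simpa using hc'
  refine ⟨n - n', c / c', (m - m') / (1 + m'), div_ne_zero hc hc', ?_, ?_⟩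
  · rw [map_div₀, h5, div_one]
    exact A.valuation.map_sub_lt h1 h3
  · rw [h2, h4, zpow_sub₀ hy0, map_div₀]
    field_simp
    simp only [zpow_natCast]
    field_simp
    ring

/-- Valuations of finite extensions of rational function fields which are trivial on constants. -/
lemma uniformizer_of_val_lt (hA : ∀ c : k₀, c ≠ 0 → A.valuation (algebraMap k₀ L c) = 1) {y : L}
    (hy : A.valuation y < 1) (hy0 : y ≠ 0) [FiniteDimensional k₀⟮y⟯ L] :
    (∃ ϖ : L, ϖ ≠ 0 ∧ A.valuation ϖ < 1 ∧
      ∀ z : L, z ≠ 0 → ∃ n : ℤ, A.valuation z = A.valuation ϖ ^ n) ∧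
    ∀ (_ : Algebra k₀ κ(A)), (∀ c : k₀, algebraMap k₀ κ(A) c =
        IsLocalRing.residue A ⟨_, algebraMap_mem_of_val hA c⟩) → FiniteDimensional k₀ κ(A) := by
  refine ⟨exists_uniformizer (F := k₀⟮y⟯) hy hy0 fun x hx => ?_, fun _ hres =>
    finite_residueField (F := k₀⟮y⟯) _ fun x hx => ?_⟩
  · obtain ⟨n, c, m, hc, hm, h⟩ := eq_of_mem_adjoin_of_val_lt hA hy hy0 x.2 (by simpa using hx)
    refine ⟨n, ?_⟩
    rw [IntermediateField.algebraMap_apply, h, map_mul, map_mul, hA _ hc,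
      val_one_add hm, map_zpow₀, mul_one, mul_one]
  · by_cases hx0 : x = 0
    · refine ⟨0, ?_⟩
      rw [map_zero, eq_comm, residue_eq_zero_iff]; simp [hx0]
    obtain ⟨n, c, m, hc, hm, h⟩ := eq_of_mem_adjoin_of_val_lt hA hy hy0 x.2 (by simpa using hx0)
    have hvx : A.valuation (x : L) = A.valuation y ^ n := by
      rw [h, map_mul, map_mul, hA _ hc, val_one_add hm, map_zpow₀, mul_one, mul_one]
    have hvy : 0 < A.valuation y := by simpa [zero_lt_iff] using hy0
    rw [IntermediateField.algebraMap_apply] at hx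
    have hn : 0 ≤ n := by
      by_contra hn
      rw [← A.valuation_le_one_iff, hvx] at hx
      exact absurd hx (not_le.2 (one_lt_zpow_of_neg₀ hvy hy (by omega)))
    rcases hn.eq_or_lt with rfl | hn
    · refine ⟨c, ?_⟩
      rw [hres, ← sub_eq_zero, ← map_sub]
      refine (residue_eq_zero_iff (A := A) (sub_mem (algebraMap_mem_of_val hA c) hx)).2 ?_
      rw [h, zpow_zero, one_mul, show algebraMap k₀ L c - algebraMap k₀ L c * (1 + m) =
        - (algebraMap k₀ L c * m) by ring, Valuation.map_neg, map_mul, hA _ hc, one_mul]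
      exact hm
    · refine ⟨0, ?_⟩
      rw [map_zero, eq_comm, residue_eq_zero_iff, IntermediateField.algebraMap_apply, hvx]
      exact (zpow_lt_one_iff_right_of_lt_one₀ hvy hy).2 hn

/-- Nontrivial valuations containing the rational numbers. -/
lemma horizontal [CharZero L] (hA : ∀ n : ℕ, n ≠ 0 → A.valuation (n : L) = 1) {y : L}
    (hy : A.valuation y < 1) (hy0 : y ≠ 0) (hL : IsCurve L) :
    (∃ ϖ : L, ϖ ≠ 0 ∧ A.valuation ϖ < 1 ∧
      ∀ z : L, z ≠ 0 → ∃ n : ℤ, A.valuation z = A.valuation ϖ ^ n) ∧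
    NumberField κ(A) := by
  have hA' : ∀ c : ℚ, c ≠ 0 → A.valuation (algebraMap ℚ L c) = 1 := fun c hc => by
    rw [eq_ratCast]; exact val_rat_eq_one hA hc
  have := hL y (transcendental_of_val_lt hA' hy hy0)
  have hres : ∀ n : ℕ, n ≠ 0 → (n : κ(A)) ≠ 0 := fun n hn h => by
    have h1 := (residue_eq_zero_iff (A := A) (x := n) (natCast_mem A n)).1
      ((map_natCast (IsLocalRing.residue A) n).trans h)
    rw [hA n hn] at h1
    exact lt_irrefl _ h1
  have : CharZero κ(A) := charZero_of_inj_zero fun n hn => by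
    by_contra h; exact hres n h hn
  obtain ⟨h1, h2⟩ := uniformizer_of_val_lt hA' hy hy0
  refine ⟨h1, @NumberField.mk _ _ this (h2 _ fun c => ?_)⟩
  let f : ℚ →+* A := ⟨⟨⟨fun c : ℚ => ⟨algebraMap ℚ L c, algebraMap_mem_of_val hA' c⟩,
    Subtype.ext (by simp)⟩, fun a b => Subtype.ext (by simp)⟩, Subtype.ext (by simp),
      fun a b => Subtype.ext (by simp)⟩
  change algebraMap ℚ κ(A) c = ((IsLocalRing.residue A).comp f) c
  congr 1
  exact Subsingleton.elim _ _

end Horizontal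

lemma FiniteField.isSquare_or_isSquare_mul {E : Type*} [Field E] [Finite E] {x y : E}
    (hx : ¬ IsSquare x) (hy : ¬ IsSquare y) : IsSquare (x * y) := by
  classical
  have := Fintype.ofFinite E
  have h0 : x * y ≠ 0 := mul_ne_zero (by rintro rfl; simp at hx) (by rintro rfl; simp at hy)
  rw [← quadraticChar_neg_one_iff_not_isSquare] at hx hy
  rw [← quadraticChar_one_iff_isSquare h0, map_mul, hx, hy]
  norm_num

/-- `A` contains the rational numbers and its residue field is a number field. -/
structure Horiz {L : Type*} [Field L] (A : ValuationSubring L) : Prop where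
  val_natCast : ∀ n : ℕ, n ≠ 0 → A.valuation (n : L) = 1
  numberField : NumberField (IsLocalRing.ResidueField A)

open IntermediateField in
/-- The residue field of `A` is a function field of one variable over a finite field. -/
def Vert {L : Type*} [Field L] (A : ValuationSubring L) (p : ℕ) [Fact p.Prime] : Prop :=
  A.valuation (p : L) < 1 ∧ ∃ (_ : Algebra (ZMod p) (IsLocalRing.ResidueField A))
    (t : IsLocalRing.ResidueField A), Transcendental (ZMod p) t ∧
      FiniteDimensional (ZMod p)⟮t⟯ (IsLocalRing.ResidueField A)

section Classify

variable {L V : Type*} [Field L] [CharZero L] [CommGroup V] {e : V} {R : V → V → V → Prop}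
  {q : Lˣ →* V} {H : Subgroup V}

lemma exists_prime_val_lt {A : ValuationSubring L} (h : ¬ ∀ n : ℕ, n ≠ 0 → A.valuation (n : L) =
    1) :
    ∃ p : ℕ, p.Prime ∧ A.valuation (p : L) < 1 := by
  by_contra! hcon
  apply h
  intro n
  induction n using Nat.recOnMul with
  | zero => simp
  | one => simp
  | prime p hp =>
    intro _
    exact le_antisymm ((A.valuation_le_one_iff _).2 (natCast_mem A p)) (hcon p hp)
  | mul a b ha hb =>
    intro hab
    rw [Nat.cast_mul, map_mul, ha (by rintro rfl; simp at hab), hb (by rintro rfl; simp at hab),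
      mul_one]

omit [CharZero L] in
lemma NonSq.not_isSquare {A : ValuationSubring L} {x : L} (hx : NonSq A x) (hxA : x ∈ A) :
    ¬ IsSquare (IsLocalRing.residue A ⟨x, hxA⟩) := by
  rintro ⟨s, hs⟩
  obtain ⟨s, rfl⟩ := IsLocalRing.residue_surjective s
  rw [← map_mul, ← sub_eq_zero, ← map_sub] at hs
  have h1 := (residue_eq_zero_iff (A := A) (sub_mem hxA (mul_mem s.2 s.2))).1 hs
  rw [← sq] at h1
  exact (hx s).1 h1

open IntermediateField in
lemma transcendental_of_nonSq {A : ValuationSubring L} {p : ℕ} [Fact p.Prime]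
    [Algebra (ZMod p) (IsLocalRing.ResidueField A)] {h : L} (hA : h ∈ A)
    (n0 : NonSq A h) (n1 : NonSq A (1 + h)) (n2 : NonSq A (h * (1 + h))) :
    Transcendental (ZMod p) (IsLocalRing.residue A ⟨h, hA⟩) := by
  intro halg
  set z := IsLocalRing.residue A ⟨h, hA⟩ with hz
  have := adjoin.finiteDimensional halg.isIntegral
  have : Finite (ZMod p)⟮z⟯ := Module.finite_of_finite (ZMod p)
  have hg : ∀ x : (ZMod p)⟮z⟯, IsSquare x → IsSquare (x : IsLocalRing.ResidueField A) :=
    fun x hx => hx.map (algebraMap (ZMod p)⟮z⟯ (IsLocalRing.ResidueField A))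
  have h1 : z = AdjoinSimple.gen (ZMod p) z := (AdjoinSimple.coe_gen _ _).symm
  have h2 : IsLocalRing.residue A ⟨1 + h, add_mem (one_mem A) hA⟩ = 1 + z := by
    rw [hz, ← map_one (IsLocalRing.residue A), ← map_add]; rfl
  have h3 : IsLocalRing.residue A ⟨h * (1 + h), mul_mem hA (add_mem (one_mem A) hA)⟩ =
      z * (1 + z) := by
    rw [← h2, hz, ← map_mul]; rfl
  refine n2.not_isSquare (mul_mem hA (add_mem (one_mem A) hA)) ?_
  rw [h3]
  refine hg (AdjoinSimple.gen (ZMod p) z * (1 + AdjoinSimple.gen (ZMod p) z))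
    (FiniteField.isSquare_or_isSquare_mul (fun hs => ?_) (fun hs => ?_))
  · exact n0.not_isSquare hA (hg _ hs)
  · exact n1.not_isSquare (add_mem (one_mem A) hA) (by rw [h2]; exact hg _ hs)

/-- Subgroups satisfying `Good` are given by the classes of even value of a discrete valuation,
whose residue field is a number field or a function field over a finite field. -/
theorem Interp.exists_dvPair_of_good (I : Interp e R q) (hL : IsCurve L) (hH : Good e R H) :
    ∃ (A : ValuationSubring L) (ϖ : L), DVPair q A H ϖ ∧
      (∃ h, A.valuation h = 1 ∧ A.valuation (1 + h) = 1 ∧ NonSq A h ∧ NonSq A (1 + h) ∧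
        NonSq A (h * (1 + h))) ∧
      (Horiz A ∨ ∃ p : ℕ, ∃ _ : Fact p.Prime, Vert A p) := by
  obtain ⟨A, hA1, hA2, h, hv, hv', hn0, hn1, hn2⟩ := I.exists_valuationSubring_of_good hH
  have key : ∀ x, A.valuation x = 1 → ¬ Pull q (TPM e R H) x → NonSq A x := by
    intro x hx hxP s
    have key' : ∀ x : L, A.valuation x = 1 → A.valuation (x - s ^ 2) < 1 →
        Pull q (TPM e R H) x := by
      intro x hx h
      have hs : A.valuation (s ^ 2) = 1 := by
        have := Valuation.map_sub_eq_of_lt_right A.valuation (x := x - s ^ 2) (y := x)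
          (by rwa [hx])
        rw [show x - s ^ 2 - x = - s ^ 2 by ring, hx] at this
        rw [← this, Valuation.map_neg]
      have hs0 : s ≠ 0 := by rintro rfl; simp at hs
      obtain ⟨m, hm, hm'⟩ := exists_eq_mul_one_add_of_lt (a := s ^ 2) (b := x - s ^ 2)
        (by rwa [hs])
      rw [show x = (1 + m) * s ^ 2 by linear_combination hm', I.pull_mul_sq hs0]
      exact hA2 m hm
    refine ⟨fun h => hxP (key' x hx h), fun h => hxP ?_⟩
    have := key' (-x) (by rwa [Valuation.map_neg]) (by
      rw [← Valuation.map_neg]; convert h using 2; ring)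
    rw [← neg_one_mul] at this
    exact (pull_mul_left_iff (I.pull_neg_one
      (Subgroup.mem_sup_right (Subgroup.mem_zpowers e)))).1 this
  have n0 := key h hv hn0
  have n1 := key _ hv' hn1
  have n2 := key (h * (1 + h)) (by rw [map_mul, hv, hv', mul_one]) hn2
  obtain ⟨y, hy0, hy⟩ : ∃ y : L, y ≠ 0 ∧ A.valuation y < 1 := by
    obtain ⟨x, hx⟩ := hH.exists_not_mem
    obtain ⟨u, rfl⟩ := I.surj x
    rcases lt_trichotomy (A.valuation (u : L)) 1 with h1 | h1 | h1
    · exact ⟨u, u.ne_zero, h1⟩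
    · exact absurd ((pull_coe u).1 (hA1 _ h1)) hx
    · refine ⟨(u : L)⁻¹, inv_ne_zero u.ne_zero, ?_⟩
      rw [map_inv₀]; exact inv_lt_one_of_one_lt₀ h1
  have main : ((∃ ϖ : L, ϖ ≠ 0 ∧ A.valuation ϖ < 1 ∧
      ∀ z : L, z ≠ 0 → ∃ n : ℤ, A.valuation z = A.valuation ϖ ^ n)) ∧
      (Horiz A ∨ ∃ p : ℕ, ∃ _ : Fact p.Prime, Vert A p) := by
    by_cases hQ : ∀ n : ℕ, n ≠ 0 → A.valuation (n : L) = 1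
    · obtain ⟨h1, h2⟩ := horizontal hQ hy hy0 hL
      exact ⟨h1, Or.inl ⟨hQ, h2⟩⟩
    · obtain ⟨p, hp, hvp⟩ := exists_prime_val_lt hQ
      have : Fact p.Prime := ⟨hp⟩
      have := charP_residue hp hvp
      let _ : Algebra (ZMod p) (IsLocalRing.ResidueField A) := ZMod.algebra _ p
      have hhA : h ∈ A := (A.valuation_le_one_iff _).1 hv.le
      have htr := transcendental_of_nonSq (p := p) hhA n0 n1 n2
      obtain ⟨h1, h2⟩ := vertical hvp hhA htr hL
      exact ⟨h1, Or.inr ⟨p, inferInstance, hvp, inferInstance, _, htr, h2⟩⟩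
  obtain ⟨⟨ϖ, h0, h1, h2⟩, h3⟩ := main
  refine ⟨A, ϖ, ⟨h0, h1, fun hϖ => ?_, hA1, h2⟩, ⟨h, hv, hv', n0, n1, n2⟩, h3⟩
  obtain ⟨x, hx⟩ := hH.exists_not_mem
  obtain ⟨u, rfl⟩ := I.surj x
  apply hx
  rw [← pull_coe]
  obtain ⟨n, hn⟩ := h2 u u.ne_zero
  have h4 : Pull q H ((u : L) / ϖ ^ n) := hA1 _ (by
    rw [map_div₀, hn, map_zpow₀, div_self]; exact zpow_ne_zero _ (by simpa using h0))
  rw [show (u : L) = u / ϖ ^ n * ϖ ^ n by field_simp]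
  exact h4.mul (hϖ.zpow n)

end Classify

section Curve

open IntermediateField

open algebraAdjoinAdjoin in
lemma isCurve_of_finiteDimensional {L : Type*} [Field L] [CharZero L] {x : L}
    [FiniteDimensional ℚ⟮x⟯ L] : IsCurve L := by
  intro y hy
  have hess : Algebra.EssFiniteType ℚ L := by
    have : Algebra.EssFiniteType ℚ ℚ⟮x⟯ := essFiniteType_iff.2 ⟨{x}, by simp⟩
    exact .comp ℚ ℚ⟮x⟯ L
  have halg : Algebra.IsAlgebraic (Algebra.adjoin ℚ {x}) L := by
    exact (IsFractionRing.comap_isAlgebraic_iff (K := ℚ⟮x⟯)).2 inferInstance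
  have htr := Algebra.IsAlgebraic.trdeg_le_cardinalMk ℚ ({x} : Set L)
  have hy' : AlgebraicIndependent ℚ (fun _ : Unit => y) :=
    (algebraicIndependent_unique_type_iff).2 hy
  have hB := hy'.isTranscendenceBasis_of_lift_trdeg_le_of_finite (by simpa using htr)
  have h2 := hB.isAlgebraic
  rw [Set.range_const] at h2
  have h3 : Algebra.IsAlgebraic ℚ⟮y⟯ L :=
    (IsFractionRing.comap_isAlgebraic_iff (A := Algebra.adjoin ℚ {y})).1 h2
  have : Algebra.EssFiniteType ℚ⟮y⟯ L := .of_comp ℚ _ _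
  exact Algebra.finite_of_essFiniteType_of_isAlgebraic

end Curve

section Conic

variable {k : Type*} [Field k] {a b : k} {K : Type*} [Field K] {ι : k →+* K}

lemma IsConicFunctionField.exists_generators (hK : IsConicFunctionField k a b K ι) :
    ∃ x y : K, ι a * x ^ 2 + ι b * y ^ 2 = 1 ∧
      ∀ z : K, ∃ P Q : MvPolynomial (Fin 2) k, MvPolynomial.eval₂ ι ![x, y] Q ≠ 0 ∧
        z = MvPolynomial.eval₂ ι ![x, y] P / MvPolynomial.eval₂ ι ![x, y] Q := by
  obtain ⟨f, hf, hι, hz⟩ := hK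
  let g : MvPolynomial (Fin 2) k →+* K := f.comp (Ideal.Quotient.mk _)
  have hg : ∀ P, g P = MvPolynomial.eval₂ ι ![g (X 0), g (X 1)] P := by
    intro P
    have : g = MvPolynomial.eval₂Hom ι ![g (X 0), g (X 1)] := by
      apply MvPolynomial.ringHom_ext
      · intro c
        rw [← hι]; simp [g]; rfl
      · intro i
        fin_cases i <;> simp
    conv_lhs => rw [this]
    rfl
  refine ⟨g (X 0), g (X 1), ?_, fun z => ?_⟩
  · have h1 : g (conicPoly k a b) = 0 := by
      simp only [g, RingHom.comp_apply]
      rw [Ideal.Quotient.eq_zero_iff_mem.2 (Ideal.mem_span_singleton_self _), map_zero]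
    have h2 := hg (conicPoly k a b)
    rw [h1] at h2
    simp [conicPoly] at h2
    linear_combination -h2
  · obtain ⟨p, q, hq, h⟩ := hz z
    obtain ⟨P, rfl⟩ := Ideal.Quotient.mk_surjective p
    obtain ⟨Q, rfl⟩ := Ideal.Quotient.mk_surjective q
    refine ⟨P, Q, ?_, ?_⟩
    · rw [← hg]; exact hq
    · rw [← hg, ← hg]; exact h

open IntermediateField in
lemma IsConicFunctionField.isCurve [NumberField k] [CharZero K] (hb : b ≠ 0)
    (hK : IsConicFunctionField k a b K ι) : IsCurve K := by
  obtain ⟨x, y, hxy, hz⟩ := hK.exists_generators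
  have hι : ∀ c, IsIntegral ℚ⟮x⟯ (ι c) := by
    intro c
    have h1 : IsIntegral ℚ c := Algebra.IsIntegral.isIntegral c
    have h2 : IsIntegral ℚ (ι.toRatAlgHom c) := h1.map ι.toRatAlgHom
    exact h2.tower_top
  have hy : IsIntegral ℚ⟮x⟯ y := by
    let M := algebraicClosure ℚ⟮x⟯ K
    have hM : ∀ z, z ∈ M ↔ IsIntegral ℚ⟮x⟯ z := fun z => by
      rw [← isAlgebraic_iff_isIntegral]; exact mem_algebraicClosure_iff
    rw [← isAlgebraic_iff_isIntegral]
    refine IsAlgebraic.of_pow (n := 2) (by norm_num) ?_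
    rw [isAlgebraic_iff_isIntegral, ← hM]
    have hb' : ι b ≠ 0 := by simpa using hb
    rw [show y ^ 2 = (1 - ι a * x ^ 2) / ι b by field_simp; linear_combination hxy]
    refine div_mem (sub_mem (one_mem M) (mul_mem ((hM _).2 (hι a)) (pow_mem ?_ 2))) ((hM _).2
        (hι b))
    exact M.algebraMap_mem (AdjoinSimple.gen ℚ x)
  obtain ⟨s, hs⟩ := (Module.finite_def (R := ℚ) (M := k)).1 inferInstance
  classical
  let S : Finset K := insert y (s.image ι)
  have hS : FiniteDimensional ℚ⟮x⟯ (adjoin ℚ⟮x⟯ (S : Set K)) := by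
    refine finiteDimensional_adjoin fun z hz => ?_
    simp only [S, Finset.coe_insert, Finset.coe_image, Set.mem_insert_iff, Set.mem_image] at hz
    rcases hz with rfl | ⟨c, -, rfl⟩
    · exact hy
    · exact hι c
  have hsub := subset_adjoin ℚ⟮x⟯ (S : Set K)
  have hyT : y ∈ adjoin ℚ⟮x⟯ (S : Set K) := hsub (by simp [S])
  have hxT : x ∈ adjoin ℚ⟮x⟯ (S : Set K) :=
    (adjoin ℚ⟮x⟯ (S : Set K)).algebraMap_mem (AdjoinSimple.gen ℚ x)
  have hkT : ∀ c, ι c ∈ adjoin ℚ⟮x⟯ (S : Set K) := by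
    intro c
    have hc : c ∈ Submodule.span ℚ (s : Set k) := by rw [hs]; trivial
    induction hc using Submodule.span_induction with
    | mem c hc => exact hsub (by simp [S]; exact Or.inr ⟨c, hc, rfl⟩)
    | zero => simp
    | add u v _ _ hu hv => rw [map_add]; exact add_mem hu hv
    | smul r u _ hu =>
      rw [Rat.smul_def, map_mul, map_ratCast]
      exact mul_mem (SubfieldClass.ratCast_mem _ r) hu
  have hev : ∀ P, MvPolynomial.eval₂ ι ![x, y] P ∈ adjoin ℚ⟮x⟯ (S : Set K) := by
    intro P
    induction P using MvPolynomial.induction_on with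
    | C c => simpa using hkT c
    | add p q hp hq => rw [MvPolynomial.eval₂_add]; exact add_mem hp hq
    | mul_X p i hp =>
      rw [MvPolynomial.eval₂_mul, MvPolynomial.eval₂_X]
      refine mul_mem hp ?_
      fin_cases i
      · exact hxT
      · exact hyT
  have htop : adjoin ℚ⟮x⟯ (S : Set K) = ⊤ := by
    rw [eq_top_iff]
    intro z _
    obtain ⟨P, Q, -, rfl⟩ := hz z
    exact div_mem (hev P) (hev Q)
  have : FiniteDimensional ℚ⟮x⟯ K := by
    rw [htop] at hS
    exact Module.Finite.equiv (IntermediateField.topEquiv (F := ℚ⟮x⟯) (E := K)).toLinearEquiv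
  exact isCurve_of_finiteDimensional (x := x)

end Conic

/-- Every binary form `x ^ 2 + h * y ^ 2` with `h` not a square is universal, and `-1` is a
square. -/
def QuadUniversal (κ : Type*) [Field κ] : Prop :=
  (∃ i : κ, i ^ 2 = -1) ∧ ∀ h : κ, ¬ IsSquare h → ∀ c : κ, ∃ x y, c = x ^ 2 + h * y ^ 2

lemma exists_valuationSubring_val_lt {F : Type*} [Field F] (R₀ : Subring F) {x : F}
    (hx : x ∈ R₀) (hx' : x⁻¹ ∉ R₀) :
    ∃ B : ValuationSubring F, R₀ ≤ B.toSubring ∧ B.valuation x < 1 := by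
  have hx0 : x ≠ 0 := by rintro rfl; simp at hx'
  obtain ⟨B, hB, h⟩ := Ideal.image_subset_nonunits_valuationSubring
    (Ideal.span {(⟨x, hx⟩ : R₀)}) (by
      rw [Ne, Ideal.span_singleton_eq_top]
      intro hu
      obtain ⟨y, hy⟩ := isUnit_iff_exists_inv.1 hu
      apply hx'
      have h1 : x * y = 1 := congrArg Subtype.val hy
      rw [inv_eq_of_mul_eq_one_right h1]
      exact y.2)
  refine ⟨B, hB, ?_⟩
  have := h ⟨_, Ideal.mem_span_singleton_self _, rfl⟩
  rwa [SetLike.mem_coe, ValuationSubring.mem_nonunits_iff] at this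

lemma QuadUniversal.false_of_finite {κ : Type*} [Field κ] (hκ : QuadUniversal κ)
    {B : ValuationSubring κ} [Finite (IsLocalRing.ResidueField B)]
    (h2 : (2 : IsLocalRing.ResidueField B) ≠ 0) {ϖ : κ} (hϖ0 : ϖ ≠ 0)
    (hϖ : B.valuation ϖ < 1) (h : ∀ x, x ≠ 0 → ∃ n : ℤ, B.valuation x = B.valuation ϖ ^ n) :
    False := by
  obtain ⟨⟨i, hi⟩, hu⟩ := hκ
  have hi' : i ∈ B := by
    rw [← B.valuation_le_one_iff]
    have : B.valuation i ^ 2 = 1 := by rw [← map_pow, hi, Valuation.map_neg, map_one]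
    exact ((pow_eq_one_iff_of_nonneg zero_le two_ne_zero).1 this).le
  obtain ⟨a, ha⟩ := FiniteField.exists_nonsquare (F := IsLocalRing.ResidueField B)
    (fun h => h2 (by
      have := ringChar.Nat.cast_ringChar (R := IsLocalRing.ResidueField B)
      rw [h] at this; exact_mod_cast this))
  have hp : 0 < B.valuation ϖ := by simpa [zero_lt_iff] using hϖ0
  obtain ⟨u, rfl⟩ := IsLocalRing.residue_surjective a
  have hvu : B.valuation (u : κ) = 1 := by
    refine ((B.valuation_le_one_iff _).2 u.2).lt_or_eq.resolve_left fun hlt => ha ?_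
    rw [(residue_eq_zero_iff u.2).2 hlt]
    exact ⟨0, by simp⟩
  have key : ∀ y ∈ B, B.valuation (1 + u * y ^ 2) = 1 := fun y hy => by
    refine ((B.valuation_le_one_iff _).2 ?_).lt_or_eq.resolve_left fun hlt => ha ?_
    · exact add_mem (one_mem _) (mul_mem u.2 (pow_mem hy 2))
    have h1 := (residue_eq_zero_iff (A := B)
      (add_mem (one_mem _) (mul_mem u.2 (pow_mem hy 2)))).2 hlt
    set r := IsLocalRing.residue B
    have h2 : 1 + r u * r ⟨y, hy⟩ ^ 2 = 0 := by
      rw [← h1, ← map_pow, ← map_mul, ← map_one r, ← map_add]; rfl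
    have h3 : r ⟨y, hy⟩ ≠ 0 := by rintro h; simp [h] at h2
    have h4 : r ⟨i, hi'⟩ ^ 2 = -1 := by
      rw [← map_pow, ← map_one r, ← map_neg]; congr 1; exact Subtype.ext hi
    refine ⟨r ⟨i, hi'⟩ / r ⟨y, hy⟩, ?_⟩
    field_simp
    linear_combination h2 - h4
  have key' : ∀ x y, B.valuation (x ^ 2 + u * y ^ 2) ≠ B.valuation ϖ := by
    have fin : ∀ x, B.valuation x ^ 2 ≠ B.valuation ϖ := fun x hx => by
      have hx0 : x ≠ 0 := by rintro rfl; simp [hp.ne] at hx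
      obtain ⟨n, hn⟩ := h x hx0
      rw [hn, ← zpow_natCast, ← zpow_mul] at hx
      conv_rhs at hx => rw [← zpow_one (B.valuation ϖ)]
      have := zpow_right_injective₀ hp hϖ.ne hx
      push_cast at this
      omega
    intro x y hxy
    rcases le_total (B.valuation y) (B.valuation x) with hle | hle
    · by_cases hx : x = 0
      · have hy : y = 0 := by simpa [hx] using hle
        simp [hx, hy, hp.ne] at hxy
      have : x ^ 2 + u * y ^ 2 = x ^ 2 * (1 + u * (y / x) ^ 2) := by field_simp
      rw [this, map_mul, key, mul_one, map_pow] at hxy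
      · exact fin x hxy
      · rw [← B.valuation_le_one_iff, map_div₀]
        exact div_le_one_of_le₀ hle zero_le
    · by_cases hy : y = 0
      · have hx : x = 0 := by simpa [hy] using hle
        simp [hx, hy, hp.ne] at hxy
      have hu0 : (u : κ) ≠ 0 := by intro h; simp [h] at hvu
      have : x ^ 2 + u * y ^ 2 = u * y ^ 2 * (1 + u * (x / (y * u)) ^ 2) := by field_simp; ring
      rw [this, map_mul, map_mul, hvu, key, mul_one, one_mul, map_pow] at hxy
      · exact fin y hxy
      · rw [← B.valuation_le_one_iff, map_div₀, map_mul, hvu, mul_one]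
        exact div_le_one_of_le₀ hle zero_le
  obtain ⟨x, y, hxy⟩ := hu u (fun ⟨s, hs⟩ => ha (by
    have hsB : s ∈ B := by
      rw [← B.valuation_le_one_iff]
      have : B.valuation s ^ 2 = 1 := by rw [← map_pow, sq, ← hs, hvu]
      exact ((pow_eq_one_iff_of_nonneg zero_le two_ne_zero).1 this).le
    exact ⟨IsLocalRing.residue B ⟨s, hsB⟩, by rw [← map_mul]; congr 1; exact Subtype.ext hs⟩)) ϖ
  exact key' x y (by rw [← hxy])
lemma not_quadUniversal_of_numberField (κ : Type*) [Field κ] [NumberField κ] :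
    ¬ QuadUniversal κ := by
  intro hκ
  have h3 : Fact (Nat.Prime 3) := ⟨Nat.prime_three⟩
  obtain ⟨B, -, hB⟩ := exists_valuationSubring_val_lt (Int.castRingHom κ).range (x := (3 : ℕ))
    ⟨3, by simp⟩ (by
      rintro ⟨n, hn⟩
      have h1 : ((n * 3 : ℤ) : κ) = 1 := by
        push_cast; rw [eq_intCast] at hn; rw [hn]; simp
      have h2 : n * 3 = 1 := by exact_mod_cast h1
      omega)
  have hp : (((3 : ℕ) : κ)) ≠ 0 := by simp
  obtain ⟨ϖ, h0, h1, h2⟩ := exists_uniformizer (F := ℚ) hB hp fun x hx => by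
    rw [eq_ratCast]; exact exists_val_rat_eq Nat.prime_three hB hx
  have := charP_residue Nat.prime_three hB
  let _ := ZMod.algebra (IsLocalRing.ResidueField B) 3
  have hf : FiniteDimensional (ZMod 3) (IsLocalRing.ResidueField B) :=
    finite_residueField (F := ℚ) _ fun x hx => by
      obtain ⟨z, hz⟩ := exists_residue_rat hB (x := x) hx
      exact ⟨z, by simpa using hz⟩
  have : Finite (IsLocalRing.ResidueField B) := Module.finite_of_finite (ZMod 3)
  refine hκ.false_of_finite (B := B) (fun h => ?_) h0 h1 h2
  have := (CharP.cast_eq_zero_iff (IsLocalRing.ResidueField B) 3 2).1 (by exact_mod_cast h)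
  omega

open IntermediateField in
lemma not_quadUniversal_of_finite_adjoin {p : ℕ} [Fact p.Prime] (hp2 : p ≠ 2) {κ : Type*}
    [Field κ] [Algebra (ZMod p) κ] {t : κ} (ht : Transcendental (ZMod p) t)
    [FiniteDimensional (ZMod p)⟮t⟯ κ] : ¬ QuadUniversal κ := by
  intro hκ
  have ht0 : t ≠ 0 := by rintro rfl; exact ht (isAlgebraic_zero)
  obtain ⟨B, hB', hB⟩ := exists_valuationSubring_val_lt (Algebra.adjoin (ZMod p) {t}).toSubring
    (x := t) (Algebra.self_mem_adjoin_singleton _ _) (by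
      intro h
      rw [Subalgebra.mem_toSubring, Algebra.adjoin_singleton_eq_range_aeval] at h
      obtain ⟨P, hP⟩ := h
      have h1 : Polynomial.aeval t (P * Polynomial.X - 1) = 0 := by
        have hP' : Polynomial.aeval t P = t⁻¹ := hP
        simp [hP', ht0]
      have h2 := (transcendental_iff.1 ht) _ h1
      have := congrArg (Polynomial.eval 0) h2
      simp at this)
  have hA : ∀ c : ZMod p, c ≠ 0 → B.valuation (algebraMap (ZMod p) κ c) = 1 := by
    have hle : ∀ c, B.valuation (algebraMap (ZMod p) κ c) ≤ 1 := fun c =>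
      (B.valuation_le_one_iff _).2 (hB' (Subalgebra.algebraMap_mem _ c))
    intro c hc
    refine le_antisymm (hle c) ?_
    have h1 := hle c⁻¹
    rw [map_inv₀, map_inv₀] at h1
    exact (inv_le_one₀ (by simpa [zero_lt_iff] using hc)).1 h1
  obtain ⟨⟨ϖ, h0, h1, h2⟩, hfin⟩ := uniformizer_of_val_lt hA hB ht0
  let f : ZMod p →+* B := (algebraMap (ZMod p) κ).codRestrict B.toSubring
    (fun c => algebraMap_mem_of_val hA c)
  let _ : Algebra (ZMod p) (IsLocalRing.ResidueField B) :=
    ((IsLocalRing.residue B).comp f).toAlgebra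
  have := hfin _ (fun c => rfl)
  have : Finite (IsLocalRing.ResidueField B) := Module.finite_of_finite (ZMod p)
  refine hκ.false_of_finite (B := B) (fun h => ?_) h0 h1 h2
  have := charP_of_injective_algebraMap (algebraMap (ZMod p) (IsLocalRing.ResidueField
      B)).injective p
  have h3 := (CharP.cast_eq_zero_iff (IsLocalRing.ResidueField B) p 2).1 (by exact_mod_cast h)
  exact hp2 ((Nat.prime_dvd_prime_iff_eq Fact.out Nat.prime_two).1 h3)

open IntermediateField in
/-- A function field of one variable over the field with two elements has degree two over its
subfield of squares. -/
lemma quadUniversal_of_finite_adjoin {κ : Type*} [Field κ] [Algebra (ZMod 2) κ] {t : κ}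
    (ht : Transcendental (ZMod 2) t) [FiniteDimensional (ZMod 2)⟮t⟯ κ] :
    QuadUniversal κ ∧ ∃ h : κ, ¬ IsSquare h := by
  have hchar : CharP κ 2 :=
    charP_of_injective_algebraMap (algebraMap (ZMod 2) κ).injective 2
  set φ := frobenius κ 2
  set K₀ : Subfield κ := (ZMod 2)⟮t⟯.toSubfield
  set S₀ := K₀.map φ
  set S : Subfield κ := (⊤ : Subfield κ).map φ
  have htK : t ∈ K₀ := mem_adjoin_simple_self (ZMod 2) t
  have hS₀ : S₀ ≤ K₀ := by
    rintro _ ⟨x, hx, rfl⟩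
    have hx : x ∈ K₀ := hx
    exact pow_mem hx 2
  have hdec : ∀ x ∈ K₀, ∃ a ∈ K₀, ∃ b ∈ K₀, x = a ^ 2 + b ^ 2 * t := by
    intro x hx'
    have hx : x ∈ (ZMod 2)⟮t⟯ := hx'
    clear hx'
    have h2 : (2 : κ) = 0 := CharTwo.two_eq_zero
    induction hx using adjoin_induction with
    | mem x hx =>
      obtain rfl : x = t := hx
      exact ⟨0, zero_mem _, 1, one_mem _, by simp⟩
    | algebraMap x =>
      refine ⟨algebraMap _ _ x, IntermediateField.algebraMap_mem (ZMod 2)⟮t⟯ x, 0, zero_mem _, ?_⟩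
      rw [← map_pow, ZMod.pow_card]; simp
    | add x y _ _ hx hy =>
      obtain ⟨a, ha, b, hb, rfl⟩ := hx
      obtain ⟨c, hc, d, hd, rfl⟩ := hy
      exact ⟨a + c, add_mem ha hc, b + d, add_mem hb hd, by
        linear_combination (- a * c - b * d * t) * h2⟩
    | mul x y _ _ hx hy =>
      obtain ⟨a, ha, b, hb, rfl⟩ := hx
      obtain ⟨c, hc, d, hd, rfl⟩ := hy
      exact ⟨a * c + b * d * t, add_mem (mul_mem ha hc) (mul_mem (mul_mem hb hd) htK),
        a * d + b * c, add_mem (mul_mem ha hd) (mul_mem hb hc), by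
        linear_combination (- 2 * a * b * c * d * t) * h2⟩
    | inv x _ hx =>
      obtain ⟨a, ha, b, hb, h⟩ := hx
      have hxK : x ∈ K₀ := by
        rw [h]; exact add_mem (pow_mem ha 2) (mul_mem (pow_mem hb 2) htK)
      by_cases hx0 : x = 0
      · exact ⟨0, zero_mem _, 0, zero_mem _, by simp [hx0]⟩
      refine ⟨a / x, div_mem ha hxK, b / x, div_mem hb hxK, ?_⟩
      field_simp
      exact h
  have htS : t ∉ S₀ := by
    rintro ⟨s, hs, hst⟩
    have hst : s ^ 2 = t := hst
    obtain ⟨P, Q, rfl⟩ := (mem_adjoin_simple_iff _ _).1 hs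
    have ht0 : t ≠ 0 := by rintro rfl; exact ht isAlgebraic_zero
    have hQ0 : Polynomial.aeval t Q ≠ 0 := by
      intro h; rw [h] at hst; apply ht0; rw [← hst]; simp
    have hQ : Q ≠ 0 := by rintro rfl; simp at hQ0
    have h1 : Polynomial.aeval t (P ^ 2 - Polynomial.X * Q ^ 2) = 0 := by
      simp only [map_sub, map_mul, map_pow, Polynomial.aeval_X]
      rw [div_pow, div_eq_iff (pow_ne_zero 2 hQ0)] at hst
      rw [hst, sub_self]
    have h2 := sub_eq_zero.1 ((transcendental_iff.1 ht) _ h1)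
    have h3 := congrArg Polynomial.natDegree h2
    rw [Polynomial.natDegree_pow, Polynomial.natDegree_mul Polynomial.X_ne_zero (pow_ne_zero 2 hQ),
      Polynomial.natDegree_pow, Polynomial.natDegree_X] at h3
    omega
  have hr0 : Subfield.relfinrank S₀ K₀ = 2 := by
    rw [Subfield.relfinrank_eq_finrank_of_le hS₀]
    set K₁ := Subfield.extendScalars hS₀
    let tK : K₁ := ⟨t, htK⟩
    have hli : LinearIndependent S₀ ![(1 : K₁), tK] := by
      rw [LinearIndependent.pair_iff]
      intro x y hxy
      have hxy : (x : κ) * 1 + y * t = 0 := congrArg Subtype.val hxy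
      by_cases hy : y = 0
      · exact ⟨by simpa [hy] using hxy, hy⟩
      · exfalso
        have hy' : (y : κ) ≠ 0 := by simpa using hy
        apply htS
        have : t = - (x / y : S₀) := by
          push_cast; field_simp; linear_combination hxy
        rw [this]
        exact neg_mem (x / y : S₀).2
    have hspan : ⊤ ≤ Submodule.span S₀ (Set.range ![(1 : K₁), tK]) := by
      rintro ⟨x, hx⟩ -
      obtain ⟨a, ha, b, hb, rfl⟩ := hdec x hx
      simp only [Matrix.range_cons, Matrix.range_empty, Set.union_empty, Set.singleton_union]
      rw [Submodule.mem_span_pair]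
      exact ⟨⟨a ^ 2, a, ha, rfl⟩, ⟨b ^ 2, b, hb, rfl⟩, Subtype.ext (by
        change a ^ 2 * 1 + b ^ 2 * t = _; ring)⟩
    rw [Module.finrank_eq_card_basis (Module.Basis.mk hli hspan)]
    simp
  have hr : Module.finrank S κ = 2 := by
    have h1 := Subfield.relfinrank_mul_relfinrank hS₀ (le_top (a := K₀))
    have h2 := Subfield.relfinrank_mul_relfinrank
      (show S₀ ≤ S from fun _ ⟨x, _, hx⟩ => ⟨x, trivial, hx⟩) (le_top (a := S))
    rw [Subfield.relfinrank_map_map] at h2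
    rw [← h2, hr0, mul_comm, Subfield.relfinrank_top_right, Subfield.relfinrank_top_right] at h1
    have : 0 < Module.finrank K₀ κ := Module.finrank_pos (R := (ZMod 2)⟮t⟯) (M := κ)
    exact (Nat.eq_of_mul_eq_mul_left this h1).symm
  have hsq : ∀ x : κ, x ∈ S ↔ IsSquare x := fun x => by
    constructor
    · rintro ⟨y, -, rfl⟩; exact ⟨y, sq y⟩
    · rintro ⟨y, rfl⟩; exact ⟨y, trivial, sq y⟩
  refine ⟨⟨⟨1, by rw [CharTwo.neg_eq, one_pow]⟩, fun h hh c => ?_⟩, ?_⟩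
  · have hli : LinearIndependent S ![(1 : κ), h] := by
      rw [LinearIndependent.pair_iff]
      intro x y hxy
      have hxy : (x : κ) * 1 + y * h = 0 := hxy
      by_cases hy : y = 0
      · exact ⟨by simpa [hy] using hxy, hy⟩
      · exfalso
        have hy' : (y : κ) ≠ 0 := by simpa using hy
        apply hh
        rw [← hsq]
        have : h = - (x / y : S) := by
          push_cast; field_simp; linear_combination hxy
        rw [this]
        exact neg_mem (x / y : S).2
    have hspan := hli.span_eq_top_of_card_eq_finrank (by rw [hr]; simp)
    have hc : c ∈ Submodule.span S (Set.range ![(1 : κ), h]) := by rw [hspan]; trivial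
    simp only [Matrix.range_cons, Matrix.range_empty, Set.union_empty, Set.singleton_union] at hc
    rw [Submodule.mem_span_pair] at hc
    obtain ⟨⟨x', x, -, hx⟩, ⟨y', y, -, hy⟩, (hxy : x' * 1 + y' * h = c)⟩ := hc
    have hx : x ^ 2 = x' := hx
    have hy : y ^ 2 = y' := hy
    refine ⟨x, y, ?_⟩
    rw [hx, hy, ← hxy]
    ring
  · by_contra! hall
    have : S = ⊤ := by
      ext x; simp only [hsq, hall, Subfield.mem_top]
    rw [← Subfield.relfinrank_top_right, this, Subfield.relfinrank_self] at hr
    norm_num at hr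

section Dyadic

variable {V : Type*} [CommGroup V] (e : V) (R : V → V → V → Prop)

/-- Good subgroups for which the residue forms `x ^ 2 + h * y ^ 2` are universal. -/
structure Dy (H : Subgroup V) : Prop where
  good : Good e R H
  e_mem : e ∈ TT R H
  univ : ∀ h ∈ H, h ∉ TT R H → ∀ c ∈ H, ∃ t₁ ∈ TT R H, ∃ t₂ ∈ TT R H, R t₁ (t₂ * h) c

variable {e R}

lemma pull_of_mem {L : Type*} [Field L] {q : Lˣ →* V} (I : Interp e R q) {H : Subgroup V} {z : V}
    (hz : z ∈ H) : ∃ x : L, ∃ hx : x ≠ 0, Pull q H x ∧ q (Units.mk0 x hx) = z := by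
  obtain ⟨u, rfl⟩ := I.surj z
  exact ⟨u, u.ne_zero, ⟨u, rfl, hz⟩, by simp⟩

variable {L : Type*} [Field L] {q : Lˣ →* V} {A : ValuationSubring L} {H : Subgroup V} {ϖ : L}

lemma pull_mk0 {x : L} (hx : x ≠ 0) : Pull q H x ↔ q (Units.mk0 x hx) ∈ H :=
  pull_coe (Units.mk0 x hx)

lemma exists_unit_mul_sq (I : Interp e R q) (D : DVPair q A H ϖ) {x : L} (hx : Pull q H x) :
    ∃ u y, A.valuation u = 1 ∧ y ≠ 0 ∧ x = u * y ^ 2 := by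
  obtain ⟨n, hn⟩ := D.exists_zpow x hx.ne_zero
  obtain ⟨m, rfl⟩ := (D.even_iff I hn).1 hx
  have h0 := zpow_ne_zero m D.ne_zero
  refine ⟨x / (ϖ ^ m) ^ 2, ϖ ^ m, ?_, h0, by field_simp⟩
  have h1 : A.valuation ϖ ≠ 0 := D.val_pos.ne'
  rw [map_div₀, map_pow, map_zpow₀, hn, ← zpow_natCast, ← zpow_mul, ← zpow_sub₀ h1]
  simp [mul_two]

lemma residue_ne_zero_iff {x : L} (hx : x ∈ A) :
    IsLocalRing.residue A ⟨x, hx⟩ ≠ 0 ↔ A.valuation x = 1 := by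
  rw [Ne, residue_eq_zero_iff, not_lt]
  exact ⟨fun h => le_antisymm ((A.valuation_le_one_iff _).2 hx) h, fun h => h.ge⟩

lemma pull_TT_iff_isSquare (I : Interp e R q) (D : DVPair q A H ϖ) {u : L}
    (hu : A.valuation u = 1) (huA : u ∈ A) :
    Pull q (TT R H) u ↔ IsSquare (IsLocalRing.residue A ⟨u, huA⟩) := by
  rw [D.pull_TT_iff I]
  constructor
  · rintro ⟨m, y, hm, hy, h⟩
    have h1 := val_one_add hm
    have h2 : A.valuation y ^ 2 = 1 := by
      have := congrArg A.valuation h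
      rw [map_mul, h1, one_mul, hu, map_pow] at this
      exact this.symm
    have hyv := (pow_eq_one_iff_of_nonneg zero_le two_ne_zero).1 h2
    have hyA : y ∈ A := (A.valuation_le_one_iff _).1 hyv.le
    refine ⟨IsLocalRing.residue A ⟨y, hyA⟩, ?_⟩
    rw [← map_mul, ← sub_eq_zero, ← map_sub]
    refine (residue_eq_zero_iff (A := A) (sub_mem huA (mul_mem hyA hyA))).2 ?_
    rw [h, show (1 + m) * y ^ 2 - y * y = m * y ^ 2 by ring, map_mul, map_pow, h2, mul_one]
    exact hm
  · rintro ⟨s, hs⟩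
    obtain ⟨s, rfl⟩ := IsLocalRing.residue_surjective s
    rw [← map_mul, ← sub_eq_zero, ← map_sub] at hs
    have h1 := (residue_eq_zero_iff (A := A) (sub_mem huA (mul_mem s.2 s.2))).1 hs
    rw [← sq] at h1
    have h2 : A.valuation ((s : L) ^ 2) = 1 := by
      have := Valuation.map_sub_eq_of_lt_right A.valuation (x := u - s ^ 2) (y := u) (by rwa [hu])
      rwa [hu, sub_sub_cancel_left, Valuation.map_neg] at this
    have hs0 : (s : L) ≠ 0 := by intro h; simp [h] at h2
    refine ⟨(u - s ^ 2) / s ^ 2, s, ?_, hs0, by field_simp; ring⟩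
    rwa [map_div₀, h2, div_one]

lemma dy_iff (I : Interp e R q) (D : DVPair q A H ϖ) (hH : Good e R H) :
    Dy e R H ↔ QuadUniversal (IsLocalRing.ResidueField A) := by
  have mem1 : ∀ {x}, A.valuation x = 1 → x ∈ A := fun h => (A.valuation_le_one_iff _).1 h.le
  have ne1 : ∀ {x}, A.valuation x = 1 → x ≠ 0 := by rintro x h rfl; simp at h
  have hneg : A.valuation (-1 : L) = 1 := by rw [Valuation.map_neg, map_one]
  have hneg' : e ∈ TT R H ↔ ∃ i : IsLocalRing.ResidueField A, i ^ 2 = -1 := by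
    rw [← I.neg_one, ← pull_coe, Units.val_neg, Units.val_one,
      pull_TT_iff_isSquare I D hneg (mem1 hneg)]
    have : IsLocalRing.residue A ⟨-1, mem1 hneg⟩ = -1 := by
      rw [← map_one (IsLocalRing.residue A), ← map_neg]; rfl
    rw [this]
    exact ⟨fun ⟨s, hs⟩ => ⟨s, by rw [hs, sq]⟩, fun ⟨s, hs⟩ => ⟨s, by rw [← hs, sq]⟩⟩
  set r := IsLocalRing.residue A
  constructor
  · rintro ⟨-, he, hu⟩
    have hi := hneg'.1 he
    refine ⟨hi, fun h hh c => ?_⟩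
    obtain ⟨i, hi⟩ := hi
    by_cases hc0 : c = 0
    · exact ⟨0, 0, by simp [hc0]⟩
    obtain ⟨⟨h, hA⟩, rfl⟩ := IsLocalRing.residue_surjective h
    obtain ⟨⟨c, cA⟩, rfl⟩ := IsLocalRing.residue_surjective c
    have hv : A.valuation h = 1 := (residue_ne_zero_iff hA).1 fun h0 => hh ⟨0, by simpa using h0⟩
    have cv : A.valuation c = 1 := (residue_ne_zero_iff cA).1 hc0
    have h1 : q (Units.mk0 h (ne1 hv)) ∉ TT R H := by
      rw [← pull_mk0, pull_TT_iff_isSquare I D hv hA]; exact hh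
    obtain ⟨t₁, ht₁, t₂, ht₂, hr⟩ := hu _ ((pull_mk0 _).1 (D.unit_mem _ hv)) h1 _
      ((pull_mk0 (ne1 cv)).1 (D.unit_mem _ cv))
    obtain ⟨t₁, t₁0, pt₁, rfl⟩ := pull_of_mem I ht₁
    obtain ⟨t₂, t₂0, pt₂, rfl⟩ := pull_of_mem I ht₂
    rw [← map_mul, I.rep] at hr
    obtain ⟨x, y, hxy⟩ := hr
    obtain ⟨m₁, y₁, hm₁, hy₁, rfl⟩ := (D.pull_TT_iff I).1 pt₁
    obtain ⟨m₂, y₂, hm₂, hy₂, rfl⟩ := (D.pull_TT_iff I).1 pt₂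
    simp only [Units.val_mul, Units.val_mk0] at hxy
    set X := y₁ * x
    set Y := y₂ * y
    have hXY : c = (1 + m₁) * X ^ 2 + (1 + m₂) * h * Y ^ 2 := by rw [hxy]; ring
    have hm₁A : m₁ ∈ A := (A.valuation_le_one_iff _).1 hm₁.le
    have hm₂A : m₂ ∈ A := (A.valuation_le_one_iff _).1 hm₂.le
    have res : ∀ (X' Y' : L) (hX : X' ∈ A) (hY : Y' ∈ A)
        (hZ : (1 + m₁) * X' ^ 2 + (1 + m₂) * h * Y' ^ 2 ∈ A), r ⟨_, hZ⟩ =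
        r ⟨X', hX⟩ ^ 2 + r ⟨h, hA⟩ * r ⟨Y', hY⟩ ^ 2 := fun X' Y' hX hY hZ => by
      have e1 : r ⟨m₁, hm₁A⟩ = 0 := (residue_eq_zero_iff hm₁A).2 hm₁
      have e2 : r ⟨m₂, hm₂A⟩ = 0 := (residue_eq_zero_iff hm₂A).2 hm₂
      have : (⟨_, hZ⟩ : A) = (1 + ⟨m₁, hm₁A⟩) * ⟨X', hX⟩ ^ 2 +
        (1 + ⟨m₂, hm₂A⟩) * ⟨h, hA⟩ * ⟨Y', hY⟩ ^ 2 := rfl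
      rw [this]
      simp only [map_add, map_mul, map_pow, map_one, e1, e2]
      ring
    have bad : ∀ X' Y' : L, X' ∈ A → Y' ∈ A → (A.valuation X' = 1 ∨ A.valuation Y' = 1) →
        ¬ A.valuation ((1 + m₁) * X' ^ 2 + (1 + m₂) * h * Y' ^ 2) < 1 := by
      intro X' Y' hX hY hor hlt
      have hZ : (1 + m₁) * X' ^ 2 + (1 + m₂) * h * Y' ^ 2 ∈ A :=
        (A.valuation_le_one_iff _).1 hlt.le
      have e1 := res X' Y' hX hY hZ
      rw [(residue_eq_zero_iff hZ).2 hlt] at e1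
      have hY0 : r ⟨Y', hY⟩ ≠ 0 := by
        rcases hor with hor | hor
        · intro h0
          rw [h0, sq (0 : IsLocalRing.ResidueField A), mul_zero, mul_zero, add_zero] at e1
          exact (residue_ne_zero_iff hX).2 hor (pow_eq_zero_iff two_ne_zero |>.1 e1.symm)
        · exact (residue_ne_zero_iff hY).2 hor
      apply hh
      refine ⟨i * r ⟨X', hX⟩ / r ⟨Y', hY⟩, ?_⟩
      field_simp
      linear_combination (-1) * e1 - hi * r ⟨X', hX⟩ ^ 2
    have scale : ∀ z : L, 1 < A.valuation z →
        A.valuation ((1 + m₁) * (X / z) ^ 2 + (1 + m₂) * h * (Y / z) ^ 2) < 1 := fun z hz => by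
      have hz0 : z ≠ 0 := by rintro rfl; simp at hz
      have : (1 + m₁) * (X / z) ^ 2 + (1 + m₂) * h * (Y / z) ^ 2 = c / z ^ 2 := by
        rw [hXY]; field_simp
      rw [this, map_div₀, cv, map_pow, one_div]
      exact inv_lt_one_of_one_lt₀ (one_lt_pow₀ hz two_ne_zero)
    have hXYA : X ∈ A ∧ Y ∈ A := by
      by_contra hcon
      rcases le_total (A.valuation X) (A.valuation Y) with hle | hle
      · have h1 : 1 < A.valuation Y := by
          by_contra h1
          exact hcon ⟨(A.valuation_le_one_iff _).1 (hle.trans (not_lt.1 h1)),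
            (A.valuation_le_one_iff _).1 (not_lt.1 h1)⟩
        have h0 : Y ≠ 0 := by intro h; simp [h] at h1
        refine bad (X / Y) (Y / Y) ?_ ?_ (Or.inr (by rw [div_self h0, map_one])) (scale Y h1)
        · rw [← A.valuation_le_one_iff, map_div₀]; exact div_le_one_of_le₀ hle zero_le
        · rw [div_self h0]; exact one_mem _
      · have h1 : 1 < A.valuation X := by
          by_contra h1
          exact hcon ⟨(A.valuation_le_one_iff _).1 (not_lt.1 h1),
            (A.valuation_le_one_iff _).1 (hle.trans (not_lt.1 h1))⟩
        have h0 : X ≠ 0 := by intro h; simp [h] at h1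
        refine bad (X / X) (Y / X) ?_ ?_ (Or.inl (by rw [div_self h0, map_one])) (scale X h1)
        · rw [div_self h0]; exact one_mem _
        · rw [← A.valuation_le_one_iff, map_div₀]; exact div_le_one_of_le₀ hle zero_le
    refine ⟨r ⟨X, hXYA.1⟩, r ⟨Y, hXYA.2⟩, ?_⟩
    rw [← res X Y _ _ (hXY ▸ cA)]
    congr 1
    exact Subtype.ext hXY
  · rintro ⟨hi, hu⟩
    refine ⟨hH, hneg'.2 hi, fun h hh hT c hc => ?_⟩
    obtain ⟨h, h0, ph, rfl⟩ := pull_of_mem I hh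
    obtain ⟨c, c0, pc, rfl⟩ := pull_of_mem I hc
    obtain ⟨u, y, hv, hy, rfl⟩ := exists_unit_mul_sq I D ph
    obtain ⟨w, z, wv, hz, rfl⟩ := exists_unit_mul_sq I D pc
    rw [← pull_mk0, I.pull_mul_sq hy, pull_TT_iff_isSquare I D hv (mem1 hv)] at hT
    obtain ⟨X, Y, hXY⟩ := hu _ hT (r ⟨w, mem1 wv⟩)
    obtain ⟨X, rfl⟩ := IsLocalRing.residue_surjective X
    obtain ⟨Y, rfl⟩ := IsLocalRing.residue_surjective Y
    have hm : A.valuation (w - (X ^ 2 + u * Y ^ 2)) < 1 := by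
      have : r (⟨w, mem1 wv⟩ - (X ^ 2 + ⟨u, mem1 hv⟩ * Y ^ 2)) = 0 := by
        rw [map_sub, map_add, map_mul, map_pow, map_pow, sub_eq_zero]; exact hXY
      exact (residue_eq_zero_iff (A := A)
        (Subtype.property (⟨w, mem1 wv⟩ - (X ^ 2 + ⟨u, mem1 hv⟩ * Y ^ 2) : A))).1 this
    set m := w - (X ^ 2 + u * Y ^ 2) with hm_def
    have fin : ∀ m₁ m₂ : L, A.valuation m₁ < 1 → A.valuation m₂ < 1 →
        w = (1 + m₁) * X ^ 2 + (1 + m₂) * u * Y ^ 2 →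
        ∃ t₁ ∈ TT R H, ∃ t₂ ∈ TT R H, R t₁ (t₂ * q (Units.mk0 (u * y ^ 2) h0))
          (q (Units.mk0 (w * z ^ 2) c0)) := by
      intro m₁ m₂ hm₁ hm₂ hw
      have n1 := ne1 (val_one_add hm₁)
      have n2 := ne1 (val_one_add hm₂)
      refine ⟨q (Units.mk0 _ n1), (pull_mk0 n1).1 (D.pull_TT_one_add I hm₁),
        q (Units.mk0 _ n2), (pull_mk0 n2).1 (D.pull_TT_one_add I hm₂), ?_⟩
      rw [← map_mul, I.rep]
      refine ⟨X * z, Y * z / y, ?_⟩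
      simp only [Units.val_mul, Units.val_mk0]
      rw [hw]
      field_simp
    by_cases hX : r X = 0
    · have hY : r Y ≠ 0 := by
        intro hY
        rw [hX, hY] at hXY
        exact (residue_ne_zero_iff (mem1 wv)).2 wv (by rw [hXY]; simp)
      have hYv := (residue_ne_zero_iff Y.2).1 hY
      refine fin 0 (m / (u * Y ^ 2)) (by simp) ?_ ?_
      · rwa [map_div₀, map_mul, map_pow, hYv, hv, one_pow, mul_one, div_one]
      · have := ne1 hv; have := ne1 hYv
        field_simp; rw [hm_def]; ring
    · have hXv := (residue_ne_zero_iff X.2).1 hX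
      refine fin (m / X ^ 2) 0 ?_ (by simp) ?_
      · rwa [map_div₀, map_pow, hXv, one_pow, div_one]
      · have := ne1 hXv
        field_simp; rw [hm_def]; ring

/-- Classification of the good subgroups satisfying the dyadic test. -/
lemma dy_iff_val_two_lt [CharZero L] (I : Interp e R q) (D : DVPair q A H ϖ) (hH : Good e R H)
    (hA : Horiz A ∨ ∃ p, ∃ _ : Fact p.Prime, Vert A p) : Dy e R H ↔ A.valuation (2 : L) < 1 := by
  rw [dy_iff I D hH]
  rcases hA with hA | ⟨p, hp, hA⟩
  · have := hA.numberField
    refine iff_of_false (not_quadUniversal_of_numberField _) ?_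
    have := hA.val_natCast 2 two_ne_zero
    push_cast at this
    rw [this]; exact lt_irrefl _
  · obtain ⟨hlt, _, t, ht, hfin⟩ := hA
    by_cases hp2 : p = 2
    · subst hp2
      refine iff_of_true (quadUniversal_of_finite_adjoin ht).1 (by exact_mod_cast hlt)
    · refine iff_of_false (not_quadUniversal_of_finite_adjoin hp2 ht) ?_
      have := val_int_eq_one (A := A) (p := p) Fact.out hlt (m := 2) (fun h =>
        hp2 ((Nat.prime_dvd_prime_iff_eq Fact.out Nat.prime_two).1 (by exact_mod_cast h)))
      push_cast at this
      rw [this]; exact lt_irrefl _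

end Dyadic

section Limits

variable {V : Type*} [CommGroup V]

/-- `J` is a pointwise limit of subgroups satisfying `𝒢`. -/
def Cl (𝒢 : Subgroup V → Prop) (J : Subgroup V) : Prop :=
  ∀ Z : Finset V, ∃ H, 𝒢 H ∧ ∀ z ∈ Z, (z ∈ H ↔ z ∈ J)

/-- Good subgroups, not satisfying the dyadic test, with a proper specialization which is a limit
of subgroups satisfying the dyadic test. -/
structure Hor (e : V) (R : V → V → V → Prop) (H : Subgroup V) : Prop where
  good : Good e R H
  not_dy : ¬ Dy e R H
  exists_cl : ∃ J, Cl (Dy e R) J ∧ J ≠ ⊤ ∧ TT R H ≤ J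

/-- The traces on `H` of the limits of good subgroups specializing `H`. -/
def Fam (e : V) (R : V → V → V → Prop) (H J : Subgroup V) : Prop :=
  ∃ H', Cl (Good e R) H' ∧ TT R H ≤ H' ∧ ¬ H ≤ H' ∧ J = H' ⊓ H

variable {L : Type*} [Field L] {q : Lˣ →* V}

lemma Cl.exists_valuationSubring {𝒢 : Subgroup V → Prop} (N : Set L)
    (h : ∀ H, 𝒢 H → ∃ A : ValuationSubring L, (∀ x ∈ N, x ∉ A) ∧
      ∀ x, A.valuation x = 1 → Pull q H x) {H' : Subgroup V} (hH' : Cl 𝒢 H') :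
    ∃ A : ValuationSubring L, (∀ x ∈ N, x ∉ A) ∧ ∀ x, A.valuation x = 1 → Pull q H' x := by
  choose G hG hG' using hH'
  choose A hA hA' using fun Z => h _ (hG Z)
  let U : Ultrafilter (Finset V) := Ultrafilter.of Filter.atTop
  have hU : (U : Filter (Finset V)) ≤ Filter.atTop := Ultrafilter.of_le _
  let B : ValuationSubring L :=
    { carrier := {x | ∀ᶠ Z in (U : Filter (Finset V)), x ∈ A Z}
      mul_mem' := fun ha hb => by
        filter_upwards [ha, hb] with Z h1 h2 using mul_mem h1 h2
      one_mem' := Filter.Eventually.of_forall fun Z => one_mem _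
      add_mem' := fun ha hb => by
        filter_upwards [ha, hb] with Z h1 h2 using add_mem h1 h2
      zero_mem' := Filter.Eventually.of_forall fun Z => zero_mem _
      neg_mem' := fun ha => by
        filter_upwards [ha] with Z h1 using neg_mem h1
      mem_or_inv_mem' := fun x => by
        change (∀ᶠ Z in (U : Filter (Finset V)), x ∈ A Z) ∨
          (∀ᶠ Z in (U : Filter (Finset V)), x⁻¹ ∈ A Z)
        rw [← Ultrafilter.eventually_or]
        exact Filter.Eventually.of_forall fun Z => (A Z).mem_or_inv_mem x }
  have hB : ∀ x, x ∈ B ↔ ∀ᶠ Z in (U : Filter (Finset V)), x ∈ A Z := fun x => Iff.rfl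
  refine ⟨B, fun x hx hxB => ?_, fun x hx => ?_⟩
  · obtain ⟨Z, hZ⟩ := ((hB x).1 hxB).exists
    exact hA Z x hx hZ
  · have hx0 : x ≠ 0 := by rintro rfl; simp at hx
    have h1 : x ∈ B := (B.valuation_le_one_iff _).1 hx.le
    have h2 : x⁻¹ ∈ B := (B.valuation_le_one_iff _).1 (by rw [map_inv₀, hx, inv_one])
    have h3 : ∀ᶠ Z in (U : Filter (Finset V)), q (Units.mk0 x hx0) ∈ Z :=
      hU (Filter.mem_atTop_sets.2 ⟨{q (Units.mk0 x hx0)}, fun Z hZ => hZ (by simp)⟩)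
    obtain ⟨Z, z1, z2, z3⟩ := (((hB x).1 h1).and (((hB _).1 h2).and h3)).exists
    rw [pull_mk0 hx0, ← hG' Z _ z3, ← pull_mk0 hx0]
    apply hA' Z
    refine le_antisymm (((A Z).valuation_le_one_iff _).2 z1) ?_
    have := ((A Z).valuation_le_one_iff _).2 z2
    rw [map_inv₀] at this
    exact (inv_le_one₀ (by simpa [zero_lt_iff] using hx0)).1 this

/-- Independence of a valuation ring of rank one and a valuation ring not contained in it. -/
lemma exists_unit_approx {A B : ValuationSubring L}
    (hA : ∀ z : L, 1 < A.valuation z → ∀ γ : L, ∃ n : ℕ, A.valuation γ < A.valuation z ^ n)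
    {b : L} (hbB : b ∈ B) (hbA : b ∉ A) {y : L} (hy : y ≠ 0) :
    ∃ u, B.valuation u = 1 ∧ A.valuation (u - y) < A.valuation y := by
  by_cases hB : ∀ x : L, x ≠ 0 → B.valuation x = 1
  · exact ⟨y, hB y hy, by simpa [zero_lt_iff] using hy⟩
  obtain ⟨m, hm0, hm⟩ : ∃ m : L, m ≠ 0 ∧ B.valuation m < 1 := by
    push Not at hB
    obtain ⟨x, hx0, hx⟩ := hB
    rcases hx.lt_or_gt with h | h
    · exact ⟨x, hx0, h⟩
    · exact ⟨x⁻¹, inv_ne_zero hx0, by rw [map_inv₀]; exact inv_lt_one_of_one_lt₀ h⟩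
  obtain ⟨d, hd0, hd, hd'⟩ : ∃ d : L, d ≠ 0 ∧ B.valuation d < 1 ∧ B.valuation (y * d) < 1 := by
    rcases le_total (B.valuation y) 1 with h | h
    · exact ⟨m, hm0, hm, by
        rw [map_mul]; exact mul_lt_one_of_nonneg_of_lt_one_right h zero_le hm⟩
    · refine ⟨m / y, div_ne_zero hm0 hy, ?_, by rwa [mul_div_cancel₀ _ hy]⟩
      rw [map_div₀]
      refine lt_of_le_of_lt ?_ hm
      exact div_le_of_le_mul₀ zero_le zero_le (le_mul_of_one_le_right zero_le h)
  have hb1 : 1 < A.valuation b := by rwa [← not_le, A.valuation_le_one_iff]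
  obtain ⟨n₁, hn₁⟩ := hA b hb1 ((1 - y) / y / d)
  obtain ⟨n₂, hn₂⟩ := hA b hb1 (1 / d)
  set n := max n₁ n₂
  set s := d * b ^ n with hs
  have hvd : 0 < A.valuation d := by simpa [zero_lt_iff] using hd0
  have hvy : 0 < A.valuation y := by simpa [zero_lt_iff] using hy
  have s1 : 1 < A.valuation s := by
    have := hn₂.trans_le (pow_le_pow_right₀ hb1.le (le_max_right n₁ n₂))
    rw [map_div₀, map_one, div_lt_iff₀ hvd] at this
    rw [hs, map_mul, map_pow, mul_comm]; exact this
  have s2 : A.valuation ((1 - y) / y) < A.valuation s := by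
    have := hn₁.trans_le (pow_le_pow_right₀ hb1.le (le_max_left n₁ n₂))
    rw [map_div₀, div_lt_iff₀ hvd] at this
    rw [hs, map_mul, map_pow, mul_comm]; exact this
  have hbn : B.valuation (b ^ n) ≤ 1 := (B.valuation_le_one_iff _).2 (pow_mem hbB n)
  have sB : B.valuation s < 1 := by
    rw [hs, map_mul]; exact mul_lt_one_of_nonneg_of_lt_one_left zero_le hd hbn
  have sB' : B.valuation (y * s) < 1 := by
    rw [hs, ← mul_assoc, map_mul]; exact mul_lt_one_of_nonneg_of_lt_one_left zero_le hd' hbn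
  have h1s : A.valuation (1 + s) = A.valuation s :=
    Valuation.map_add_eq_of_lt_right _ (by rwa [map_one])
  have h1s0 : 1 + s ≠ 0 := by
    intro h
    rw [h, map_zero] at h1s
    rw [← h1s] at s1
    simp at s1
  refine ⟨(1 + y * s) / (1 + s), by rw [map_div₀, val_one_add sB, val_one_add sB', div_one], ?_⟩
  have : (1 + y * s) / (1 + s) - y = (1 - y) / (1 + s) := by field_simp; ring
  rw [this, map_div₀, h1s, div_lt_iff₀ (zero_lt_one.trans s1)]
  rw [map_div₀, div_lt_iff₀ hvy] at s2
  rwa [mul_comm] at s2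

variable {e : V} {R : V → V → V → Prop} {A : ValuationSubring L} {H : Subgroup V} {ϖ : L}

lemma DVPair.archimedean (D : DVPair q A H ϖ) {z : L} (hz : 1 < A.valuation z) (γ : L) :
    ∃ n : ℕ, A.valuation γ < A.valuation z ^ n := by
  by_cases hγ : γ = 0
  · exact ⟨0, by simp [hγ]⟩
  have hz0 : z ≠ 0 := by rintro rfl; simp at hz
  obtain ⟨a, ha⟩ := D.exists_zpow z hz0
  obtain ⟨b, hb⟩ := D.exists_zpow γ hγ
  have ha0 : a < 0 := by
    by_contra h
    rw [ha] at hz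
    exact absurd hz (not_lt.2 (zpow_le_one₀ D.val_pos D.lt_one.le (not_lt.1 h)))
  refine ⟨b.natAbs + 1, ?_⟩
  rw [ha, hb, ← zpow_natCast, ← zpow_mul]
  apply zpow_lt_zpow_right_of_lt_one₀ D.val_pos D.lt_one
  push_cast
  have := neg_abs_le b
  nlinarith [abs_nonneg b]

/-- If `H'` specializes `H` and contains the units of a valuation ring not contained in `A`, then
`H'` is trivial. -/
lemma eq_top_of_not_le (I : Interp e R q) (D : DVPair q A H ϖ) {H' : Subgroup V}
    (hT : TT R H ≤ H') {B : ValuationSubring L} (hB : ∀ x, B.valuation x = 1 → Pull q H' x)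
    (hBA : ¬ B ≤ A) : H' = ⊤ := by
  obtain ⟨b, hbB, hbA⟩ := SetLike.not_le_iff_exists.1 hBA
  rw [eq_top_iff]
  intro v _
  obtain ⟨y, rfl⟩ := I.surj v
  obtain ⟨u, hu, hlt⟩ := exists_unit_approx (fun z hz γ => D.archimedean hz γ) hbB hbA y.ne_zero
  have h1 : Pull q (TT R H) (1 + (u - y) / y) := D.pull_TT_one_add I (by
    rw [map_div₀]
    exact (div_lt_one₀ (by simp [zero_lt_iff])).2 hlt)
  have hy := y.ne_zero
  have h2 : (y : L) = u / (1 + (u - y) / y) := by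
    have hu0 : u ≠ 0 := by rintro rfl; simp at hu
    have : 1 + (u - y) / y = u / y := by field_simp; ring
    rw [this]; field_simp
  rw [← pull_coe, h2]
  exact (hB u hu).div (h1.mono hT)

lemma Hor.exists_dvPair [CharZero L] (I : Interp e R q) (hL : IsCurve L) (hH : Hor e R H) :
    ∃ A ϖ, DVPair q A H ϖ ∧ Horiz A := by
  obtain ⟨A, ϖ, D, -, hA⟩ := I.exists_dvPair_of_good hL hH.good
  refine ⟨A, ϖ, D, hA.resolve_right ?_⟩
  rintro ⟨p, hp, hV⟩
  have h2 := (dy_iff_val_two_lt I D hH.good (Or.inr ⟨p, hp, hV⟩)).not.1 hH.not_dy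
  obtain ⟨H', hcl, hne, hT⟩ := hH.exists_cl
  obtain ⟨B, hB2, hB⟩ := hcl.exists_valuationSubring (q := q) {(2 : L)⁻¹} fun G hG => by
    obtain ⟨A', ϖ', D', -, hA'⟩ := I.exists_dvPair_of_good hL hG.good
    refine ⟨A', fun x hx => ?_, D'.unit_mem⟩
    obtain rfl : x = 2⁻¹ := hx
    rw [← A'.valuation_le_one_iff, map_inv₀, not_le]
    have := (dy_iff_val_two_lt I D' hG.good hA').1 hG
    exact (one_lt_inv₀ (by simp [zero_lt_iff])).2 this
  refine hne (eq_top_of_not_le I D hT hB fun hle => ?_)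
  have h2B : B.valuation ((2 : ℕ) : L) < 1 := by
    have := hB2 _ rfl
    rw [← B.valuation_le_one_iff, map_inv₀, not_le] at this
    push_cast
    exact (one_lt_inv₀ (by simp [zero_lt_iff])).1 this
  have hpB : B.valuation ((p : ℤ) : L) = 1 := val_int_eq_one Nat.prime_two h2B (fun h => by
    have h3 := (Nat.prime_dvd_prime_iff_eq Nat.prime_two hp.out).1 (by exact_mod_cast h)
    subst h3
    exact h2 (by exact_mod_cast hV.1))
  have hpA : ((p : ℤ) : L)⁻¹ ∈ A := hle ((B.valuation_le_one_iff _).1 (by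
    rw [map_inv₀, hpB, inv_one]))
  rw [← A.valuation_le_one_iff, map_inv₀] at hpA
  push_cast at hpA
  exact absurd hpA (not_le.2 ((one_lt_inv₀ (by simpa [zero_lt_iff] using hp.out.ne_zero)).2 hV.1))

end Limits

section Parity

open WithZero

variable {L V : Type*} [Field L] [CommGroup V] {e : V} {R : V → V → V → Prop} {q : Lˣ →* V}

/-- The subgroup of classes on which `d` is even. -/
def evenSub (q : Lˣ →* V) (d : Lˣ →* Multiplicative ℤ) : Subgroup V :=
  ((MonoidHom.range (powMonoidHom 2 : Multiplicative ℤ →* Multiplicative ℤ)).comap d).map q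

lemma mem_evenSub (I : Interp e R q) {d : Lˣ →* Multiplicative ℤ} {u : Lˣ} :
    q u ∈ evenSub q d ↔ Even (d u).toAdd := by
  have key : ∀ z : Multiplicative ℤ,
      z ∈ MonoidHom.range (powMonoidHom 2 : Multiplicative ℤ →* Multiplicative ℤ) ↔
        Even z.toAdd := fun z => by
    constructor
    · rintro ⟨y, rfl⟩
      exact ⟨y.toAdd, by simp [two_mul]⟩
    · rintro ⟨y, hy⟩
      exact ⟨Multiplicative.ofAdd y, by
        apply Multiplicative.toAdd.injective; simp [hy, two_mul]⟩
  constructor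
  · rintro ⟨v, hv, hvu⟩
    obtain ⟨s, hs⟩ := (I.ker (u * v⁻¹)).1 (by rw [map_mul, map_inv, hvu, mul_inv_cancel])
    have : u = v * s ^ 2 := by rw [← hs]; simp
    rw [this]
    have h := (key _).1 hv
    simp only [map_mul, map_pow, toAdd_mul, toAdd_pow]
    exact h.add (by simp)
  · intro h
    exact ⟨u, (key _).2 h, rfl⟩

/-- The additive form of a discrete valuation. -/
def valLog (w : Valuation L ℤᵐ⁰) : Lˣ →* Multiplicative ℤ where
  toFun u := Multiplicative.ofAdd (log (w u))
  map_one' := by simp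
  map_mul' u v := by
    rw [Units.val_mul, map_mul, log_mul (by simp) (by simp), ofAdd_add]

lemma pull_evenSub_valLog (I : Interp e R q) (w : Valuation L ℤᵐ⁰) {x : L} :
    Pull q (evenSub q (valLog w)) x ↔ x ≠ 0 ∧ Even (log (w x)) := by
  constructor
  · rintro ⟨u, rfl, hu⟩
    exact ⟨u.ne_zero, (mem_evenSub I).1 hu⟩
  · rintro ⟨h0, h⟩
    exact ⟨Units.mk0 x h0, rfl, (mem_evenSub I).2 h⟩

lemma exists_dvPair_of_odd (I : Interp e R q) (w : Valuation L ℤᵐ⁰) {f : L} (hf0 : f ≠ 0)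
    (hf : Odd (log (w f))) :
    ∃ ϖ, DVPair q w.valuationSubring (evenSub q (valLog w)) ϖ := by
  have hw := w.isEquiv_valuation_valuationSubring
  let G : AddSubgroup ℤ := (valLog w).range.toAddSubgroup'
  have hG : ∀ n, n ∈ G ↔ ∃ x, x ≠ 0 ∧ log (w x) = n := by
    intro n
    constructor
    · rintro ⟨u, hu⟩
      exact ⟨u, u.ne_zero, congrArg Multiplicative.toAdd hu⟩
    · rintro ⟨x, hx, rfl⟩
      exact ⟨Units.mk0 x hx, rfl⟩
  obtain ⟨m, hm⟩ := Int.subgroup_cyclic G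
  rw [← AddSubgroup.zmultiples_eq_closure] at hm
  have hm' : ∀ x : L, x ≠ 0 → ∃ k : ℤ, log (w x) = k * m := fun x hx => by
    have := (hG _).2 ⟨x, hx, rfl⟩
    rw [hm, AddSubgroup.mem_zmultiples_iff] at this
    obtain ⟨k, hk⟩ := this
    exact ⟨k, by simpa using hk.symm⟩
  have hodd : Odd m := by
    obtain ⟨k, hk⟩ := hm' f hf0
    rw [hk, Int.odd_mul] at hf
    exact hf.2
  have hmG : -|m| ∈ G := by
    rw [hm]
    rcases abs_choice m with h | h <;> rw [h] <;> simp
  obtain ⟨ϖ, hϖ0, hϖ⟩ := (hG _).1 hmG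
  have hlt : log (w ϖ) < 0 := by
    rw [hϖ]
    have : m ≠ 0 := by rintro rfl; simp at hodd
    simpa using this
  refine ⟨ϖ, hϖ0, ?_, ?_, ?_, ?_⟩
  · rw [← hw.lt_one_iff_lt_one, ← log_lt_log (by simpa using hϖ0) one_ne_zero]
    simpa using hlt
  · rw [pull_evenSub_valLog I, hϖ]
    rintro ⟨-, h⟩
    rw [even_neg, even_abs, ← Int.not_odd_iff_even] at h
    exact h hodd
  · intro x hx
    rw [← hw.eq_one_iff_eq_one] at hx
    rw [pull_evenSub_valLog I, hx]
    exact ⟨by rintro rfl; simp at hx, by simp⟩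
  · intro x hx
    obtain ⟨k, hk⟩ := hm' x hx
    have : ∃ n : ℤ, log (w x) = n * log (w ϖ) := by
      rw [hϖ]
      rcases abs_choice m with h | h <;> rw [h]
      · exact ⟨-k, by rw [hk]; ring⟩
      · exact ⟨k, by rw [hk]; ring⟩
    obtain ⟨n, hn⟩ := this
    refine ⟨n, ?_⟩
    rw [← map_zpow₀, ← hw.eq_iff, map_zpow₀]
    have h1 : w x ≠ 0 := by simpa using hx
    have h2 : w ϖ ^ n ≠ 0 := zpow_ne_zero _ (by simpa using hϖ0)
    rw [← exp_log h1, ← exp_log h2, hn, log_zpow, smul_eq_mul]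

end Parity

section Gauss

open WithZero

variable {F : Type*} [Field F] (v : Valuation F ℤᵐ⁰)

/-- The maximal value of a coefficient. -/
noncomputable def gaussSup (P : Polynomial F) : ℤᵐ⁰ := P.support.sup fun i => v (P.coeff i)

variable {v}

lemma le_gaussSup (P : Polynomial F) (i : ℕ) : v (P.coeff i) ≤ gaussSup v P := by
  by_cases h : P.coeff i = 0
  · simp [h]
  · exact Finset.le_sup (f := fun i => v (P.coeff i)) (Polynomial.mem_support_iff.2 h)

lemma gaussSup_le_iff {P : Polynomial F} {a : ℤᵐ⁰} : gaussSup v P ≤ a ↔ ∀ i, v (P.coeff i) ≤ a :=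
  ⟨fun h i => (le_gaussSup P i).trans h, fun h => Finset.sup_le fun i _ => h i⟩

lemma gaussSup_lt_iff {P : Polynomial F} {a : ℤᵐ⁰} (ha : 0 < a) :
    gaussSup v P < a ↔ ∀ i, v (P.coeff i) < a :=
  ⟨fun h i => (le_gaussSup P i).trans_lt h, fun h =>
    (Finset.sup_lt_iff (by simpa using ha)).2 fun i _ => h i⟩

lemma gaussSup_C_mul (a : F) (P : Polynomial F) :
    gaussSup v (Polynomial.C a * P) = v a * gaussSup v P := by
  have key : ∀ (a : F) (P : Polynomial F),
      gaussSup v (Polynomial.C a * P) ≤ v a * gaussSup v P := fun a P => by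
    rw [gaussSup_le_iff]
    intro i
    rw [Polynomial.coeff_C_mul, map_mul]
    exact mul_le_mul_right (le_gaussSup P i) _
  by_cases ha : a = 0
  · simp [ha, gaussSup]
  refine le_antisymm (key a P) ?_
  have h := key a⁻¹ (Polynomial.C a * P)
  rw [← mul_assoc, ← map_mul, inv_mul_cancel₀ ha, map_one, one_mul, map_inv₀] at h
  have hva : v a ≠ 0 := by simpa using ha
  calc v a * gaussSup v P ≤ v a * ((v a)⁻¹ * _) := mul_le_mul_right h _
    _ = _ := by rw [mul_inv_cancel_left₀ hva]

lemma exists_gaussSup_eq {P : Polynomial F} (hP : P ≠ 0) :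
    ∃ a Q, a ≠ 0 ∧ P = Polynomial.C a * Q ∧ gaussSup v Q = 1 := by
  have hs : P.support.Nonempty := Polynomial.support_nonempty.2 hP
  obtain ⟨i, hi, h⟩ := P.support.exists_mem_eq_sup hs fun i => v (P.coeff i)
  have ha : P.coeff i ≠ 0 := Polynomial.mem_support_iff.1 hi
  refine ⟨P.coeff i, Polynomial.C (P.coeff i)⁻¹ * P, ha, ?_, ?_⟩
  · rw [← mul_assoc, ← map_mul, mul_inv_cancel₀ ha, map_one, one_mul]
  · rw [gaussSup_C_mul, gaussSup, h, map_inv₀, inv_mul_cancel₀ (by simpa using ha)]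

/-- The reduction map on polynomials with integral coefficients. -/
noncomputable def redPoly (v : Valuation F ℤᵐ⁰) :
    Polynomial v.valuationSubring →+* Polynomial (IsLocalRing.ResidueField v.valuationSubring) :=
  Polynomial.mapRingHom (IsLocalRing.residue _)

lemma exists_lift_of_gaussSup_le {P : Polynomial F} (hP : gaussSup v P ≤ 1) :
    ∃ P₀ : Polynomial v.valuationSubring, P₀.map (algebraMap v.valuationSubring F) = P := by
  rw [← Polynomial.mem_lifts, Polynomial.lifts_iff_coeff_lifts]
  exact fun i => ⟨⟨P.coeff i, gaussSup_le_iff.1 hP i⟩, rfl⟩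

lemma gaussSup_map_le (P : Polynomial v.valuationSubring) :
    gaussSup v (P.map (algebraMap v.valuationSubring F)) ≤ 1 := by
  rw [gaussSup_le_iff]
  intro i
  rw [Polynomial.coeff_map]
  exact (P.coeff i).2

lemma gaussSup_map_lt_iff (P : Polynomial v.valuationSubring) :
    gaussSup v (P.map (algebraMap v.valuationSubring F)) < 1 ↔ redPoly v P = 0 := by
  rw [gaussSup_lt_iff zero_lt_one, Polynomial.ext_iff]
  refine forall_congr' fun i => ?_
  rw [Polynomial.coeff_map, redPoly, Polynomial.coe_mapRingHom, Polynomial.coeff_map,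
    Polynomial.coeff_zero, IsLocalRing.residue_eq_zero_iff]
  rw [v.isEquiv_valuation_valuationSubring.lt_one_iff_lt_one]
  exact (v.valuationSubring.valuation_lt_one_iff _).symm

lemma gaussSup_map_eq_one_iff (P : Polynomial v.valuationSubring) :
    gaussSup v (P.map (algebraMap v.valuationSubring F)) = 1 ↔ redPoly v P ≠ 0 := by
  rw [Ne, ← gaussSup_map_lt_iff, not_lt]
  exact ⟨fun h => h.ge, fun h => le_antisymm (gaussSup_map_le P) h⟩

lemma gaussSup_mul (P Q : Polynomial F) : gaussSup v (P * Q) = gaussSup v P * gaussSup v Q := by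
  by_cases hP : P = 0
  · simp [hP, gaussSup]
  by_cases hQ : Q = 0
  · simp [hQ, gaussSup]
  obtain ⟨a, P, -, rfl, hP1⟩ := exists_gaussSup_eq (v := v) hP
  obtain ⟨b, Q, -, rfl, hQ1⟩ := exists_gaussSup_eq (v := v) hQ
  have : Polynomial.C a * P * (Polynomial.C b * Q) = Polynomial.C (a * b) * (P * Q) := by
    rw [map_mul]; ring
  rw [this, gaussSup_C_mul, gaussSup_C_mul, gaussSup_C_mul, map_mul, hP1, hQ1, mul_one, mul_one]
  suffices gaussSup v (P * Q) = 1 by rw [this, mul_one]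
  obtain ⟨P, rfl⟩ := exists_lift_of_gaussSup_le hP1.le
  obtain ⟨Q, rfl⟩ := exists_lift_of_gaussSup_le hQ1.le
  rw [gaussSup_map_eq_one_iff] at hP1 hQ1
  rw [← Polynomial.map_mul, gaussSup_map_eq_one_iff, map_mul]
  exact mul_ne_zero hP1 hQ1

variable (v) in
/-- The Gauss valuation on polynomials. -/
noncomputable def gaussVal : Valuation (Polynomial F) ℤᵐ⁰ where
  toFun := gaussSup v
  map_zero' := by simp [gaussSup]
  map_one' := by
    rw [← map_one Polynomial.C, ← mul_one (Polynomial.C (1 : F)), gaussSup_C_mul, map_one, one_mul]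
    refine le_antisymm (gaussSup_le_iff.2 fun i => ?_) ?_
    · rw [Polynomial.coeff_one]; split_ifs <;> simp
    · simpa using le_gaussSup (v := v) (1 : Polynomial F) 0
  map_mul' := gaussSup_mul
  map_add_le_max' P Q := by
    rw [gaussSup_le_iff]
    intro i
    rw [Polynomial.coeff_add]
    exact (v.map_add _ _).trans (max_le_max (le_gaussSup P i) (le_gaussSup Q i))

variable (v) in
/-- The Gauss valuation for which `X` has the same value as `c`. -/
noncomputable def gaussRat (c : F) (hc : c ≠ 0) : Valuation (RatFunc F) ℤᵐ⁰ :=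
  Valuation.extendToLocalization
    ((gaussVal v).comap (Polynomial.compRingHom (Polynomial.C c * Polynomial.X)))
    (S := nonZeroDivisors (Polynomial F)) (fun P hP h => by
      have hP0 := nonZeroDivisors.ne_zero hP
      have h : gaussSup v (P.comp (Polynomial.C c * Polynomial.X)) = 0 := h
      obtain ⟨i, hi⟩ : ∃ i, P.coeff i ≠ 0 := by
        by_contra h
        push Not at h
        exact hP0 (Polynomial.ext fun i => by simp [h i])
      have := le_gaussSup (v := v) (P.comp (Polynomial.C c * Polynomial.X)) i
      rw [h, Polynomial.comp_C_mul_X_coeff] at this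
      exact mul_ne_zero hi (pow_ne_zero _ hc) (by simpa using this)) (RatFunc F)

variable {c : F} {hc : c ≠ 0}

lemma gaussRat_poly (P : Polynomial F) : gaussRat v c hc (algebraMap _ _ P) =
    gaussSup v (P.comp (Polynomial.C c * Polynomial.X)) :=
  Valuation.extendToLocalization_apply_map_apply _ _ _ _

lemma gaussRat_C (a : F) : gaussRat v c hc (RatFunc.C a) = v a := by
  rw [← RatFunc.algebraMap_C, gaussRat_poly, Polynomial.C_comp, ← mul_one (Polynomial.C a),
    gaussSup_C_mul]
  have : gaussSup v (1 : Polynomial F) = 1 := (gaussVal v).map_one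
  rw [this, mul_one]

lemma gaussRat_X : gaussRat v c hc RatFunc.X = v c := by
  rw [← RatFunc.algebraMap_X, gaussRat_poly, Polynomial.X_comp, gaussSup_C_mul]
  have h : gaussSup v (Polynomial.X : Polynomial F) = 1 := by
    refine le_antisymm (gaussSup_le_iff.2 fun i => ?_) ?_
    · rw [Polynomial.coeff_X]; split_ifs <;> simp
    · simpa using le_gaussSup (v := v) (Polynomial.X : Polynomial F) 1
  rw [h, mul_one]

end Gauss

section Leading

open WithZero Filter

variable {F : Type*} [Field F]

/-- The order valuation at `X = 0`. -/
noncomputable abbrev ordX (F : Type*) [Field F] : Valuation (RatFunc F) ℤᵐ⁰ :=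
  (Polynomial.idealX F).valuation (RatFunc F)

lemma ordX_X : ordX F RatFunc.X = exp (-1) := Polynomial.valuation_X_eq_neg_one F

lemma ordX_poly_le (P : Polynomial F) : ordX F (algebraMap _ _ P) ≤ 1 :=
  (Polynomial.idealX F).valuation_le_one P

lemma ordX_C {a : F} (ha : a ≠ 0) : ordX F (RatFunc.C a) = 1 := by
  refine le_antisymm (by rw [← RatFunc.algebraMap_C]; exact ordX_poly_le _) ?_
  have h := ordX_poly_le (Polynomial.C a⁻¹)
  rw [RatFunc.algebraMap_C, map_inv₀, map_inv₀] at h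
  exact (inv_le_one₀ (by simpa [zero_lt_iff] using ha)).1 h

variable (v : Valuation F ℤᵐ⁰) {π : F} (hπ0 : π ≠ 0)

/-- Elements which are small at `X = 0` and for the Gauss valuations close to it. -/
def NearZero (m : RatFunc F) : Prop :=
  ordX F m < 1 ∧ ∀ᶠ N : ℕ in atTop, gaussRat v (π ^ N) (pow_ne_zero N hπ0) m < 1

variable {v hπ0}

lemma NearZero.neg {m : RatFunc F} (h : NearZero v hπ0 m) : NearZero v hπ0 (-m) := by
  simpa [NearZero, Valuation.map_neg] using h

lemma NearZero.add {m m' : RatFunc F} (h : NearZero v hπ0 m) (h' : NearZero v hπ0 m') :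
    NearZero v hπ0 (m + m') :=
  ⟨Valuation.map_add_lt _ h.1 h'.1, by
    filter_upwards [h.2, h'.2] with N h1 h2 using Valuation.map_add_lt _ h1 h2⟩

lemma NearZero.div_one_add {m m' : RatFunc F} (h : NearZero v hπ0 m) (h' : NearZero v hπ0 m') :
    NearZero v hπ0 (m / (1 + m')) :=
  ⟨by rw [map_div₀, Valuation.map_one_add_of_lt _ h'.1, div_one]; exact h.1, by
    filter_upwards [h.2, h'.2] with N h1 h2
    rw [map_div₀, Valuation.map_one_add_of_lt _ h2, div_one]; exact h1⟩

lemma NearZero.one_add_ne_zero {m : RatFunc F} (h : NearZero v hπ0 m) : 1 + m ≠ 0 := by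
  intro h0
  have := Valuation.map_one_add_of_lt _ h.1
  rw [h0, map_zero] at this
  exact zero_ne_one this

variable (hπ0) in
include hπ0 in
lemma eventually_mul_pow_lt_one (hπ : v π < 1) (a : ℤᵐ⁰) : ∀ᶠ N : ℕ in atTop, a * v π ^ N < 1 := by
  by_cases ha : a = 0
  · simp [ha]
  have hvπ : v π ≠ 0 := by simpa using hπ0
  filter_upwards [eventually_gt_atTop (log a).natAbs] with N hN
  rw [← log_lt_log (mul_ne_zero ha (pow_ne_zero _ hvπ)) one_ne_zero,
    log_mul ha (pow_ne_zero _ hvπ), log_pow, log_one]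
  have h1 : log (v π) < 0 := by
    rw [← log_one (M := ℤ), log_lt_log hvπ one_ne_zero]; exact hπ
  have h2 : log a < N := by omega
  rw [nsmul_eq_mul]
  nlinarith

lemma small_X_mul (hπ : v π < 1) (Q : Polynomial F) :
    NearZero v hπ0 (algebraMap (Polynomial F) (RatFunc F) (Polynomial.X * Q)) := by
  constructor
  · rw [map_mul, map_mul, RatFunc.algebraMap_X, ordX_X]
    exact mul_lt_one_of_nonneg_of_lt_one_left zero_le (by rw [← exp_zero, exp_lt_exp]; simp)
      (ordX_poly_le Q)
  · have : ∀ᶠ N : ℕ in atTop, ∀ i ∈ Q.support, v (Q.coeff i) * v π ^ N < 1 :=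
      (Finset.eventually_all _).2 fun i _ => eventually_mul_pow_lt_one hπ0 hπ _
    filter_upwards [this] with N hN
    rw [gaussRat_poly, gaussSup_lt_iff zero_lt_one]
    intro i
    rw [Polynomial.comp_C_mul_X_coeff]
    cases i with
    | zero => simp
    | succ i =>
      rw [Polynomial.coeff_X_mul]
      by_cases hi : Q.coeff i = 0
      · simp [hi]
      have h1 := hN i (Polynomial.mem_support_iff.2 hi)
      rw [map_mul, map_pow, map_pow, pow_succ, mul_comm (_ ^ i), ← mul_assoc]
      exact mul_lt_one_of_nonneg_of_lt_one_left zero_le h1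
        (pow_le_one₀ zero_le (pow_le_one₀ zero_le hπ.le))

variable (hπ0) in
lemma exists_leading_poly (hπ : v π < 1) {P : Polynomial F} (hP : P ≠ 0) :
    ∃ (c : F) (n : ℤ) (m : RatFunc F), c ≠ 0 ∧ NearZero v hπ0 m ∧
      algebraMap _ _ P = RatFunc.C c * RatFunc.X ^ n * (1 + m) := by
  obtain ⟨Q, hQ, hd⟩ := Polynomial.exists_eq_pow_rootMultiplicity_mul_and_not_dvd P hP 0
  rw [map_zero, sub_zero] at hQ hd
  rw [Polynomial.X_dvd_iff] at hd
  set c := Q.coeff 0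
  refine ⟨c, (P.rootMultiplicity 0 : ℕ), _, hd,
    small_X_mul hπ (Polynomial.C c⁻¹ * Q.divX), ?_⟩
  have hQ' : Q = Polynomial.C c * (1 + Polynomial.X * (Polynomial.C c⁻¹ * Q.divX)) := by
    conv_lhs => rw [← Polynomial.divX_mul_X_add Q]
    have : Polynomial.C c * Polynomial.C c⁻¹ = 1 := by
      rw [← map_mul, mul_inv_cancel₀ hd, map_one]
    linear_combination (-Polynomial.X * Q.divX) * this
  rw [zpow_natCast, ← RatFunc.algebraMap_X, ← RatFunc.algebraMap_C, ← map_pow, ← map_mul,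
    ← map_one (algebraMap (Polynomial F) (RatFunc F)), ← map_add, ← map_mul]
  congr 1
  rw [mul_comm (Polynomial.C c), mul_assoc, ← hQ']
  exact hQ

variable (hπ0) in
lemma exists_leading (hπ : v π < 1) {g : RatFunc F} (hg : g ≠ 0) :
    ∃ (c : F) (n : ℤ) (m : RatFunc F), c ≠ 0 ∧ NearZero v hπ0 m ∧
      g = RatFunc.C c * RatFunc.X ^ n * (1 + m) := by
  induction g using RatFunc.induction_on with
  | f P Q hQ =>
    have hP : P ≠ 0 := by rintro rfl; simp at hg
    obtain ⟨c, n, m, hc, hm, hP'⟩ := exists_leading_poly hπ0 hπ hP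
    obtain ⟨c', n', m', hc', hm', hQ'⟩ := exists_leading_poly hπ0 hπ hQ
    have h1 := hm.one_add_ne_zero
    have h2 := hm'.one_add_ne_zero
    have h3 : (RatFunc.C c' : RatFunc F) ≠ 0 := by simpa using hc'
    refine ⟨c / c', n - n', (m + -m') / (1 + m'), div_ne_zero hc hc',
      (hm.add hm'.neg).div_one_add hm', ?_⟩
    rw [hP', hQ', map_div₀, zpow_sub₀ RatFunc.X_ne_zero]
    field_simp
    ring

end Leading

section GoodCriteria

variable {L V : Type*} [Field L] [CommGroup V] {e : V} {R : V → V → V → Prop}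
  {q : Lˣ →* V} {H : Subgroup V} {A : ValuationSubring L} {ϖ : L}

lemma nonSq_of_not_isSquare {x : L} (hx : x ∈ A)
    (h1 : ¬ IsSquare (IsLocalRing.residue A ⟨x, hx⟩))
    (h2 : ¬ IsSquare (-IsLocalRing.residue A ⟨x, hx⟩)) : NonSq A x := by
  intro s
  have key : ∀ y : L, y ∈ A → A.valuation (y - s ^ 2) < 1 → s ∈ A := by
    intro y hy h
    have h3 : s ^ 2 ∈ A := by
      have := sub_mem hy ((A.valuation_le_one_iff _).1 h.le)
      simpa using this
    rw [← A.valuation_le_one_iff, map_pow] at h3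
    rw [← A.valuation_le_one_iff]
    exact (pow_le_one_iff_of_nonneg zero_le two_ne_zero).1 h3
  constructor
  · intro h
    have hs := key x hx h
    apply h1
    refine ⟨IsLocalRing.residue A ⟨s, hs⟩, ?_⟩
    rw [← map_mul, ← sub_eq_zero, ← map_sub]
    refine (residue_eq_zero_iff (A := A) (sub_mem hx (mul_mem hs hs))).2 ?_
    rwa [← sq]
  · intro h
    have h' : A.valuation (-x - s ^ 2) < 1 := by
      rw [← Valuation.map_neg]; simpa [add_comm] using h
    have hs := key (-x) (neg_mem hx) h'
    apply h2
    refine ⟨IsLocalRing.residue A ⟨s, hs⟩, ?_⟩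
    rw [← map_mul, ← map_neg, ← sub_eq_zero, ← map_sub]
    refine (residue_eq_zero_iff (A := A) (sub_mem (neg_mem hx) (mul_mem hs hs))).2 ?_
    rwa [← sq]

lemma DVPair.good_of_residue (I : Interp e R q) (D : DVPair q A H ϖ)
    {y : IsLocalRing.ResidueField A} (h0 : ¬ IsSquare y) (h0' : ¬ IsSquare (-y))
    (h1 : ¬ IsSquare (1 + y)) (h1' : ¬ IsSquare (-(1 + y)))
    (h2 : ¬ IsSquare (y * (1 + y))) (h2' : ¬ IsSquare (-(y * (1 + y)))) : Good e R H := by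
  obtain ⟨⟨x, hx⟩, rfl⟩ := IsLocalRing.residue_surjective y
  have hy0 : IsLocalRing.residue A ⟨x, hx⟩ ≠ 0 := by intro h; rw [h] at h0; simp at h0
  have e1 : IsLocalRing.residue A ⟨1 + x, add_mem (one_mem A) hx⟩ =
      1 + IsLocalRing.residue A ⟨x, hx⟩ :=
    (map_add (IsLocalRing.residue A) 1 ⟨x, hx⟩).trans (by rw [map_one])
  have e2 : IsLocalRing.residue A ⟨x * (1 + x), mul_mem hx (add_mem (one_mem A) hx)⟩ =
      IsLocalRing.residue A ⟨x, hx⟩ * (1 + IsLocalRing.residue A ⟨x, hx⟩) :=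
    (map_mul (IsLocalRing.residue A) ⟨x, hx⟩ ⟨1 + x, _⟩).trans (by rw [e1])
  have hy1 : IsLocalRing.residue A ⟨1 + x, add_mem (one_mem A) hx⟩ ≠ 0 := by
    rw [e1]; intro h; rw [h] at h1; simp at h1
  exact D.good I ((residue_ne_zero_iff hx).1 hy0) ((residue_ne_zero_iff _).1 hy1)
    (nonSq_of_not_isSquare hx h0 h0')
    (nonSq_of_not_isSquare (add_mem (one_mem A) hx) (by rwa [e1]) (by rwa [e1]))
    (nonSq_of_not_isSquare (mul_mem hx (add_mem (one_mem A) hx)) (by rwa [e2]) (by rwa [e2]))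

lemma DVPair.dy_of_transcendental [CharZero L] (I : Interp e R q) (D : DVPair q A H ϖ)
    (hL : IsCurve L) (h2 : A.valuation ((2 : ℕ) : L) < 1) {t : L} (ht : t ∈ A)
    (htr : ∀ P : Polynomial ℤ, P.map (Int.castRingHom (ZMod 2)) ≠ 0 →
      A.valuation (Polynomial.aeval t P) = 1) : Dy e R H := by
  have : Fact (Nat.Prime 2) := ⟨Nat.prime_two⟩
  have hch : CharP (IsLocalRing.ResidueField A) 2 := charP_residue Nat.prime_two h2
  let alg : Algebra (ZMod 2) (IsLocalRing.ResidueField A) := ZMod.algebra _ 2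
  have htr' : Transcendental (ZMod 2) (IsLocalRing.residue A ⟨t, ht⟩) := by
    rw [transcendental_iff]
    intro P hP
    by_contra h
    obtain ⟨P, rfl⟩ := Polynomial.map_surjective (Int.castRingHom (ZMod 2))
      ZMod.intCast_surjective P
    have h3 := htr P h
    have h4 : Polynomial.aeval t P ∈ A := (A.valuation_le_one_iff _).1 h3.le
    refine (residue_ne_zero_iff h4).2 h3 ?_
    rw [← hP]
    have e1 : (⟨Polynomial.aeval t P, h4⟩ : A) = Polynomial.aeval (⟨t, ht⟩ : A) P := by
      apply Subtype.ext
      have := Polynomial.aeval_algebraMap_apply L (⟨t, ht⟩ : A) P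
      exact this
    rw [e1, Polynomial.aeval_def, Polynomial.hom_eval₂, Polynomial.aeval_def, Polynomial.eval₂_map]
    congr 1
    exact RingHom.ext_int _ _
  have hfin := (vertical h2 ht htr' hL).2
  obtain ⟨hu, y, hy⟩ := quadUniversal_of_finite_adjoin htr'
  have hneg : ∀ z : IsLocalRing.ResidueField A, -z = z := fun z => CharTwo.neg_eq z
  have h20 : (2 : IsLocalRing.ResidueField A) = 0 := CharTwo.two_eq_zero
  have hy1 : ¬ IsSquare (1 + y) := by
    rintro ⟨s, hs⟩
    refine hy ⟨s + 1, ?_⟩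
    rw [CharTwo.add_mul_self, ← hs]
    linear_combination -h20
  have hy2 : ¬ IsSquare (y * (1 + y)) := by
    rintro ⟨s, hs⟩
    refine hy ⟨s + y, ?_⟩
    rw [CharTwo.add_mul_self, ← hs]
    linear_combination (-y ^ 2) * h20
  have hg : Good e R H := D.good_of_residue I hy (by rwa [hneg]) hy1 (by rwa [hneg]) hy2
    (by rwa [hneg])
  exact (dy_iff I D hg).2 hu

end GoodCriteria

section GaussNonSq

open WithZero

variable {F : Type*} [Field F] {v : Valuation F ℤᵐ⁰}

lemma not_gaussSup_lt {U : Polynomial v.valuationSubring}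
    (hU : ∀ P Q, Q ≠ 0 → redPoly v U * Q ^ 2 ≠ P ^ 2) {P Q : Polynomial F} (hQ : Q ≠ 0) :
    ¬ gaussSup v (U.map (algebraMap v.valuationSubring F) * Q ^ 2 - P ^ 2) < gaussSup v Q ^ 2 := by
  intro h
  obtain ⟨a, Q, ha, rfl, hQ1⟩ := exists_gaussSup_eq (v := v) hQ
  obtain ⟨P, rfl⟩ : ∃ P', P = Polynomial.C a * P' :=
    ⟨Polynomial.C a⁻¹ * P, by
      rw [← mul_assoc, ← map_mul, mul_inv_cancel₀ ha, map_one, one_mul]⟩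
  have hva : 0 < v a ^ 2 := by
    have : v a ≠ 0 := by simpa using ha
    exact pow_pos (zero_lt_iff.2 this) 2
  have e1 : U.map (algebraMap v.valuationSubring F) * (Polynomial.C a * Q) ^ 2 -
      (Polynomial.C a * P) ^ 2 =
      Polynomial.C (a ^ 2) * (U.map (algebraMap v.valuationSubring F) * Q ^ 2 - P ^ 2) := by
    rw [map_pow]; ring
  rw [e1, gaussSup_C_mul, gaussSup_C_mul, hQ1, mul_one, map_pow] at h
  have h1 : gaussSup v (U.map (algebraMap v.valuationSubring F) * Q ^ 2 - P ^ 2) < 1 := by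
    by_contra h'
    exact absurd h (not_lt.2 (le_mul_of_one_le_right zero_le (not_lt.1 h')))
  have hP1 : gaussSup v P ≤ 1 := by
    have h2 : gaussVal v (P ^ 2) ≤ 1 := by
      have e2 : P ^ 2 = U.map (algebraMap v.valuationSubring F) * Q ^ 2 -
        (U.map (algebraMap v.valuationSubring F) * Q ^ 2 - P ^ 2) := by ring
      rw [e2]
      refine Valuation.map_sub_le (v := gaussVal v) ?_ (le_of_lt (show gaussVal v _ < 1 from h1))
      rw [map_mul, map_pow]
      have : gaussVal v Q = 1 := hQ1
      rw [this, one_pow, mul_one]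
      exact gaussSup_map_le U
    rw [map_pow] at h2
    exact (pow_le_one_iff_of_nonneg zero_le two_ne_zero).1 h2
  obtain ⟨P, rfl⟩ := exists_lift_of_gaussSup_le hP1
  obtain ⟨Q, rfl⟩ := exists_lift_of_gaussSup_le hQ1.le
  rw [gaussSup_map_eq_one_iff] at hQ1
  rw [← Polynomial.map_pow, ← Polynomial.map_pow, ← Polynomial.map_mul, ← Polynomial.map_sub,
    gaussSup_map_lt_iff, map_sub, map_mul, map_pow, map_pow, sub_eq_zero] at h1
  exact hU _ _ hQ1 h1

/-- Nonsquares for the Gauss valuation. -/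
lemma not_gaussRat_lt {U : Polynomial v.valuationSubring}
    (hU : ∀ P Q, Q ≠ 0 → redPoly v U * Q ^ 2 ≠ P ^ 2) {c : F} (hc : c ≠ 0) (g : RatFunc F) :
    ¬ gaussRat v c hc (Polynomial.eval₂ (RatFunc.C.comp (algebraMap v.valuationSubring F))
      (RatFunc.X / RatFunc.C c) U - g ^ 2) < 1 := by
  induction g using RatFunc.induction_on with
  | f P Q hQ =>
    intro h
    set φ : Polynomial F →+* Polynomial F :=
      Polynomial.compRingHom (Polynomial.C c⁻¹ * Polynomial.X) with hφ
    have hcomp : ∀ P : Polynomial F, (φ P).comp (Polynomial.C c * Polynomial.X) = P := fun P => by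
      rw [hφ, Polynomial.coe_compRingHom_apply, Polynomial.comp_assoc]
      simp [← mul_assoc, ← Polynomial.C_mul, inv_mul_cancel₀ hc]
    have hUe : Polynomial.eval₂ (RatFunc.C.comp (algebraMap v.valuationSubring F))
      (RatFunc.X / RatFunc.C c) U =
        algebraMap _ (RatFunc F) (φ (U.map (algebraMap v.valuationSubring F))) := by
      rw [hφ, Polynomial.coe_compRingHom_apply, Polynomial.comp, Polynomial.eval₂_map,
        Polynomial.hom_eval₂]
      congr 1
      rw [map_mul, RatFunc.algebraMap_X, RatFunc.algebraMap_C, map_inv₀, div_eq_mul_inv, mul_comm]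
    have hQ' : algebraMap (Polynomial F) (RatFunc F) Q ≠ 0 := by simpa using hQ
    have e1 : algebraMap _ (RatFunc F) (φ (U.map (algebraMap v.valuationSubring F))) -
        (algebraMap _ (RatFunc F) P / algebraMap _ (RatFunc F) Q) ^ 2 =
        algebraMap _ (RatFunc F) (φ (U.map (algebraMap v.valuationSubring F)) * Q ^ 2 - P ^ 2) /
          algebraMap _ (RatFunc F) (Q ^ 2) := by
      rw [map_sub, map_mul, map_pow, map_pow]
      field_simp
    rw [hUe, e1, map_div₀, div_lt_one₀ (by simpa [zero_lt_iff] using hQ), gaussRat_poly,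
      gaussRat_poly, Polynomial.sub_comp, Polynomial.mul_comp, Polynomial.pow_comp,
      Polynomial.pow_comp, hcomp] at h
    have hQc : Q.comp (Polynomial.C c * Polynomial.X) ≠ 0 := by
      intro h0
      have := gaussRat_poly (v := v) (hc := hc) Q
      rw [h0] at this
      have h2 : gaussRat v c hc (algebraMap _ _ Q) = 0 := by rw [this]; simp [gaussSup]
      exact hQ' (by simpa using h2)
    have e3 : gaussSup v (Q.comp (Polynomial.C c * Polynomial.X) ^ 2) =
        gaussSup v (Q.comp (Polynomial.C c * Polynomial.X)) ^ 2 := (gaussVal v).map_pow _ 2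
    rw [e3] at h
    exact not_gaussSup_lt hU hQc h

lemma mul_sq_ne_sq_of_odd_natDegree {k : Type*} [Field k] {U P Q : Polynomial k}
    (hU : Odd U.natDegree) (hQ : Q ≠ 0) : U * Q ^ 2 ≠ P ^ 2 := by
  intro h
  have hU0 : U ≠ 0 := by rintro rfl; simp at hU
  have := congrArg Polynomial.natDegree h
  rw [Polynomial.natDegree_mul hU0 (pow_ne_zero _ hQ), Polynomial.natDegree_pow,
    Polynomial.natDegree_pow] at this
  obtain ⟨r, hr⟩ := hU
  omega

lemma mul_sq_ne_sq_of_odd_natTrailingDegree {k : Type*} [Field k] {U P Q : Polynomial k}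
    (hU : Odd U.natTrailingDegree) (hQ : Q ≠ 0) : U * Q ^ 2 ≠ P ^ 2 := by
  intro h
  have hU0 : U ≠ 0 := by rintro rfl; simp at hU
  have hP0 : P ≠ 0 := by
    rintro rfl
    rw [zero_pow two_ne_zero] at h
    exact mul_ne_zero hU0 (pow_ne_zero _ hQ) h
  have := congrArg Polynomial.natTrailingDegree h
  rw [sq, sq, Polynomial.natTrailingDegree_mul hU0 (mul_ne_zero hQ hQ),
    Polynomial.natTrailingDegree_mul hQ hQ, Polynomial.natTrailingDegree_mul hP0 hP0] at this
  obtain ⟨r, hr⟩ := hU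
  omega

end GaussNonSq

section Leading

open WithZero Filter

variable {F : Type*} [Field F]

/-- `g` has leading term `c * X ^ n` at `X = 0`. -/
def IsLead (g : RatFunc F) (c : F) (n : ℤ) : Prop :=
  c ≠ 0 ∧ ∃ m, ordX F m < 1 ∧ g = RatFunc.C c * RatFunc.X ^ n * (1 + m)

lemma IsLead.ordX_eq {g : RatFunc F} {c : F} {n : ℤ} (h : IsLead g c n) :
    ordX F g = exp (-n) := by
  obtain ⟨hc, m, hm, rfl⟩ := h
  rw [map_mul, map_mul, map_zpow₀, ordX_C hc, ordX_X, Valuation.map_one_add_of_lt _ hm, one_mul,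
    mul_one, ← exp_zsmul]
  simp

lemma IsLead.mul {g g' : RatFunc F} {c c' : F} {n n' : ℤ} (h : IsLead g c n)
    (h' : IsLead g' c' n') : IsLead (g * g') (c * c') (n + n') := by
  obtain ⟨hc, m, hm, rfl⟩ := h
  obtain ⟨hc', m', hm', rfl⟩ := h'
  refine ⟨mul_ne_zero hc hc', m + m' + m * m',
    Valuation.map_add_lt _ (Valuation.map_add_lt _ hm hm') ?_, ?_⟩
  · rw [map_mul]; exact mul_lt_one_of_nonneg_of_lt_one_left zero_le hm hm'.le
  · rw [zpow_add₀ RatFunc.X_ne_zero, map_mul]; ring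

lemma IsLead.unique {g : RatFunc F} {c c' : F} {n n' : ℤ} (h : IsLead g c n)
    (h' : IsLead g c' n') : c = c' ∧ n = n' := by
  have hn : n = n' := by
    have := h.ordX_eq.symm.trans h'.ordX_eq
    rw [exp_inj] at this
    omega
  subst hn
  refine ⟨?_, rfl⟩
  obtain ⟨hc, m, hm, rfl⟩ := h
  obtain ⟨hc', m', hm', he⟩ := h'
  have hX : (RatFunc.X : RatFunc F) ^ n ≠ 0 := zpow_ne_zero _ RatFunc.X_ne_zero
  have e1 : RatFunc.C (c - c') = RatFunc.C c' * m' - RatFunc.C c * m := by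
    rw [map_sub]
    apply mul_right_cancel₀ hX
    linear_combination he
  by_contra hne
  have h1 := ordX_C (sub_ne_zero.2 hne)
  have h2 : ordX F (RatFunc.C (c - c')) < 1 := by
    rw [e1]
    refine Valuation.map_sub_lt _ ?_ ?_
    · rwa [map_mul, ordX_C hc', one_mul]
    · rwa [map_mul, ordX_C hc, one_mul]
  exact h2.ne h1

lemma IsLead.ne_zero {g : RatFunc F} {c : F} {n : ℤ} (h : IsLead g c n) : g ≠ 0 := by
  rintro rfl
  have := h.ordX_eq
  rw [map_zero] at this
  exact exp_ne_zero this.symm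

lemma isLead_one_add {m : RatFunc F} (hm : ordX F m < 1) : IsLead (1 + m) 1 0 :=
  ⟨one_ne_zero, m, hm, by simp⟩

lemma isLead_C {c : F} (hc : c ≠ 0) : IsLead (RatFunc.C c) c 0 :=
  ⟨hc, 0, by simp, by simp⟩

lemma IsLead.inv {g : RatFunc F} {c : F} {n : ℤ} (h : IsLead g c n) : IsLead g⁻¹ c⁻¹ (-n) := by
  obtain ⟨hc, m, hm, rfl⟩ := h
  have h1 := Valuation.map_one_add_of_lt _ hm
  have h0 : 1 + m ≠ 0 := by intro h0; rw [h0, map_zero] at h1; exact zero_ne_one h1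
  refine ⟨inv_ne_zero hc, -m / (1 + m), ?_, ?_⟩
  · rw [map_div₀, h1, div_one, Valuation.map_neg]; exact hm
  · rw [mul_inv, mul_inv, map_inv₀, zpow_neg]
    congr 1
    field_simp
    ring

lemma IsLead.zpow {g : RatFunc F} {c : F} {n : ℤ} (h : IsLead g c n) (r : ℤ) :
    IsLead (g ^ r) (c ^ r) (r * n) := by
  have key : ∀ r : ℕ, IsLead (g ^ r) (c ^ r) (r * n) := fun r => by
    induction r with
    | zero => simpa using isLead_C (F := F) one_ne_zero
    | succ r ih =>
      rw [pow_succ, pow_succ, show ((r + 1 : ℕ) : ℤ) * n = r * n + n by push_cast; ring]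
      exact ih.mul h
  obtain ⟨s, rfl | rfl⟩ := r.eq_nat_or_neg
  · simpa using key s
  · simpa using (key s).inv

/-- The leading coefficient and exponent. -/
noncomputable def leadHom (hF : ∀ g : RatFunc F, g ≠ 0 → ∃ c n, IsLead g c n) :
    (RatFunc F)ˣ →* Fˣ × Multiplicative ℤ where
  toFun u := (Units.mk0 (hF u u.ne_zero).choose (hF u u.ne_zero).choose_spec.choose_spec.1,
    Multiplicative.ofAdd (hF u u.ne_zero).choose_spec.choose)
  map_one' := by
    have h := (hF _ (1 : (RatFunc F)ˣ).ne_zero).choose_spec.choose_spec.unique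
      (c' := 1) (n' := 0) (by simpa using isLead_C (F := F) one_ne_zero)
    ext
    · simpa using h.1
    · simpa using h.2
  map_mul' u u' := by
    have h := (hF _ (u * u').ne_zero).choose_spec.choose_spec.unique
      ((hF _ u.ne_zero).choose_spec.choose_spec.mul (hF _ u'.ne_zero).choose_spec.choose_spec)
    ext
    · simpa using h.1
    · simpa using h.2

lemma leadHom_spec (hF : ∀ g : RatFunc F, g ≠ 0 → ∃ c n, IsLead g c n) (u : (RatFunc F)ˣ) :
    IsLead (u : RatFunc F) ((leadHom hF u).1 : F) (leadHom hF u).2.toAdd :=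
  (hF u u.ne_zero).choose_spec.choose_spec

variable (v : Valuation F ℤᵐ⁰) {π : F} (hπ0 : π ≠ 0)

/-- The Gauss valuation with `X` of value `π ^ N`. -/
noncomputable abbrev gaussAt (N : ℕ) : Valuation (RatFunc F) ℤᵐ⁰ :=
  gaussRat v (π ^ N) (pow_ne_zero N hπ0)

variable {v}

include hπ0 in
lemma exists_isLead (hπ : v π < 1) (g : RatFunc F) (hg : g ≠ 0) : ∃ c n, IsLead g c n := by
  obtain ⟨c, n, m, hc, hm, h⟩ := exists_leading hπ0 hπ hg
  exact ⟨c, n, hc, m, hm.1, h⟩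

lemma IsLead.exists_nearZero (hπ : v π < 1) {g : RatFunc F} {c : F} {n : ℤ} (h : IsLead g c n) :
    ∃ m, NearZero v hπ0 m ∧ g = RatFunc.C c * RatFunc.X ^ n * (1 + m) := by
  obtain ⟨c', n', m, hc, hm, h'⟩ := exists_leading hπ0 hπ h.ne_zero
  obtain ⟨rfl, rfl⟩ := h.unique ⟨hc, m, hm.1, h'⟩
  exact ⟨m, hm, h'⟩

lemma IsLead.eventually (hπ : v π = exp (-1)) {g : RatFunc F} {c : F} {n : ℤ}
    (h : IsLead g c n) : ∀ᶠ N : ℕ in atTop, log (gaussAt v hπ0 N g) = log (v c) - N * n := by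
  obtain ⟨m, hm, he⟩ := h.exists_nearZero (v := v) hπ0
    (by rw [hπ, ← exp_zero, exp_lt_exp]; simp)
  have hvc : v c ≠ 0 := by simpa using h.1
  filter_upwards [hm.2] with N hN
  rw [he, map_mul, Valuation.map_one_add_of_lt _ hN, mul_one, map_mul, gaussRat_C, map_zpow₀,
    gaussRat_X, map_pow, hπ, log_mul hvc (by simp), log_zpow, log_pow, log_exp]
  simp
  ring

variable {L V : Type*} [Field L] [CommGroup V] {e : V} {R : V → V → V → Prop} {q : Lˣ →* V}
  (j : L →+* RatFunc F)

/-- Limits of `valLog ((gaussAt v hπ0 N).comap j)` for `N` in a fixed parity class. -/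
noncomputable def limLog (v : Valuation F ℤᵐ⁰)
    (hF : ∀ g : RatFunc F, g ≠ 0 → ∃ c n, IsLead g c n) (j : L →+* RatFunc F) (ε : ℤ) :
    Lˣ →* Multiplicative ℤ where
  toFun u := Multiplicative.ofAdd (ε * (leadHom hF (Units.map j u)).2.toAdd +
    log (v (leadHom hF (Units.map j u)).1))
  map_one' := by simp
  map_mul' u u' := by
    rw [map_mul, map_mul, Prod.snd_mul, Prod.fst_mul, toAdd_mul, Units.val_mul, map_mul,
      log_mul (by simp) (by simp), ← ofAdd_add]
    congr 1
    ring

variable {j} (hF : ∀ g : RatFunc F, g ≠ 0 → ∃ c n, IsLead g c n)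

lemma pull_limLog (I : Interp e R q) {x : L} {c : F} {n ε : ℤ} (h : IsLead (j x) c n) :
    Pull q (evenSub q (limLog v hF j ε)) x ↔ Even (ε * n + log (v c)) := by
  have hx : x ≠ 0 := by rintro rfl; exact h.ne_zero (map_zero j)
  obtain ⟨h1, h2⟩ := (leadHom_spec hF (Units.map j (Units.mk0 x hx))).unique (by simpa using h)
  rw [pull_mk0 hx, mem_evenSub I]
  subst h1 h2
  rfl

/-- Convergence of the parity subgroups. -/
lemma cl_limLog (I : Interp e R q) (hπ : v π = exp (-1)) {𝒢 : Subgroup V → Prop} {ε : ℕ}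
    (h : ∀ᶠ M : ℕ in atTop, 𝒢 (evenSub q (valLog ((gaussAt v hπ0 (2 * M + ε)).comap j)))) :
    Cl 𝒢 (evenSub q (limLog v hF j ε)) := by
  intro Z
  have hlim : Tendsto (fun M : ℕ => 2 * M + ε) atTop atTop :=
    tendsto_atTop_mono (fun M => by simp only [id]; omega) tendsto_id
  have key : ∀ᶠ M : ℕ in atTop, ∀ z ∈ Z,
      (z ∈ evenSub q (valLog ((gaussAt v hπ0 (2 * M + ε)).comap j)) ↔
        z ∈ evenSub q (limLog v hF j ε)) := by
    rw [Filter.eventually_all_finset]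
    intro z _
    obtain ⟨u, rfl⟩ := I.surj z
    have hu := leadHom_spec hF (Units.map j u)
    filter_upwards [hlim.eventually (hu.eventually hπ0 hπ)] with M hM
    rw [mem_evenSub I, mem_evenSub I]
    change Even (log (gaussAt v hπ0 (2 * M + ε) (j u))) ↔
      Even ((ε : ℤ) * (leadHom hF (Units.map j u)).2.toAdd +
        log (v (leadHom hF (Units.map j u)).1))
    have hM' : log (gaussAt v hπ0 (2 * M + ε) (j u)) = _ := hM
    rw [hM']
    push_cast
    rw [show ∀ a b c d : ℤ, c - (2 * a + b) * d = (b * d + c) + 2 * (- (a + b) * d) from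
      fun a b c d => by ring, Int.even_add]
    simp
  obtain ⟨M, h1, h2⟩ := (h.and key).exists
  exact ⟨_, h1, h2⟩

lemma tt_le_limLog (I : Interp e R q) {ϖ : L} {H0 : Subgroup V}
    (D : DVPair q ((ordX F).comap j).valuationSubring H0 ϖ) (ε : ℤ) :
    TT R H0 ≤ evenSub q (limLog v hF j ε) := by
  intro z hz
  obtain ⟨x, hx, hp, rfl⟩ := pull_of_mem I hz
  obtain ⟨m, y, hm, hy, hxy⟩ := (D.pull_TT_iff I).1 hp
  rw [← pull_mk0 hx, hxy, I.pull_mul_sq hy]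
  have hm' : ordX F (j m) < 1 :=
    ((ordX F).comap j).isEquiv_valuation_valuationSubring.lt_one_iff_lt_one.2 hm
  have := isLead_one_add hm'
  rw [pull_limLog hF I (c := 1) (n := 0) (by rwa [map_add, map_one])]
  simp

end Leading

section DyadicGauss

open WithZero Filter

variable {F : Type*} [Field F] {v : Valuation F ℤᵐ⁰}

lemma val_intCast_le_one {K Γ : Type*} [Field K] [LinearOrderedCommGroupWithZero Γ]
    (v : Valuation K Γ) (n : ℤ) : v (n : K) ≤ 1 := by
  induction n with
  | zero => simp
  | succ i ih => push_cast at ih ⊢; exact Valuation.map_add_le _ ih (by simp)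
  | pred i ih => push_cast at ih ⊢; exact Valuation.map_sub_le (v := v) ih (by simp)

lemma val_intCast_eq_one {K Γ : Type*} [Field K] [LinearOrderedCommGroupWithZero Γ]
    {v : Valuation K Γ} (h2 : v 2 < 1) {n : ℤ} (hn : Odd n) : v (n : K) = 1 := by
  obtain ⟨r, rfl⟩ := hn
  push_cast
  rw [add_comm]
  refine Valuation.map_one_add_of_lt _ ?_
  rw [map_mul]
  exact mul_lt_one_of_nonneg_of_lt_one_left zero_le h2 (val_intCast_le_one v r)

lemma val_one_add_pow_sub_one {K Γ : Type*} [Field K] [LinearOrderedCommGroupWithZero Γ]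
    {v : Valuation K Γ} {m : K} (hm : v m < 1) (r : ℕ) : v ((1 + m) ^ r - 1) < 1 := by
  induction r with
  | zero => simp
  | succ r ih =>
    rw [show (1 + m) ^ (r + 1) - 1 = ((1 + m) ^ r - 1) * (1 + m) + m by ring]
    refine Valuation.map_add_lt _ ?_ hm
    rw [map_mul, Valuation.map_one_add_of_lt _ hm, mul_one]
    exact ih

lemma val_eval₂_sub_eval₂ {K Γ : Type*} [Field K] [LinearOrderedCommGroupWithZero Γ]
    {v : Valuation K Γ} {s t : K} (hs : v s ≤ 1) (h : v (t - s) < 1) (P : Polynomial ℤ) :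
    v (P.eval₂ (Int.castRingHom K) t - P.eval₂ (Int.castRingHom K) s) < 1 := by
  have ht : v t ≤ 1 := by
    rw [show t = (t - s) + s by ring]
    exact Valuation.map_add_le _ h.le hs
  have key : ∀ P : Polynomial ℤ, v (P.eval₂ (Int.castRingHom K) t - P.eval₂ (Int.castRingHom K)
      s) < 1 ∧
      v (P.eval₂ (Int.castRingHom K) s) ≤ 1 := fun P => by
    induction P using Polynomial.induction_on with
    | C a => rw [Polynomial.eval₂_C, Polynomial.eval₂_C]; simp [val_intCast_le_one]
    | add p q hp hq =>
      simp only [Polynomial.eval₂_add]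
      refine ⟨?_, Valuation.map_add_le _ hp.2 hq.2⟩
      rw [add_sub_add_comm]
      exact Valuation.map_add_lt _ hp.1 hq.1
    | monomial n a ih =>
      simp only [pow_succ, ← mul_assoc]
      rw [Polynomial.eval₂_mul_X, Polynomial.eval₂_mul_X]
      set x := (Polynomial.C a * Polynomial.X ^ n).eval₂ (Int.castRingHom K) t
      set y := (Polynomial.C a * Polynomial.X ^ n).eval₂ (Int.castRingHom K) s
      constructor
      · rw [show x * t - y * s = (x - y) * t + y * (t - s) by ring]
        refine Valuation.map_add_lt _ ?_ ?_
        · rw [map_mul]; exact mul_lt_one_of_nonneg_of_lt_one_left zero_le ih.1 ht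
        · rw [map_mul, mul_comm]; exact mul_lt_one_of_nonneg_of_lt_one_left zero_le h ih.2
      · rw [map_mul]; exact mul_le_one₀ ih.2 zero_le hs
  exact (key P).1

lemma gaussRat_eval₂ (h2 : v 2 < 1) {c d : F} (hc : c ≠ 0) {r : ℕ} (hr : 0 < r)
    (hs : gaussRat v c hc (RatFunc.C d * RatFunc.X ^ r) = 1) {P : Polynomial ℤ}
    (hP : P.map (Int.castRingHom (ZMod 2)) ≠ 0) :
    gaussRat v c hc (P.eval₂ (Int.castRingHom (RatFunc F)) (RatFunc.C d * RatFunc.X ^ r)) = 1 := by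
  rw [map_mul, map_pow, gaussRat_X, gaussRat_C] at hs
  set Q : Polynomial F := Polynomial.expand F r
    ((P.map (Int.castRingHom F)).comp (Polynomial.C d * Polynomial.X)) with hQ
  have e1 : P.eval₂ (Int.castRingHom (RatFunc F)) (RatFunc.C d * RatFunc.X ^ r) =
      algebraMap (Polynomial F) (RatFunc F) Q := by
    rw [hQ, Polynomial.expand_eq_comp_X_pow, Polynomial.comp_assoc, Polynomial.comp,
      Polynomial.eval₂_map, Polynomial.hom_eval₂]
    congr 1
    · exact RingHom.ext_int _ _
    · simp [RatFunc.algebraMap_X, RatFunc.algebraMap_C]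
  have hval : ∀ i, v (P.coeff i * d ^ i * c ^ (i * r)) = v (P.coeff i : F) := fun i => by
    rw [mul_assoc, mul_comm i r, pow_mul, ← mul_pow, map_mul, map_pow, map_mul, map_pow, hs,
      one_pow, mul_one]
  rw [e1, gaussRat_poly]
  refine le_antisymm (gaussSup_le_iff.2 fun i => ?_) ?_
  · rw [Polynomial.comp_C_mul_X_coeff, hQ, Polynomial.coeff_expand hr]
    split_ifs with h
    · obtain ⟨i, rfl⟩ := h
      rw [Nat.mul_div_cancel_left _ hr, Polynomial.comp_C_mul_X_coeff, Polynomial.coeff_map,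
        mul_comm r i]
      exact (hval i).trans_le (val_intCast_le_one v _)
    · simp
  · obtain ⟨i, hi⟩ : ∃ i, Odd (P.coeff i) := by
      by_contra h
      push Not at h
      apply hP
      ext i
      rw [Polynomial.coeff_map, Polynomial.coeff_zero]
      exact (ZMod.intCast_zmod_eq_zero_iff_dvd _ 2).2 (Int.not_odd_iff_even.1 (h i)).two_dvd
    refine le_trans ?_ (le_gaussSup _ (i * r))
    rw [Polynomial.comp_C_mul_X_coeff, hQ, Polynomial.coeff_expand_mul hr,
      Polynomial.comp_C_mul_X_coeff, Polynomial.coeff_map]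
    exact ((hval i).trans (val_intCast_eq_one h2 hi)).ge

variable {L V : Type*} [Field L] [CommGroup V] {e : V} {R : V → V → V → Prop} {q : Lˣ →* V}
  {j : L →+* RatFunc F}

lemma dy_gaussRat [CharZero L] (I : Interp e R q) (hL : IsCurve L) (h2 : v 2 < 1) {p : F}
    (hp : p ≠ 0) {f : L} {c : F} {n : ℕ} (hn : 0 < n) {m : RatFunc F}
    (hm : gaussRat v p hp m < 1) (hf : j f = RatFunc.C c * RatFunc.X ^ n * (1 + m))
    (hodd : Odd (log (gaussRat v p hp (j f)))) :
    Dy e R (evenSub q (valLog ((gaussRat v p hp).comap j))) := by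
  set w := gaussRat v p hp with hw
  have hf0 : f ≠ 0 := by rintro rfl; simp at hodd
  have hF2 : (2 : F) ≠ 0 := by
    intro h
    have h3 : j (2 : L) = RatFunc.C (2 : F) := by rw [map_ofNat, map_ofNat]
    rw [h, map_zero] at h3
    exact two_ne_zero ((map_eq_zero j).1 h3)
  obtain ⟨ϖ, D⟩ := exists_dvPair_of_odd I (w.comap j) hf0 hodd
  have hA := (w.comap j).isEquiv_valuation_valuationSubring
  have hw2 : w (j 2) = v 2 := by
    rw [map_ofNat, show (2 : RatFunc F) = RatFunc.C 2 by rw [map_ofNat], hw, gaussRat_C]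
  have hv2 : v 2 ≠ 0 := by simpa using hF2
  have hE : log (v 2) < 0 := by
    have := log_lt_log hv2 one_ne_zero |>.2 h2
    simpa using this
  obtain ⟨E, hE'⟩ : ∃ E : ℕ, (E : ℤ) = - log (v 2) := ⟨(- log (v 2)).toNat, by omega⟩
  have hE0 : 0 < E := by omega
  set M : ℤ := log (w (j f)) with hM
  have hwf : w (j f) ≠ 0 := by simpa using hf0
  set τ : L := f ^ E * 2 ^ M with hτ
  have hjτ : j τ = RatFunc.C (2 ^ M * c ^ E) * RatFunc.X ^ (n * E) * (1 + m) ^ E := by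
    rw [hτ, map_mul, map_pow, map_zpow₀, hf, map_ofNat, map_mul, map_zpow₀, map_pow, map_ofNat,
      mul_pow, mul_pow, ← pow_mul]
    ring
  have hwτ : w (j τ) = 1 := by
    have h0 : w (j τ) ≠ 0 := by
      simp only [ne_eq, map_eq_zero]
      exact mul_ne_zero (pow_ne_zero _ hf0) (zpow_ne_zero _ two_ne_zero)
    have : log (w (j τ)) = 0 := by
      rw [hτ, map_mul, map_mul, map_pow, map_pow, map_zpow₀, map_zpow₀, hw2,
        log_mul (pow_ne_zero _ hwf) (zpow_ne_zero _ hv2), log_pow, log_zpow, ← hM]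
      simp only [smul_eq_mul, nsmul_eq_mul]
      rw [hE']
      ring
    rw [← exp_log h0, this, exp_zero]
  set s : RatFunc F := RatFunc.C (2 ^ M * c ^ E) * RatFunc.X ^ (n * E) with hs
  have h1m : w ((1 + m) ^ E) = 1 := by rw [map_pow, Valuation.map_one_add_of_lt _ hm, one_pow]
  have hws : w s = 1 := by
    rw [hjτ, map_mul, h1m, mul_one] at hwτ
    exact hwτ
  have hsub : w (j τ - s) < 1 := by
    rw [hjτ, ← mul_sub_one, map_mul, hws, one_mul]
    exact val_one_add_pow_sub_one hm E
  have hτA : τ ∈ (w.comap j).valuationSubring := by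
    rw [Valuation.mem_valuationSubring_iff]; exact hwτ.le
  refine D.dy_of_transcendental I hL (hA.lt_one_iff_lt_one.1 ?_) hτA fun P hP =>
    hA.eq_one_iff_eq_one.1 ?_
  · rw [Nat.cast_ofNat, Valuation.comap_apply, hw2]; exact h2
  · rw [Valuation.comap_apply]
    have e1 : j (Polynomial.aeval τ P) = P.eval₂ (Int.castRingHom (RatFunc F)) (j τ) := by
      rw [Polynomial.aeval_def, Polynomial.hom_eval₂]
      congr 1
      exact RingHom.ext_int _ _
    have h3 := gaussRat_eval₂ h2 hp (Nat.mul_pos hn hE0) hws hP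
    have h4 := val_eval₂_sub_eval₂ hws.le hsub P
    rw [e1, ← h3]
    exact Valuation.map_eq_of_sub_lt _ (by rw [h3]; exact h4)

/-- A horizontal subgroup has a proper specialization which is a limit of dyadic ones. -/
lemma exists_cl_dy [CharZero L] (I : Interp e R q) (hL : IsCurve L) {π : F}
    (hπ : v π = exp (-1)) (h2 : v 2 < 1) {f : L} {c : F} {n : ℤ} (hf : IsLead (j f) c n)
    (hn : Odd n) {ϖ : L} {H0 : Subgroup V}
    (D : DVPair q ((ordX F).comap j).valuationSubring H0 ϖ) :
    ∃ H', Cl (Dy e R) H' ∧ H' ≠ ⊤ ∧ TT R H0 ≤ H' := by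
  have hπ0 : π ≠ 0 := by rintro rfl; rw [map_zero] at hπ; exact exp_ne_zero hπ.symm
  have hπ1 : v π < 1 := by rw [hπ, ← exp_zero, exp_lt_exp]; simp
  wlog hn0 : 0 < n generalizing f c n
  · refine this (f := f⁻¹) (c := c⁻¹) (n := -n) (by rw [map_inv₀]; exact hf.inv) hn.neg ?_
    obtain ⟨r, rfl⟩ := hn
    omega
  obtain ⟨n, rfl⟩ := Int.eq_ofNat_of_zero_le hn0.le
  have hF := exists_isLead (v := v) hπ0 hπ1
  obtain ⟨ε, hε⟩ : ∃ ε : ℕ, Odd (ε * (n : ℤ) + log (v c)) := by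
    by_cases h : Odd (log (v c))
    · exact ⟨0, by simpa using h⟩
    · exact ⟨1, by simpa using hn.add_even (Int.not_odd_iff_even.1 h)⟩
  refine ⟨evenSub q (limLog v hF j ε), cl_limLog hπ0 hF I hπ ?_, fun h => ?_,
    tt_le_limLog hF I D ε⟩
  · obtain ⟨m, hm, he⟩ := hf.exists_nearZero hπ0 hπ1
    have hlim : Tendsto (fun M : ℕ => 2 * M + ε) atTop atTop :=
      tendsto_atTop_mono (fun M => by simp only [id]; omega) tendsto_id
    filter_upwards [hlim.eventually (hf.eventually hπ0 hπ), hlim.eventually hm.2] with M h1 h3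
    refine dy_gaussRat I hL h2 (pow_ne_zero _ hπ0) (n := n) (by omega) h3
      (by rw [he, zpow_natCast]) ?_
    rw [h1]
    push_cast
    rw [show ∀ a b c d : ℤ, c - (2 * a + b) * d = (b * d + c) + 2 * (- (a + b) * d) from
      fun a b c d => by ring, Int.odd_add]
    simpa using hε
  · have h3 : Pull q (evenSub q (limLog v hF j ε)) f := by
      have hf0 : f ≠ 0 := by rintro rfl; exact hf.ne_zero (map_zero j)
      rw [pull_mk0 hf0, h]; trivial
    rw [pull_limLog hF I hf] at h3
    exact (Int.not_even_iff_odd.2 hε) h3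

end DyadicGauss

section NumberFieldNonsquares

open WithZero NumberField IsDedekindDomain

variable (κ : Type*) [Field κ] [NumberField κ]

lemma exists_heightOne_mem {p : ℕ} (hp : p.Prime) :
    ∃ 𝔭 : HeightOneSpectrum (𝓞 κ), 𝔭.valuation κ (p : κ) < 1 := by
  have hp0 : (p : 𝓞 κ) ≠ 0 := by exact_mod_cast hp.ne_zero
  have hu : ¬ IsUnit (p : 𝓞 κ) := by
    rintro ⟨u, hu⟩
    have h1 : IsIntegral ℤ (algebraMap ℚ κ (p : ℚ)⁻¹) := by
      have h2 : IsIntegral ℤ (((u⁻¹ : (𝓞 κ)ˣ) : 𝓞 κ) : κ) := RingOfIntegers.isIntegral_coe _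
      have h3 : (((u⁻¹ : (𝓞 κ)ˣ) : 𝓞 κ) : κ) * p = 1 := by
        have : ((u⁻¹ : (𝓞 κ)ˣ) : 𝓞 κ) * (p : 𝓞 κ) = 1 := by rw [← hu]; simp
        simpa using congrArg (algebraMap (𝓞 κ) κ) this
      rw [eq_inv_of_mul_eq_one_left h3] at h2
      simpa using h2
    rw [isIntegral_algebraMap_iff (algebraMap ℚ κ).injective] at h1
    obtain ⟨n, hn⟩ := IsIntegrallyClosed.isIntegral_iff.1 h1
    rw [eq_intCast] at hn
    have h4 : ((n * p : ℤ) : ℚ) = 1 := by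
      push_cast; rw [hn, inv_mul_cancel₀ (by exact_mod_cast hp.ne_zero)]
    have h5 : n * p = 1 := by exact_mod_cast h4
    have h6 : (p : ℤ) = 1 := Int.eq_one_of_dvd_one (by positivity) ⟨n, by rw [← h5, mul_comm]⟩
    exact hp.one_lt.ne' (by exact_mod_cast h6)
  obtain ⟨M, hM, hle⟩ := Ideal.exists_le_maximal (Ideal.span {(p : 𝓞 κ)})
    (by rwa [Ne, Ideal.span_singleton_eq_top])
  have hpM : (p : 𝓞 κ) ∈ M := hle (Ideal.mem_span_singleton_self _)
  let 𝔭 : HeightOneSpectrum (𝓞 κ) :=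
    ⟨M, hM.isPrime, by rintro rfl; exact hp0 (by simpa using hpM)⟩
  refine ⟨𝔭, ?_⟩
  have := (𝔭.valuation_lt_one_iff_mem (K := κ) (p : 𝓞 κ)).2 hpM
  simpa using this

variable {κ}

omit [NumberField κ] in
lemma not_isSquare_of_odd_log (v : Valuation κ ℤᵐ⁰) {x : κ} (hx : Odd (log (v x))) :
    ¬ IsSquare x := by
  rintro ⟨s, rfl⟩
  rw [map_mul] at hx
  by_cases hs : v s = 0
  · rw [hs] at hx; simp at hx
  · rw [log_mul hs hs] at hx
    exact (Int.not_even_iff_odd.2 hx) ⟨_, rfl⟩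

variable (κ) in
lemma exists_nonsquares : ∃ y : κ, ¬ IsSquare y ∧ ¬ IsSquare (-y) ∧ ¬ IsSquare (1 + y) ∧
    ¬ IsSquare (-(1 + y)) ∧ ¬ IsSquare (y * (1 + y)) ∧ ¬ IsSquare (-(y * (1 + y))) := by
  obtain ⟨𝔭, h𝔭⟩ := exists_heightOne_mem κ Nat.prime_two
  obtain ⟨𝔮, h𝔮⟩ := exists_heightOne_mem κ Nat.prime_three
  have hne : 𝔭.asIdeal ≠ 𝔮.asIdeal := by
    intro h
    have h' : 𝔭 = 𝔮 := HeightOneSpectrum.ext h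
    subst h'
    have h1 : 𝔭.valuation κ ((3 : ℕ) - (2 : ℕ) : κ) < 1 := Valuation.map_sub_lt _ h𝔮 h𝔭
    norm_num at h1
  have hcop : IsCoprime (𝔭.asIdeal ^ 2) (𝔮.asIdeal ^ 2) := by
    refine IsCoprime.pow ?_
    have := 𝔭.isMaximal
    have := 𝔮.isMaximal
    exact Ideal.isCoprime_of_isMaximal hne
  obtain ⟨a, ha, b, hb, hab⟩ := Ideal.isCoprime_iff_exists.1 hcop
  obtain ⟨π, hπ⟩ := 𝔭.intValuation_exists_uniformizer
  obtain ⟨ρ, hρ⟩ := 𝔮.intValuation_exists_uniformizer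
  have key : ∀ (𝔭 : HeightOneSpectrum (𝓞 κ)) (π d : 𝓞 κ), 𝔭.intValuation π = exp (-1) →
      d ∈ 𝔭.asIdeal ^ 2 → 𝔭.valuation κ ((π + d : 𝓞 κ) : κ) = exp (-1) := by
    intro 𝔭 π d hπ hd
    rw [HeightOneSpectrum.valuation_of_algebraMap, ← hπ]
    refine Valuation.map_add_eq_of_lt_left _ ?_
    refine ((𝔭.intValuation_le_pow_iff_mem d 2).2 hd).trans_lt ?_
    rw [hπ, exp_lt_exp]
    norm_num
  have e1 := key 𝔭 π (a * (ρ - 1 - π)) hπ (Ideal.mul_mem_right _ _ ha)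
  have e2 := key 𝔮 ρ (b * (π - ρ + 1)) hρ (Ideal.mul_mem_right _ _ hb)
  set y : κ := ((π + a * (ρ - 1 - π) : 𝓞 κ) : κ) with hy
  have hy1 : ((ρ + b * (π - ρ + 1) : 𝓞 κ) : κ) = 1 + y := by
    rw [hy, ← map_one (algebraMap (𝓞 κ) κ), ← map_add]
    congr 1
    linear_combination (π - ρ + 1) * hab
  rw [hy1] at e2
  have hlt : exp (-1 : ℤ) < (1 : ℤᵐ⁰) := by rw [← exp_zero, exp_lt_exp]; simp
  have e3 : 𝔭.valuation κ (1 + y) = 1 := Valuation.map_one_add_of_lt _ (by rw [e1]; exact hlt)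
  have o1 : Odd (log (𝔭.valuation κ y)) := by rw [e1]; simp
  have o2 : Odd (log (𝔮.valuation κ (1 + y))) := by rw [e2]; simp
  have o3 : Odd (log (𝔭.valuation κ (y * (1 + y)))) := by rw [map_mul, e3, mul_one]; exact o1
  exact ⟨y, not_isSquare_of_odd_log _ o1, not_isSquare_of_odd_log (𝔭.valuation κ)
    (by rwa [Valuation.map_neg]), not_isSquare_of_odd_log _ o2,
    not_isSquare_of_odd_log (𝔮.valuation κ) (by rwa [Valuation.map_neg]),
    not_isSquare_of_odd_log _ o3, not_isSquare_of_odd_log (𝔭.valuation κ)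
    (by rwa [Valuation.map_neg])⟩

end NumberFieldNonsquares

section OrdHor

open WithZero NumberField IsDedekindDomain

variable {F : Type*} [Field F]  {L V : Type*} [Field L] [CommGroup V]
  {e : V} {R : V → V → V → Prop} {q : Lˣ →* V} {j : L →+* RatFunc F}

lemma exists_dvPair_ordX (I : Interp e R q) {f : L} {c : F} {n : ℤ} (hf : IsLead (j f) c n)
    (hn : Odd n) : ∃ ϖ, DVPair q ((ordX F).comap j).valuationSubring
      (evenSub q (valLog ((ordX F).comap j))) ϖ := by
  refine exists_dvPair_of_odd I _ (f := f) ?_ ?_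
  · rintro rfl; exact hf.ne_zero (map_zero j)
  · rw [Valuation.comap_apply, hf.ordX_eq, log_exp]; exact hn.neg

lemma horiz_ordX [CharZero F] [CharZero L] (hL : IsCurve L) {f : L} {c : F} {n : ℤ}
    (hf : IsLead (j f) c n) (hn : n ≠ 0) : Horiz ((ordX F).comap j).valuationSubring := by
  have hA := ((ordX F).comap j).isEquiv_valuation_valuationSubring
  have h1 : ∀ n : ℕ, n ≠ 0 →
      ((ordX F).comap j).valuationSubring.valuation (n : L) = 1 := fun n hn => by
    rw [← hA.eq_one_iff_eq_one, Valuation.comap_apply, map_natCast,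
      ← map_natCast (RatFunc.C (K := F)), ordX_C (by exact_mod_cast hn)]
  refine ⟨h1, ?_⟩
  wlog hn0 : 0 < n generalizing f c n
  · exact this (f := f⁻¹) (c := c⁻¹) (n := -n) (by rw [map_inv₀]; exact hf.inv) (by omega)
      (by omega)
  refine (horizontal h1 (y := f) (hA.lt_one_iff_lt_one.1 ?_) ?_ hL).2
  · rw [Valuation.comap_apply, hf.ordX_eq, ← exp_zero, exp_lt_exp]; omega
  · rintro rfl; exact hf.ne_zero (map_zero j)

lemma good_ordX [CharZero F] [CharZero L] (I : Interp e R q) (hL : IsCurve L) {f : L} {c : F}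
    {n : ℤ} (hf : IsLead (j f) c n) (hn : Odd n) :
    Good e R (evenSub q (valLog ((ordX F).comap j))) := by
  have hn0 : n ≠ 0 := by rintro rfl; simp at hn
  obtain ⟨ϖ, D⟩ := exists_dvPair_ordX I hf hn
  have := (horiz_ordX hL hf hn0).numberField
  obtain ⟨y, h1, h2, h3, h4, h5, h6⟩ :=
    exists_nonsquares (IsLocalRing.ResidueField ((ordX F).comap j).valuationSubring)
  exact D.good_of_residue I h1 h2 h3 h4 h5 h6

lemma hor_ordX [NumberField F] [CharZero L] (I : Interp e R q) (hL : IsCurve L) {f : L} {c : F}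
    {n : ℤ} (hf : IsLead (j f) c n) (hn : Odd n) :
    Hor e R (evenSub q (valLog ((ordX F).comap j))) := by
  have hn0 : n ≠ 0 := by rintro rfl; simp at hn
  have hg := good_ordX I hL hf hn
  obtain ⟨ϖ, D⟩ := exists_dvPair_ordX I hf hn
  have hh := horiz_ordX hL hf hn0
  refine ⟨hg, ?_, ?_⟩
  · rw [dy_iff_val_two_lt I D hg (Or.inl hh)]
    have := hh.val_natCast 2 two_ne_zero
    push_cast at this
    rw [this]; exact lt_irrefl _
  · obtain ⟨𝔭, h𝔭⟩ := exists_heightOne_mem F Nat.prime_two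
    obtain ⟨π, hπ⟩ := 𝔭.valuation_exists_uniformizer F
    exact exists_cl_dy (v := 𝔭.valuation F) I hL hπ (by simpa using h𝔭) hf hn D

end OrdHor

section Family

open WithZero Filter

variable {F : Type*} [Field F] {v : Valuation F ℤᵐ⁰} {L V : Type*} [Field L] [CommGroup V]
  {e : V} {R : V → V → V → Prop} {q : Lˣ →* V} {j : L →+* RatFunc F}

lemma nonSq_gaussRat {p : F} (hp : p ≠ 0) {U : Polynomial v.valuationSubring}
    (hU : ∀ P Q, Q ≠ 0 → redPoly v U * Q ^ 2 ≠ P ^ 2)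
    (hU' : ∀ P Q, Q ≠ 0 → -redPoly v U * Q ^ 2 ≠ P ^ 2) {x : L}
    (hx : gaussRat v p hp (j x - Polynomial.eval₂
      (RatFunc.C.comp (algebraMap v.valuationSubring F)) (RatFunc.X / RatFunc.C p) U) < 1) :
    NonSq ((gaussRat v p hp).comap j).valuationSubring x := by
  set w := gaussRat v p hp with hw
  set T := Polynomial.eval₂
      (RatFunc.C.comp (algebraMap v.valuationSubring F)) (RatFunc.X / RatFunc.C p) U with hT
  have hA := (w.comap j).isEquiv_valuation_valuationSubring
  intro s
  constructor
  · intro h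
    rw [← hA.lt_one_iff_lt_one, Valuation.comap_apply, map_sub, map_pow] at h
    refine not_gaussRat_lt hU hp (j s) ?_
    rw [← hT, ← hw, show T - j s ^ 2 = (j x - j s ^ 2) - (j x - T) by ring]
    exact Valuation.map_sub_lt _ h hx
  · intro h
    rw [← hA.lt_one_iff_lt_one, Valuation.comap_apply, map_add, map_pow] at h
    refine not_gaussRat_lt (U := -U) (by rwa [map_neg]) hp (j s) ?_
    rw [Polynomial.eval₂_neg, ← hT, ← hw,
      show -T - j s ^ 2 = (j x - T) - (j x + j s ^ 2) by ring]
    exact Valuation.map_sub_lt _ hx h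

lemma good_gaussRat (I : Interp e R q) {p : F} (hp : p ≠ 0) {z s : L} (hz0 : z ≠ 0)
    (hz : Odd (log (gaussRat v p hp (j z))))
    (hs : gaussRat v p hp (j s - RatFunc.X / RatFunc.C p) < 1) :
    Good e R (evenSub q (valLog ((gaussRat v p hp).comap j))) := by
  obtain ⟨ϖ, D⟩ := exists_dvPair_of_odd I ((gaussRat v p hp).comap j) hz0 hz
  set w := gaussRat v p hp with hw
  set A := (w.comap j).valuationSubring with hA'
  have hA := (w.comap j).isEquiv_valuation_valuationSubring
  set T : RatFunc F := RatFunc.X / RatFunc.C p with hT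
  have hwT : w T = 1 := by
    rw [hT, map_div₀, hw, gaussRat_X, gaussRat_C, div_self (by simpa using hp)]
  have hws : w (j s) = 1 := by
    rw [← hwT]; exact Valuation.map_eq_of_sub_lt _ (by rw [hwT]; exact hs)
  have hw1 : w (1 + j s) ≤ 1 := Valuation.map_add_le _ (by simp) hws.le
  have dX : Polynomial.natDegree (Polynomial.X :
      Polynomial (IsLocalRing.ResidueField v.valuationSubring)) = 1 := Polynomial.natDegree_X
  have d1X : Polynomial.natDegree (1 + Polynomial.X :
      Polynomial (IsLocalRing.ResidueField v.valuationSubring)) = 1 := by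
    rw [add_comm, ← Polynomial.C_1, Polynomial.natDegree_X_add_C]
  have t1X : Polynomial.natTrailingDegree (1 + Polynomial.X :
      Polynomial (IsLocalRing.ResidueField v.valuationSubring)) = 0 := by
    apply Polynomial.natTrailingDegree_eq_zero_of_constantCoeff_ne_zero
    simp
  have dXX : Polynomial.natTrailingDegree (Polynomial.X * (1 + Polynomial.X) :
      Polynomial (IsLocalRing.ResidueField v.valuationSubring)) = 1 := by
    rw [Polynomial.natTrailingDegree_mul Polynomial.X_ne_zero
      (by intro h; rw [h] at d1X; simp at d1X), t1X, Polynomial.natTrailingDegree_X]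
  have rX : redPoly v Polynomial.X = Polynomial.X := by simp [redPoly]
  have n0 : NonSq A s := by
    refine nonSq_gaussRat hp (U := Polynomial.X) (fun P Q hQ => ?_) (fun P Q hQ => ?_) (by simpa)
    · rw [rX]
      exact mul_sq_ne_sq_of_odd_natDegree (by rw [dX]; exact odd_one) hQ
    · rw [rX]
      exact mul_sq_ne_sq_of_odd_natDegree (by rw [Polynomial.natDegree_neg, dX]; exact odd_one) hQ
  have n1 : NonSq A (1 + s) := by
    refine nonSq_gaussRat hp (U := 1 + Polynomial.X) (fun P Q hQ => ?_) (fun P Q hQ => ?_)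
      (by simpa [← hw])
    · rw [map_add, map_one, rX]
      exact mul_sq_ne_sq_of_odd_natDegree (by rw [d1X]; exact odd_one) hQ
    · rw [map_add, map_one, rX]
      exact mul_sq_ne_sq_of_odd_natDegree (by rw [Polynomial.natDegree_neg, d1X]; exact odd_one) hQ
  have n2 : NonSq A (s * (1 + s)) := by
    refine nonSq_gaussRat hp (U := Polynomial.X * (1 + Polynomial.X)) (fun P Q hQ => ?_)
      (fun P Q hQ => ?_) ?_
    · rw [map_mul, map_add, map_one, rX]
      exact mul_sq_ne_sq_of_odd_natTrailingDegree (by rw [dXX]; exact odd_one) hQ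
    · rw [map_mul, map_add, map_one, rX]
      exact mul_sq_ne_sq_of_odd_natTrailingDegree
        (by rw [Polynomial.natTrailingDegree_neg, dXX]; exact odd_one) hQ
    · rw [map_mul, map_add, map_one, Polynomial.eval₂_mul, Polynomial.eval₂_add,
        Polynomial.eval₂_one, Polynomial.eval₂_X, ← hT, ← hw,
        show j s * (1 + j s) - T * (1 + T) = (j s - T) * ((1 + j s) + T) by ring, map_mul]
      exact mul_lt_one_of_nonneg_of_lt_one_left zero_le hs (Valuation.map_add_le _ hw1 hwT.le)
  refine D.good I (h := s) (hA.eq_one_iff_eq_one.1 hws) ?_ n0 n1 n2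
  refine le_antisymm ?_ (not_lt.1 fun h => (n1 0).1 (by simpa using h))
  rw [A.valuation_le_one_iff, hA', Valuation.mem_valuationSubring_iff, Valuation.comap_apply,
    map_add, map_one]
  exact hw1

/-- The parity subgroups of the primes of the residue field belong to the family. -/
lemma fam_limLog (I : Interp e R q) {π : F} (hπ : v π = exp (-1))
    (hF : ∀ g : RatFunc F, g ≠ 0 → ∃ c n, IsLead g c n) {f z : L}
    (hf : IsLead (j f) 1 1) (hz : IsLead (j z) π 0) :
    Fam e R (evenSub q (valLog ((ordX F).comap j)))
      (evenSub q (limLog v hF j 0) ⊓ evenSub q (valLog ((ordX F).comap j))) := by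
  have hπ0 : π ≠ 0 := hz.1
  have hπ1 : v π < 1 := by rw [hπ, ← exp_zero, exp_lt_exp]; simp
  obtain ⟨ϖ, D⟩ := exists_dvPair_ordX (e := e) (R := R) I hf odd_one
  have hz0 : z ≠ 0 := by rintro rfl; exact hz.ne_zero (map_zero j)
  have hf0 : f ≠ 0 := by rintro rfl; exact hf.ne_zero (map_zero j)
  refine ⟨evenSub q (limLog v hF j 0), ?_, tt_le_limLog hF I D 0, fun h => ?_, rfl⟩
  · refine cl_limLog (ε := 0) hπ0 hF I hπ ?_
    obtain ⟨m, hm, he⟩ := hf.exists_nearZero hπ0 hπ1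
    obtain ⟨m', hm', he'⟩ := hz.exists_nearZero hπ0 hπ1
    have hlim : Tendsto (fun M : ℕ => 2 * M + 0) atTop atTop :=
      tendsto_atTop_mono (fun M => by simp only [id]; omega) tendsto_id
    filter_upwards [hlim.eventually (hz.eventually hπ0 hπ), hlim.eventually hm.2,
      hlim.eventually hm'.2] with M h1 h2 h3
    set N := 2 * M + 0
    set w := gaussAt v hπ0 N
    refine good_gaussRat I (pow_ne_zero N hπ0) (z := z) (s := f / z ^ N) hz0 ?_ ?_
    · rw [h1, hπ]; simp
    · have hm1 : w ((1 + m') ^ N) = 1 := by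
        rw [map_pow, Valuation.map_one_add_of_lt _ h3, one_pow]
      have hne : (1 + m') ^ N ≠ 0 := by intro h; rw [h, map_zero] at hm1; exact zero_ne_one hm1
      have hc : RatFunc.C π ≠ 0 := by simpa using hπ0
      have e1 : j (f / z ^ N) - RatFunc.X / RatFunc.C (π ^ N) =
          RatFunc.X / RatFunc.C (π ^ N) * ((m - ((1 + m') ^ N - 1)) / (1 + m') ^ N) := by
        rw [map_div₀, map_pow, he, he', map_one, map_pow]
        simp only [zpow_one, zpow_zero, one_mul, mul_one, mul_pow]
        field_simp
        ring
      rw [e1, map_mul, map_div₀, map_div₀, gaussRat_X, gaussRat_C, div_self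
          ((Valuation.ne_zero_iff _).2 (pow_ne_zero N hπ0)),
        one_mul, hm1, div_one]
      exact Valuation.map_sub_lt _ h2 (val_one_add_pow_sub_one h3 N)
  · have h1 : Pull q (evenSub q (valLog ((ordX F).comap j))) z := by
      rw [pull_evenSub_valLog I, Valuation.comap_apply, hz.ordX_eq]
      exact ⟨hz0, by simp⟩
    have h2 := h1.mono h
    rw [pull_limLog hF I hz, hπ] at h2
    simp at h2

end Family

section

open NumberField IsDedekindDomain WithZero

/-- The subgroup of squares of a commutative group. -/
abbrev squares (G : Type*) [CommGroup G] : Subgroup G := (powMonoidHom 2 : G →* G).range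

theorem index_range_pow_multiplicative (ι : Type*) [Fintype ι] (n : ℕ) [NeZero n] :
    (powMonoidHom n : Multiplicative (ι → ℤ) →* Multiplicative (ι → ℤ)).range.index =
      n ^ Fintype.card ι := by
  let g : (ι → ℤ) →+ (ι → ZMod n) :=
    { toFun := fun f i ↦ (f i : ZMod n)
      map_zero' := by ext; simp
      map_add' := fun _ _ ↦ by ext; simp }
  have h : (powMonoidHom n : Multiplicative (ι → ℤ) →* Multiplicative (ι → ℤ)).range =
      (AddMonoidHom.toMultiplicative g).ker := by
    ext x
    rw [MonoidHom.mem_ker]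
    constructor
    · rintro ⟨y, rfl⟩
      change Multiplicative.ofAdd (g (n • y.toAdd)) = 1
      rw [map_nsmul]
      refine congrArg Multiplicative.ofAdd (funext fun i ↦ ?_)
      simp
    · intro hx
      have hx' : ∀ i, ((x.toAdd i : ℤ) : ZMod n) = 0 := fun i ↦ congrFun (congrArg
          Multiplicative.toAdd hx) i
      simp only [ZMod.intCast_zmod_eq_zero_iff_dvd] at hx'
      choose y hy using hx'
      refine ⟨Multiplicative.ofAdd y, ?_⟩
      refine congrArg Multiplicative.ofAdd (funext fun i ↦ ?_ : n • y = x.toAdd)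
      simp [hy i]
  have hs : Function.Surjective (AddMonoidHom.toMultiplicative g) := by
    intro y
    refine ⟨Multiplicative.ofAdd fun i ↦ (y.toAdd i).cast, ?_⟩
    refine congrArg Multiplicative.ofAdd (funext fun i ↦ ?_ : g _ = y.toAdd)
    simp [g]
  rw [h, Subgroup.index_ker, MonoidHom.range_eq_top.2 hs, Subgroup.card_top,
    Nat.card_congr Multiplicative.toAdd, Nat.card_fun, Nat.card_zmod, Nat.card_eq_fintype_card]

theorem relIndex_map_sq_of_index_ne_zero {ι : Type*} [Fintype ι]
    {Λ : Subgroup (Multiplicative (ι → ℤ))} (h : Λ.index ≠ 0) :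
    (Λ.map (powMonoidHom 2)).relIndex Λ = 2 ^ Fintype.card ι := by
  have hle : Λ.map (powMonoidHom 2) ≤ Λ := by
    rintro _ ⟨x, hx, rfl⟩
    exact pow_mem hx 2
  have hinj : Function.Injective
      (powMonoidHom 2 : Multiplicative (ι → ℤ) →* Multiplicative (ι → ℤ)) := by
    intro x y hxy
    have hxy' : (2 : ℕ) • x.toAdd = (2 : ℕ) • y.toAdd := hxy
    refine congrArg Multiplicative.ofAdd (funext fun i ↦ ?_ : x.toAdd = y.toAdd)
    simpa using congrFun hxy' i
  have h1 := Subgroup.relIndex_mul_index hle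
  have h2 := Subgroup.relIndex_mul_index
    (Subgroup.map_mono (f := (powMonoidHom 2 : Multiplicative (ι → ℤ) →* _)) (le_top (a := Λ)))
  rw [Subgroup.relIndex_map_map_of_injective _ _ hinj, Subgroup.relIndex_top_right,
    ← MonoidHom.range_eq_map, index_range_pow_multiplicative] at h2
  rw [← h2, mul_comm] at h1
  exact Nat.eq_of_mul_eq_mul_left (Nat.pos_of_ne_zero h) h1

theorem index_squares_eq {G : Type*} [CommGroup G] {ι : Type*} [Fintype ι]
    (f : G →* Multiplicative (ι → ℤ)) (hf : f.range.index ≠ 0) :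
    (squares G).index = 2 ^ Fintype.card ι * (squares f.ker).index := by
  have h1 := Subgroup.relIndex_mul_index (le_sup_left : squares G ≤ squares G ⊔ f.ker)
  have h2 := Subgroup.relIndex_map_map f (squares G) ⊤
  rw [top_sup_eq, Subgroup.relIndex_top_right, ← MonoidHom.range_eq_map] at h2
  have h3 : (squares G).map f = f.range.map (powMonoidHom 2) := by
    rw [MonoidHom.map_range, MonoidHom.map_range]
    congr 1
    ext x : 1
    simp
  rw [h3, relIndex_map_sq_of_index_ne_zero hf] at h2
  rw [← h1, ← h2, mul_comm, Subgroup.relIndex_sup_left]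
  congr 1
  change (Subgroup.subgroupOf _ _).index = _
  congr 1
  ext x
  rw [Subgroup.mem_subgroupOf]
  constructor
  · rintro ⟨y, hy⟩
    have hy' : y ^ 2 = x := hy
    have h4 : f y ^ 2 = 1 := by rw [← map_pow, hy']; exact x.2
    have h5 : (2 : ℕ) • (f y).toAdd = 0 := h4
    have h6 : f y = 1 := by
      have := (smul_eq_zero.1 h5).resolve_left two_ne_zero
      exact congrArg Multiplicative.ofAdd this
    exact ⟨⟨y, h6⟩, Subtype.ext hy'⟩
  · rintro ⟨y, hy⟩
    exact ⟨y, congrArg Subtype.val hy⟩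

theorem index_squares_congr {G H : Type*} [CommGroup G] [CommGroup H] (e : G ≃* H) :
    (squares G).index = (squares H).index := by
  rw [← Subgroup.index_map_equiv (squares G) e]
  congr 1
  ext x
  constructor
  · rintro ⟨_, ⟨y, rfl⟩, rfl⟩
    exact ⟨e y, by simp⟩
  · rintro ⟨y, rfl⟩
    exact ⟨_, ⟨e.symm y, rfl⟩, by simp⟩

theorem index_squares_of_isCyclic (G : Type*) [CommGroup G] [Finite G] [IsCyclic G]
    (h : Even (Nat.card G)) : (squares G).index = 2 := by
  rw [IsCyclic.index_powMonoidHom_range]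
  exact Nat.gcd_eq_right h.two_dvd

variable (F : Type*) [Field F] [NumberField F]

theorem index_squares_units : (squares (𝓞 F)ˣ).index = 2 ^ Fintype.card (InfinitePlace F) := by
  let g : Units.torsion F × Multiplicative (Fin (Units.rank F) → ℤ) →* (𝓞 F)ˣ :=
    { toFun := fun x ↦ x.1 * ∏ i, Units.fundSystem F i ^ (x.2.toAdd i)
      map_one' := by simp
      map_mul' := fun x y ↦ by
        simp only [Prod.fst_mul, Prod.snd_mul, toAdd_mul, Pi.add_apply, zpow_add,
          Finset.prod_mul_distrib, Subgroup.coe_mul]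
        exact mul_mul_mul_comm _ _ _ _ }
  have hg : Function.Bijective g := by
    rw [Function.bijective_iff_existsUnique]
    intro u
    obtain ⟨x, hx, hx'⟩ := Units.exist_unique_eq_mul_prod F u
    exact ⟨(x.1, Multiplicative.ofAdd x.2), hx.symm, fun y hy ↦
      congrArg (fun z : _ × _ ↦ (z.1, Multiplicative.ofAdd z.2)) (hx' (y.1, y.2.toAdd) hy.symm)⟩
  let e : (MonoidHom.snd (Units.torsion F)
      (Multiplicative (Fin (Units.rank F) → ℤ))).ker ≃* Units.torsion F :=
    { toFun := fun x ↦ x.1.1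
      invFun := fun x ↦ ⟨(x, 1), rfl⟩
      left_inv := by
        rintro ⟨⟨x, y⟩, hy : y = 1⟩
        subst hy
        rfl
      right_inv := fun x ↦ rfl
      map_mul' := fun x y ↦ rfl }
  have hs : Function.Surjective (MonoidHom.snd (Units.torsion F)
      (Multiplicative (Fin (Units.rank F) → ℤ))) := fun y ↦ ⟨(1, y), rfl⟩
  rw [← index_squares_congr (MulEquiv.ofBijective g hg), index_squares_eq (MonoidHom.snd _ _)
    (by rw [MonoidHom.range_eq_top.2 hs]; simp), Fintype.card_fin,
    index_squares_congr e, index_squares_of_isCyclic,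
    Units.rank, ← pow_succ, Nat.sub_add_cancel Fintype.card_pos]
  exact Units.even_torsionOrder F

end

section

open NumberField IsDedekindDomain WithZero

noncomputable section

section SUnits

variable (F : Type*) [Field F] [NumberField F]

/-- The group of `S`-units of a number field. -/
def sUnits (S : Finset (HeightOneSpectrum (𝓞 F))) : Subgroup Fˣ where
  carrier := {x | ∀ 𝔭 ∉ S, 𝔭.valuation F (x : F) = 1}
  one_mem' := by simp
  mul_mem' hx hy 𝔭 h𝔭 := by rw [Units.val_mul, map_mul, hx 𝔭 h𝔭, hy 𝔭 h𝔭, one_mul]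
  inv_mem' hx 𝔭 h𝔭 := by rw [Units.val_inv_eq_inv_val, map_inv₀, hx 𝔭 h𝔭, inv_one]

/-- The elements of a number field with even valuation outside `S`. -/
def sSelmer (S : Finset (HeightOneSpectrum (𝓞 F))) : Subgroup Fˣ where
  carrier := {x | ∀ 𝔭 ∉ S, Even (log (𝔭.valuation F (x : F)))}
  one_mem' := by simp
  mul_mem' {x y} hx hy 𝔭 h𝔭 := by
    rw [Units.val_mul, map_mul, log_mul (by simp) (by simp)]
    exact (hx 𝔭 h𝔭).add (hy 𝔭 h𝔭)
  inv_mem' hx 𝔭 h𝔭 := by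
    rw [Units.val_inv_eq_inv_val, map_inv₀, log_inv]
    exact (hx 𝔭 h𝔭).neg

variable {F}

lemma valuation_eq_exp {𝔭 : HeightOneSpectrum (𝓞 F)} {y : 𝓞 F} {n : ℕ}
    (h1 : 𝔭.asIdeal ^ n ∣ Ideal.span {y}) (h2 : ¬ 𝔭.asIdeal ^ (n + 1) ∣ Ideal.span {y}) :
    𝔭.valuation F (y : F) = exp (-(n : ℤ)) := by
  rw [HeightOneSpectrum.valuation_of_algebraMap]
  rw [← HeightOneSpectrum.intValuation_le_pow_iff_dvd] at h1 h2
  refine le_antisymm h1 ?_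
  rw [not_le] at h2
  have h0 : 𝔭.intValuation y ≠ 0 := fun h ↦ by simp [h] at h2
  rw [← exp_log h0, exp_lt_exp] at h2
  rw [← exp_log h0, exp_le_exp]
  push_cast at h2
  omega

lemma HeightOneSpectrum.eq_of_dvd {𝔭 𝔮 : HeightOneSpectrum (𝓞 F)} (h : 𝔭.asIdeal ∣ 𝔮.asIdeal) :
    𝔭 = 𝔮 := by
  refine HeightOneSpectrum.ext ?_
  exact ((Ideal.dvd_iff_le.1 h |> (𝔮.isMaximal.eq_of_le 𝔭.isPrime.ne_top)).symm)

lemma exists_val_eq_exp_classNumber (𝔭 : HeightOneSpectrum (𝓞 F)) :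
    ∃ y : Fˣ, 𝔭.valuation F (y : F) = exp (-(classNumber F : ℤ)) ∧
      ∀ 𝔮 ≠ 𝔭, 𝔮.valuation F (y : F) = 1 := by
  have h0 : 𝔭.asIdeal ^ classNumber F ∈ nonZeroDivisors (Ideal (𝓞 F)) :=
    mem_nonZeroDivisors_of_ne_zero (pow_ne_zero _ 𝔭.ne_bot)
  have h1 : (𝔭.asIdeal ^ classNumber F).IsPrincipal := by
    rw [← ClassGroup.mk0_eq_one_iff h0]
    have : (⟨_, h0⟩ : nonZeroDivisors (Ideal (𝓞 F))) =
        ⟨𝔭.asIdeal, mem_nonZeroDivisors_of_ne_zero 𝔭.ne_bot⟩ ^ classNumber F := rfl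
    rw [this, map_pow]
    exact pow_card_eq_one
  obtain ⟨y, hy⟩ := h1.principal
  have hy' : 𝔭.asIdeal ^ classNumber F = Ideal.span {y} := hy
  have hy0 : y ≠ 0 := by
    rintro rfl
    exact pow_ne_zero _ 𝔭.ne_bot (hy'.trans (by simp))
  have hp := (Ideal.prime_of_isPrime 𝔭.ne_bot 𝔭.isPrime)
  refine ⟨Units.mk0 (y : F) (by exact_mod_cast hy0), ?_, fun 𝔮 h𝔮 ↦ ?_⟩
  · refine valuation_eq_exp (by rw [hy']) ?_
    rw [← hy']
    intro h
    have := (pow_dvd_pow_iff hp.ne_zero hp.not_isUnit).1 h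
    omega
  · have := valuation_eq_exp (𝔭 := 𝔮) (y := y) (n := 0) (by simp) ?_
    · simpa using this
    · rw [← hy', zero_add, pow_one]
      intro h
      exact h𝔮 (HeightOneSpectrum.eq_of_dvd
        ((Ideal.prime_of_isPrime 𝔮.ne_bot 𝔮.isPrime).dvd_of_dvd_pow h))

variable (F) in
lemma exists_generating : ∃ S₀ : Finset (HeightOneSpectrum (𝓞 F)),
    ∀ 𝔭 ∉ S₀, ∃ y : Fˣ, 𝔭.valuation F (y : F) = exp (-1) ∧
      ∀ 𝔮 ∉ S₀, 𝔮 ≠ 𝔭 → 𝔮.valuation F (y : F) = 1 := by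
  classical
  choose I hI using ClassGroup.mk0_surjective (R := 𝓞 F)
  have hfin : (⋃ c, {𝔮 : HeightOneSpectrum (𝓞 F) | 𝔮.asIdeal ∣ (I c : Ideal (𝓞 F))}).Finite :=
    Set.finite_iUnion fun c ↦ Ideal.finite_factors (nonZeroDivisors.ne_zero (I c).2)
  refine ⟨hfin.toFinset, fun 𝔭 h𝔭 ↦ ?_⟩
  have hS : ∀ 𝔮 ∉ hfin.toFinset, ∀ c, ¬ 𝔮.asIdeal ∣ (I c : Ideal (𝓞 F)) := by
    intro 𝔮 h c hc
    exact h (hfin.mem_toFinset.2 (Set.mem_iUnion.2 ⟨c, hc⟩))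
  let P : nonZeroDivisors (Ideal (𝓞 F)) := ⟨𝔭.asIdeal, mem_nonZeroDivisors_of_ne_zero 𝔭.ne_bot⟩
  obtain ⟨y, hy0, hy⟩ := ClassGroup.mk0_eq_mk0_inv_iff.1 (hI (ClassGroup.mk0 P)⁻¹)
  have hp := (Ideal.prime_of_isPrime 𝔭.ne_bot 𝔭.isPrime)
  let J : Ideal (𝓞 F) := (I (ClassGroup.mk0 P)⁻¹).1
  have hy' : J * 𝔭.asIdeal = Ideal.span {y} := hy
  refine ⟨Units.mk0 (y : F) (by exact_mod_cast hy0), ?_, fun 𝔮 h𝔮 hne ↦ ?_⟩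
  · have := valuation_eq_exp (𝔭 := 𝔭) (y := y) (n := 1) (by rw [← hy']; simp) ?_
    · simpa using this
    · rw [← hy', pow_succ, pow_one, mul_dvd_mul_iff_right hp.ne_zero]
      exact hS 𝔭 h𝔭 _
  · have := valuation_eq_exp (𝔭 := 𝔮) (y := y) (n := 0) (by simp) ?_
    · simpa using this
    · rw [← hy', zero_add, pow_one]
      intro h
      rcases (Ideal.prime_of_isPrime 𝔮.ne_bot 𝔮.isPrime).dvd_or_dvd h with h | h
      · exact hS 𝔮 h𝔮 _ h
      · exact hne (HeightOneSpectrum.eq_of_dvd h)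

/-- The valuations at the primes of `S`. -/
def sVal (S : Finset (HeightOneSpectrum (𝓞 F))) :
    sUnits F S →* Multiplicative (S → ℤ) where
  toFun u := Multiplicative.ofAdd fun 𝔭 ↦ log (𝔭.1.valuation F ((u : Fˣ) : F))
  map_one' := by
    refine congrArg Multiplicative.ofAdd (funext fun 𝔭 ↦ ?_ : _ = (0 : S → ℤ))
    simp
  map_mul' u v := by
    refine congrArg Multiplicative.ofAdd (funext fun 𝔭 ↦ ?_ : _ = (_ + _ : S → ℤ))
    simp [log_mul]

lemma index_range_sVal (S : Finset (HeightOneSpectrum (𝓞 F))) :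
    (sVal S).range.index ≠ 0 := by
  classical
  have : NeZero (classNumber F) := ⟨Fintype.card_ne_zero⟩
  have h1 := index_range_pow_multiplicative S (classNumber F)
  have hle : (powMonoidHom (classNumber F) :
      Multiplicative (S → ℤ) →* Multiplicative (S → ℤ)).range ≤ (sVal S).range := by
    rintro _ ⟨x, rfl⟩
    choose y hy hy' using exists_val_eq_exp_classNumber (F := F)
    let u : S → sUnits F S := fun 𝔭 ↦ ⟨y 𝔭.1, fun 𝔮 h𝔮 ↦ hy' _ 𝔮 (by rintro rfl; exact h𝔮 𝔭.2)⟩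
    refine ⟨∏ 𝔭, u 𝔭 ^ (-x.toAdd 𝔭), ?_⟩
    rw [map_prod]
    refine Multiplicative.toAdd.injective ?_
    rw [toAdd_prod]
    funext 𝔮
    rw [Finset.sum_apply, Finset.sum_eq_single 𝔮]
    · rw [map_zpow, toAdd_zpow, Pi.smul_apply]
      change (-x.toAdd 𝔮) • log (𝔮.1.valuation F (y 𝔮.1 : F)) = (classNumber F • x.toAdd) 𝔮
      rw [hy, log_exp]
      simp [mul_comm]
    · intro 𝔭 _ h𝔭
      rw [map_zpow, toAdd_zpow, Pi.smul_apply]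
      change (-x.toAdd 𝔭) • log (𝔮.1.valuation F (y 𝔭.1 : F)) = 0
      rw [hy' _ _ (fun h ↦ h𝔭 (Subtype.ext h.symm))]
      simp
    · simp
  intro h
  have := Subgroup.index_dvd_of_le hle
  rw [h, h1, zero_dvd_iff] at this
  exact pow_ne_zero _ (NeZero.ne _) this

lemma exists_unit_of_valuation {x : F} (hx : ∀ 𝔭 : HeightOneSpectrum (𝓞 F), 𝔭.valuation F x = 1)
    (hx0 : x ≠ 0) : ∃ u : (𝓞 F)ˣ, ((u : 𝓞 F) : F) = x := by
  obtain ⟨y, hy⟩ := HeightOneSpectrum.mem_integers_of_valuation_le_one (R := 𝓞 F) F x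
    fun 𝔭 ↦ (hx 𝔭).le
  obtain ⟨z, hz⟩ := HeightOneSpectrum.mem_integers_of_valuation_le_one (R := 𝓞 F) F x⁻¹
    fun 𝔭 ↦ by rw [map_inv₀, hx, inv_one]
  have h : y * z = 1 := by
    apply RingOfIntegers.coe_injective
    rw [map_mul, map_one]
    exact (congrArg₂ (· * ·) hy hz).trans (mul_inv_cancel₀ hx0)
  exact ⟨⟨y, z, h, by rw [mul_comm, h]⟩, hy⟩

lemma valuation_unit (u : (𝓞 F)ˣ) (𝔭 : HeightOneSpectrum (𝓞 F)) :
    𝔭.valuation F ((u : 𝓞 F) : F) = 1 := by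
  refine (HeightOneSpectrum.valuation_eq_one_iff_notMem (K := F) 𝔭).2 fun h ↦ ?_
  exact 𝔭.isPrime.ne_top (Ideal.eq_top_of_isUnit_mem _ h u.isUnit)

lemma index_squares_ker_sVal (S : Finset (HeightOneSpectrum (𝓞 F))) :
    (squares (sVal S).ker).index = 2 ^ Fintype.card (InfinitePlace F) := by
  rw [← index_squares_units]
  let f : (𝓞 F)ˣ →* Fˣ := Units.map (algebraMap (𝓞 F) F : 𝓞 F →* F)
  let g : (𝓞 F)ˣ →* (sVal S).ker := ((f.codRestrict (sUnits F S)
    (fun u 𝔭 _ ↦ valuation_unit u 𝔭)).codRestrict (sVal S).ker fun u ↦ by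
      refine congrArg Multiplicative.ofAdd (funext fun 𝔭 ↦ ?_ : _ = (0 : S → ℤ))
      change log (𝔭.1.valuation F ((u : 𝓞 F) : F)) = 0
      rw [valuation_unit, log_one])
  refine (index_squares_congr (MulEquiv.ofBijective g ⟨fun u v h ↦ ?_, ?_⟩)).symm
  · have : ((u : 𝓞 F) : F) = ((v : 𝓞 F) : F) := congrArg (fun z ↦ ((z.1 : Fˣ) : F)) h
    exact Units.ext (RingOfIntegers.coe_injective this)
  · rintro ⟨⟨x, hx⟩, hx'⟩
    have hx' : (fun 𝔭 : S ↦ log (𝔭.1.valuation F (x : F))) = 0 := hx'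
    have h1 : ∀ 𝔭 : HeightOneSpectrum (𝓞 F), 𝔭.valuation F (x : F) = 1 := by
      intro 𝔭
      by_cases h : 𝔭 ∈ S
      · have h2 : log (𝔭.valuation F (x : F)) = 0 := congrFun hx' ⟨𝔭, h⟩
        have h3 : 𝔭.valuation F (x : F) ≠ 0 := (Valuation.ne_zero_iff _).2 x.ne_zero
        rw [← exp_log h3, h2, exp_zero]
      · exact hx 𝔭 h
    obtain ⟨u, hu⟩ := exists_unit_of_valuation h1 x.ne_zero
    exact ⟨u, Subtype.ext (Subtype.ext (Units.ext hu))⟩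

lemma squares_relIndex_sUnits (S : Finset (HeightOneSpectrum (𝓞 F))) :
    (squares Fˣ).relIndex (sUnits F S) = 2 ^ (Fintype.card (InfinitePlace F) + S.card) := by
  have h := index_squares_eq (sVal S) (index_range_sVal S)
  rw [index_squares_ker_sVal, Fintype.card_coe, ← pow_add, add_comm] at h
  rw [← h]
  change (Subgroup.subgroupOf _ _).index = _
  congr 1
  ext x
  rw [Subgroup.mem_subgroupOf]
  constructor
  · rintro ⟨y, hy⟩
    have hy' : y ^ 2 = x := hy
    refine ⟨⟨y, fun 𝔭 h𝔭 ↦ ?_⟩, Subtype.ext hy'⟩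
    have h2 := x.2 𝔭 h𝔭
    rw [← hy', Units.val_pow_eq_pow_val, map_pow] at h2
    exact (pow_eq_one_iff_of_nonneg zero_le two_ne_zero).1 h2
  · rintro ⟨y, hy⟩
    exact ⟨y, congrArg Subtype.val hy⟩

variable (F) in
lemma exists_squares_relIndex_sSelmer : ∃ S₀ : Finset (HeightOneSpectrum (𝓞 F)), ∀ S, S₀ ⊆ S →
    (squares Fˣ).relIndex (sSelmer F S) = 2 ^ (Fintype.card (InfinitePlace F) + S.card) := by
  classical
  obtain ⟨S₀, hS₀⟩ := exists_generating F
  refine ⟨S₀, fun S hS ↦ ?_⟩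
  rw [← squares_relIndex_sUnits]
  have h : sSelmer F S = sUnits F S ⊔ squares Fˣ := by
    apply le_antisymm
    · intro x hx
      choose! y hy hy' using hS₀
      have hfin : {𝔭 : HeightOneSpectrum (𝓞 F) | 𝔭.valuation F (x : F) ≠ 1}.Finite := by
        refine ((HeightOneSpectrum.Support.finite (𝓞 F) (x : F)).union
          (HeightOneSpectrum.Support.finite (𝓞 F) (x : F)⁻¹)).subset fun 𝔭 h ↦ ?_
        rcases lt_or_gt_of_ne h with h | h
        · right
          change 1 < 𝔭.valuation F (x : F)⁻¹
          rw [map_inv₀]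
          exact (one_lt_inv₀ ((Valuation.pos_iff _).2 x.ne_zero)).2 h
        · exact Or.inl h
      let T := hfin.toFinset \ S
      let w : Fˣ := ∏ 𝔭 ∈ T, y 𝔭 ^ (log (𝔭.valuation F (x : F)) / 2)
      have hw : ∀ 𝔮 ∉ S, 𝔮.valuation F (w : F) ^ 2 * 𝔮.valuation F (x : F) = 1 := by
        intro 𝔮 h𝔮
        have hq0 : 𝔮 ∉ S₀ := fun h ↦ h𝔮 (hS h)
        have hx0 : 𝔮.valuation F (x : F) ≠ 0 := (Valuation.ne_zero_iff _).2 x.ne_zero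
        have hprod : 𝔮.valuation F (w : F) =
            ∏ 𝔭 ∈ T, 𝔮.valuation F (y 𝔭 : F) ^ (log (𝔭.valuation F (x : F)) / 2) := by
          simp only [w, Units.coe_prod, map_prod, Units.val_zpow_eq_zpow_val, map_zpow₀]
        have hne : ∀ 𝔭 ∈ T, 𝔭 ≠ 𝔮 →
            𝔮.valuation F (y 𝔭 : F) ^ (log (𝔭.valuation F (x : F)) / 2) = 1 := by
          intro 𝔭 h𝔭 h
          rw [hy' 𝔭 (fun h' ↦ (Finset.mem_sdiff.1 h𝔭).2 (hS h')) 𝔮 hq0 h.symm, one_zpow]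
        by_cases hT : 𝔮 ∈ T
        · rw [hprod, Finset.prod_eq_single 𝔮 hne (fun h ↦ absurd hT h), hy 𝔮 hq0]
          have h1 := Int.two_mul_ediv_two_of_even (hx 𝔮 h𝔮)
          rw [← exp_zsmul, ← exp_nsmul]
          nth_rewrite 2 [← exp_log hx0]
          rw [← exp_add, ← exp_zero]
          congr 1
          simp only [smul_eq_mul, nsmul_eq_mul]
          push_cast
          linarith
        · rw [hprod, Finset.prod_eq_one fun 𝔭 h𝔭 ↦ hne 𝔭 h𝔭 (by rintro rfl; exact hT h𝔭)]
          have : 𝔮.valuation F (x : F) = 1 := by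
            by_contra h
            exact hT (Finset.mem_sdiff.2 ⟨hfin.mem_toFinset.2 h, h𝔮⟩)
          rw [this, one_pow, one_mul]
      refine Subgroup.mem_sup.2 ⟨w ^ 2 * x, fun 𝔮 h𝔮 ↦ ?_, (w⁻¹) ^ 2, ⟨w⁻¹, rfl⟩, ?_⟩
      · rw [Units.val_mul, Units.val_pow_eq_pow_val, map_mul, map_pow]
        exact hw 𝔮 h𝔮
      · rw [mul_comm, ← mul_assoc, ← mul_pow, inv_mul_cancel, one_pow, one_mul]
    · rw [sup_le_iff]
      refine ⟨fun x hx 𝔭 h𝔭 ↦ by rw [hx 𝔭 h𝔭]; simp, ?_⟩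
      rintro _ ⟨x, rfl⟩ 𝔭 -
      simp
  rw [h, Subgroup.relIndex_sup_right]

lemma le_squares_relIndex_sSelmer (S : Finset (HeightOneSpectrum (𝓞 F))) :
    2 ^ (Fintype.card (InfinitePlace F) + S.card) ≤ (squares Fˣ).relIndex (sSelmer F S) := by
  classical
  obtain ⟨S₀, hS₀⟩ := exists_squares_relIndex_sSelmer F
  suffices h : ∀ T S : Finset (HeightOneSpectrum (𝓞 F)), S₀ ⊆ S ∪ T →
      2 ^ (Fintype.card (InfinitePlace F) + S.card) ≤ (squares Fˣ).relIndex (sSelmer F S) from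
    h S₀ S Finset.subset_union_right
  intro T
  induction T using Finset.induction_on with
  | empty => intro S hS; exact (hS₀ S (by simpa using hS)).ge
  | insert 𝔭 T _ ih =>
    intro S hS
    by_cases hp : 𝔭 ∈ S
    · exact ih S fun 𝔮 h𝔮 ↦ by
        rcases Finset.mem_union.1 (hS h𝔮) with h | h
        · exact Finset.mem_union_left _ h
        · rcases Finset.mem_insert.1 h with rfl | h
          · exact Finset.mem_union_left _ hp
          · exact Finset.mem_union_right _ h
    have h1 := ih (insert 𝔭 S) (by rwa [Finset.insert_union, ← Finset.union_insert])
    rw [Finset.card_insert_of_notMem hp] at h1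
    have hle : sSelmer F S ≤ sSelmer F (insert 𝔭 S) :=
      fun x hx 𝔮 h𝔮 ↦ hx 𝔮 fun h ↦ h𝔮 (Finset.mem_insert_of_mem h)
    have hsq : squares Fˣ ≤ sSelmer F S := by
      rintro _ ⟨x, rfl⟩ 𝔭 -
      simp
    rw [← Subgroup.relIndex_mul_relIndex _ _ _ hsq hle] at h1
    have h2 : (sSelmer F S).relIndex (sSelmer F (insert 𝔭 S)) ∣ 2 := by
      rw [Subgroup.relIndex_dvd_two_iff]
      by_cases h : ∃ a ∈ sSelmer F (insert 𝔭 S), a ∉ sSelmer F S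
      · obtain ⟨a, ha, ha'⟩ := h
        have key : ∀ b ∈ sSelmer F (insert 𝔭 S), b ∉ sSelmer F S →
            ¬ Even (log (𝔭.valuation F (b : F))) := fun b hb hb' he ↦ hb' fun 𝔮 h𝔮 ↦ by
          by_cases h : 𝔮 = 𝔭
          · rwa [h]
          · exact hb 𝔮 (by simp [h, h𝔮])
        refine ⟨a, ha, fun b hb ↦ or_iff_not_imp_right.2 fun hb' 𝔮 h𝔮 ↦ ?_⟩
        by_cases h : 𝔮 = 𝔭
        · rw [h, Units.val_mul, map_mul, log_mul (by simp) (by simp)]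
          exact (Int.not_even_iff_odd.1 (key b hb hb')).add_odd
            (Int.not_even_iff_odd.1 (key a ha ha'))
        · exact (mul_mem hb ha) 𝔮 (by simp [h, h𝔮])
      · push Not at h
        exact ⟨1, one_mem _, fun b hb ↦ Or.inr (h b hb)⟩
    have h3 := Nat.le_of_dvd two_pos h2
    have h4 := Nat.mul_le_mul_left ((squares Fˣ).relIndex (sSelmer F S)) h3
    rw [← add_assoc, pow_succ] at h1
    omega

end SUnits

end

end

section

open NumberField IsDedekindDomain WithZero

section ResidueSubring

variable {L : Type*} [Field L]

local notation "κ(" A ")" => IsLocalRing.ResidueField A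

/-- The valuation ring of the residue field of `A` induced by a valuation ring contained in `A`. -/
def residueValuationSubring (A B : ValuationSubring L) : ValuationSubring κ(A) :=
  { Subring.map (IsLocalRing.residue A) (Subring.comap A.subtype B.toSubring) with
    mem_or_inv_mem' := by
      intro ξ
      change ξ ∈ Subring.map _ _ ∨ ξ⁻¹ ∈ Subring.map _ _
      obtain ⟨⟨x, hx⟩, rfl⟩ := IsLocalRing.residue_surjective ξ
      by_cases h0 : IsLocalRing.residue A ⟨x, hx⟩ = 0
      · exact Or.inl (by rw [h0]; exact zero_mem _)
      rcases B.mem_or_inv_mem x with h | h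
      · exact Or.inl ⟨_, h, rfl⟩
      · have hv := (residue_ne_zero_iff hx).1 h0
        have hx0 : x ≠ 0 := by rintro rfl; simp at hv
        have hi : x⁻¹ ∈ A := (A.valuation_le_one_iff _).1 (by rw [map_inv₀, hv, inv_one])
        refine Or.inr ⟨⟨x⁻¹, hi⟩, h, ?_⟩
        rw [eq_comm, inv_eq_iff_eq_inv]
        refine eq_inv_of_mul_eq_one_left ?_
        rw [← map_mul, ← map_one (IsLocalRing.residue A)]
        congr 1
        exact Subtype.ext (mul_inv_cancel₀ hx0) }

lemma mem_residueValuationSubring {A B : ValuationSubring L} (hBA : B ≤ A) {x : L} (hx : x ∈ A) :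
    IsLocalRing.residue A ⟨x, hx⟩ ∈ residueValuationSubring A B ↔ x ∈ B := by
  constructor
  · rintro ⟨⟨y, hy⟩, hyB, hxy⟩
    have h1 : IsLocalRing.residue A ⟨x - y, sub_mem hx hy⟩ = 0 := by
      rw [show (⟨x - y, sub_mem hx hy⟩ : A) = ⟨x, hx⟩ - ⟨y, hy⟩ from rfl, map_sub, sub_eq_zero]
      exact hxy.symm
    rw [residue_eq_zero_iff] at h1
    have h2 : x - y ∈ B := by
      by_contra h
      have h3 : (x - y)⁻¹ ∈ A := hBA ((B.mem_or_inv_mem _).resolve_left h)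
      rw [← A.valuation_le_one_iff, map_inv₀] at h3
      have h4 : x - y ≠ 0 := by rintro h4; exact h (by rw [h4]; exact zero_mem _)
      exact absurd h3 (not_le.2 ((one_lt_inv₀ (by simpa [zero_lt_iff] using h4)).2 h1))
    simpa using add_mem h2 (hyB : y ∈ B)
  · exact fun h ↦ ⟨_, h, rfl⟩

lemma val_eq_one_iff_mem (B : ValuationSubring L) {x : L} :
    B.valuation x = 1 ↔ x ≠ 0 ∧ x ∈ B ∧ x⁻¹ ∈ B := by
  constructor
  · intro h
    refine ⟨by rintro rfl; simp at h, (B.valuation_le_one_iff _).1 h.le,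
      (B.valuation_le_one_iff _).1 (by rw [map_inv₀, h, inv_one])⟩
  · rintro ⟨h0, h1, h2⟩
    rw [← B.valuation_le_one_iff] at h1 h2
    rw [map_inv₀] at h2
    exact le_antisymm h1 ((inv_le_one₀ (by simpa [zero_lt_iff] using h0)).1 h2)

lemma exists_heightOne_of_ne_top {F : Type*} [Field F] [NumberField F] {B : ValuationSubring F}
    (hB : B ≠ ⊤) : ∃ 𝔭 : HeightOneSpectrum (𝓞 F), ∀ x : F, 𝔭.valuation F x = 1 →
      B.valuation x = 1 := by
  have h_int : ∀ a : 𝓞 F, (a : F) ∈ B := fun a ↦ by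
    have h1 : IsIntegral ℤ (a : F) := RingOfIntegers.isIntegral_coe a
    have h2 : IsIntegral B (a : F) := h1.tower_top
    obtain ⟨y, hy⟩ := IsIntegrallyClosed.isIntegral_iff.1 h2
    rw [← hy]
    exact y.2
  let f : 𝓞 F →+* B := (algebraMap (𝓞 F) F).codRestrict B.toSubring h_int
  let P : Ideal (𝓞 F) := (IsLocalRing.maximalIdeal B).comap f
  have hP : ∀ a : 𝓞 F, a ∈ P ↔ B.valuation (a : F) < 1 := fun a ↦ by
    rw [Ideal.mem_comap, ValuationSubring.valuation_lt_one_iff]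
    rfl
  have hP0 : P ≠ ⊥ := by
    intro h
    refine hB (eq_top_iff.2 fun x _ ↦ ?_)
    obtain ⟨a, b, hb, rfl⟩ := IsFractionRing.div_surjective (A := 𝓞 F) x
    rw [div_eq_mul_inv]
    refine mul_mem (h_int a) ?_
    have h1 : ¬ B.valuation (b : F) < 1 := by
      rw [← hP, h, Ideal.mem_bot]
      exact nonZeroDivisors.ne_zero hb
    rw [← B.valuation_le_one_iff, map_inv₀]
    exact inv_le_one_of_one_le₀ (not_lt.1 h1)
  let 𝔭 : HeightOneSpectrum (𝓞 F) := ⟨P, Ideal.comap_isPrime _ _, hP0⟩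
  have hle : ∀ x : F, 𝔭.valuation F x ≤ 1 → x ∈ B := by
    intro x hx
    obtain ⟨n, d, h⟩ := 𝔭.exists_primeCompl_mul_eq_of_integer x hx
    have h1 : B.valuation ((d : 𝓞 F) : F) = 1 := by
      refine le_antisymm ((B.valuation_le_one_iff _).2 (h_int _)) (not_lt.1 fun h' ↦ ?_)
      exact d.2 ((hP _).2 h')
    have h2 := congrArg B.valuation h
    rw [map_mul] at h2
    have h3 : B.valuation x * 1 = B.valuation ((n : 𝓞 F) : F) := by rw [← h1]; exact h2
    rw [← B.valuation_le_one_iff, ← mul_one (B.valuation x), h3]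
    exact (B.valuation_le_one_iff _).2 (h_int _)
  refine ⟨𝔭, fun x hx ↦ ?_⟩
  rw [val_eq_one_iff_mem]
  refine ⟨by rintro rfl; simp at hx, hle x hx.le, hle _ ?_⟩
  rw [map_inv₀, hx, inv_one]

end ResidueSubring

section FamSound

variable {L V : Type*} [Field L] [CommGroup V] {e : V} {R : V → V → V → Prop} {q : Lˣ →* V}
  {A : ValuationSubring L} {H J : Subgroup V} {ϖ : L}

local notation "κ(" A ")" => IsLocalRing.ResidueField A

lemma Cl.mul_mem {H' : Subgroup V} (h : Cl (Good e R) H') {x y : V} (hx : x ∉ H') (hy : y ∉ H') :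
    x * y ∈ H' := by
  classical
  obtain ⟨G, hG, hZ⟩ := h {x, y, x * y}
  rw [← hZ _ (by simp)]
  exact hG.index _ _ (by rwa [hZ _ (by simp)]) (by rwa [hZ _ (by simp)])

/-- Members of the family of `H` are parity groups of primes of the residue field. -/
lemma Fam.exists_heightOne [CharZero L] [NumberField κ(A)] (I : Interp e R q) (hL : IsCurve L)
    (D : DVPair q A H ϖ) (hJ : Fam e R H J) :
    ∃ 𝔭 : HeightOneSpectrum (𝓞 κ(A)), ∀ x (hx : x ∈ A), A.valuation x = 1 →
      (Pull q J x ↔ Even (log (𝔭.valuation κ(A) (IsLocalRing.residue A ⟨x, hx⟩)))) := by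
  obtain ⟨H', hcl, hT, hne, rfl⟩ := hJ
  have hidx := fun x y (hx : x ∉ H') hy ↦ hcl.mul_mem (x := x) (y := y) hx hy
  obtain ⟨B, -, hB⟩ := hcl.exists_valuationSubring (q := q) ∅ fun G hG ↦ by
    obtain ⟨A', ϖ', D', -⟩ := I.exists_dvPair_of_good hL hG
    exact ⟨A', by simp, D'.unit_mem⟩
  have hBA : B ≤ A := by
    by_contra h
    exact hne (by rw [eq_top_of_not_le I D hT hB h]; exact le_top)
  obtain ⟨h, hhH, hhH'⟩ := SetLike.not_le_iff_exists.1 hne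
  obtain ⟨h, rfl⟩ := I.surj h
  rw [← pull_coe] at hhH hhH'
  obtain ⟨u, y, hu, hy, huy⟩ := exists_unit_mul_sq I D hhH
  rw [huy, I.pull_mul_sq hy] at hhH'
  have hmem : ∀ {x : L}, A.valuation x = 1 → x ∈ A := fun hx ↦ (A.valuation_le_one_iff _).1 hx.le
  have hunit : ∀ x (hx : x ∈ A), (residueValuationSubring A B).valuation
      (IsLocalRing.residue A ⟨x, hx⟩) = 1 → Pull q H' x := by
    intro x hx h
    refine hB x ?_
    rw [val_eq_one_iff_mem] at h ⊢
    obtain ⟨h0, h1, h2⟩ := h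
    have hv := (residue_ne_zero_iff hx).1 h0
    have hx0 : x ≠ 0 := by rintro rfl; simp at hv
    have hv' : A.valuation x⁻¹ = 1 := by rw [map_inv₀, hv, inv_one]
    refine ⟨hx0, (mem_residueValuationSubring hBA hx).1 h1, ?_⟩
    refine (mem_residueValuationSubring hBA (hmem hv')).1 ?_
    convert h2 using 1
    refine eq_inv_of_mul_eq_one_left ?_
    rw [← map_mul, ← map_one (IsLocalRing.residue A)]
    congr 1
    exact Subtype.ext (inv_mul_cancel₀ hx0)
  have htop : residueValuationSubring A B ≠ ⊤ := by
    intro h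
    refine hhH' (hunit u (hmem hu) ?_)
    rw [h, val_eq_one_iff_mem]
    exact ⟨(residue_ne_zero_iff _).2 hu, trivial, trivial⟩
  obtain ⟨𝔭, h𝔭⟩ := exists_heightOne_of_ne_top htop
  refine ⟨𝔭, ?_⟩
  have hunit' : ∀ x (hx : x ∈ A), 𝔭.valuation κ(A) (IsLocalRing.residue A ⟨x, hx⟩) = 1 →
      Pull q H' x := fun x hx h ↦ hunit x hx (h𝔭 _ h)
  obtain ⟨π, hπ⟩ := 𝔭.valuation_exists_uniformizer κ(A)
  obtain ⟨⟨π, hπA⟩, rfl⟩ := IsLocalRing.residue_surjective π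
  have hπ' : 𝔭.valuation κ(A) (IsLocalRing.residue A ⟨π, hπA⟩) = exp (-1) := hπ
  have hπv : A.valuation π = 1 := (residue_ne_zero_iff hπA).1 fun h ↦ by
    rw [h, map_zero] at hπ'
    exact exp_ne_zero hπ'.symm
  have hπ0 : π ≠ 0 := by rintro rfl; simp at hπv
  have hres : ∀ (x : L) (hx : x ∈ A) (n : ℤ) (hxn : x * π ^ n ∈ A),
      IsLocalRing.residue A ⟨x * π ^ n, hxn⟩ =
        IsLocalRing.residue A ⟨x, hx⟩ * IsLocalRing.residue A ⟨π, hπA⟩ ^ n := by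
    intro x hx n hxn
    obtain ⟨u, hu⟩ : IsUnit (⟨π, hπA⟩ : A) := (A.valuation_eq_one_iff _).2 hπv
    have h1 : (⟨x * π ^ n, hxn⟩ : A) = ⟨x, hx⟩ * ((u ^ n : Aˣ) : A) := by
      apply Subtype.ext
      change x * π ^ n = x * ((Units.map (A.subtype : A →* L) (u ^ n) : Lˣ) : L)
      rw [map_zpow, Units.val_zpow_eq_zpow_val, Units.coe_map]
      simp [hu]
    have h2 : IsLocalRing.residue A ((u ^ n : Aˣ) : A) = IsLocalRing.residue A ⟨π, hπA⟩ ^ n := by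
      change ((Units.map (IsLocalRing.residue A : A →* κ(A)) (u ^ n) : κ(A)ˣ) : κ(A)) = _
      rw [map_zpow, Units.val_zpow_eq_zpow_val, Units.coe_map, hu]
      rfl
    rw [h1, map_mul, h2]
  have key : ∀ x (hx : x ∈ A), A.valuation x = 1 → ∃ n : ℤ,
      log (𝔭.valuation κ(A) (IsLocalRing.residue A ⟨x, hx⟩)) = n ∧ Pull q H' (x * π ^ n) := by
    intro x hx hv
    refine ⟨_, rfl, ?_⟩
    set n := log (𝔭.valuation κ(A) (IsLocalRing.residue A ⟨x, hx⟩))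
    have hm : x * π ^ n ∈ A := hmem (by rw [map_mul, map_zpow₀, hv, hπv]; simp)
    refine hunit' _ hm ?_
    have hx0 : 𝔭.valuation κ(A) (IsLocalRing.residue A ⟨x, hx⟩) ≠ 0 :=
      (Valuation.ne_zero_iff _).2 ((residue_ne_zero_iff hx).2 hv)
    rw [hres x hx, map_mul, map_zpow₀, hπ', ← exp_zsmul, ← exp_log hx0, ← exp_add, ← exp_zero]
    congr 1
    simp [n]
  have hπH : ¬ Pull q H' π := by
    intro h
    obtain ⟨n, -, hn⟩ := key u (hmem hu) hu
    exact hhH' ((pull_mul_right_iff (h.zpow n)).1 hn)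
  intro x hx hv
  obtain ⟨n, hn, hxn⟩ := key x hx hv
  have h1 : Pull q (H' ⊓ H) x ↔ Pull q H' x := by
    refine ⟨fun h ↦ h.mono inf_le_left, ?_⟩
    rintro ⟨u, rfl, hu⟩
    exact ⟨u, rfl, hu, pull_coe _ |>.1 (D.unit_mem _ hv)⟩
  rw [h1, hn]
  have hsq : ∀ m : ℤ, Pull q H' (π ^ (m + m)) := fun m ↦ by
    rw [zpow_add₀ hπ0, ← sq]
    exact I.pull_sq (zpow_ne_zero m hπ0)
  constructor
  · intro h
    by_contra hodd
    obtain ⟨m, hm⟩ := Int.not_even_iff_odd.1 hodd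
    have h2 : Pull q H' (π ^ n) := (pull_mul_left_iff h).1 hxn
    rw [hm, two_mul, zpow_add₀ hπ0, zpow_one] at h2
    exact hπH ((pull_mul_left_iff (hsq m)).1 h2)
  · rintro ⟨m, rfl⟩
    exact (pull_mul_right_iff (hsq m)).1 hxn

lemma Fam.le (hJ : Fam e R H J) : J ≤ H := by
  obtain ⟨H', -, -, -, rfl⟩ := hJ
  exact inf_le_right

open Classical in
/-- A bound for the number of infinite places of the residue field. -/
lemma card_infinitePlace_le_of_relIndex_le [CharZero L] [NumberField κ(A)] (I : Interp e R q)
    (hL : IsCurve L) (D : DVPair q A H ϖ) (n : ℕ) (S : Finset (Subgroup V))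
    (hS : ∀ J ∈ S, Fam e R H J)
    (h0 : (TT R H).relIndex (H ⊓ sInf ({J | Fam e R H J} \ S)) ≠ 0)
    (h1 : (TT R H).relIndex (H ⊓ sInf ({J | Fam e R H J} \ S)) ≤ 2 ^ (n + S.card)) :
    Fintype.card (InfinitePlace κ(A)) ≤ n := by
  choose P hP using fun J : {J // Fam e R H J} ↦ Fam.exists_heightOne I hL D J.2
  have hinj' : ∀ J₁ J₂ : {J // Fam e R H J}, P J₁ = P J₂ → J₁.1 ≤ J₂.1 := by
    rintro J₁ J₂ h v hv
    obtain ⟨v, rfl⟩ := I.surj v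
    have hH : Pull q H v := pull_coe _ |>.2 (J₁.2.le hv)
    obtain ⟨u, y, hu, hy, huy⟩ := exists_unit_mul_sq I D hH
    have huA : u ∈ A := (A.valuation_le_one_iff _).1 hu.le
    rw [← pull_coe, huy, I.pull_mul_sq hy, hP _ u huA hu] at hv ⊢
    rwa [← h]
  have hinj : Function.Injective P := fun J₁ J₂ h ↦
    Subtype.ext (le_antisymm (hinj' _ _ h) (hinj' _ _ h.symm))
  let T : Finset (HeightOneSpectrum (𝓞 κ(A))) := S.attach.image fun J ↦ P ⟨J.1, hS J.1 J.2⟩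
  have hT : T.card = S.card := by
    rw [Finset.card_image_of_injective, Finset.card_attach]
    intro J₁ J₂ h
    have h2 := congrArg Subtype.val (hinj h)
    exact Subtype.ext h2
  let r : Aˣ →* κ(A)ˣ := Units.map (IsLocalRing.residue A : A →* κ(A))
  let s : Aˣ →* V := q.comp (Units.map (A.subtype : A →* L))
  have hr : Function.Surjective r :=
    IsLocalRing.surjective_units_map_of_local_ringHom _ IsLocalRing.residue_surjective
      inferInstance
  have hv : ∀ x : Aˣ, A.valuation (x : L) = 1 := fun x ↦ A.valuation_unit x
  have hpull : ∀ (x : Aˣ) (J : Subgroup V), s x ∈ J ↔ Pull q J ((x : A) : L) := fun x J ↦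
    (pull_coe (H := J) (Units.map (A.subtype : A →* L) x)).symm
  have hTT : (TT R H).comap s = (squares κ(A)ˣ).comap r := by
    ext x
    rw [Subgroup.mem_comap, hpull, pull_TT_iff_isSquare I D (hv x) (x : A).2, Subgroup.mem_comap,
      MonoidHom.mem_range]
    constructor
    · rintro ⟨z, hz⟩
      have hz0 : z ≠ 0 := by
        rintro rfl
        exact (r x).ne_zero (hz.trans (mul_zero 0))
      exact ⟨Units.mk0 z hz0, Units.ext (by rw [powMonoidHom_apply, sq]; exact hz.symm)⟩
    · rintro ⟨z, hz⟩
      refine ⟨z, ?_⟩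
      rw [← sq]
      exact (congrArg Units.val hz).symm
  have hle : ((sSelmer κ(A) T).comap r).map s ≤ H ⊓ sInf ({J | Fam e R H J} \ S) := by
    rw [Subgroup.map_le_iff_le_comap]
    intro x hx
    refine ⟨(hpull _ _).2 (D.unit_mem _ (hv x)), Subgroup.mem_sInf.2 ?_⟩
    rintro J ⟨hJ, hJS⟩
    rw [hpull, hP ⟨J, hJ⟩ _ (x : A).2 (hv x)]
    refine hx _ fun h ↦ hJS ?_
    obtain ⟨J', -, hJ'⟩ := Finset.mem_image.1 h
    have h2 := congrArg Subtype.val (hinj hJ')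
    change J'.1 = J at h2
    exact h2 ▸ J'.2
  have h2 : (squares κ(A)ˣ).relIndex (sSelmer κ(A) T) ≤ 2 ^ (n + S.card) := by
    refine le_trans ?_ h1
    rw [← Subgroup.map_comap_eq_self_of_surjective hr (sSelmer κ(A) T), ← Subgroup.relIndex_comap,
      ← hTT, Subgroup.relIndex_comap]
    exact Subgroup.relIndex_le_of_le_right hle h0
  have h3 := (le_squares_relIndex_sSelmer T).trans h2
  rw [hT] at h3
  have h4 := (Nat.pow_le_pow_iff_right (by norm_num)).1 h3
  omega

end FamSound

end

section Lift

variable {k : Type*} [Field k] {a b : k} {K : Type*} [Field K] {ι : k →+* K}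

lemma eval₂_coprod_mk {S : Type*} [CommRing S] (g : ConicRing k a b →+* S) (σ : k →+* S)
    (hσ : g.comp (algebraMap k (ConicRing k a b)) = σ) (P : MvPolynomial (Fin 2) k) :
    g (Ideal.Quotient.mk _ P) = MvPolynomial.eval₂ σ
      ![g (Ideal.Quotient.mk _ (X 0)), g (Ideal.Quotient.mk _ (X 1))] P := by
  have : g.comp (Ideal.Quotient.mk _) = MvPolynomial.eval₂Hom σ
      ![g (Ideal.Quotient.mk _ (X 0)), g (Ideal.Quotient.mk _ (X 1))] := by
    apply MvPolynomial.ringHom_ext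
    · intro c
      rw [← hσ]; simp; rfl
    · intro i
      fin_cases i <;> simp
  exact congrFun (congrArg DFunLike.coe this) P

/-- Generators of a conic function field, with their universal property. -/
lemma IsConicFunctionField.exists_lift.{w} (ha : a ≠ 0) (hK : IsConicFunctionField k a b K ι) :
    ∃ x y : K, ι a * x ^ 2 + ι b * y ^ 2 = 1 ∧
      (∀ z : K, ∃ P Q : MvPolynomial (Fin 2) k, MvPolynomial.eval₂ ι ![x, y] Q ≠ 0 ∧
        z = MvPolynomial.eval₂ ι ![x, y] P / MvPolynomial.eval₂ ι ![x, y] Q) ∧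
      ∀ (M : Type w) [Field M] (σ : k →+* M) (u v : M), σ a * u ^ 2 + σ b * v ^ 2 = 1 →
        (∀ p : Polynomial k, p.eval₂ σ v = 0 → p = 0) →
        ∃ j : K →+* M, j.comp ι = σ ∧ j x = u ∧ j y = v := by
  obtain ⟨f, hf, hι, hz⟩ := hK
  have hfe := eval₂_coprod_mk f ι hι
  refine ⟨f (Ideal.Quotient.mk _ (X 0)), f (Ideal.Quotient.mk _ (X 1)), ?_, fun z => ?_, ?_⟩
  · have h1 := hfe (conicPoly k a b)
    rw [Ideal.Quotient.eq_zero_iff_mem.2 (Ideal.mem_span_singleton_self _), map_zero] at h1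
    generalize f (Ideal.Quotient.mk _ (X 0)) = x at h1 ⊢
    generalize f (Ideal.Quotient.mk _ (X 1)) = y at h1 ⊢
    simp [conicPoly] at h1
    linear_combination -h1
  · obtain ⟨p, q, hq, h⟩ := hz z
    obtain ⟨P, rfl⟩ := Ideal.Quotient.mk_surjective p
    obtain ⟨Q, rfl⟩ := Ideal.Quotient.mk_surjective q
    exact ⟨P, Q, by rwa [← hfe], by rwa [← hfe, ← hfe]⟩
  · intro M _ σ u v huv hv
    have hdom : IsDomain (ConicRing k a b) := hf.isDomain
    let g : ConicRing k a b →+* M := Ideal.Quotient.lift _ (MvPolynomial.eval₂Hom σ ![u, v]) (by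
      intro P hP
      obtain ⟨Q, rfl⟩ := Ideal.mem_span_singleton.1 hP
      rw [map_mul]
      refine mul_eq_zero_of_left ?_ _
      simp [conicPoly]
      linear_combination huv)
    have hgX0 : g (Ideal.Quotient.mk _ (X 0)) = u := by simp [g]
    have hgX1 : g (Ideal.Quotient.mk _ (X 1)) = v := by simp [g]
    have hgC : ∀ c : k, g (algebraMap k _ c) = σ c := fun c => by
      change g (Ideal.Quotient.mk _ (C c)) = _
      simp [g]
    let φ : Polynomial k →+* ConicRing k a b :=
      Polynomial.eval₂RingHom (algebraMap k _) (Ideal.Quotient.mk _ (X 1))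
    have hgφ : ∀ p, g (φ p) = p.eval₂ σ v := fun p => by
      have : g.comp φ = Polynomial.eval₂RingHom σ v := by
        apply Polynomial.ringHom_ext
        · intro c; simp [φ, hgC]
        · simp [φ, hgX1]
      exact congrFun (congrArg DFunLike.coe this) p
    have hφC : ∀ c, φ.IsIntegralElem (algebraMap k _ c) := fun c => by
      have : φ (Polynomial.C c) = algebraMap k _ c := by simp [φ]
      rw [← this]
      exact φ.isIntegralElem_map
    have hX1 : φ.IsIntegralElem (Ideal.Quotient.mk _ (X 1)) := by
      have : φ Polynomial.X = Ideal.Quotient.mk _ (X 1) := by simp [φ]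
      rw [← this]
      exact φ.isIntegralElem_map
    have hX0 : φ.IsIntegralElem (Ideal.Quotient.mk _ (X 0)) := by
      have h1 : (Ideal.Quotient.mk _ (X 0) : ConicRing k a b) ^ 2 =
          algebraMap k _ a⁻¹ * (1 - algebraMap k _ b * (Ideal.Quotient.mk _ (X 1)) ^ 2) := by
        have h2 : (Ideal.Quotient.mk _ (conicPoly k a b) : ConicRing k a b) = 0 :=
          Ideal.Quotient.eq_zero_iff_mem.2 (Ideal.mem_span_singleton_self _)
        have h3 : (algebraMap k (ConicRing k a b) a) * (Ideal.Quotient.mk _ (X 0)) ^ 2 +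
          (algebraMap k (ConicRing k a b) b) * (Ideal.Quotient.mk _ (X 1)) ^ 2 - 1 = 0 := by
          rw [← h2]; simp [conicPoly]; rfl
        have h4 : algebraMap k (ConicRing k a b) a⁻¹ * algebraMap k (ConicRing k a b) a = 1 := by
          rw [← map_mul, inv_mul_cancel₀ ha, map_one]
        linear_combination (algebraMap k (ConicRing k a b) a⁻¹) * h3 -
          (Ideal.Quotient.mk _ (X 0)) ^ 2 * h4
      let _ : Algebra (Polynomial k) (ConicRing k a b) := φ.toAlgebra
      refine IsIntegral.of_pow (R := Polynomial k) (n := 2) (by norm_num) ?_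
      rw [h1, sq]
      exact (hφC _).mul _ ((φ.isIntegralElem_one).sub _ ((hφC _).mul _ (hX1.mul _ hX1)))
    have h_int : φ.IsIntegral := by
      intro z
      obtain ⟨P, rfl⟩ := Ideal.Quotient.mk_surjective z
      induction P using MvPolynomial.induction_on with
      | C c => exact hφC c
      | add p q hp hq => rw [map_add]; exact hp.add _ hq
      | mul_X p i hp =>
        rw [map_mul]
        refine hp.mul _ ?_
        fin_cases i
        · exact hX0
        · exact hX1
    let _ : Algebra (Polynomial k) (ConicRing k a b) := φ.toAlgebra
    have : Algebra.IsIntegral (Polynomial k) (ConicRing k a b) := ⟨h_int⟩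
    have hker : RingHom.ker g = ⊥ := by
      refine Ideal.eq_bot_of_comap_eq_bot (R := Polynomial k) ?_
      rw [eq_bot_iff]
      intro p hp
      exact hv p (by rw [← hgφ]; exact hp)
    have hginj : Function.Injective g := (RingHom.injective_iff_ker_eq_bot g).2 hker
    let _ : Algebra (ConicRing k a b) K := f.toAlgebra
    have : FaithfulSMul (ConicRing k a b) K := (faithfulSMul_iff_algebraMap_injective _ _).2 hf
    have : IsFractionRing (ConicRing k a b) K := by
      refine IsFractionRing.of_field _ _ fun z => ?_
      obtain ⟨p, q, -, h⟩ := hz z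
      exact ⟨p, q, h⟩
    have hj : ∀ z, IsFractionRing.lift (K := K) hginj (f z) = g z :=
      fun z => IsFractionRing.lift_algebraMap hginj z
    refine ⟨IsFractionRing.lift hginj, ?_, ?_, ?_⟩
    · ext c
      rw [RingHom.comp_apply, ← hι, RingHom.comp_apply, hj, hgC]
    · rw [hj, hgX0]
    · rw [hj, hgX1]

end Lift

section Param

variable {F : Type*} [Field F]

lemma RatFunc.eval₂_eq_zero_of_ne_C {k : Type*} [Field k] (σ : k →+* F) {g : RatFunc F}
    (hg : ∀ c, g ≠ RatFunc.C c) {p : Polynomial k}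
    (hp : p.eval₂ ((RatFunc.C : F →+* RatFunc F).comp σ) g = 0) : p = 0 := by
  have h1 := RatFunc.transcendental_of_ne_C (f := g) (fun ⟨c, hc⟩ => hg c hc)
  rw [transcendental_iff] at h1
  have h2 := h1 (p.map σ) (by
    rw [Polynomial.aeval_def, Polynomial.eval₂_map]
    exact hp)
  exact (Polynomial.map_eq_zero σ).1 h2

lemma RatFunc.X_add_C_ne_C (θ c : F) : RatFunc.X + RatFunc.C θ ≠ RatFunc.C c := by
  intro h
  refine (RatFunc.transcendental_X (K := F)) ?_
  rw [show (RatFunc.X : RatFunc F) = algebraMap F (RatFunc F) (c - θ) by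
    rw [map_sub]; exact eq_sub_of_add_eq h]
  exact isAlgebraic_algebraMap _

end Param

section

open WithZero

section RatFuncHom

variable {E F : Type*} [Field E] [Field F]

lemma RatFunc.exists_hom (τ : E →+* F) {g : RatFunc F} (hg : ∀ c, g ≠ RatFunc.C c) :
    ∃ ψ : RatFunc E →+* RatFunc F, (∀ c, ψ (RatFunc.C c) = RatFunc.C (τ c)) ∧
      ψ RatFunc.X = g ∧ ∀ P : Polynomial E, ψ (algebraMap _ _ P) =
        P.eval₂ ((RatFunc.C : F →+* RatFunc F).comp τ) g := by
  let φ : Polynomial E →+* RatFunc F := Polynomial.eval₂RingHom (RatFunc.C.comp τ) g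
  have hφ : Function.Injective φ := by
    rw [injective_iff_map_eq_zero]
    exact fun p hp => RatFunc.eval₂_eq_zero_of_ne_C τ hg hp
  have h : ∀ P, IsFractionRing.lift (K := RatFunc E) hφ (algebraMap _ _ P) = φ P :=
    fun P => IsFractionRing.lift_algebraMap hφ P
  refine ⟨IsFractionRing.lift hφ, fun c => ?_, ?_, h⟩
  · rw [← RatFunc.algebraMap_C, h]; simp [φ]
  · rw [← RatFunc.algebraMap_X, h]; simp [φ]

lemma isLead_poly_of_coeff_zero_ne {P : Polynomial F} (h : P.coeff 0 ≠ 0) :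
    IsLead (algebraMap _ (RatFunc F) P) (P.coeff 0) 0 := by
  refine ⟨h, RatFunc.C (P.coeff 0)⁻¹ * (RatFunc.X * algebraMap _ _ P.divX), ?_, ?_⟩
  · rw [map_mul, map_mul, ordX_C (inv_ne_zero h), one_mul, ordX_X]
    refine mul_lt_one_of_lt_of_le ?_ (ordX_poly_le _)
    rw [← exp_zero, exp_lt_exp]; simp
  · have hc : RatFunc.C (P.coeff 0) ≠ 0 := by simpa using h
    conv_lhs => rw [← Polynomial.divX_mul_X_add P]
    rw [map_add, map_mul, RatFunc.algebraMap_X, RatFunc.algebraMap_C, map_inv₀]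
    field_simp
    ring

lemma isLead_poly_of_coeff_one_ne {P : Polynomial F} (h0 : P.coeff 0 = 0) (h : P.coeff 1 ≠ 0) :
    IsLead (algebraMap _ (RatFunc F) P) (P.coeff 1) 1 := by
  have h1 : IsLead (RatFunc.X : RatFunc F) 1 1 := ⟨one_ne_zero, 0, by simp, by simp⟩
  have h2 := isLead_poly_of_coeff_zero_ne (P := P.divX) (by simpa using h)
  have h3 := h1.mul h2
  rw [← RatFunc.algebraMap_X, ← map_mul, Polynomial.coeff_divX] at h3
  have h4 := Polynomial.divX_mul_X_add P
  rw [h0, map_zero, add_zero, mul_comm] at h4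
  simpa [h4] using h3

lemma forall_exists_isLead [NumberField F] (g : RatFunc F) (hg : g ≠ 0) :
    ∃ c n, IsLead g c n := by
  obtain ⟨𝔭, -⟩ := exists_heightOne_mem F Nat.prime_two
  obtain ⟨π, hπ⟩ := 𝔭.valuation_exists_uniformizer F
  refine exists_isLead (v := 𝔭.valuation F) (π := π) ?_ ?_ g hg
  · rintro rfl
    rw [map_zero] at hπ
    exact exp_ne_zero hπ.symm
  · rw [hπ]
    exact_mod_cast (by rw [← exp_zero, exp_lt_exp]; simp : (exp (-1 : ℤ)) < (1 : ℤᵐ⁰))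

/-- Coefficients of a translated polynomial. -/
lemma coeff_zero_translate (τ : E →+* F) (θ : F) (P : Polynomial E) :
    ((P.map τ).comp (Polynomial.X + Polynomial.C θ)).coeff 0 = P.eval₂ τ θ := by
  rw [Polynomial.coeff_zero_eq_eval_zero, Polynomial.eval_comp, Polynomial.eval_map]
  simp

lemma coeff_one_translate (τ : E →+* F) (θ : F) (P : Polynomial E) :
    ((P.map τ).comp (Polynomial.X + Polynomial.C θ)).coeff 1 = P.derivative.eval₂ τ θ := by
  rw [← coeff_zero_translate, ← Polynomial.derivative_map]
  have h := Polynomial.derivative_comp (P.map τ) (Polynomial.X + Polynomial.C θ)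
  have h1 := Polynomial.coeff_derivative ((P.map τ).comp (Polynomial.X + Polynomial.C θ)) 0
  rw [h] at h1
  simpa using h1.symm

/-- The translation `X ↦ X + θ`. -/
lemma exists_translate (τ : E →+* F) (θ : F) :
    ∃ ψ : RatFunc E →+* RatFunc F, (∀ c, ψ (RatFunc.C c) = RatFunc.C (τ c)) ∧
      ∀ P : Polynomial E, ψ (algebraMap _ _ P) =
        algebraMap _ _ ((P.map τ).comp (Polynomial.X + Polynomial.C θ)) := by
  obtain ⟨ψ, h1, -, h3⟩ := RatFunc.exists_hom τ (RatFunc.X_add_C_ne_C θ)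
  refine ⟨ψ, h1, fun P => ?_⟩
  rw [h3, Polynomial.comp, Polynomial.hom_eval₂, Polynomial.eval₂_map, map_add,
    RatFunc.algebraMap_X, RatFunc.algebraMap_C]
  congr 1

end RatFuncHom

section OddOrder

variable {E : Type*} [Field E]

lemma exists_sq_or_exists_irreducible (n : ℕ) (P : Polynomial E) (hP : P ≠ 0)
    (hn : P.natDegree ≤ n) :
    (∃ c m, P = Polynomial.C c * m ^ 2) ∨
      ∃ p s m, Irreducible p ∧ ¬ p ∣ s ∧ P = p * s * m ^ 2 := by
  induction n generalizing P with
  | zero =>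
    left
    refine ⟨P.coeff 0, 1, ?_⟩
    rw [one_pow, mul_one]
    exact Polynomial.eq_C_of_natDegree_le_zero hn
  | succ n ih =>
    by_cases hu : IsUnit P
    · left
      obtain ⟨c, -, rfl⟩ := Polynomial.isUnit_iff.1 hu
      exact ⟨c, 1, by simp⟩
    obtain ⟨p, hp, s, rfl⟩ := WfDvdMonoid.exists_irreducible_factor hu hP
    by_cases hs : p ∣ s
    · obtain ⟨s, rfl⟩ := hs
      have hs0 : s ≠ 0 := by rintro rfl; simp at hP
      have hp1 := hp.natDegree_pos
      rw [Polynomial.natDegree_mul hp.ne_zero (mul_ne_zero hp.ne_zero hs0),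
        Polynomial.natDegree_mul hp.ne_zero hs0] at hn
      rcases ih s hs0 (by omega) with ⟨c, m, rfl⟩ | ⟨p', s', m, h1, h2, rfl⟩
      · exact Or.inl ⟨c, p * m, by ring⟩
      · exact Or.inr ⟨p', s', p * m, h1, h2, by ring⟩
    · exact Or.inr ⟨p, s, 1, hp, hs, by ring⟩

/-- A rational function which is not a constant times a square has odd order at some point. -/
lemma exists_odd_order.{u} {E : Type u} [Field E] [NumberField E] {G : RatFunc E} (hG : G ≠ 0)
    (h : ¬ ∃ c g, G = RatFunc.C c * g ^ 2) :
    ∃ (F : Type u) (_ : Field F) (_ : NumberField F) (ψ : RatFunc E →+* RatFunc F) (c : F) (n : ℤ),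
      Odd n ∧ IsLead (ψ G) c n := by
  obtain ⟨A, B, hA, hB, hGe⟩ : ∃ A B : Polynomial E, A ≠ 0 ∧ B ≠ 0 ∧
      G = algebraMap _ (RatFunc E) A / algebraMap _ (RatFunc E) B :=
    ⟨_, _, RatFunc.num_ne_zero hG, G.denom_ne_zero, (RatFunc.num_div_denom G).symm⟩
  have hd : algebraMap _ (RatFunc E) B ≠ 0 := RatFunc.algebraMap_ne_zero hB
  replace hGe : G = algebraMap _ _ (A * B) / (algebraMap _ (RatFunc E) B) ^ 2 := by
    rw [hGe, map_mul]
    field_simp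
  rcases exists_sq_or_exists_irreducible _ (A * B) (mul_ne_zero hA hB)
    le_rfl with ⟨c, m, hm⟩ | ⟨p, s, m, hp, hs, he⟩
  · refine absurd ⟨c, algebraMap _ _ m / algebraMap _ _ B, ?_⟩ h
    rw [hGe, hm, map_mul, map_pow, RatFunc.algebraMap_C]
    ring
  have : Fact (Irreducible p) := ⟨hp⟩
  let F := AdjoinRoot p
  have hfin : FiniteDimensional E F := (AdjoinRoot.powerBasis hp.ne_zero).finite
  have hchar : CharZero F := charZero_of_injective_algebraMap (algebraMap E F).injective
  have hnf : NumberField F := @NumberField.mk _ _ hchar (Module.Finite.trans E F)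
  obtain ⟨ψ, -, hψ⟩ := exists_translate (AdjoinRoot.of p) (AdjoinRoot.root p)
  have hm0 : m ≠ 0 := by
    rintro rfl
    rw [sq, zero_mul, mul_zero] at he
    exact mul_ne_zero hA hB he
  have h1 : ψ (algebraMap _ _ m / algebraMap _ _ B) ≠ 0 :=
    (map_ne_zero ψ).2 (div_ne_zero (RatFunc.algebraMap_ne_zero hm0) hd)
  obtain ⟨c1, n1, h1⟩ := forall_exists_isLead _ h1
  have hev : ∀ P : Polynomial E, P.eval₂ (AdjoinRoot.of p) (AdjoinRoot.root p) = 0 ↔ p ∣ P := by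
    intro P
    rw [← AdjoinRoot.mk_eq_zero, ← AdjoinRoot.aeval_eq, Polynomial.aeval_def]
    rfl
  have h2 := isLead_poly_of_coeff_zero_ne
    (P := (s.map (AdjoinRoot.of p)).comp (Polynomial.X + Polynomial.C (AdjoinRoot.root p)))
    (by rwa [coeff_zero_translate, ne_eq, hev])
  have h3 := isLead_poly_of_coeff_one_ne
    (P := (p.map (AdjoinRoot.of p)).comp (Polynomial.X + Polynomial.C (AdjoinRoot.root p)))
    (by rw [coeff_zero_translate, hev])
    (by
      rw [coeff_one_translate, ne_eq, hev]
      exact fun hdvd => hp.not_isUnit (hp.separable.isUnit_of_dvd' dvd_rfl hdvd))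
  rw [← hψ] at h2 h3
  have h4 := (h3.mul h2).mul (h1.mul h1)
  rw [← map_mul ψ, ← map_mul ψ, ← map_mul ψ] at h4
  have h5 : G = algebraMap _ _ p * algebraMap _ _ s *
      (algebraMap _ _ m / algebraMap _ _ B * (algebraMap _ _ m / algebraMap _ _ B)) := by
    rw [hGe, he, map_mul, map_mul, map_pow]
    ring
  rw [← h5] at h4
  exact ⟨F, inferInstance, hnf, ψ, _, _, ⟨n1, by ring⟩, h4⟩

end OddOrder

end

section

open WithZero

section Quadratic

variable {k : Type*} [Field k] {a b : k} {K : Type*} [Field K] {ι : k →+* K} {E : Type*} [Field E]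

lemma RatFunc.sq_add_C_ne_zero (b : E) : (RatFunc.X : RatFunc E) ^ 2 + RatFunc.C b ≠ 0 := by
  rw [← RatFunc.algebraMap_X, ← RatFunc.algebraMap_C, ← map_pow, ← map_add]
  exact RatFunc.algebraMap_ne_zero (Polynomial.monic_X_pow_add_C b two_ne_zero).ne_zero

/-- The rational parametrization of a conic. -/
lemma IsConicFunctionField.exists_param [CharZero E] (ha : a ≠ 0)
    (hK : IsConicFunctionField k a b K ι) (σ : k →+* E) {r : E} (hr : r ^ 2 = σ a) :
    ∃ (x y : K) (j : K →+* RatFunc E),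
      (∀ z : K, ∃ P Q : MvPolynomial (Fin 2) k, MvPolynomial.eval₂ ι ![x, y] Q ≠ 0 ∧
        z = MvPolynomial.eval₂ ι ![x, y] P / MvPolynomial.eval₂ ι ![x, y] Q) ∧
      (∀ c, j (ι c) = RatFunc.C (σ c)) ∧
      j x = (RatFunc.C (σ b) - RatFunc.X ^ 2) /
        (RatFunc.C r * (RatFunc.X ^ 2 + RatFunc.C (σ b))) ∧
      j y = 2 * RatFunc.X / (RatFunc.X ^ 2 + RatFunc.C (σ b)) := by
  obtain ⟨x, y, -, hgen, hlift⟩ := hK.exists_lift ha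
  have hd := RatFunc.sq_add_C_ne_zero (σ b)
  have hr0 : r ≠ 0 := by
    rintro rfl
    rw [zero_pow two_ne_zero] at hr
    exact ha (by simpa using hr.symm)
  have hrC : RatFunc.C r ≠ 0 := by simpa using hr0
  obtain ⟨j, h1, h2, h3⟩ := hlift (RatFunc E) ((RatFunc.C : E →+* RatFunc E).comp σ)
    ((RatFunc.C (σ b) - RatFunc.X ^ 2) / (RatFunc.C r * (RatFunc.X ^ 2 + RatFunc.C (σ b))))
    (2 * RatFunc.X / (RatFunc.X ^ 2 + RatFunc.C (σ b))) (by
      rw [RingHom.comp_apply, RingHom.comp_apply, ← hr, map_pow]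
      field_simp
      ring) (fun p hp => RatFunc.eval₂_eq_zero_of_ne_C σ (fun c hc => by
        rw [div_eq_iff hd] at hc
        refine RatFunc.transcendental_X (K := E)
          ⟨Polynomial.C c * (Polynomial.X ^ 2 + Polynomial.C (σ b)) - Polynomial.C 2 *
              Polynomial.X, ?_, ?_⟩
        · intro h
          have h2 := congrArg (fun p => Polynomial.coeff p 1) h
          simp at h2
        · simp only [map_sub, map_mul, map_add, map_pow, Polynomial.aeval_C, Polynomial.aeval_X,
            RatFunc.algebraMap_eq_C]
          rw [← hc, map_ofNat, sub_self]) hp)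
  exact ⟨x, y, j, hgen, fun c => congrFun (congrArg DFunLike.coe h1) c, h2, h3⟩

lemma exists_eq_add_of_param [CharZero E] (ha : a ≠ 0) {σ : k →+* E} {r : E} (hr : r ^ 2 = σ a)
    (hE : ∀ e, ∃ u w, e = σ u + r * σ w) {x y : K} {j : K →+* RatFunc E}
    (hj : ∀ c, j (ι c) = RatFunc.C (σ c))
    (hx : j x = (RatFunc.C (σ b) - RatFunc.X ^ 2) /
        (RatFunc.C r * (RatFunc.X ^ 2 + RatFunc.C (σ b))))
    (hy : j y = 2 * RatFunc.X / (RatFunc.X ^ 2 + RatFunc.C (σ b))) (g : RatFunc E) :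
    ∃ u w, g = j u + RatFunc.C r * j w := by
  have hr' : RatFunc.C r * RatFunc.C r = j (ι a) := by rw [hj, ← map_mul, ← sq, hr]
  have hr0 : r ≠ 0 := by
    rintro rfl
    rw [zero_pow two_ne_zero] at hr
    exact ha (by simpa using hr.symm)
  let S : Subfield (RatFunc E) :=
    { carrier := {g | ∃ u w, g = j u + RatFunc.C r * j w}
      mul_mem' := by
        rintro _ _ ⟨u, w, rfl⟩ ⟨u', w', rfl⟩
        refine ⟨u * u' + ι a * (w * w'), u * w' + u' * w, ?_⟩
        rw [map_add, map_add, map_mul, map_mul, map_mul, map_mul, map_mul, ← hr']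
        ring
      one_mem' := ⟨1, 0, by simp⟩
      add_mem' := by
        rintro _ _ ⟨u, w, rfl⟩ ⟨u', w', rfl⟩
        exact ⟨u + u', w + w', by rw [map_add, map_add]; ring⟩
      zero_mem' := ⟨0, 0, by simp⟩
      neg_mem' := by
        rintro _ ⟨u, w, rfl⟩
        exact ⟨-u, -w, by rw [map_neg, map_neg]; ring⟩
      inv_mem' := by
        rintro _ ⟨u, w, rfl⟩
        by_cases h : j u - RatFunc.C r * j w = 0
        · refine ⟨(2 * u)⁻¹, 0, ?_⟩
          rw [map_inv₀, map_mul, map_ofNat, map_zero, ← sub_eq_zero.1 h]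
          ring
        · by_cases h' : j u + RatFunc.C r * j w = 0
          · exact ⟨0, 0, by rw [h']; simp⟩
          refine ⟨u / (u ^ 2 - ι a * w ^ 2), -w / (u ^ 2 - ι a * w ^ 2), ?_⟩
          have h2 : j (u ^ 2 - ι a * w ^ 2) =
              (j u - RatFunc.C r * j w) * (j u + RatFunc.C r * j w) := by
            rw [map_sub, map_mul, map_pow, map_pow, ← hr']
            ring
          rw [map_div₀, map_div₀, h2, map_neg]
          field_simp
          ring }
  have hjS : ∀ u, j u ∈ S := fun u => ⟨u, 0, by simp⟩
  have hrS : RatFunc.C r ∈ S := ⟨0, 1, by simp⟩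
  have hC : ∀ e, RatFunc.C e ∈ S := by
    intro e
    obtain ⟨u, w, rfl⟩ := hE e
    exact ⟨ι u, ι w, by rw [hj, hj]; simp⟩
  have hX : (RatFunc.X : RatFunc E) ∈ S := by
    have hd := RatFunc.sq_add_C_ne_zero (σ b)
    have hrC : RatFunc.C r ≠ 0 := by simpa using hr0
    have hX0 : (RatFunc.X : RatFunc E) ≠ 0 := RatFunc.X_ne_zero
    have : (RatFunc.X : RatFunc E) = (1 - RatFunc.C r * j x) / j y := by
      rw [hx, hy]
      field_simp
      ring
    rw [this]
    exact div_mem (sub_mem (one_mem S) (mul_mem hrS (hjS x))) (hjS y)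
  have hP : ∀ P : Polynomial E, algebraMap _ (RatFunc E) P ∈ S := by
    intro P
    induction P using Polynomial.induction_on' with
    | add p q hp hq => rw [map_add]; exact add_mem hp hq
    | monomial n c =>
      rw [← Polynomial.C_mul_X_pow_eq_monomial, map_mul, map_pow, RatFunc.algebraMap_X,
        RatFunc.algebraMap_C]
      exact mul_mem (hC c) (pow_mem hX n)
  rw [← RatFunc.num_div_denom g]
  exact div_mem (hP _) (hP _)

lemma C_notMem_range_of_param {σ : k →+* E} {r : E} [CharZero E] (hr0 : r ≠ 0) (hb : b ≠ 0) {x y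
    : K}
    {j : K →+* RatFunc E}
    (hgen : ∀ z : K, ∃ P Q : MvPolynomial (Fin 2) k, MvPolynomial.eval₂ ι ![x, y] Q ≠ 0 ∧
        z = MvPolynomial.eval₂ ι ![x, y] P / MvPolynomial.eval₂ ι ![x, y] Q)
    (hj : ∀ c, j (ι c) = RatFunc.C (σ c))
    (hx : j x = (RatFunc.C (σ b) - RatFunc.X ^ 2) /
        (RatFunc.C r * (RatFunc.X ^ 2 + RatFunc.C (σ b))))
    (hy : j y = 2 * RatFunc.X / (RatFunc.X ^ 2 + RatFunc.C (σ b)))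
    (τ : E →+* E) (hτ : ∀ c, τ (σ c) = σ c) (hτr : τ r = -r) (z : K) : j z ≠ RatFunc.C r := by
  intro hz
  have hX0 : (RatFunc.X : RatFunc E) ≠ 0 := RatFunc.X_ne_zero
  have hb' : RatFunc.C (σ b) ≠ 0 := by simpa using hb
  have hrC : RatFunc.C r ≠ 0 := by simpa using hr0
  have hd := RatFunc.sq_add_C_ne_zero (σ b)
  obtain ⟨ψ, h1, h2, -⟩ := RatFunc.exists_hom τ (g := RatFunc.C (σ b) / RatFunc.X) (fun c hc => by
    have hc0 : RatFunc.C c ≠ 0 := by rw [← hc]; exact div_ne_zero hb' hX0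
    refine RatFunc.X_add_C_ne_C 0 (σ b / c) ?_
    rw [map_zero, add_zero, map_div₀, eq_div_iff hc0, ← hc]
    field_simp)
  have hψx : ψ (j x) = j x := by
    rw [hx, map_div₀, map_mul, map_add, map_sub, map_pow, h1, h1, h2, hτ, hτr, map_neg]
    have h3 : RatFunc.C (σ b) ^ 2 + RatFunc.X ^ 2 * RatFunc.C (σ b) ≠ 0 := by
      rw [show RatFunc.C (σ b) ^ 2 + RatFunc.X ^ 2 * RatFunc.C (σ b) =
        RatFunc.C (σ b) * (RatFunc.X ^ 2 + RatFunc.C (σ b)) by ring]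
      exact mul_ne_zero hb' hd
    have h4 : (RatFunc.C (σ b) / RatFunc.X) ^ 2 + RatFunc.C (σ b) ≠ 0 := by
      rw [div_pow, div_add' _ _ _ (pow_ne_zero 2 hX0)]
      refine div_ne_zero ?_ (pow_ne_zero 2 hX0)
      rwa [mul_comm (RatFunc.C (σ b))]
    rw [div_eq_div_iff (mul_ne_zero (neg_ne_zero.2 hrC) h4) (mul_ne_zero hrC hd)]
    field_simp
    ring
  have hψy : ψ (j y) = j y := by
    rw [hy, map_div₀, map_mul, map_add, map_pow, h1, h2, hτ, map_ofNat]
    have h4 : (RatFunc.C (σ b) / RatFunc.X) ^ 2 + RatFunc.C (σ b) ≠ 0 := by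
      rw [div_pow, div_add' _ _ _ (pow_ne_zero 2 hX0)]
      refine div_ne_zero ?_ (pow_ne_zero 2 hX0)
      rw [show RatFunc.C (σ b) ^ 2 + RatFunc.C (σ b) * RatFunc.X ^ 2 =
        RatFunc.C (σ b) * (RatFunc.X ^ 2 + RatFunc.C (σ b)) by ring]
      exact mul_ne_zero hb' hd
    rw [div_eq_div_iff h4 hd]
    field_simp
    ring
  have hev : ∀ P, ψ (j (MvPolynomial.eval₂ ι ![x, y] P)) = j (MvPolynomial.eval₂ ι ![x, y] P) := by
    intro P
    have : (ψ.comp j).comp (MvPolynomial.eval₂Hom ι ![x, y]) =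
        j.comp (MvPolynomial.eval₂Hom ι ![x, y]) := by
      apply MvPolynomial.ringHom_ext
      · intro c; simp [hj, h1, hτ]
      · intro i; fin_cases i <;> simp [hψx, hψy]
    exact congrFun (congrArg DFunLike.coe this) P
  obtain ⟨P, Q, -, hPQ⟩ := hgen z
  have h5 : ψ (j z) = j z := by rw [hPQ, map_div₀, map_div₀, hev, hev]
  rw [hz, h1, hτr] at h5
  exact hr0 (by
    have := RatFunc.C_injective h5
    linear_combination -(1 / 2) * this)

end Quadratic

end

section

open WithZero

section Quadratic

variable {k : Type*} [Field k] {a b : k} {K : Type*} [Field K] {ι : k →+* K} {E : Type*} [Field E]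

/-- The rational function field `E(t)` obtained from a `k`-field `K` by adjoining `r = √a`. -/
structure QuadParam (ι : k →+* K) (a : k) (σ : k →+* E) (r : E) (j : K →+* RatFunc E) : Prop where
  sq_eq : r ^ 2 = σ a
  map_const : ∀ c, j (ι c) = RatFunc.C (σ c)
  exists_const : ∀ e, ∃ u w, e = σ u + r * σ w
  exists_fun : ∀ g, ∃ u w, g = j u + RatFunc.C r * j w
  split_or_notMem : (∃ s, σ s = r) ∨ ∀ z, j z ≠ RatFunc.C r

namespace QuadParam

variable {σ : k →+* E} {r : E} {j : K →+* RatFunc E}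

lemma exists_eq_of_map_eq_C (h : QuadParam ι a σ r j) {z : K} {e : E} (hz : j z = RatFunc.C e) :
    ∃ c, z = ι c := by
  obtain ⟨u, w, rfl⟩ := h.exists_const e
  rcases h.split_or_notMem with ⟨s, rfl⟩ | hr
  · exact ⟨u + s * w, j.injective (by rw [hz, h.map_const, ← map_mul, ← map_add])⟩
  · by_cases hw : w = 0
    · exact ⟨u, j.injective (by rw [hz, h.map_const, hw]; simp)⟩
    · refine absurd ?_ (hr ((z - ι u) / ι w))
      have : RatFunc.C (σ w) ≠ 0 := by simpa using hw
      rw [map_div₀, map_sub, hz, h.map_const, h.map_const, div_eq_iff this, map_add, map_mul]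
      ring

lemma exists_eq_of_aeval_eq_zero (h : QuadParam ι a σ r j) {z : K} {P : Polynomial E}
    (hP : P ≠ 0) (hz : Polynomial.aeval (j z) P = 0) : ∃ c, z = ι c := by
  by_contra hc
  refine RatFunc.transcendental_of_ne_C (f := j z) ?_ ⟨P, hP, hz⟩
  rintro ⟨e, he⟩
  exact hc (h.exists_eq_of_map_eq_C he)

lemma exists_sq_of_map_sq (h : QuadParam ι a σ r j) {c : k} {w : K} (hw : ι c = w ^ 2) :
    ∃ d, c = d ^ 2 := by
  obtain ⟨d, rfl⟩ := h.exists_eq_of_aeval_eq_zero (z := w)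
    (P := Polynomial.X ^ 2 - Polynomial.C (σ c)) (Polynomial.X_pow_sub_C_ne_zero two_pos _) (by
      simp [← map_pow j, ← hw, h.map_const])
  exact ⟨d, ι.injective (by rw [hw, map_pow])⟩

lemma exists_const_mul_sq [CharZero E] (h : QuadParam ι a σ r j) {f : K} (hf : f ≠ 0) {c : E} {g
    : RatFunc E}
    (hfg : j f = RatFunc.C c * g ^ 2) : ∃ (c' : k) (w : K), f = ι c' * w ^ 2 := by
  obtain ⟨u, w, rfl⟩ := h.exists_fun g
  obtain ⟨c₀, c₁, rfl⟩ := h.exists_const c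
  rcases h.split_or_notMem with ⟨s, rfl⟩ | hr
  · refine ⟨c₀ + s * c₁, u + ι s * w, j.injective ?_⟩
    rw [hfg, map_mul, map_pow, map_add j, map_mul j, h.map_const, h.map_const, ← map_mul σ,
      ← map_add]
  · have hr' : RatFunc.C r * RatFunc.C r = j (ι a) := by
      rw [h.map_const, ← map_mul, ← sq, h.sq_eq]
    have key : j (f - (ι c₀ * (u ^ 2 + ι a * w ^ 2) + 2 * ι a * ι c₁ * u * w)) =
        RatFunc.C r * j (ι c₁ * (u ^ 2 + ι a * w ^ 2) + 2 * ι c₀ * u * w) := by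
      simp only [map_sub, map_add, map_mul, map_pow, hfg, map_ofNat, h.map_const]
      have h2 : RatFunc.C (σ a) = RatFunc.C r * RatFunc.C r := by rw [hr', h.map_const]
      rw [h2]
      ring
    have h0 : ι c₁ * (u ^ 2 + ι a * w ^ 2) + 2 * ι c₀ * u * w = 0 := by
      by_contra h0
      refine hr _ ((map_div₀ j _ _).trans
        (eq_div_of_mul_eq ((map_ne_zero j).2 h0) key.symm).symm)
    rw [h0, map_zero, mul_zero, map_eq_zero, sub_eq_zero] at key
    by_cases hw : w = 0
    · exact ⟨c₀, u, by rw [key, hw]; ring⟩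
    by_cases hc : c₀ = 0 ∧ c₁ = 0
    · rw [hc.1, hc.2] at key
      exact absurd (by rw [key]; simp) hf
    have h2 : ι c₁ * (u / w) ^ 2 + 2 * ι c₀ * (u / w) + ι c₁ * ι a = 0 := by
      field_simp
      linear_combination h0
    obtain ⟨s, hs⟩ := h.exists_eq_of_aeval_eq_zero (z := u / w)
      (P := Polynomial.C (σ c₁) * Polynomial.X ^ 2 + Polynomial.C (2 * σ c₀) * Polynomial.X +
        Polynomial.C (σ (c₁ * a))) (fun hP => hc ⟨by
          have := congrArg (fun p => Polynomial.coeff p 1) hP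
          simpa [Polynomial.coeff_X_pow] using this, by
          have := congrArg (fun p => Polynomial.coeff p 2) hP
          simpa [Polynomial.coeff_X, Polynomial.coeff_C] using this⟩) (by
        have := congrArg j h2
        simp only [map_add, map_mul, map_pow, h.map_const, map_ofNat, map_zero] at this
        simpa only [map_add, map_mul, map_pow, Polynomial.aeval_C, Polynomial.aeval_X,
          RatFunc.algebraMap_eq_C, map_ofNat] using this)
    refine ⟨c₀ * (s ^ 2 + a) + 2 * a * c₁ * s, w, ?_⟩
    rw [key, (div_eq_iff hw).1 hs]
    simp only [map_add, map_mul, map_pow, map_ofNat]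
    ring

end QuadParam

end Quadratic

end

section

open WithZero

section Quadratic

lemma exists_sqrt_extension.{u} {k : Type u} [Field k] [NumberField k] {a : k}
    (h : ∀ s, s ^ 2 ≠ a) :
    ∃ (E : Type u) (_ : Field E) (_ : NumberField E) (σ : k →+* E) (r : E) (τ : E →+* E),
      r ^ 2 = σ a ∧ (∀ e, ∃ u w, e = σ u + r * σ w) ∧ (∀ c, τ (σ c) = σ c) ∧ τ r = -r := by
  have hp : Irreducible (Polynomial.X ^ 2 - Polynomial.C a) :=
    X_pow_sub_C_irreducible_of_prime Nat.prime_two h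
  have : Fact (Irreducible (Polynomial.X ^ 2 - Polynomial.C a)) := ⟨hp⟩
  let E := AdjoinRoot (Polynomial.X ^ 2 - Polynomial.C a)
  have hfin : FiniteDimensional k E := (AdjoinRoot.powerBasis hp.ne_zero).finite
  have hchar : CharZero E := charZero_of_injective_algebraMap (algebraMap k E).injective
  have hnf : NumberField E := @NumberField.mk _ _ hchar (Module.Finite.trans k E)
  let r : E := AdjoinRoot.root _
  have hr : r ^ 2 = AdjoinRoot.of _ a := by
    have := AdjoinRoot.eval₂_root (Polynomial.X ^ 2 - Polynomial.C a)
    simpa [sub_eq_zero] using this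
  refine ⟨E, inferInstance, hnf, AdjoinRoot.of _, r, AdjoinRoot.lift (AdjoinRoot.of _) (-r) ?_, hr,
    fun e => ?_, fun c => AdjoinRoot.lift_of _, AdjoinRoot.lift_root _⟩
  · simp [hr]
  · obtain ⟨P, rfl⟩ := AdjoinRoot.mk_surjective e
    have hm : (Polynomial.X ^ 2 - Polynomial.C a).Monic := Polynomial.monic_X_pow_sub_C a
        two_ne_zero
    obtain ⟨u, w, huw⟩ := Polynomial.exists_eq_X_add_C_of_natDegree_le_one
      (p := P %ₘ (Polynomial.X ^ 2 - Polynomial.C a)) (by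
        have := Polynomial.natDegree_modByMonic_lt P hm hp.ne_one
        rw [Polynomial.natDegree_X_pow_sub_C] at this
        omega)
    refine ⟨w, u, ?_⟩
    rw [← Polynomial.modByMonic_add_div P (Polynomial.X ^ 2 - Polynomial.C a), map_add, map_mul,
      AdjoinRoot.mk_self, zero_mul, add_zero, huw, map_add, map_mul, AdjoinRoot.mk_C,
      AdjoinRoot.mk_C, AdjoinRoot.mk_X]
    ring

lemma IsConicFunctionField.exists_quadParam.{u} {k : Type u} [Field k] [NumberField k] {a b : k}
    {K : Type*} [Field K] {ι : k →+* K} (ha : a ≠ 0) (hb : b ≠ 0)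
    (hK : IsConicFunctionField k a b K ι) :
    ∃ (E : Type u) (_ : Field E) (_ : NumberField E) (σ : k →+* E) (r : E) (j : K →+* RatFunc E),
      QuadParam ι a σ r j := by
  by_cases h : ∀ s, s ^ 2 ≠ a
  · obtain ⟨E, _, _, σ, r, τ, hr, hE, hτ, hτr⟩ := exists_sqrt_extension h
    have hr0 : r ≠ 0 := by
      rintro rfl
      rw [zero_pow two_ne_zero] at hr
      exact ha (by simpa using hr.symm)
    obtain ⟨x, y, j, hgen, hj, hx, hy⟩ := hK.exists_param ha σ hr
    exact ⟨E, _, ‹_›, σ, r, j, hr, hj, hE, exists_eq_add_of_param ha hr hE hj hx hy,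
      Or.inr (C_notMem_range_of_param hr0 hb hgen hj hx hy τ hτ hτr)⟩
  · push Not at h
    obtain ⟨s, hs⟩ := h
    obtain ⟨x, y, j, hgen, hj, hx, hy⟩ := hK.exists_param ha (RingHom.id k) (r := s) hs
    have hE : ∀ e, ∃ u w, e = RingHom.id k u + s * RingHom.id k w := fun e => ⟨e, 0, by simp⟩
    exact ⟨k, _, ‹_›, RingHom.id k, s, j, hs, hj, hE, exists_eq_add_of_param ha hs hE hj hx hy,
      Or.inl ⟨s, rfl⟩⟩

lemma IsConicFunctionField.exists_sq_of_map_sq.{u} {k : Type u} [Field k] [NumberField k] {a b : k}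
    {K : Type*} [Field K] {ι : k →+* K} (ha : a ≠ 0) (hb : b ≠ 0)
    (hK : IsConicFunctionField k a b K ι) {c : k} {w : K} (hw : ι c = w ^ 2) : ∃ d, c = d ^ 2 := by
  obtain ⟨E, _, _, σ, r, j, h⟩ := hK.exists_quadParam ha hb
  exact h.exists_sq_of_map_sq hw

/-- A function that is not a constant times a square has odd order at some place. -/
lemma IsConicFunctionField.exists_hor_notMem.{u} {k : Type u} [Field k] [NumberField k] {a b : k}
    {K V : Type*} [Field K] [CharZero K] [CommGroup V] {ι : k →+* K} (ha : a ≠ 0) (hb : b ≠ 0)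
    (hK : IsConicFunctionField k a b K ι) {e : V} {R : V → V → V → Prop} {q : Kˣ →* V}
    (I : Interp e R q) {f : Kˣ} (hf : ∀ c w, (f : K) ≠ ι c * w ^ 2) :
    ∃ H, Hor e R H ∧ q f ∉ H := by
  obtain ⟨E, _, _, σ, r, j, h⟩ := hK.exists_quadParam ha hb
  obtain ⟨F, _, _, ψ, c, n, hn, hl⟩ := exists_odd_order ((map_ne_zero j).2 f.ne_zero) (by
    rintro ⟨c, g, hg⟩
    obtain ⟨c', w, hw⟩ := h.exists_const_mul_sq f.ne_zero hg
    exact hf c' w hw)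
  refine ⟨_, hor_ordX (j := ψ.comp j) I (hK.isCurve hb) hl hn, fun hm => ?_⟩
  rw [← pull_coe (q := q), pull_evenSub_valLog I] at hm
  have h2 : (ordX F).comap (ψ.comp j) (f : K) = exp (-n) := hl.ordX_eq
  rw [h2, log_exp, even_neg] at hm
  exact Int.not_even_iff_odd.2 hn hm.2

end Quadratic

end

section

open NumberField
lemma card_infinitePlace_of_sq_eq_neg_one {F : Type*} [Field F] [NumberField F] {i : F}
    (hi : i ^ 2 = -1) : 2 * Fintype.card (InfinitePlace F) = Module.finrank ℚ F := by
  have : NumberField.IsTotallyComplex F := ⟨fun v => by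
    rw [← InfinitePlace.not_isReal_iff_isComplex]
    intro h
    have h1 := congrArg (InfinitePlace.embedding_of_isReal h) hi
    rw [map_pow, map_neg, map_one] at h1
    nlinarith [sq_nonneg (InfinitePlace.embedding_of_isReal h i)]⟩
  rw [IsTotallyComplex.finrank, InfinitePlace.card_eq_nrRealPlaces_add_nrComplexPlaces,
    IsTotallyComplex.nrRealPlaces_eq_zero, zero_add]

lemma four_le_finrank {l F : Type*} [Field l] [Field F] [CharZero l] [Algebra l F]
    [FiniteDimensional l F]
    {c₁ c₂ : l} {s₁ s₂ : F} (h₁ : s₁ ^ 2 = algebraMap l F c₁) (h₂ : s₂ ^ 2 = algebraMap l F c₂)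
    (hc₁ : ∀ d, c₁ ≠ d ^ 2) (hc₂ : ∀ d, c₂ ≠ d ^ 2) (hc : ∀ d, c₁ * c₂ ≠ d ^ 2) :
    4 ≤ Module.finrank l F := by
  have hinj := (algebraMap l F).injective
  have h1 : ∀ u v : l, algebraMap l F u + algebraMap l F v * s₁ = 0 → u = 0 ∧ v = 0 := by
    intro u v h
    by_cases hv : v = 0
    · exact ⟨by simpa [hv] using h, hv⟩
    · refine absurd (hinj ?_) (hc₁ (u / v))
      have hv' : algebraMap l F v ≠ 0 := by simpa using hv
      rw [map_pow, map_div₀, ← h₁]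
      field_simp
      linear_combination (algebraMap l F v * s₁ - algebraMap l F u) * h
  have h2 : ∀ u v : l, s₂ ≠ algebraMap l F u + algebraMap l F v * s₁ := by
    intro u v h
    have h3 : algebraMap l F (u ^ 2 + v ^ 2 * c₁ - c₂) + algebraMap l F (2 * u * v) * s₁ = 0 := by
      simp only [map_sub, map_add, map_mul, map_pow, map_ofNat, ← h₁, ← h₂]
      rw [h]
      ring
    obtain ⟨h4, h5⟩ := h1 _ _ h3
    rcases mul_eq_zero.1 h5 with h5 | rfl
    · obtain rfl : u = 0 := by simpa using h5
      exact hc (v * c₁) (by linear_combination -c₁ * h4)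
    · exact hc₂ u (by linear_combination -h4)
  have hli : LinearIndependent l ![1, s₁, s₂, s₁ * s₂] := by
    rw [Fintype.linearIndependent_iff]
    intro g hg
    simp only [Fin.sum_univ_four, Algebra.smul_def, Matrix.cons_val] at hg
    have h3 : g 2 = 0 ∧ g 3 = 0 := by
      by_contra h3
      have h4 : algebraMap l F (g 2) + algebraMap l F (g 3) * s₁ ≠ 0 := fun h => h3 (h1 _ _ h)
      have h4' : algebraMap l F (g 2) + algebraMap l F (-g 3) * s₁ ≠ 0 := fun h =>
        h3 (by simpa using h1 _ _ h)
      have h5 : g 2 ^ 2 - g 3 ^ 2 * c₁ ≠ 0 := by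
        intro h
        have := congrArg (algebraMap l F) h
        rw [map_zero, map_sub, map_mul, map_pow, map_pow, ← h₁] at this
        refine mul_ne_zero h4 h4' ?_
        rw [map_neg]
        linear_combination this
      have h5' : algebraMap l F (g 2 ^ 2 - g 3 ^ 2 * c₁) ≠ 0 := (map_ne_zero _).2 h5
      refine h2 (-(g 0 * g 2 - g 1 * g 3 * c₁) / (g 2 ^ 2 - g 3 ^ 2 * c₁))
        (-(g 1 * g 2 - g 0 * g 3) / (g 2 ^ 2 - g 3 ^ 2 * c₁)) ?_
      rw [map_div₀, map_div₀]
      field_simp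
      simp only [map_neg, map_sub, map_mul, map_pow, ← h₁]
      linear_combination (algebraMap l F (g 2) - algebraMap l F (g 3) * s₁) * hg
    rw [h3.1, h3.2, map_zero] at hg
    have h6 := h1 (g 0) (g 1) (by linear_combination hg)
    intro i
    fin_cases i
    exacts [h6.1, h6.2, h3.1, h3.2]
  simpa using hli.fintype_card_le_finrank

lemma Horiz.valuation_map {l L : Type*} [Field l] [NumberField l] [Field L] {A : ValuationSubring L}
    (hA : Horiz A) (ι : l →+* L) {c : l} (hc : c ≠ 0) : A.valuation (ι c) = 1 := by
  have h : ∀ c, A.valuation (ι c) ≤ 1 := by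
    intro c
    have h1 : IsAlgebraic ℤ c := (IsFractionRing.isAlgebraic_iff ℤ ℚ l).2
        (Algebra.IsAlgebraic.isAlgebraic c)
    obtain ⟨y, hy, h2⟩ := h1.exists_integral_multiple
    have h3 : IsIntegral A (ι (y • c)) := (h2.map (ι.toIntAlgHom)).tower_top
    obtain ⟨z, hz⟩ := IsIntegrallyClosed.isIntegral_iff.1 h3
    have h4 : A.valuation (ι (y • c)) ≤ 1 := by
      rw [← hz]; exact A.valuation_le_one z
    rw [zsmul_eq_mul, map_mul, map_mul, map_intCast] at h4
    have h5 : A.valuation (y : L) = 1 := by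
      have h6 := hA.val_natCast y.natAbs (by simpa using hy)
      rcases Int.natAbs_eq y with h | h
      · rwa [h, Int.cast_natCast]
      · rwa [h, Int.cast_neg, Valuation.map_neg, Int.cast_natCast]
    rwa [h5, one_mul] at h4
  refine le_antisymm (h c) ?_
  have h7 := h c⁻¹
  rw [map_inv₀, map_inv₀] at h7
  exact (inv_le_one₀ (by simpa [zero_lt_iff] using hc)).1 h7

/-- A condition on the representation relation which for function fields of conics bounds the
degree of the field of constants. -/
def HalfDegreeLE {V : Type*} [CommGroup V] (e : V) (R : V → V → V → Prop) (n : ℕ) : Prop :=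
  ∃ H, Hor e R H ∧ (∃ X : Subgroup V, (∃ x ∈ X, ∃ y ∈ X, x ≠ 1 ∧ y ≠ 1 ∧ x * y ≠ 1) ∧
    e ∈ X ∧ X ≤ TT R H ∧ ∀ H', Hor e R H' → X ≤ H') ∧
    ∃ S : Finset (Subgroup V), (∀ J ∈ S, Fam e R H J) ∧
      (TT R H).relIndex (H ⊓ sInf ({J | Fam e R H J} \ S)) ≠ 0 ∧
      (TT R H).relIndex (H ⊓ sInf ({J | Fam e R H J} \ S)) ≤ 2 ^ (n + S.card)

/-- The degree bound for the field of constants. -/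
lemma IsConicFunctionField.two_mul_finrank_le.{u} {l : Type u} [Field l] [NumberField l] {c d : l}
    {L V : Type*} [Field L] [CharZero L] [CommGroup V] {ι : l →+* L} (hc : c ≠ 0) (hd : d ≠ 0)
    (hL : IsConicFunctionField l c d L ι) {e : V} {R : V → V → V → Prop} {q : Lˣ →* V}
    (I : Interp e R q) {n : ℕ} (h : HalfDegreeLE e R n) : 2 * Module.finrank ℚ l ≤ n := by
  obtain ⟨H, hH, ⟨X, ⟨x₁, hX₁, x₂, hX₂, hx₁, hx₂, hx⟩, heX, hXT, hXH⟩, S, hS, h0, h1⟩ := h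
  obtain ⟨A, ϖ, D, hA⟩ := hH.exists_dvPair I (hL.isCurve hd)
  have := hA.numberField
  have hn := card_infinitePlace_le_of_relIndex_le I (hL.isCurve hd) D n S hS
  have hmem : ∀ c, ι c ∈ A := by
    intro c
    by_cases hc : c = 0
    · rw [hc, map_zero]; exact A.zero_mem
    · exact (A.valuation_le_one_iff _).1 (hA.valuation_map ι hc).le
  let ρ : l →+* IsLocalRing.ResidueField A := (IsLocalRing.residue A).comp (ι.codRestrict A hmem)
  let _ : Algebra l (IsLocalRing.ResidueField A) := ρ.toAlgebra
  have hsq : ∀ u : Lˣ, ∀ c, (u : L) = ι c → q u ∈ TT R H → ∃ s, s ^ 2 = ρ c := by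
    intro u c huc hu
    have hc : c ≠ 0 := by
      rintro rfl
      exact u.ne_zero (by rw [huc, map_zero])
    rw [← pull_coe, huc, pull_TT_iff_isSquare I D (hA.valuation_map ι hc) (hmem c)] at hu
    obtain ⟨s, hs⟩ := hu
    exact ⟨s, by rw [sq, ← hs]; rfl⟩
  obtain ⟨i, hi⟩ := hsq (-1) (-1) (by simp) (by rw [I.neg_one]; exact hXT heX)
  have hrep : ∀ x ∈ X, ∃ (u : Lˣ) (c : l), q u = x ∧ (u : L) = ι c := by
    intro x hx
    obtain ⟨u, rfl⟩ := I.surj x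
    by_contra! hu
    obtain ⟨H', hH', hu'⟩ := hL.exists_hor_notMem hc hd I (f := u) (fun c w huw => by
      have hw : w ≠ 0 := by
        rintro rfl
        exact u.ne_zero (by rw [huw]; simp)
      refine hu (u / (Units.mk0 w hw) ^ 2) c ?_ ?_
      · rw [map_div, (I.ker _).2 ⟨_, rfl⟩, div_one]
      · rw [Units.val_div_eq_div_val, huw]
        simp [hw])
    exact hu' (hXH H' hH' hx)
  obtain ⟨u₁, c₁, hu₁, huc₁⟩ := hrep _ hX₁
  obtain ⟨u₂, c₂, hu₂, huc₂⟩ := hrep _ hX₂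
  have hns : ∀ (u : Lˣ) (c : l), (u : L) = ι c → q u ≠ 1 → ∀ d, c ≠ d ^ 2 := by
    rintro u _ huc hu d rfl
    have hd0 : ι d ≠ 0 := fun hd0 => u.ne_zero (by rw [huc, map_pow, hd0, zero_pow two_ne_zero])
    exact hu ((I.ker _).2 ⟨Units.mk0 _ hd0, Units.ext (by rw [huc, map_pow]; rfl)⟩)
  obtain ⟨s₁, hs₁⟩ := hsq u₁ c₁ huc₁ (by rw [hu₁]; exact hXT hX₁)
  obtain ⟨s₂, hs₂⟩ := hsq u₂ c₂ huc₂ (by rw [hu₂]; exact hXT hX₂)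
  have hfin : FiniteDimensional l (IsLocalRing.ResidueField A) := Module.Finite.right ℚ l _
  have h4 := four_le_finrank (F := IsLocalRing.ResidueField A) hs₁ hs₂
    (hns u₁ c₁ huc₁ (by rw [hu₁]; exact hx₁))
    (hns u₂ c₂ huc₂ (by rw [hu₂]; exact hx₂))
    (hns (u₁ * u₂) (c₁ * c₂) (by rw [Units.val_mul, huc₁, huc₂, map_mul])
      (by rw [map_mul, hu₁, hu₂]; exact hx))
  have h5 := card_infinitePlace_of_sq_eq_neg_one (i := i) (by rw [hi]; simp)
  have h6 := Module.finrank_mul_finrank ℚ l (IsLocalRing.ResidueField A)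
  have h7 := hn (by convert h0) (by convert h1)
  nlinarith

end

section

open NumberField IsDedekindDomain WithZero

section ConstantExtension

lemma exists_sqrt_extension_finrank_le.{u} {k : Type u} [Field k] [NumberField k] (a : k) :
    ∃ (E : Type u) (_ : Field E) (_ : NumberField E) (σ : k →+* E) (r : E),
      r ^ 2 = σ a ∧ Module.finrank ℚ E ≤ 2 * Module.finrank ℚ k := by
  by_cases h : ∀ s, s ^ 2 ≠ a
  · obtain ⟨E, _, _, σ, r, τ, hr, hE, -⟩ := exists_sqrt_extension h
    refine ⟨E, _, ‹_›, σ, r, hr, ?_⟩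
    let φ : k × k →ₗ[ℚ] E := (σ.toRatAlgHom.toLinearMap).coprod
      (LinearMap.mulLeft ℚ r ∘ₗ σ.toRatAlgHom.toLinearMap)
    have hφ : Function.Surjective φ := fun e => by
      obtain ⟨u, w, rfl⟩ := hE e
      exact ⟨(u, w), rfl⟩
    have := LinearMap.finrank_le_finrank_of_surjective hφ
    rwa [Module.finrank_prod, ← two_mul] at this
  · push Not at h
    obtain ⟨s, hs⟩ := h
    exact ⟨k, _, ‹_›, RingHom.id k, s, hs, by omega⟩

variable (k : Type*) [Field k] [NumberField k]

lemma exists_notMem_asIdeal_of_ne {𝔭 𝔮 : HeightOneSpectrum (𝓞 k)} (h : 𝔭 ≠ 𝔮) :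
    ∃ x ∈ 𝔭.asIdeal, x ∉ 𝔮.asIdeal := by
  by_contra! hle
  exact h (HeightOneSpectrum.ext (𝔭.isMaximal.eq_of_le 𝔮.isPrime.ne_top hle))

/-- An element of odd order at `𝔭` and even order at `𝔮`. -/
lemma exists_odd_log_even_log {𝔭 𝔮 : HeightOneSpectrum (𝓞 k)} (h : 𝔭 ≠ 𝔮) :
    ∃ c : k, c ≠ 0 ∧ Odd (log (𝔭.valuation k c)) ∧ Even (log (𝔮.valuation k c)) := by
  obtain ⟨a, hap, haq⟩ := exists_notMem_asIdeal_of_ne k h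
  obtain ⟨b, hbq, hbp⟩ := exists_notMem_asIdeal_of_ne k h.symm
  obtain ⟨π, hπ⟩ := 𝔭.intValuation_exists_uniformizer
  rw [← 𝔭.valuation_lt_one_iff_mem (K := k)] at hap hbp
  rw [← 𝔮.valuation_lt_one_iff_mem (K := k)] at haq hbq
  have hle : ∀ (𝔯 : HeightOneSpectrum (𝓞 k)) (x : 𝓞 k), 𝔯.valuation k (algebraMap _ k x) ≤ 1 :=
    fun 𝔯 x => 𝔯.valuation_le_one x
  have hbp1 : 𝔭.valuation k (algebraMap _ k b) = 1 := le_antisymm (hle _ _) (not_lt.1 hbp)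
  have haq1 : 𝔮.valuation k (algebraMap _ k a) = 1 := le_antisymm (hle _ _) (not_lt.1 haq)
  have hπ' : 𝔭.valuation k (algebraMap _ k π) = exp (-1) := by
    rw [HeightOneSpectrum.valuation_of_algebraMap, hπ]
  have hq : 𝔮.valuation k (algebraMap _ k (π * b + a ^ 2)) = 1 := by
    rw [map_add, map_mul, map_pow, Valuation.map_add_eq_of_lt_right, map_pow, haq1, one_pow]
    rw [map_pow, haq1, one_pow, map_mul, mul_comm]
    exact mul_lt_one_of_lt_of_le hbq (hle _ _)
  have hp : 𝔭.valuation k (algebraMap _ k (π * b + a ^ 2)) = exp (-1) := by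
    rw [map_add, map_mul, map_pow, Valuation.map_add_eq_of_lt_left, map_mul, hπ', hbp1, mul_one]
    rw [map_mul, hπ', hbp1, mul_one, map_pow]
    by_cases ha0 : 𝔭.valuation k (algebraMap _ k a) = 0
    · rw [ha0, zero_pow two_ne_zero]; exact exp_pos
    · obtain ⟨n, hn⟩ : ∃ n, 𝔭.valuation k (algebraMap _ k a) = exp n := ⟨_, (exp_log ha0).symm⟩
      rw [hn, ← exp_zero, exp_lt_exp] at hap
      rw [hn, ← exp_nsmul, exp_lt_exp]
      simp only [nsmul_eq_mul]
      push_cast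
      omega
  refine ⟨algebraMap _ k (π * b + a ^ 2), ?_, ?_, ?_⟩
  · intro h0
    rw [h0, map_zero] at hq
    exact zero_ne_one hq
  · rw [hp, log_exp]; decide
  · rw [hq, log_one]; exact Even.zero

lemma infinite_heightOneSpectrum : Infinite (HeightOneSpectrum (𝓞 k)) := by
  choose P hP using fun p : Nat.Primes => exists_heightOne_mem k p.2
  refine Infinite.of_injective P fun p p' h => ?_
  by_contra hne
  have hc : IsCoprime ((p : ℕ) : ℤ) ((p' : ℕ) : ℤ) :=
    Nat.isCoprime_iff_coprime.2 ((Nat.coprime_primes p.2 p'.2).2 fun h => hne (Subtype.ext h))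
  obtain ⟨u, v, huv⟩ := hc
  have h_int : ∀ z : ℤ, (P p).valuation k (z : k) ≤ 1 := fun z => by
    simpa using (P p).valuation_le_one (K := k) (z : 𝓞 k)
  have h1 := congrArg (fun z : ℤ => (P p).valuation k (z : k)) huv
  simp only [Int.cast_add, Int.cast_mul, Int.cast_natCast, Int.cast_one, map_one] at h1
  refine ((Valuation.map_add_lt _ ?_ ?_).ne h1)
  · rw [map_mul, mul_comm]; exact mul_lt_one_of_lt_of_le (hP p) (h_int u)
  · rw [map_mul, h, mul_comm]; exact mul_lt_one_of_lt_of_le (hP p') (h ▸ h_int v)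

variable {k}

lemma exists_mul_ne_sq {c : k} (hc : c ≠ 0) :
    ∃ c' : k, (∀ d, c' ≠ d ^ 2) ∧ ∀ d, c * c' ≠ d ^ 2 := by
  have hfin : {𝔭 : HeightOneSpectrum (𝓞 k) | 𝔭.valuation k c ≠ 1}.Finite := by
    refine ((HeightOneSpectrum.Support.finite (𝓞 k) c).union
      (HeightOneSpectrum.Support.finite (𝓞 k) c⁻¹)).subset fun 𝔭 h ↦ ?_
    rcases lt_or_gt_of_ne h with h | h
    · right
      change 1 < 𝔭.valuation k c⁻¹
      rw [map_inv₀]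
      exact (one_lt_inv₀ ((Valuation.pos_iff _).2 hc)).2 h
    · exact Or.inl h
  have := infinite_heightOneSpectrum k
  obtain ⟨𝔭, hp⟩ := hfin.exists_notMem
  simp only [Set.mem_ofPred_eq, not_not] at hp
  obtain ⟨π, hπ⟩ := 𝔭.valuation_exists_uniformizer k
  have hodd : ∀ d : k, 𝔭.valuation k π ≠ 𝔭.valuation k d ^ 2 := by
    intro d hd
    have h1 := congrArg log hd
    rw [hπ, log_pow, log_exp, nsmul_eq_mul] at h1
    push_cast at h1
    omega
  refine ⟨π, fun d hd => hodd d (by rw [hd, map_pow]), fun d hd => hodd d ?_⟩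
  rw [← map_pow, ← hd, map_mul, hp, one_mul]

/-- A biquadratic extension containing square roots of `-1` and `a`. -/
lemma exists_biquadratic_extension.{u} {k : Type u} [Field k] [NumberField k] {a : k} (ha : a ≠ 0) :
    ∃ (F : Type u) (_ : Field F) (_ : NumberField F) (σ : k →+* F) (i r : F) (c₁ c₂ : k)
      (s₁ s₂ : F), i ^ 2 = -1 ∧ r ^ 2 = σ a ∧ s₁ ^ 2 = σ c₁ ∧ s₂ ^ 2 = σ c₂ ∧
      (∀ d, c₁ ≠ d ^ 2) ∧ (∀ d, c₂ ≠ d ^ 2) ∧ (∀ d, c₁ * c₂ ≠ d ^ 2) ∧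
      Module.finrank ℚ F ≤ 4 * Module.finrank ℚ k := by
  have hc₁ : ∃ c₁ : k, (∀ d, c₁ ≠ d ^ 2) ∧ ((∃ d : k, -1 = d ^ 2) ∨ c₁ = -1) ∧
      ((∃ d, a = d ^ 2) ∨ c₁ = -1 ∨ c₁ = a) := by
    by_cases h1 : ∃ d : k, -1 = d ^ 2
    · by_cases h2 : ∃ d : k, a = d ^ 2
      · obtain ⟨c, hc, -⟩ := exists_mul_ne_sq (one_ne_zero (α := k))
        exact ⟨c, hc, Or.inl h1, Or.inl h2⟩
      · push Not at h2
        exact ⟨a, h2, Or.inl h1, Or.inr (Or.inr rfl)⟩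
    · push Not at h1
      exact ⟨-1, h1, Or.inr rfl, Or.inr (Or.inl rfl)⟩
  obtain ⟨c₁, hc₁, h1, -⟩ := hc₁
  have hc₁0 : c₁ ≠ 0 := fun h => hc₁ 0 (by rw [h, zero_pow two_ne_zero])
  have hc₂ : ∃ c₂ : k, (∀ d, c₂ ≠ d ^ 2) ∧ (∀ d, c₁ * c₂ ≠ d ^ 2) ∧
      ((∃ d, a = d ^ 2) ∨ (∃ d, c₁ * a = d ^ 2) ∨ c₂ = a) := by
    obtain ⟨c, hc, hc'⟩ := exists_mul_ne_sq hc₁0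
    by_cases h2 : ∃ d : k, a = d ^ 2
    · exact ⟨c, hc, hc', Or.inl h2⟩
    by_cases h3 : ∃ d : k, c₁ * a = d ^ 2
    · exact ⟨c, hc, hc', Or.inr (Or.inl h3)⟩
    push Not at h2 h3
    exact ⟨a, h2, h3, Or.inr (Or.inr rfl)⟩
  obtain ⟨c₂, hc₂, hc, h2⟩ := hc₂
  obtain ⟨E, _, _, σ, s₁, hs₁, hE⟩ := exists_sqrt_extension_finrank_le c₁
  obtain ⟨F, _, _, τ, s₂, hs₂, hF⟩ := exists_sqrt_extension_finrank_le (σ c₂)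
  have hs₁' : τ s₁ ^ 2 = τ (σ c₁) := by rw [← map_pow, hs₁]
  have hi : ∃ i : F, i ^ 2 = -1 := by
    rcases h1 with ⟨d, hd⟩ | rfl
    · exact ⟨τ (σ d), by rw [← map_pow, ← map_pow, ← hd]; simp⟩
    · exact ⟨τ s₁, by rw [hs₁']; simp⟩
  have hr : ∃ r : F, r ^ 2 = τ (σ a) := by
    rcases h2 with ⟨d, rfl⟩ | ⟨d, hd⟩ | rfl
    · exact ⟨τ (σ d), by rw [← map_pow, ← map_pow]⟩
    · refine ⟨τ (σ d) / τ s₁, ?_⟩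
      have h0 : τ (σ c₁) ≠ 0 := by simpa using hc₁0
      rw [div_pow, hs₁', ← map_pow, ← map_pow, ← hd, div_eq_iff h0, map_mul, map_mul, mul_comm]
    · exact ⟨s₂, hs₂⟩
  obtain ⟨i, hi⟩ := hi
  obtain ⟨r, hr⟩ := hr
  exact ⟨F, _, ‹_›, τ.comp σ, i, r, c₁, c₂, τ s₁, s₂, hi, hr, hs₁', hs₂, hc₁, hc₂, hc, by omega⟩

end ConstantExtension

end

section

open NumberField IsDedekindDomain WithZero

section UpperBound

variable {F : Type*} [Field F] {L V : Type*} [Field L] [CommGroup V] {e : V}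
  {R : V → V → V → Prop} {q : Lˣ →* V} {j : L →+* RatFunc F}

lemma pull_TT_of_isLead {H : Subgroup V} {ϖ : L} (I : Interp e R q)
    (D : DVPair q ((ordX F).comap j).valuationSubring H ϖ)
    (hc : ∀ c : F, c ≠ 0 → ∃ z, IsLead (j z) c 0) {f : L} (hf : IsLead (j f) 1 1) {z : L} {s : F}
    {n : ℤ} (h : IsLead (j z) (s ^ 2) (2 * n)) : Pull q (TT R H) z := by
  have hs : s ≠ 0 := fun hs => h.1 (by rw [hs, zero_pow two_ne_zero])
  obtain ⟨z₀, hz₀⟩ := hc s hs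
  have hy : IsLead (j (z₀ * f ^ n)) s n := by
    rw [map_mul, map_zpow₀]
    simpa using hz₀.mul (hf.zpow n)
  have hy0 : z₀ * f ^ n ≠ 0 := fun h0 => hy.ne_zero (by rw [h0, map_zero])
  refine (D.pull_TT_iff I).2 ⟨z / (z₀ * f ^ n) ^ 2 - 1, z₀ * f ^ n, ?_, hy0, ?_⟩
  · have h1 : IsLead (j (z / (z₀ * f ^ n) ^ 2)) 1 0 := by
      have h2 := h.mul (hy.mul hy).inv
      rw [div_eq_mul_inv, sq, map_mul, map_inv₀, map_mul j (z₀ * f ^ n)]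
      convert h2 using 1
      · field_simp
      · ring
    obtain ⟨-, m, hm, h3⟩ := h1
    rw [← (((ordX F).comap j).isEquiv_valuation_valuationSubring).lt_one_iff_lt_one,
      Valuation.comap_apply, map_sub, h3]
    simpa using hm
  · rw [add_sub_cancel, div_mul_cancel₀ _ (pow_ne_zero 2 hy0)]

variable [NumberField F]

lemma exists_finset_relIndex_le {H : Subgroup V} {ϖ : L} (I : Interp e R q)
    (hH : H = evenSub q (valLog ((ordX F).comap j)))
    (D : DVPair q ((ordX F).comap j).valuationSubring H ϖ)
    (hc : ∀ c : F, c ≠ 0 → ∃ z, IsLead (j z) c 0) {f : L} (hf : IsLead (j f) 1 1) :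
    ∃ S : Finset (Subgroup V), (∀ J ∈ S, Fam e R H J) ∧
      (TT R H).relIndex (H ⊓ sInf ({J | Fam e R H J} \ S)) ≠ 0 ∧
      (TT R H).relIndex (H ⊓ sInf ({J | Fam e R H J} \ S)) ≤
        2 ^ (Fintype.card (InfinitePlace F) + S.card) := by
  classical
  have hF : ∀ g : RatFunc F, g ≠ 0 → ∃ c n, IsLead g c n := forall_exists_isLead
  let P : HeightOneSpectrum (𝓞 F) → Subgroup V := fun 𝔭 =>
    evenSub q (limLog (𝔭.valuation F) hF j 0) ⊓ H
  have hP : ∀ 𝔭, Fam e R H (P 𝔭) := by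
    intro 𝔭
    obtain ⟨π, hπ⟩ := 𝔭.valuation_exists_uniformizer F
    obtain ⟨z, hz⟩ := hc π (by rintro rfl; rw [map_zero] at hπ; exact exp_ne_zero hπ.symm)
    subst hH
    exact fam_limLog I hπ hF hf hz
  have hl : ∀ u : Lˣ, IsLead (j u) (leadHom hF (Units.map (j : L →* RatFunc F) u)).1
      (leadHom hF (Units.map (j : L →* RatFunc F) u)).2.toAdd := fun u =>
    leadHom_spec hF (Units.map (j : L →* RatFunc F) u)
  have hmem : ∀ (u : Lˣ), q u ∈ H ↔ Even (leadHom hF (Units.map (j : L →* RatFunc F) u)).2.toAdd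
      := by
    intro u
    have h1 : (ordX F).comap j (u : L) = exp (-(leadHom hF (Units.map (j : L →* RatFunc F)
        u)).2.toAdd) :=
      (hl u).ordX_eq
    rw [hH, mem_evenSub I]
    change Even (log ((ordX F).comap j (u : L))) ↔ _
    rw [h1, log_exp, even_neg]
  have hmemP : ∀ (u : Lˣ) 𝔭, q u ∈ P 𝔭 ↔
      Even (log (𝔭.valuation F (leadHom hF (Units.map (j : L →* RatFunc F) u)).1)) ∧ q u ∈ H := by
    intro u 𝔭
    rw [Subgroup.mem_inf, ← pull_coe (q := q) (H := evenSub _ _),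
      pull_limLog hF I (hl u), zero_mul, zero_add]
  have hinj : Function.Injective P := by
    intro 𝔭 𝔮 h
    by_contra hne
    obtain ⟨c, hc0, hp, hq⟩ := exists_odd_log_even_log F hne
    obtain ⟨z, hz⟩ := hc c hc0
    have hz0 : z ≠ 0 := by rintro rfl; exact hz.ne_zero (map_zero j)
    obtain ⟨h1, h2⟩ := (hl (Units.mk0 z hz0)).unique hz
    have h3 := hmemP (Units.mk0 z hz0) 𝔭
    have h4 := hmemP (Units.mk0 z hz0) 𝔮
    rw [hmem, h1, h2] at h3 h4
    rw [h] at h3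
    exact Int.not_even_iff_odd.2 hp (h3.1 (h4.2 ⟨hq, Even.zero⟩)).1
  obtain ⟨S₀, hS₀⟩ := exists_squares_relIndex_sSelmer F
  let φ : Lˣ →* Fˣ := (MonoidHom.fst _ _).comp ((leadHom hF).comp (Units.map (j : L →* RatFunc F)))
  set S := S₀.image P with hS
  have hcard : S.card = S₀.card := Finset.card_image_of_injective _ hinj
  set U := H ⊓ sInf ({J | Fam e R H J} \ S) with hU
  have hsel : (U.comap q).map φ ≤ sSelmer F S₀ := by
    rintro _ ⟨u, hu, rfl⟩ 𝔭 h𝔭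
    refine ((hmemP u 𝔭).1 (Subgroup.mem_sInf.1 hu.2 (P 𝔭) ⟨hP 𝔭, ?_⟩)).1
    rw [hS, Finset.coe_image]
    rintro ⟨𝔮, h𝔮, h⟩
    exact h𝔭 (hinj h ▸ h𝔮)
  have hTT : (squares Fˣ).comap φ ⊓ U.comap q ≤ (TT R H).comap q := by
    rintro u ⟨⟨s, hs⟩, hu⟩
    obtain ⟨n, hn⟩ := (hmem u).1 hu.1
    have h1 := hl u
    rw [Subgroup.mem_comap, ← pull_coe (q := q)]
    refine pull_TT_of_isLead I D hc hf (s := s) (n := n) ?_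
    rw [two_mul, ← hn]
    have h2 : ((leadHom hF (Units.map (j : L →* RatFunc F) u)).1 : F) = (s : F) ^ 2 := (congrArg
        Units.val hs).symm
    rw [← h2]
    exact h1
  have hmap : (U.comap q).map q = U := Subgroup.map_comap_eq_self_of_surjective I.surj U
  have h2 := hS₀ S₀ subset_rfl
  have h3 : (squares Fˣ).relIndex (sSelmer F S₀) ≠ 0 := by rw [h2]; positivity
  have h4 : ((squares Fˣ).comap φ ⊓ U.comap q).relIndex (U.comap q) =
      (squares Fˣ).relIndex ((U.comap q).map φ) := by
    rw [Subgroup.inf_relIndex_right, Subgroup.relIndex_comap]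
  have h5 : (TT R H).relIndex U = ((TT R H).comap q).relIndex (U.comap q) := by
    rw [Subgroup.relIndex_comap, hmap]
  have h6 : (squares Fˣ).relIndex ((U.comap q).map φ) ≠ 0 :=
    fun h => h3 (Subgroup.relIndex_eq_zero_of_le_right hsel h)
  have h7 := Subgroup.relIndex_dvd_of_le_left (U.comap q) hTT
  rw [h4, ← h5] at h7
  refine ⟨S, ?_, ne_zero_of_dvd_ne_zero h6 h7, (Nat.le_of_dvd (Nat.pos_of_ne_zero h6) h7).trans ?_⟩
  · intro J hJ
    obtain ⟨𝔭, -, rfl⟩ := Finset.mem_image.1 hJ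
    exact hP 𝔭
  · rw [hcard, ← h2]
    exact Subgroup.relIndex_le_of_le_right hsel h3

end UpperBound

end

section

open NumberField IsDedekindDomain WithZero

section Coordinate

variable {F : Type*} [Field F]

lemma ordX_C_le (c : F) : ordX F (RatFunc.C c) ≤ 1 := by
  by_cases hc : c = 0
  · rw [hc, map_zero, map_zero]; exact zero_le
  · exact (ordX_C hc).le

lemma ordX_X_lt : ordX F RatFunc.X < 1 := by
  rw [ordX_X, ← exp_zero, exp_lt_exp]; norm_num

lemma isLead_X : IsLead (RatFunc.X : RatFunc F) 1 1 :=
  ⟨one_ne_zero, 0, by simp, by simp⟩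

lemma isLead_C_add {c : F} (hc : c ≠ 0) {m : RatFunc F} (hm : ordX F m < 1) :
    IsLead (RatFunc.C c + m) c 0 := by
  refine ⟨hc, m / RatFunc.C c, by rwa [map_div₀, ordX_C hc, div_one], ?_⟩
  have h : RatFunc.C c ≠ 0 := (map_ne_zero _).2 hc
  rw [zpow_zero, mul_one, mul_add, mul_one, mul_div_cancel₀ _ h]

lemma exists_taylor {k : Type*} [Field k] (σ : k →+* F) (p : Polynomial k) (y : F)
    {h : RatFunc F} (hh : ordX F h < 1) :
    ∃ κ, ordX F κ ≤ 1 ∧ p.eval₂ ((RatFunc.C : F →+* RatFunc F).comp σ) (RatFunc.C y + h) =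
      RatFunc.C (p.eval₂ σ y) + RatFunc.C (p.derivative.eval₂ σ y) * h + κ * h ^ 2 := by
  let O := (ordX F).integer
  let C' : F →+* O := (RatFunc.C : F →+* RatFunc F).codRestrict O ordX_C_le
  let h' : O := ⟨h, hh.le⟩
  obtain ⟨κ, hκ⟩ := Polynomial.binomExpansion (p.map (C'.comp σ)) (C' y) h'
  have e (P : Polynomial k) (x : O) : ((P.eval₂ (C'.comp σ) x : O) : RatFunc F) =
      P.eval₂ ((RatFunc.C : F →+* RatFunc F).comp σ) x :=
    Polynomial.hom_eval₂ P (C'.comp σ) O.subtype x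
  have e' (P : Polynomial k) : P.eval₂ ((RatFunc.C : F →+* RatFunc F).comp σ) (RatFunc.C y) =
      RatFunc.C (P.eval₂ σ y) := (Polynomial.hom_eval₂ P σ RatFunc.C y).symm
  refine ⟨κ, κ.2, ?_⟩
  rw [Polynomial.derivative_map, Polynomial.eval_map, Polynomial.eval_map, Polynomial.eval_map]
    at hκ
  have h2 := congrArg O.subtype hκ
  rw [map_add, map_add, map_mul, map_mul, map_pow] at h2
  rw [← e', ← e']
  simp only [Subring.subtype_apply, e] at h2
  exact h2

lemma isLead_sub {b θ : F} [CharZero F] (hθ : θ ≠ 0) (h1 : θ ^ 2 ≠ b) (h2 : θ ^ 2 ≠ -b) :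
    ∃ c, IsLead (2 * (RatFunc.X + RatFunc.C θ) / ((RatFunc.X + RatFunc.C θ) ^ 2 + RatFunc.C b) -
      RatFunc.C (2 * θ / (θ ^ 2 + b))) c 1 := by
  have h1' : b - θ ^ 2 ≠ 0 := fun h => h1 (sub_eq_zero.1 h).symm
  have h2' : θ ^ 2 + b ≠ 0 := fun h => h2 (eq_neg_of_add_eq_zero_left h)
  have hm1 : ordX F (-RatFunc.C θ * RatFunc.X) < 1 := by
    rw [map_mul, Valuation.map_neg, ordX_C hθ, one_mul]; exact ordX_X_lt
  have hm2 : ordX F (RatFunc.X * (RatFunc.X + 2 * RatFunc.C θ)) < 1 := by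
    rw [map_mul]
    refine mul_lt_one_of_lt_of_le ordX_X_lt (Valuation.map_add_le _ ordX_X_lt.le ?_)
    rw [← map_ofNat (RatFunc.C : F →+* RatFunc F) 2, ← map_mul]
    exact ordX_C_le _
  have l1 := isLead_C_add h1' hm1
  have l2 := isLead_C_add h2' hm2
  have l := ((isLead_X.mul l1).mul (isLead_C (two_ne_zero (α := F)))).mul
    (l2.mul (isLead_C h2')).inv
  refine ⟨1 * (b - θ ^ 2) * 2 * ((θ ^ 2 + b) * (θ ^ 2 + b))⁻¹, ?_⟩
  rw [show (1 + 0 + 0 + -(0 + 0) : ℤ) = 1 by norm_num] at l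
  convert l using 1
  have n1 := l2.ne_zero
  have n2 := (isLead_C h2').ne_zero
  have e1 : RatFunc.C (θ ^ 2 + b) + RatFunc.X * (RatFunc.X + 2 * RatFunc.C θ) =
      (RatFunc.X + RatFunc.C θ) ^ 2 + RatFunc.C b := by
    rw [map_add, map_pow]; ring
  rw [e1] at n1 ⊢
  rw [← div_eq_mul_inv, map_div₀, div_sub_div _ _ n1 n2]
  congr 1
  rw [map_sub, map_mul, map_add, map_pow, map_ofNat]
  ring

end Coordinate

/-- A generic point of the conic generates the field of constants. -/
lemma exists_generator {k F : Type*} [Field k] [NumberField k] [Field F] [NumberField F]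
    (σ : k →+* F) {b : k} (hb : b ≠ 0) :
    ∃ θ : F, θ ≠ 0 ∧ θ ^ 2 ≠ σ b ∧ θ ^ 2 ≠ -σ b ∧
      (∀ c, ∃ p : Polynomial k, p.eval₂ σ (2 * θ / (θ ^ 2 + σ b)) = c) ∧
      ∃ p : Polynomial k, p.eval₂ σ (2 * θ / (θ ^ 2 + σ b)) = 0 ∧
        p.derivative.eval₂ σ (2 * θ / (θ ^ 2 + σ b)) ≠ 0 := by
  let _ : Algebra k F := σ.toAlgebra
  have : IsScalarTower ℚ k F := .of_algebraMap_eq' (Subsingleton.elim _ _)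
  have : FiniteDimensional k F := Module.Finite.of_restrictScalars_finite ℚ k F
  have hb' : σ b ≠ 0 := (map_ne_zero σ).2 hb
  obtain ⟨γ, hγ0, hγ⟩ : ∃ γ : F, γ ≠ 0 ∧ IntermediateField.adjoin k {γ} = ⊤ := by
    obtain ⟨γ, hγ⟩ := Field.exists_primitive_element k F
    by_cases h0 : γ = 0
    · refine ⟨1, one_ne_zero, ?_⟩
      rw [IntermediateField.adjoin_one, ← hγ, h0, IntermediateField.adjoin_zero]
    · exact ⟨γ, h0, hγ⟩
  have hfin : Finite (IntermediateField k F) :=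
    Field.finite_intermediateField_of_exists_primitive_element k F ⟨γ, hγ⟩
  let B : Set ℕ := {m | (m * γ : F) = 0 ∨ (m * γ : F) ^ 2 = σ b ∨ (m * γ : F) ^ 2 = -σ b}
  have hinj : Function.Injective fun m : ℕ => (m * γ : F) := fun m m' h =>
    Nat.cast_injective (mul_right_cancel₀ hγ0 h)
  have hB : B.Finite := by
    let P : Polynomial F := Polynomial.X * ((Polynomial.X ^ 2 - Polynomial.C (σ b)) *
      (Polynomial.X ^ 2 - Polynomial.C (-σ b)))
    have hP : P ≠ 0 := mul_ne_zero Polynomial.X_ne_zero (mul_ne_zero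
      (Polynomial.X_pow_sub_C_ne_zero two_pos _) (Polynomial.X_pow_sub_C_ne_zero two_pos _))
    refine ((Polynomial.finite_setOfPred_isRoot hP).preimage hinj.injOn).subset ?_
    intro m hm
    change P.eval (m * γ : F) = 0
    rcases hm with h | h | h <;> simp [P, h]
  have hBc : Infinite (Bᶜ : Set ℕ) := hB.infinite_compl.to_subtype
  obtain ⟨⟨m, hm⟩, ⟨m', hm'⟩, hne, he⟩ := Finite.exists_ne_map_eq_of_infinite
    fun m : (Bᶜ : Set ℕ) => IntermediateField.adjoin k
      {2 * ((m : ℕ) * γ) / (((m : ℕ) * γ) ^ 2 + σ b)}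
  dsimp only at he
  simp only [B, Set.mem_compl_iff, Set.mem_ofPred_eq, not_or] at hm hm'
  set M := IntermediateField.adjoin k {2 * ((m : ℕ) * γ) / (((m : ℕ) * γ) ^ 2 + σ b)} with hM
  have key : ∀ n : ℕ, (n * γ : F) ≠ 0 →
      2 * ((n : ℕ) * γ) / (((n : ℕ) * γ) ^ 2 + σ b) ∈ M → (n : F) ^ 2 * γ + σ b / γ ∈ M := by
    intro n hn h
    have h1 := M.mul_mem (M.mul_mem (natCast_mem M n) (natCast_mem M 2)) (M.inv_mem h)
    convert h1 using 1
    obtain ⟨hn0, -⟩ := mul_ne_zero_iff.1 hn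
    rw [inv_div]
    push_cast
    field_simp
  have h1 := key m hm.1 (IntermediateField.mem_adjoin_simple_self k _)
  have h2 := key m' hm'.1 (he ▸ IntermediateField.mem_adjoin_simple_self k _)
  have hmm : (m : F) ^ 2 - (m' : F) ^ 2 ≠ 0 := by
    intro h
    have h3 : m ^ 2 = m' ^ 2 := by exact_mod_cast sub_eq_zero.1 h
    exact hne (Subtype.ext (Nat.pow_left_injective two_ne_zero h3))
  have hγM : γ ∈ M := by
    have h3 := M.div_mem (M.sub_mem h1 h2)
      (M.sub_mem (M.pow_mem (natCast_mem M m) 2) (M.pow_mem (natCast_mem M m') 2))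
    convert h3 using 1
    field_simp
    ring
  have hMtop : M = ⊤ := top_le_iff.1 (hγ ▸ (IntermediateField.adjoin_simple_le_iff.2 hγM))
  refine ⟨m * γ, hm.1, hm.2.1, hm.2.2, fun c => ?_, ?_⟩
  · have h3 : c ∈ M.toSubalgebra := hMtop ▸ IntermediateField.mem_top
    rw [hM, IntermediateField.adjoin_simple_toSubalgebra_of_isAlgebraic
      (Algebra.IsAlgebraic.isAlgebraic _), Algebra.adjoin_singleton_eq_range_aeval] at h3
    obtain ⟨p, hp⟩ := h3
    exact ⟨p, hp⟩
  · exact ⟨minpoly k _, minpoly.aeval k _, (Algebra.IsSeparable.isSeparable k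
      _).aeval_derivative_ne_zero
      (minpoly.aeval k _)⟩

/-- A place of the conic with prescribed residue field. -/
lemma IsConicFunctionField.exists_coordinate {k : Type*} [Field k] [NumberField k] {a b : k}
    {K : Type*} [Field K] {ι : k →+* K} (ha : a ≠ 0) (hb : b ≠ 0)
    (hK : IsConicFunctionField k a b K ι) {F : Type*} [Field F] [NumberField F] (σ : k →+* F)
    {r : F} (hr : r ^ 2 = σ a) :
    ∃ j : K →+* RatFunc F, (∀ c, j (ι c) = RatFunc.C (σ c)) ∧
      (∀ c : F, c ≠ 0 → ∃ z, IsLead (j z) c 0) ∧ ∃ f, IsLead (j f) 1 1 := by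
  obtain ⟨x, y, j₀, -, hj, -, hy⟩ := hK.exists_param ha σ hr
  obtain ⟨θ, h0, h1, h2, hgen, p, hp0, hp1⟩ := exists_generator σ hb
  obtain ⟨ψ, hψ, hψ'⟩ := exists_translate (RingHom.id F) θ
  obtain ⟨d, hd⟩ := isLead_sub h0 h1 h2
  have hψX : ψ RatFunc.X = RatFunc.X + RatFunc.C θ := by
    have h := hψ' Polynomial.X
    rwa [RatFunc.algebraMap_X, Polynomial.map_X, Polynomial.X_comp, map_add, RatFunc.algebraMap_X,
      RatFunc.algebraMap_C] at h
  have hψC : ∀ c, (ψ.comp j₀) (ι c) = RatFunc.C (σ c) := by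
    intro c
    rw [RingHom.comp_apply, hj, hψ, RingHom.id_apply]
  have hψC' : (ψ.comp j₀).comp ι = (RatFunc.C : F →+* RatFunc F).comp σ := RingHom.ext hψC
  set η := 2 * θ / (θ ^ 2 + σ b)
  have hjy : (ψ.comp j₀) y = 2 * (RatFunc.X + RatFunc.C θ) /
      ((RatFunc.X + RatFunc.C θ) ^ 2 + RatFunc.C (σ b)) := by
    rw [RingHom.comp_apply, hy, map_div₀, map_mul, map_add, map_pow, hψX, hψ, map_ofNat,
      RingHom.id_apply]
  rw [← hjy] at hd
  set h := (ψ.comp j₀) y - RatFunc.C η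
  have hh : ordX F h < 1 := by
    rw [hd.ordX_eq, ← exp_zero, exp_lt_exp]; norm_num
  have hev : ∀ P : Polynomial k, ∃ κ, ordX F κ ≤ 1 ∧ (ψ.comp j₀) (P.eval₂ ι y) =
      RatFunc.C (P.eval₂ σ η) + RatFunc.C (P.derivative.eval₂ σ η) * h + κ * h ^ 2 := by
    intro P
    obtain ⟨κ, hκ, h3⟩ := exists_taylor σ P η hh
    refine ⟨κ, hκ, ?_⟩
    rw [← h3, Polynomial.hom_eval₂, add_sub_cancel, hψC']
  have hc : ∀ c : F, c ≠ 0 → ∃ z, IsLead ((ψ.comp j₀) z) c 0 := by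
    intro c hc
    obtain ⟨P, hP⟩ := hgen c
    obtain ⟨κ, hκ, h3⟩ := hev P
    refine ⟨P.eval₂ ι y, ?_⟩
    rw [h3, add_assoc, hP]
    refine isLead_C_add hc (Valuation.map_add_lt _ ?_ ?_)
    · rw [map_mul, mul_comm]; exact mul_lt_one_of_lt_of_le hh (ordX_C_le _)
    · rw [map_mul, map_pow, mul_comm]
      exact mul_lt_one_of_lt_of_le (pow_lt_one₀ zero_le hh two_ne_zero) hκ
  refine ⟨ψ.comp j₀, hψC, hc, ?_⟩
  obtain ⟨κ, hκ, h3⟩ := hev p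
  rw [hp0, map_zero, zero_add, sq, ← mul_assoc, ← add_mul] at h3
  have h4 : ordX F (κ * h) < 1 := by
    rw [map_mul, mul_comm]; exact mul_lt_one_of_lt_of_le hh hκ
  have h5 := (isLead_C_add hp1 h4).mul hd
  rw [← h3] at h5
  obtain ⟨z, hz⟩ := hc _ (inv_ne_zero h5.1)
  refine ⟨z * p.eval₂ ι y, ?_⟩
  have h6 := hz.mul h5
  rwa [← map_mul, inv_mul_cancel₀ h5.1, zero_add, zero_add] at h6

end

section Main

/-- The degree bound from above. -/
lemma IsConicFunctionField.halfDegreeLE {k : Type*} [Field k] [NumberField k] {a b : k}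
    {K V : Type*} [Field K] [CharZero K] [CommGroup V] {ι : k →+* K} (ha : a ≠ 0) (hb : b ≠ 0)
    (hK : IsConicFunctionField k a b K ι) {e : V} {R : V → V → V → Prop} {q : Kˣ →* V}
    (I : Interp e R q) : HalfDegreeLE e R (2 * Module.finrank ℚ k) := by
  obtain ⟨F, _, _, σ, i, r, c₁, c₂, s₁, s₂, hi, hr, hs₁, hs₂, hc₁, hc₂, hc, hdeg⟩ :=
    exists_biquadratic_extension ha
  obtain ⟨j, hj, hz, f, hf⟩ := hK.exists_coordinate ha hb σ hr
  have hH := hor_ordX I (hK.isCurve hb) hf odd_one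
  obtain ⟨ϖ, D⟩ := exists_dvPair_ordX I hf odd_one
  obtain ⟨S, hS, h0, h1⟩ := exists_finset_relIndex_le I rfl D hz hf
  let ιu : kˣ →* Kˣ := Units.map (ι : k →* K)
  let Y : Subgroup kˣ := (sqSubgroup F).comap (Units.map (σ : k →* F))
  have hY : ∀ (c : k) (s : F) (hc : c ≠ 0), s ^ 2 = σ c → Units.mk0 c hc ∈ Y := by
    intro c s hc hs
    have hs0 : s ≠ 0 := by
      rintro rfl
      rw [zero_pow two_ne_zero] at hs
      exact hc ((map_eq_zero σ).1 hs.symm)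
    exact ⟨Units.mk0 s hs0, Units.ext hs⟩
  have hker : ∀ (c : k) (hc : c ≠ 0), (∀ d, c ≠ d ^ 2) → q (ιu (Units.mk0 c hc)) ≠ 1 := by
    intro c hc hd h
    obtain ⟨w, hw⟩ := (I.ker _).1 h
    obtain ⟨d, hd'⟩ := hK.exists_sq_of_map_sq ha hb (c := c) (w := w) (congrArg Units.val hw)
    exact hd d hd'
  have hn : ∀ c : k, (∀ d, c ≠ d ^ 2) → c ≠ 0 := fun c h h0 => h 0 (by rw [h0]; simp)
  refine ⟨_, hH, ⟨Y.map (q.comp ιu), ⟨_, ⟨_, hY c₁ s₁ (hn _ hc₁) hs₁, rfl⟩, _,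
    ⟨_, hY c₂ s₂ (hn _ hc₂) hs₂, rfl⟩, hker _ _ hc₁, hker _ _ hc₂, ?_⟩, ?_, ?_, ?_⟩, S, hS, h0,
    h1.trans (Nat.pow_le_pow_right two_pos ?_)⟩
  · rw [← map_mul]
    have h := hker _ (hn _ hc) hc
    convert h using 2
    rw [MonoidHom.comp_apply]
    congr 2
    ext; rfl
  · refine ⟨-1, ⟨Units.mk0 i ?_, Units.ext ?_⟩, ?_⟩
    · rintro rfl
      rw [zero_pow two_ne_zero] at hi
      exact neg_ne_zero.2 one_ne_zero hi.symm
    · change i ^ 2 = σ (-1)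
      rw [hi, map_neg, map_one]
    · rw [← I.neg_one, MonoidHom.comp_apply]
      congr 1
      ext
      change ι (-1) = -1
      rw [map_neg, map_one]
  · rintro _ ⟨c, ⟨s, hs⟩, rfl⟩
    have h2 : ((s : F)) ^ 2 = σ c := congrArg Units.val hs
    rw [MonoidHom.comp_apply, ← pull_coe (q := q)]
    refine pull_TT_of_isLead I D hz hf (s := s) (n := 0) ?_
    change IsLead (j (ι c)) _ _
    rw [hj, h2, mul_zero]
    exact isLead_C ((map_ne_zero σ).2 c.ne_zero)
  · rintro H' hH' _ ⟨c, -, rfl⟩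
    obtain ⟨A, ϖ', D', hA⟩ := hH'.exists_dvPair I (hK.isCurve hb)
    rw [MonoidHom.comp_apply, ← pull_coe (q := q)]
    exact D'.unit_mem _ (hA.valuation_map ι c.ne_zero)
  · have := card_infinitePlace_of_sq_eq_neg_one hi
    omega

/-- The square class `c` is represented by the form `⟨a, b⟩`. -/
def RepresentsClass (K : Type*) [Field K] (v₁ v₂ v₃ : SqClass K) : Prop :=
  ∃ a b c : Kˣ, sqCl a = v₁ ∧ sqCl b = v₂ ∧ sqCl c = v₃ ∧
    ∃ x y : K, (c : K) = a * x ^ 2 + b * y ^ 2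

lemma sqCl_eq_iff {K : Type*} [Field K] {u v : Kˣ} : sqCl u = sqCl v ↔ ∃ w, v = u * w ^ 2 := by
  rw [sqCl, sqCl, QuotientGroup.eq]
  constructor
  · rintro ⟨w, hw⟩
    exact ⟨w, by rw [show w ^ 2 = u⁻¹ * v from hw, mul_inv_cancel_left]⟩
  · rintro ⟨w, rfl⟩
    exact ⟨w, by rw [inv_mul_cancel_left]; rfl⟩

lemma representsClass_iff {K : Type*} [Field K] (a b c : Kˣ) :
    RepresentsClass K (sqCl a) (sqCl b) (sqCl c) ↔
      ∃ x y : K, (c : K) = a * x ^ 2 + b * y ^ 2 := by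
  refine ⟨?_, fun h => ⟨a, b, c, rfl, rfl, rfl, h⟩⟩
  rintro ⟨a', b', c', ha, hb, hc, x, y, h⟩
  obtain ⟨s, rfl⟩ := sqCl_eq_iff.1 ha.symm
  obtain ⟨t, rfl⟩ := sqCl_eq_iff.1 hb.symm
  obtain ⟨w, rfl⟩ := sqCl_eq_iff.1 hc
  refine ⟨s * x * w, t * y * w, ?_⟩
  push_cast at h ⊢
  rw [h]
  ring

lemma interp_mk (K : Type*) [Field K] :
    Interp (sqCl (-1)) (RepresentsClass K) (QuotientGroup.mk' (sqSubgroup K)) where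
  surj := QuotientGroup.mk'_surjective _
  ker u := by
    rw [QuotientGroup.mk'_apply, QuotientGroup.eq_one_iff]
    exact ⟨fun ⟨v, hv⟩ => ⟨v, hv.symm⟩, fun ⟨v, hv⟩ => ⟨v, hv.symm⟩⟩
  neg_one := rfl
  rep := representsClass_iff

lemma IsWittEquiv.interp {K L : Type*} [Field K] [Field L] {α : SqClass K ≃* SqClass L}
    (h : IsWittEquiv α) : Interp (sqCl (-1)) (RepresentsClass K)
      (α.symm.toMonoidHom.comp (QuotientGroup.mk' (sqSubgroup L))) where
  surj := α.symm.surjective.comp (QuotientGroup.mk'_surjective _)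
  ker u := by
    rw [← (interp_mk L).ker u]
    exact map_eq_one_iff α.symm α.symm.injective
  neg_one := by
    change α.symm (sqCl (-1)) = _
    rw [← h.map_neg_one, MulEquiv.symm_apply_apply]
  rep a b c := by
    change RepresentsClass K (α.symm (sqCl a)) (α.symm (sqCl b)) (α.symm (sqCl c)) ↔ _
    obtain ⟨a', ha⟩ := QuotientGroup.mk_surjective (α.symm (sqCl a))
    obtain ⟨b', hb⟩ := QuotientGroup.mk_surjective (α.symm (sqCl b))
    obtain ⟨c', hc⟩ := QuotientGroup.mk_surjective (α.symm (sqCl c))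
    rw [← ha, ← hb, ← hc]
    refine (representsClass_iff a' b' c').trans (h.represents a' b' c' a b c ?_ ?_ ?_)
    · exact (α.eq_symm_apply).1 ha
    · exact (α.eq_symm_apply).1 hb
    · exact (α.eq_symm_apply).1 hc

end Main

/-- Let `k, ℓ` be number fields, `K = k_{a,b}` and `L = ℓ_{c,d}`.  If `K` and `L` are Witt
equivalent, then `[k : ℚ] = [ℓ : ℚ]`. -/
theorem wittEquiv_conic_degree_eq
    (k : Type*) [Field k] [NumberField k] (l : Type*) [Field l] [NumberField l]
    (a b : k) (ha : a ≠ 0) (hb : b ≠ 0) (c d : l) (hc : c ≠ 0) (hd : d ≠ 0)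
    (K : Type*) [Field K] (ι : k →+* K) (hK : IsConicFunctionField k a b K ι)
    (L : Type*) [Field L] (ι' : l →+* L) (hL : IsConicFunctionField l c d L ι')
    (hWE : WittEquivalent K L) :
    Module.finrank ℚ k = Module.finrank ℚ l := by
  have : CharZero K := charZero_of_injective_ringHom ι.injective
  have : CharZero L := charZero_of_injective_ringHom ι'.injective
  obtain ⟨α, hα⟩ := hWE
  have h1 := hL.two_mul_finrank_le hc hd hα.interp (hK.halfDegreeLE ha hb (interp_mk K))
  have h2 := hK.two_mul_finrank_le ha hb (interp_mk K) (hL.halfDegreeLE hc hd hα.interp)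
  omega

end
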